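/- Every algebra over an algebraically closed field k that is derived equivalent to one of the algebras T(p,q) (1 ≤ p ≤ q), T(2,2,r)* (r ≥ 2), T(3,3,3), T(2,4,4) or T(2,3,6) is τ-tilting infinite. -/

import Mathlib

open MulOpposite CategoryTheory CategoryTheory.Limits

noncomputable section

/-- A submodule `N ≤ M` is superfluous if `N ⊔ K = ⊤` implies `K = ⊤`. -/
def SuperfluousSubmodule {R M : Type} [Ring R] [AddCommGroup M] [Module R M]
    (N : Submodule R M) : Prop :=
  ∀ K : Submodule R M, N ⊔ K = ⊤ → K = ⊤

section TauTilting

variable (k : Type) [Field k]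
variable (B : Type) [Ring B] [Algebra k B]

/-- A minimal projective presentation `P1 → P0 → M → 0` of a right `B`-module `M`. -/
def IsMinimalProjPresentation (M P1 P0 : ModuleCat.{0} Bᵐᵒᵖ)
    (f : P1 →ₗ[Bᵐᵒᵖ] P0) (g : P0 →ₗ[Bᵐᵒᵖ] M) : Prop :=
  Module.Projective Bᵐᵒᵖ P1 ∧ Module.Projective Bᵐᵒᵖ P0 ∧
    Function.Surjective g ∧ LinearMap.range f = LinearMap.ker g ∧
    SuperfluousSubmodule (LinearMap.ker g) ∧ SuperfluousSubmodule (LinearMap.ker f)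

/-- Left multiplication by `b` on the left `B`-module `Hom_B(P, B)` of a right module `P`. -/
def leftMulHom {P : Type} [AddCommGroup P] [Module Bᵐᵒᵖ P] (b : B)
    (h : P →ₗ[Bᵐᵒᵖ] B) : P →ₗ[Bᵐᵒᵖ] B where
  toFun p := b * h p
  map_add' x y := by simp [mul_add]
  map_smul' r p := by
    simp only [map_smul, RingHom.id_apply]
    rw [MulOpposite.smul_eq_mul_unop, MulOpposite.smul_eq_mul_unop, mul_assoc]

/-- `M` is τ-rigid:  `Hom_B(M, τM) = 0`, where `τM = D(Tr M)` is computed from a minimal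
projective presentation `P1 --f--> P0 → M → 0`, `Tr M = coker(Hom(P0,B) → Hom(P1,B))`, and
`D = Hom_k(-, k)`.  A right-module map `M → D(Tr M)` is encoded as an additive map
`β : M →+ Hom_k(Hom_B(P1, B), k)` which is balanced (`β (m·b) = β m (b·-)`) and vanishes on
the image of `Hom(P0,B)`, i.e. descends to the cokernel `Tr M`. -/
def IsTauRigid (M : ModuleCat.{0} Bᵐᵒᵖ) : Prop :=
  ∀ (P1 P0 : ModuleCat.{0} Bᵐᵒᵖ) (f : P1 →ₗ[Bᵐᵒᵖ] P0) (g : P0 →ₗ[Bᵐᵒᵖ] M),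
    IsMinimalProjPresentation B M P1 P0 f g →
    ∀ β : M →+ ((P1 →ₗ[Bᵐᵒᵖ] B) →ₗ[k] k),
      (∀ (m : M) (b : B) (h : P1 →ₗ[Bᵐᵒᵖ] B),
        β (op b • m) h = β m (leftMulHom B b h)) →
      (∀ (m : M) (g0 : P0 →ₗ[Bᵐᵒᵖ] B), β m (g0.comp f) = 0) →
      β = 0

/-- A module is indecomposable if it is nonzero and admits no nontrivial direct sum
decomposition. -/
def IndecomposableMod (M : ModuleCat.{0} Bᵐᵒᵖ) : Prop :=
  Nontrivial M ∧ ∀ (L L' : ModuleCat.{0} Bᵐᵒᵖ),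
    Nonempty (M ≃ₗ[Bᵐᵒᵖ] (L × L')) → Subsingleton L ∨ Subsingleton L'

/-- A module is basic (multiplicity-free) if it has no repeated direct summand. -/
def IsBasicMod (M : ModuleCat.{0} Bᵐᵒᵖ) : Prop :=
  ∀ (L C : ModuleCat.{0} Bᵐᵒᵖ),
    Nonempty (M ≃ₗ[Bᵐᵒᵖ] (L × L × C)) → Subsingleton L

/-- `L` is an indecomposable direct summand of `M`. -/
def IsIndecSummand (L M : ModuleCat.{0} Bᵐᵒᵖ) : Prop :=
  IndecomposableMod B L ∧ ∃ L' : ModuleCat.{0} Bᵐᵒᵖ, Nonempty (M ≃ₗ[Bᵐᵒᵖ] (L × L'))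

/-- The rank of the Grothendieck group `K_0(B)` is `n`, i.e. there are exactly `n`
isomorphism classes of simple right `B`-modules. -/
def RankK0Is (n : ℕ) : Prop :=
  ∃ S : Fin n → ModuleCat.{0} Bᵐᵒᵖ,
    (∀ i, IsSimpleModule Bᵐᵒᵖ (S i)) ∧
    (∀ i j, i ≠ j → IsEmpty ((S i) ≃ₗ[Bᵐᵒᵖ] (S j))) ∧
    (∀ T : ModuleCat.{0} Bᵐᵒᵖ, IsSimpleModule Bᵐᵒᵖ T → ∃ i, Nonempty (T ≃ₗ[Bᵐᵒᵖ] S i))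

/-- The number of isomorphism classes of indecomposable direct summands of `M` is `n`. -/
def NumIndecSummandsIs (M : ModuleCat.{0} Bᵐᵒᵖ) (n : ℕ) : Prop :=
  ∃ N : Fin n → ModuleCat.{0} Bᵐᵒᵖ,
    (∀ i, IsIndecSummand B (N i) M) ∧
    (∀ i j, i ≠ j → IsEmpty ((N i) ≃ₗ[Bᵐᵒᵖ] (N j))) ∧
    (∀ L, IsIndecSummand B L M → ∃ i, Nonempty (L ≃ₗ[Bᵐᵒᵖ] N i))

/-- `M` is a τ-tilting module over `B`: it is a finitely generated τ-rigid module whose number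
of non-isomorphic indecomposable direct summands equals the rank of `K_0(B)`. -/
def IsTauTiltingMod (M : ModuleCat.{0} Bᵐᵒᵖ) : Prop :=
  Module.Finite Bᵐᵒᵖ M ∧ IsTauRigid k B M ∧
    ∃ n : ℕ, NumIndecSummandsIs B M n ∧ RankK0Is B n

end TauTilting

section Support

variable (k : Type) [Field k]
variable (A : Type) [Ring A] [Algebra k A]

/-- The quotient of `A` by the two-sided ideal `AeA` generated by `e`. -/
def IdemQuot (e : A) : Type := ((TwoSidedIdeal.span {e}).ringCon).Quotient

instance (e : A) : Ring (IdemQuot A e) :=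
  inferInstanceAs (Ring ((TwoSidedIdeal.span {e}).ringCon).Quotient)

/-- The quotient map `A → A/AeA`. -/
def IdemQuot.mk (e : A) : A →+* IdemQuot A e := RingCon.mk' _

instance (e : A) : Algebra k (IdemQuot A e) :=
  RingHom.toAlgebra' ((IdemQuot.mk A e).comp (algebraMap k A)) (by
    intro c x
    induction x using Quotient.ind with
    | _ a =>
      show (IdemQuot.mk A e) (algebraMap k A c) * (IdemQuot.mk A e) a
          = (IdemQuot.mk A e) a * (IdemQuot.mk A e) (algebraMap k A c)
      rw [← map_mul, ← map_mul, Algebra.commutes])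

/-- `M` is a support τ-tilting module over `A`: there is an idempotent `e ∈ A` such that `M` is
(the restriction of) a τ-tilting module over `A/AeA`. -/
def IsSupportTauTilting (M : ModuleCat.{0} Aᵐᵒᵖ) : Prop :=
  ∃ e : A, IsIdempotentElem e ∧
    ∃ N : ModuleCat.{0} (IdemQuot A e)ᵐᵒᵖ,
      IsTauTiltingMod k (IdemQuot A e) N ∧
      letI : Module Aᵐᵒᵖ N := Module.compHom N (RingHom.op (IdemQuot.mk A e))
      Nonempty (M ≃ₛₗ[RingHom.id Aᵐᵒᵖ] N)

/-- `A` is τ-tilting finite: it admits only finitely many basic support τ-tilting modules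
up to isomorphism. -/
def TauTiltingFinite : Prop :=
  ∃ (n : ℕ) (R : Fin n → ModuleCat.{0} Aᵐᵒᵖ),
    ∀ M : ModuleCat.{0} Aᵐᵒᵖ, IsSupportTauTilting k A M → IsBasicMod A M →
      ∃ i, Nonempty (M ≃ₗ[Aᵐᵒᵖ] R i)

/-- `A` is representation-finite: it has only finitely many isomorphism classes of finitely
generated indecomposable right modules. -/
def RepresentationFinite : Prop :=
  ∃ (n : ℕ) (R : Fin n → ModuleCat.{0} Aᵐᵒᵖ),
    ∀ M : ModuleCat.{0} Aᵐᵒᵖ, Module.Finite Aᵐᵒᵖ M → IndecomposableMod A M →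
      ∃ i, Nonempty (M ≃ₗ[Aᵐᵒᵖ] R i)

end Support

section Der
/-- Two rings are derived equivalent if there is a triangulated equivalence between their
derived categories of right modules. -/
def DerivedEquivalent (A' B' : Type) [Ring A'] [Ring B'] : Prop :=
  letI : HasDerivedCategory (ModuleCat.{0} A'ᵐᵒᵖ) := HasDerivedCategory.standard _
  letI : HasDerivedCategory (ModuleCat.{0} B'ᵐᵒᵖ) := HasDerivedCategory.standard _
  ∃ (e : DerivedCategory (ModuleCat.{0} A'ᵐᵒᵖ) ≌ DerivedCategory (ModuleCat.{0} B'ᵐᵒᵖ))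
    (_ : e.functor.CommShift ℤ), e.functor.IsTriangulated

end Der

section QuiverAlg
variable (k : Type) [Field k]

/-- The product in the path algebra of a word of arrows (paths are composed from left to
right, so the path `α₁α₂` corresponds to the product `α₁ * α₂`). -/
def arrWord {V E : Type} (l : List E) : FreeAlgebra k (V ⊕ E) :=
  (l.map (fun a => FreeAlgebra.ι k (Sum.inr a))).prod

/-- The defining relations of a bound quiver algebra `kQ/I`: the vertices `e_v` are orthogonal
idempotents summing to `1`, each arrow `a : u → v` satisfies `e_u a = a = a e_v`, and the
extra relations generating the admissible ideal `I` hold. -/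
def quivRel {V E : Type} [Fintype V] [DecidableEq V] (s t : E → V)
    (extra : FreeAlgebra k (V ⊕ E) → FreeAlgebra k (V ⊕ E) → Prop) :
    FreeAlgebra k (V ⊕ E) → FreeAlgebra k (V ⊕ E) → Prop := fun x y =>
  (∃ v w : V, x = FreeAlgebra.ι k (Sum.inl v) * FreeAlgebra.ι k (Sum.inl w) ∧
    y = if v = w then FreeAlgebra.ι k (Sum.inl v) else 0) ∨
  (x = ∑ v : V, FreeAlgebra.ι k (Sum.inl v) ∧ y = 1) ∨
  (∃ a : E, x = FreeAlgebra.ι k (Sum.inl (s a)) * FreeAlgebra.ι k (Sum.inr a) ∧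
    y = FreeAlgebra.ι k (Sum.inr a)) ∨
  (∃ a : E, x = FreeAlgebra.ι k (Sum.inr a) * FreeAlgebra.ι k (Sum.inl (t a)) ∧
    y = FreeAlgebra.ι k (Sum.inr a)) ∨
  extra x y

/-- The bound quiver algebra presented by a quiver `(V, E, s, t)` and extra relations. -/
def BoundQuiverAlg {V E : Type} [Fintype V] [DecidableEq V] (s t : E → V)
    (extra : FreeAlgebra k (V ⊕ E) → FreeAlgebra k (V ⊕ E) → Prop) : Type :=
  RingQuot (quivRel k s t extra)

instance {V E : Type} [Fintype V] [DecidableEq V] (s t : E → V)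
    (extra : FreeAlgebra k (V ⊕ E) → FreeAlgebra k (V ⊕ E) → Prop) :
    Ring (BoundQuiverAlg k s t extra) :=
  inferInstanceAs (Ring (RingQuot (quivRel k s t extra)))

instance {V E : Type} [Fintype V] [DecidableEq V] (s t : E → V)
    (extra : FreeAlgebra k (V ⊕ E) → FreeAlgebra k (V ⊕ E) → Prop) :
    Algebra k (BoundQuiverAlg k s t extra) :=
  inferInstanceAs (Algebra k (RingQuot (quivRel k s t extra)))

end QuiverAlg

section QuiverAlg
variable (k : Type) [Field k]

/-! ### The quiver `Δ(p,q,r)`: three oriented cycles glued at a common vertex `0` -/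

def TriV (p q r : ℕ) : Type :=
  Option ({i : ZMod p // i ≠ 0} ⊕ {j : ZMod q // j ≠ 0} ⊕ {l : ZMod r // l ≠ 0})

instance (p q r : ℕ) : DecidableEq (TriV p q r) :=
  inferInstanceAs (DecidableEq (Option
    ({i : ZMod p // i ≠ 0} ⊕ {j : ZMod q // j ≠ 0} ⊕ {l : ZMod r // l ≠ 0})))

instance (p q r : ℕ) [NeZero p] [NeZero q] [NeZero r] : Fintype (TriV p q r) :=
  inferInstanceAs (Fintype (Option
    ({i : ZMod p // i ≠ 0} ⊕ {j : ZMod q // j ≠ 0} ⊕ {l : ZMod r // l ≠ 0})))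

def TriE (p q r : ℕ) : Type := ZMod p ⊕ ZMod q ⊕ ZMod r

def triV1 (p q r : ℕ) (i : ZMod p) : TriV p q r :=
  if h : i = 0 then none else some (Sum.inl ⟨i, h⟩)
def triV2 (p q r : ℕ) (j : ZMod q) : TriV p q r :=
  if h : j = 0 then none else some (Sum.inr (Sum.inl ⟨j, h⟩))
def triV3 (p q r : ℕ) (l : ZMod r) : TriV p q r :=
  if h : l = 0 then none else some (Sum.inr (Sum.inr ⟨l, h⟩))

def triSrc (p q r : ℕ) : TriE p q r → TriV p q r
  | Sum.inl i => triV1 p q r i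
  | Sum.inr (Sum.inl j) => triV2 p q r j
  | Sum.inr (Sum.inr l) => triV3 p q r l

def triTgt (p q r : ℕ) : TriE p q r → TriV p q r
  | Sum.inl i => triV1 p q r (i + 1)
  | Sum.inr (Sum.inl j) => triV2 p q r (j + 1)
  | Sum.inr (Sum.inr l) => triV3 p q r (l + 1)

/-- The word `α_{s+1} ⋯ α_{s+len}` on the first cycle of `Δ(p,q,r)`. -/
def taw (p q r : ℕ) (st len : ℕ) : List (TriE p q r) :=
  (List.range len).map (fun u => Sum.inl ((st + u : ℕ) : ZMod p))
/-- The word `β_{s+1} ⋯ β_{s+len}` on the second cycle of `Δ(p,q,r)`. -/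
def tbw (p q r : ℕ) (st len : ℕ) : List (TriE p q r) :=
  (List.range len).map (fun u => Sum.inr (Sum.inl ((st + u : ℕ) : ZMod q)))
/-- The word `γ_{s+1} ⋯ γ_{s+len}` on the third cycle of `Δ(p,q,r)`. -/
def tgw (p q r : ℕ) (st len : ℕ) : List (TriE p q r) :=
  (List.range len).map (fun u => Sum.inr (Sum.inr ((st + u : ℕ) : ZMod r)))

section Tri
variable (p q r : ℕ)

/-- The relations `I₃(n)` of the algebra `Γ(n)` (on the quiver `Δ(2,2,n)`). -/
def GamRelExtra (n : ℕ) : FreeAlgebra k (TriV 2 2 n ⊕ TriE 2 2 n) →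
    FreeAlgebra k (TriV 2 2 n ⊕ TriE 2 2 n) → Prop := fun x y =>
  (x = arrWord k (taw 2 2 n 0 2) ∧ y = arrWord k (tgw 2 2 n 0 n ++ tgw 2 2 n 0 n)) ∨
  (x = arrWord k (tbw 2 2 n 0 2) ∧ y = arrWord k (tgw 2 2 n 0 n ++ tgw 2 2 n 0 n)) ∨
  (x = arrWord k (taw 2 2 n 1 1 ++ tgw 2 2 n 0 1) ∧ y = 0) ∨
  (x = arrWord k (tbw 2 2 n 1 1 ++ tgw 2 2 n 0 1) ∧ y = 0) ∨
  (x = arrWord k (tgw 2 2 n (n - 1) 1 ++ taw 2 2 n 0 1) ∧ y = 0) ∨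
  (x = arrWord k (tgw 2 2 n (n - 1) 1 ++ tbw 2 2 n 0 1) ∧ y = 0) ∨
  (x = arrWord k (taw 2 2 n 1 1 ++ tbw 2 2 n 0 1) ∧ y = 0) ∨
  (x = arrWord k (tbw 2 2 n 1 1 ++ taw 2 2 n 0 1) ∧ y = 0) ∨
  (∃ j : ℕ, 2 ≤ j ∧ j ≤ n - 1 ∧
    x = arrWord k (tgw 2 2 n (j - 1) (n - j + 1) ++ tgw 2 2 n 0 n ++ tgw 2 2 n 0 j) ∧
    y = 0)

/-- The algebra `Γ(n) = kΔ(2,2,n)/I₃(n)`. -/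
def GamAlg (n : ℕ) (_ : 0 < n) : Type :=
  haveI : NeZero n := ⟨by omega⟩
  BoundQuiverAlg k (triSrc 2 2 n) (triTgt 2 2 n) (GamRelExtra k n)

instance (n : ℕ) (hn : 0 < n) : Ring (GamAlg k n hn) :=
  haveI : NeZero n := ⟨by omega⟩
  inferInstanceAs (Ring (BoundQuiverAlg k (triSrc 2 2 n) (triTgt 2 2 n) (GamRelExtra k n)))

instance (n : ℕ) (hn : 0 < n) : Algebra k (GamAlg k n hn) :=
  haveI : NeZero n := ⟨by omega⟩
  inferInstanceAs (Algebra k (BoundQuiverAlg k (triSrc 2 2 n) (triTgt 2 2 n) (GamRelExtra k n)))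

/-- The relations `I₄(p,q,r)` of the algebra `T(p,q,r)`. -/
def TRelExtra : FreeAlgebra k (TriV p q r ⊕ TriE p q r) →
    FreeAlgebra k (TriV p q r ⊕ TriE p q r) → Prop := fun x y =>
  (x = arrWord k (taw p q r 0 p) ∧ y = arrWord k (tbw p q r 0 q)) ∨
  (x = arrWord k (tbw p q r 0 q) ∧ y = arrWord k (tgw p q r 0 r)) ∨
  (x = arrWord k (taw p q r (p - 1) 1 ++ tgw p q r 0 1) ∧ y = 0) ∨
  (x = arrWord k (tbw p q r (q - 1) 1 ++ tgw p q r 0 1) ∧ y = 0) ∨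
  (x = arrWord k (tgw p q r (r - 1) 1 ++ taw p q r 0 1) ∧ y = 0) ∨
  (x = arrWord k (tgw p q r (r - 1) 1 ++ tbw p q r 0 1) ∧ y = 0) ∨
  (x = arrWord k (taw p q r (p - 1) 1 ++ tbw p q r 0 1) ∧ y = 0) ∨
  (x = arrWord k (tbw p q r (q - 1) 1 ++ taw p q r 0 1) ∧ y = 0) ∨
  (∃ i : ℕ, 2 ≤ i ∧ i ≤ p - 1 ∧
    x = arrWord k (taw p q r (i - 1) (p - i + 1) ++ taw p q r 0 i) ∧ y = 0) ∨
  (∃ j : ℕ, 2 ≤ j ∧ j ≤ q - 1 ∧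
    x = arrWord k (tbw p q r (j - 1) (q - j + 1) ++ tbw p q r 0 j) ∧ y = 0) ∨
  (∃ l : ℕ, 2 ≤ l ∧ l ≤ r - 1 ∧
    x = arrWord k (tgw p q r (l - 1) (r - l + 1) ++ tgw p q r 0 l) ∧ y = 0)

/-- The algebra `T(p,q,r) = kΔ(p,q,r)/I₄(p,q,r)`. -/
def TAlg3 (_ : 0 < p) (_ : 0 < q) (_ : 0 < r) : Type :=
  haveI : NeZero p := ⟨by omega⟩
  haveI : NeZero q := ⟨by omega⟩
  haveI : NeZero r := ⟨by omega⟩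
  BoundQuiverAlg k (triSrc p q r) (triTgt p q r) (TRelExtra k p q r)

instance (hp : 0 < p) (hq : 0 < q) (hr : 0 < r) : Ring (TAlg3 k p q r hp hq hr) :=
  haveI : NeZero p := ⟨by omega⟩
  haveI : NeZero q := ⟨by omega⟩
  haveI : NeZero r := ⟨by omega⟩
  inferInstanceAs (Ring (BoundQuiverAlg k (triSrc p q r) (triTgt p q r) (TRelExtra k p q r)))

instance (hp : 0 < p) (hq : 0 < q) (hr : 0 < r) : Algebra k (TAlg3 k p q r hp hq hr) :=
  haveI : NeZero p := ⟨by omega⟩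
  haveI : NeZero q := ⟨by omega⟩
  haveI : NeZero r := ⟨by omega⟩
  inferInstanceAs (Algebra k
    (BoundQuiverAlg k (triSrc p q r) (triTgt p q r) (TRelExtra k p q r)))

end Tri
end QuiverAlg

section QuiverAlg
variable (k : Type) [Field k]

/-! ### The quiver `Σ(p,q)` -/

/-- Vertices of `Σ(p,q)`: `none` is `u`, `some none` is `v`, and the rest are the interior
vertices of the two paths from `u` to `v`. -/
def SigV (p q : ℕ) : Type := Option (Option (Fin (p - 1) ⊕ Fin (q - 1)))

/-- Arrows of `Σ(p,q)`: `Sum.inl true` is `γ`, `Sum.inl false` is `σ`, `Sum.inr (Sum.inl i)`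
is `α_{i+1}` and `Sum.inr (Sum.inr j)` is `β_{j+1}`. -/
def SigE (p q : ℕ) : Type := Bool ⊕ (Fin p ⊕ Fin q)

instance (p q : ℕ) : DecidableEq (SigV p q) :=
  inferInstanceAs (DecidableEq (Option (Option (Fin (p - 1) ⊕ Fin (q - 1)))))
instance (p q : ℕ) : Fintype (SigV p q) :=
  inferInstanceAs (Fintype (Option (Option (Fin (p - 1) ⊕ Fin (q - 1)))))

/-- The `j`-th vertex on the `α`-path of `Σ(p,q)` (`j = 0` is `u`, `j = p` is `v`). -/
def sigVA (p q : ℕ) (j : ℕ) : SigV p q :=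
  if h0 : j = 0 then none else if h : p ≤ j then some none
  else some (some (Sum.inl ⟨j - 1, by omega⟩))

/-- The `j`-th vertex on the `β`-path of `Σ(p,q)` (`j = 0` is `u`, `j = q` is `v`). -/
def sigVB (p q : ℕ) (j : ℕ) : SigV p q :=
  if h0 : j = 0 then none else if h : q ≤ j then some none
  else some (some (Sum.inr ⟨j - 1, by omega⟩))

def sigSrc (p q : ℕ) : SigE p q → SigV p q
  | Sum.inl _ => some none
  | Sum.inr (Sum.inl i) => sigVA p q i.1
  | Sum.inr (Sum.inr j) => sigVB p q j.1

def sigTgt (p q : ℕ) : SigE p q → SigV p q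
  | Sum.inl _ => none
  | Sum.inr (Sum.inl i) => sigVA p q (i.1 + 1)
  | Sum.inr (Sum.inr j) => sigVB p q (j.1 + 1)

/-- The word `α_{s+1} ⋯ α_{s+len}` on the `α`-path of `Σ(p,q)`. -/
def saw (p q : ℕ) (hp : 0 < p) (st len : ℕ) : List (SigE p q) :=
  (List.range len).map (fun u => Sum.inr (Sum.inl ⟨(st + u) % p, Nat.mod_lt _ hp⟩))

/-- The word `β_{s+1} ⋯ β_{s+len}` on the `β`-path of `Σ(p,q)`. -/
def sbw (p q : ℕ) (hq : 0 < q) (st len : ℕ) : List (SigE p q) :=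
  (List.range len).map (fun u => Sum.inr (Sum.inr ⟨(st + u) % q, Nat.mod_lt _ hq⟩))

section Sig
variable (p q : ℕ) (hp : 0 < p) (hq : 0 < q)

/-- The relations `I₅(p,q)` of the algebra `T(p,q)`. -/
def TpqRelExtra : FreeAlgebra k (SigV p q ⊕ SigE p q) →
    FreeAlgebra k (SigV p q ⊕ SigE p q) → Prop := fun x y =>
  (x = arrWord k (saw p q hp 0 p ++ ([Sum.inl true] : List (SigE p q))) ∧
    y = arrWord k (sbw p q hq 0 q ++ ([Sum.inl false] : List (SigE p q)))) ∨
  (x = arrWord k (Sum.inl true :: saw p q hp 0 p) ∧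
    y = arrWord k (Sum.inl false :: sbw p q hq 0 q)) ∨
  (x = arrWord k (saw p q hp (p - 1) 1 ++ ([Sum.inl false] : List (SigE p q))) ∧ y = 0) ∨
  (x = arrWord k (Sum.inl false :: saw p q hp 0 1) ∧ y = 0) ∨
  (x = arrWord k (sbw p q hq (q - 1) 1 ++ ([Sum.inl true] : List (SigE p q))) ∧ y = 0) ∨
  (x = arrWord k (Sum.inl true :: sbw p q hq 0 1) ∧ y = 0) ∨
  (∃ i : ℕ, 2 ≤ i ∧ i ≤ p - 1 ∧
    x = arrWord k (saw p q hp (i - 1) (p - i + 1) ++ ([Sum.inl true] : List (SigE p q)) ++ saw p q hp 0 i) ∧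
    y = 0) ∨
  (∃ j : ℕ, 2 ≤ j ∧ j ≤ q - 1 ∧
    x = arrWord k (sbw p q hq (j - 1) (q - j + 1) ++ ([Sum.inl false] : List (SigE p q)) ++ sbw p q hq 0 j) ∧
    y = 0)

/-- The algebra `T(p,q) = kΣ(p,q)/I₅(p,q)`. -/
def TAlg2 : Type := BoundQuiverAlg k (sigSrc p q) (sigTgt p q) (TpqRelExtra k p q hp hq)

instance : Ring (TAlg2 k p q hp hq) :=
  inferInstanceAs (Ring (BoundQuiverAlg k (sigSrc p q) (sigTgt p q) (TpqRelExtra k p q hp hq)))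

instance : Algebra k (TAlg2 k p q hp hq) :=
  inferInstanceAs (Algebra k
    (BoundQuiverAlg k (sigSrc p q) (sigTgt p q) (TpqRelExtra k p q hp hq)))

end Sig

/-! ### The quiver `Θ(r)` -/

/-- Vertices of `Θ(r)`: `Sum.inl 0 = 0`, `Sum.inl 1 = a`, `Sum.inl 2 = b`, `Sum.inl 3 = d`,
and `Sum.inr i = c_{i+1}`. -/
def ThV (r : ℕ) : Type := Fin 4 ⊕ Fin (r - 1)

/-- Arrows of `Θ(r)`: `Sum.inl 0, ..., Sum.inl 5` are `α₁, α₂, β₁, β₂, σ₁, σ₂`, and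
`Sum.inr i` is `γ_{i+1}`. -/
def ThE (r : ℕ) : Type := Fin 6 ⊕ Fin r

instance (r : ℕ) : DecidableEq (ThV r) :=
  inferInstanceAs (DecidableEq (Fin 4 ⊕ Fin (r - 1)))
instance (r : ℕ) : Fintype (ThV r) :=
  inferInstanceAs (Fintype (Fin 4 ⊕ Fin (r - 1)))

/-- The `j`-th vertex on the `γ`-cycle of `Θ(r)` (`j = 0` and `j = r` are the vertex `0`). -/
def thC (r : ℕ) (j : ℕ) : ThV r :=
  if h : j = 0 ∨ r ≤ j then Sum.inl 0 else Sum.inr ⟨j - 1, by omega⟩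

def thSrc (r : ℕ) : ThE r → ThV r
  | Sum.inl i =>
      if i.1 = 0 ∨ i.1 = 2 ∨ i.1 = 4 then Sum.inl 0
      else if i.1 = 1 then Sum.inl 1 else if i.1 = 3 then Sum.inl 2 else Sum.inl 3
  | Sum.inr i => thC r i.1

def thTgt (r : ℕ) : ThE r → ThV r
  | Sum.inl i =>
      if i.1 = 1 ∨ i.1 = 3 then Sum.inl 0
      else if i.1 = 0 then Sum.inl 1 else if i.1 = 2 then Sum.inl 2
      else if i.1 = 4 then Sum.inl 3 else thC r 2
  | Sum.inr i => thC r (i.1 + 1)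

/-- The word `γ_{s+1} ⋯ γ_{s+len}` on the `γ`-cycle of `Θ(r)`. -/
def thw (r : ℕ) (hr : 0 < r) (st len : ℕ) : List (ThE r) :=
  (List.range len).map (fun u => Sum.inr ⟨(st + u) % r, Nat.mod_lt _ hr⟩)

section Theta
variable (r : ℕ) (hr : 0 < r)

/-- The relations `I₆(r)` of the algebra `T(2,2,r)*`. -/
def TStarRelExtra : FreeAlgebra k (ThV r ⊕ ThE r) → FreeAlgebra k (ThV r ⊕ ThE r) → Prop :=
  fun x y =>
  (x = arrWord k [(Sum.inl 0 : ThE r), Sum.inl 1] ∧ y = arrWord k (thw r hr 0 r)) ∨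
  (x = arrWord k [(Sum.inl 2 : ThE r), Sum.inl 3] ∧ y = arrWord k (thw r hr 0 r)) ∨
  (x = arrWord k (thw r hr (r - 1) 1 ++ ([Sum.inl 0] : List (ThE r))) ∧ y = 0) ∨
  (x = arrWord k [(Sum.inl 3 : ThE r), Sum.inl 0] ∧ y = 0) ∨
  (x = arrWord k (thw r hr (r - 1) 1 ++ ([Sum.inl 2] : List (ThE r))) ∧ y = 0) ∨
  (x = arrWord k [(Sum.inl 1 : ThE r), Sum.inl 2] ∧ y = 0) ∨
  (x = arrWord k (Sum.inl 1 :: thw r hr 0 1) ∧ y = 0) ∨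
  (x = arrWord k [(Sum.inl 1 : ThE r), Sum.inl 4] ∧ y = 0) ∨
  (x = arrWord k (Sum.inl 3 :: thw r hr 0 1) ∧ y = 0) ∨
  (x = arrWord k [(Sum.inl 3 : ThE r), Sum.inl 4] ∧ y = 0) ∨
  (x = arrWord k [(Sum.inl 1 : ThE r), Sum.inl 0, Sum.inl 1] ∧ y = 0) ∨
  (x = arrWord k [(Sum.inl 3 : ThE r), Sum.inl 2, Sum.inl 3] ∧ y = 0) ∨
  (x = arrWord k (thw r hr 1 (r - 1) ++ ([Sum.inl 4] : List (ThE r))) ∧ y = 0) ∨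
  (x = arrWord k (Sum.inl 5 :: (thw r hr 2 (r - 2) ++ thw r hr 0 1)) ∧ y = 0) ∨
  (∃ l : ℕ, 3 ≤ l ∧ l ≤ r - 1 ∧
    x = arrWord k (thw r hr (l - 1) (r - l + 1) ++ thw r hr 0 l) ∧ y = 0)

/-- The algebra `T(2,2,r)* = kΘ(r)/I₆(r)`. -/
def TStarAlg : Type := BoundQuiverAlg k (thSrc r) (thTgt r) (TStarRelExtra k r hr)

instance : Ring (TStarAlg k r hr) :=
  inferInstanceAs (Ring (BoundQuiverAlg k (thSrc r) (thTgt r) (TStarRelExtra k r hr)))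

instance : Algebra k (TStarAlg k r hr) :=
  inferInstanceAs (Algebra k (BoundQuiverAlg k (thSrc r) (thTgt r) (TStarRelExtra k r hr)))

end Theta
end QuiverAlg

set_option autoImplicit false
set_option linter.unusedSectionVars false

namespace DerivedTools

set_option hygiene false in
local notation "RMod" => ModuleCat.{0}
set_option hygiene false in
local notation "DMod" R:max => DerivedCategory (ModuleCat.{0} R)
set_option hygiene false in
local notation "HasDMod" R:max => HasDerivedCategory.{1} (ModuleCat.{0} R)
set_option hygiene false in
local notation "ChMod" R:max => CochainComplex (ModuleCat.{0} R) ℤ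

section
variable {R : Type} [Ring R]

section QuasiIso

/-- The homology class of an element killed by the differential. -/
def homCls (S : ShortComplex (RMod R)) (x : S.X₂) (hx : S.g x = 0) : S.homology :=
  S.moduleCatHomologyIso.inv (Submodule.Quotient.mk ⟨x, hx⟩)

lemma homCls_surj (S : ShortComplex (RMod R)) (h : S.homology) :
    ∃ x hx, homCls S x hx = h := by
  obtain ⟨⟨x, hx⟩, h'⟩ := Submodule.Quotient.mk_surjective _ (S.moduleCatHomologyIso.hom h)
  refine ⟨x, hx, ?_⟩
  unfold homCls
  rw [h']
  exact S.moduleCatHomologyIso.hom_inv_id_apply h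

lemma homCls_eq_iff (S : ShortComplex (RMod R)) (x y : S.X₂) (hx hy) :
    homCls S x hx = homCls S y hy ↔ ∃ z, x = y + S.f z := by
  have hinj : Function.Injective S.moduleCatHomologyIso.inv :=
    (ModuleCat.mono_iff_injective _).1 inferInstance
  unfold homCls
  refine hinj.eq_iff.trans ((Submodule.Quotient.eq _).trans ?_)
  constructor
  · rintro ⟨z, hz⟩
    refine ⟨z, ?_⟩
    have := congrArg Subtype.val hz
    change S.f z = x - y at this
    rw [this]; abel
  · rintro ⟨z, hz⟩
    refine ⟨z, Subtype.ext ?_⟩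
    change S.f z = x - y
    rw [hz]; abel

lemma homologyπ_cyclesIso (S : ShortComplex (RMod R)) (x : S.X₂) (hx : S.g x = 0) :
    homCls S x hx = S.homologyπ (S.moduleCatCyclesIso.inv ⟨x, hx⟩) := by
  unfold homCls
  exact (ConcreteCategory.congr_hom S.moduleCatCyclesIso_inv_π ⟨x, hx⟩).symm

lemma homologyMap_homCls {S T : ShortComplex (RMod R)} (f : S ⟶ T) (x : S.X₂)
    (hx : S.g x = 0) (hy : T.g (f.τ₂ x) = 0) :
    ShortComplex.homologyMap f (homCls S x hx) = homCls T (f.τ₂ x) hy := by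
  rw [homologyπ_cyclesIso, homologyπ_cyclesIso]
  have := ConcreteCategory.congr_hom (ShortComplex.homologyπ_naturality f)
    (S.moduleCatCyclesIso.inv ⟨x, hx⟩)
  refine this.trans ?_
  change T.homologyπ (ShortComplex.cyclesMap f _) = _
  congr 1
  have hinj : Function.Injective T.iCycles := (ModuleCat.mono_iff_injective _).1 inferInstance
  apply hinj
  have e1 := ConcreteCategory.congr_hom (ShortComplex.cyclesMap_i f)
    (S.moduleCatCyclesIso.inv ⟨x, hx⟩)
  refine e1.trans ?_
  have e2 := ConcreteCategory.congr_hom S.moduleCatCyclesIso_inv_iCycles ⟨x, hx⟩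
  have e3 := ConcreteCategory.congr_hom T.moduleCatCyclesIso_inv_iCycles ⟨f.τ₂ x, hy⟩
  change f.τ₂ (S.iCycles _) = _
  erw [e2, e3]
  rfl

lemma sc_quasiIso_iff {S T : ShortComplex (RMod R)} (f : S ⟶ T) :
    ShortComplex.QuasiIso f ↔ (∀ x : S.X₂, S.g x = 0 → (∃ y, f.τ₂ x = T.f y) → ∃ z, x = S.f z) ∧
      (∀ y : T.X₂, T.g y = 0 → ∃ x, S.g x = 0 ∧ ∃ z, y = f.τ₂ x + T.f z) := by
  have hg : ∀ x : S.X₂, S.g x = 0 → T.g (f.τ₂ x) = 0 := fun x hx => by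
    have := ConcreteCategory.congr_hom f.comm₂₃ x
    change T.g (f.τ₂ x) = f.τ₃ (S.g x) at this
    rw [this, hx, map_zero]
  rw [ShortComplex.quasiIso_iff, ConcreteCategory.isIso_iff_bijective]
  constructor
  · intro hb
    refine ⟨fun x hx ⟨y, hy⟩ => ?_, fun y hy => ?_⟩
    · have h1 : homCls S x hx = homCls S 0 (map_zero _) := by
        apply hb.1
        rw [homologyMap_homCls f x hx (hg x hx), homologyMap_homCls f 0 _ (hg 0 (map_zero _)),
          homCls_eq_iff]
        exact ⟨y, by rw [hy, map_zero, zero_add]⟩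
      obtain ⟨z, hz⟩ := (homCls_eq_iff S _ _ _ _).1 h1
      exact ⟨z, by rw [hz, zero_add]⟩
    · obtain ⟨h, hh⟩ := hb.2 (homCls T y hy)
      obtain ⟨x, hx, rfl⟩ := homCls_surj S h
      rw [homologyMap_homCls f x hx (hg x hx)] at hh
      exact ⟨x, hx, (homCls_eq_iff T _ _ _ _).1 hh.symm⟩
  · rintro ⟨h1, h2⟩
    refine ⟨?_, ?_⟩
    · intro a b hab
      obtain ⟨x, hx, rfl⟩ := homCls_surj S a
      obtain ⟨y, hy, rfl⟩ := homCls_surj S b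
      rw [homologyMap_homCls f x hx (hg x hx), homologyMap_homCls f y hy (hg y hy),
        homCls_eq_iff] at hab
      obtain ⟨z, hz⟩ := hab
      obtain ⟨w, hw⟩ := h1 (x - y) (by rw [map_sub, hx, hy, sub_zero])
        ⟨z, by rw [map_sub, hz]; abel⟩
      rw [homCls_eq_iff]
      exact ⟨w, by rw [← hw]; abel⟩
    · intro a
      obtain ⟨y, hy, rfl⟩ := homCls_surj T a
      obtain ⟨x, hx, z, hz⟩ := h2 y hy
      refine ⟨homCls S x hx, ?_⟩
      rw [homologyMap_homCls f x hx (hg x hx), homCls_eq_iff]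
      refine ⟨-z, ?_⟩
      rw [hz, map_neg]; abel

lemma quasiIso_elem_iff {K L : ChMod R} (f : K ⟶ L) :
    QuasiIso f ↔ ∀ i j k : ℤ, i + 1 = j → j + 1 = k →
      (∀ x : K.X j, K.d j k x = 0 → (∃ y, f.f j x = L.d i j y) → ∃ z, x = K.d i j z) ∧
      (∀ y : L.X j, L.d j k y = 0 → ∃ x, K.d j k x = 0 ∧ ∃ z, y = f.f j x + L.d i j z) := by
  rw [quasiIso_iff]
  constructor
  · intro h i j k hi hk
    have := h j
    rw [quasiIsoAt_iff' f i j k (by simp; omega) (by simp; omega), sc_quasiIso_iff] at this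
    exact this
  · intro h j
    rw [quasiIsoAt_iff' f (j-1) j (j+1) (by simp) (by simp), sc_quasiIso_iff]
    exact h (j-1) j (j+1) (by omega) rfl

end QuasiIso
end

section
variable {R : Type} [Ring R]

section DirectSum
open scoped Classical

variable {ι : Type} {M N : ι → RMod R}

variable (M) in
/-- The direct sum of a family of modules. -/
def dsum : RMod R := ModuleCat.of R (Π₀ n, M n)

variable (M) in
/-- The inclusion of a summand. -/
def dsumι (n : ι) : M n ⟶ dsum M :=
  ModuleCat.ofHom (DFinsupp.lsingle (R := R) (M := fun n => M n) n)

/-- The map of direct sums induced by a family of maps. -/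
def dsumMap (f : ∀ n, M n ⟶ N n) : dsum M ⟶ dsum N :=
  ModuleCat.ofHom (DFinsupp.mapRange.linearMap fun n => (f n).hom)

/-- The map out of a direct sum. -/
def dsumDesc {P : RMod R} (f : ∀ n, M n ⟶ P) : dsum M ⟶ P :=
  ModuleCat.ofHom (DFinsupp.lsum (R := R) (M := fun n => M n) ℕ fun n => (f n).hom)

lemma dsumι_map (f : ∀ n, M n ⟶ N n) (n : ι) : dsumι M n ≫ dsumMap f = f n ≫ dsumι N n := by
  ext x
  exact DFinsupp.mapRange_single (hf := fun n => map_zero (f n).hom)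

lemma dsumι_desc {P : RMod R} (f : ∀ n, M n ⟶ P) (n : ι) :
    dsumι M n ≫ dsumDesc f = f n := by
  ext x
  exact DFinsupp.lsum_single (R := R) (M := fun n => M n) ℕ (fun n => (f n).hom) n x

lemma dsum_hom_ext {P : RMod R} {f g : dsum M ⟶ P}
    (h : ∀ n, dsumι M n ≫ f = dsumι M n ≫ g) : f = g :=
  ModuleCat.hom_ext (DFinsupp.lhom_ext fun n x => ConcreteCategory.congr_hom (h n) x)

/-- The component of an element of a direct sum. -/
def dsumApp (x : dsum M) (n : ι) : M n := DFunLike.coe (F := Π₀ n, M n) x n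

lemma dsumMap_app (f : ∀ n, M n ⟶ N n) (x : dsum M) (n : ι) :
    dsumApp (dsumMap f x) n = f n (dsumApp x n) := rfl

lemma dsum_ext {x y : dsum M} (h : ∀ n, dsumApp x n = dsumApp y n) : x = y :=
  DFinsupp.ext h

lemma dsumι_app_same (n : ι) (x : M n) : dsumApp (dsumι M n x) n = x :=
  DFinsupp.single_eq_same (i := n) (β := fun n => M n) (b := x)

lemma dsumι_app_of_ne {m n : ι} (h : m ≠ n) (x : M m) : dsumApp (dsumι M m x) n = 0 :=
  DFinsupp.single_eq_of_ne (i := m) (β := fun n => M n) (b := x) (Ne.symm h)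

lemma exists_dsum_eq_sum (P : RMod R) [Module.Finite R P] (f : P ⟶ dsum M) :
    ∃ t : Finset ι, ∀ x, f x = ∑ n ∈ t, dsumι M n (dsumApp (f x) n) := by
  let ψ : P →ₗ[R] Π₀ n, M n := f.hom
  obtain ⟨S, hS⟩ := Module.Finite.fg_top (R := R) (M := P)
  let t : Finset ι := S.sup fun x => (ψ x).support
  have ht : ∀ x, (ψ x).support ⊆ t := fun x => by
    have hx : x ∈ Submodule.span R (S : Set P) := by rw [hS]; trivial
    induction hx using Submodule.span_induction with
    | mem x hx => exact Finset.le_sup (f := fun x => (ψ x).support) hx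
    | zero => simp
    | add x y _ _ hx hy =>
      rw [map_add]; exact DFinsupp.support_add.trans (Finset.union_subset hx hy)
    | smul a x _ hx =>
      rw [map_smul]; exact (DFinsupp.support_smul _ _).trans hx
  refine ⟨t, fun x => ?_⟩
  change ψ x = ∑ n ∈ t, (DFinsupp.single n (ψ x n) : Π₀ n, M n)
  ext n
  rw [DFinsupp.finsetSum_apply]
  by_cases h : n ∈ t
  · rw [Finset.sum_eq_single n, DFinsupp.single_eq_same]
    · intro m _ hm
      exact DFinsupp.single_eq_of_ne (Ne.symm hm)
    · exact fun h' => (h' h).elim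
  · rw [Finset.sum_eq_zero, DFinsupp.notMem_support_iff.1 fun h' => h (ht x h')]
    intro m hm
    exact DFinsupp.single_eq_of_ne fun h' => h (h' ▸ hm)

lemma exists_dsum_supported (x : dsum M) {N : ι → RMod R} (y : ∀ n, N n) :
    ∃ z : dsum N, ∀ n, (dsumApp x n = 0 → dsumApp z n = 0) ∧
      (dsumApp x n ≠ 0 → dsumApp z n = y n) := by
  let x' : Π₀ n, M n := x
  refine ⟨(DFinsupp.mk x'.support fun n => y n : Π₀ n, N n), fun n => ⟨fun h => ?_, fun h => ?_⟩⟩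
  · exact DFinsupp.mk_of_notMem (by simpa using! h)
  · exact DFinsupp.mk_of_mem (by simpa using! h)

end DirectSum

section SumProd
variable {ι : Type} (K L : ι → ChMod R)

/-- The direct sum of a family of complexes. -/
@[reducible] def sumCx : ChMod R where
  X i := dsum fun n => (K n).X i
  d i j := dsumMap fun n => (K n).d i j
  shape i j h := dsum_hom_ext fun n => by
    rw [dsumι_map, (K n).shape i j h, zero_comp, comp_zero]
  d_comp_d' i j k _ _ := dsum_hom_ext fun n => by
    rw [← Category.assoc, dsumι_map, Category.assoc, dsumι_map, ← Category.assoc,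
      (K n).d_comp_d, zero_comp, comp_zero]

/-- The direct product of a family of complexes. -/
@[reducible] def prodCx : ChMod R where
  X i := ModuleCat.of R (∀ n, (K n).X i)
  d i j := ModuleCat.ofHom (LinearMap.pi fun n => ((K n).d i j).hom ∘ₗ LinearMap.proj n)
  shape i j h := by
    ext x n
    change (K n).d i j _ = 0
    rw [(K n).shape i j h]; rfl
  d_comp_d' i j k _ _ := by
    ext x n
    exact ConcreteCategory.congr_hom ((K n).d_comp_d i j k) (id (α := ∀ n, (K n).X i) x n)

variable {K L}

/-- The direct sum of a family of chain maps. -/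
@[reducible] def sumCxMap (f : ∀ n, K n ⟶ L n) : sumCx K ⟶ sumCx L where
  f i := dsumMap fun n => (f n).f i
  comm' i j _ := dsum_hom_ext fun n => by
    change _ ≫ _ ≫ dsumMap (fun n => (L n).d i j) = _ ≫ dsumMap (fun n => (K n).d i j) ≫ _
    rw [← Category.assoc, dsumι_map, Category.assoc, dsumι_map, ← Category.assoc,
      (f n).comm i j, ← Category.assoc, dsumι_map, Category.assoc, Category.assoc, dsumι_map]

/-- The direct product of a family of chain maps. -/
@[reducible] def prodCxMap (f : ∀ n, K n ⟶ L n) : prodCx K ⟶ prodCx L where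
  f i := ModuleCat.ofHom (LinearMap.pi fun n => ((f n).f i).hom ∘ₗ LinearMap.proj n)
  comm' i j _ := by
    ext x n
    exact ConcreteCategory.congr_hom ((f n).comm i j) (id (α := ∀ n, (K n).X i) x n)

variable (K) in
/-- The inclusion of a summand. -/
@[reducible] def sumCxι (n : ι) : K n ⟶ sumCx K where
  f i := dsumι (fun n => (K n).X i) n
  comm' i j _ := dsumι_map (fun n => (K n).d i j) n

variable (K) in
/-- The projection to a factor. -/
@[reducible] def prodCxπ (n : ι) : prodCx K ⟶ K n where
  f i := ModuleCat.ofHom (LinearMap.proj n)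

/-- The map out of a direct sum. -/
@[reducible] def sumCxDesc {M : ChMod R} (f : ∀ n, K n ⟶ M) : sumCx K ⟶ M where
  f i := dsumDesc fun n => (f n).f i
  comm' i j _ := dsum_hom_ext fun n => by
    change _ = _ ≫ dsumMap (fun n => (K n).d i j) ≫ _
    rw [← Category.assoc, dsumι_desc, ← Category.assoc, dsumι_map, Category.assoc, dsumι_desc,
      (f n).comm i j]

/-- The map into a direct product. -/
@[reducible] def prodCxLift {M : ChMod R} (f : ∀ n, M ⟶ K n) : M ⟶ prodCx K where
  f i := ModuleCat.ofHom (LinearMap.pi fun n => ((f n).f i).hom)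
  comm' i j _ := by
    ext x n
    exact ConcreteCategory.congr_hom ((f n).comm i j) x

lemma sumCxι_desc {M : ChMod R} (f : ∀ n, K n ⟶ M) (n : ι) :
    sumCxι K n ≫ sumCxDesc f = f n := by
  ext i : 1
  exact dsumι_desc (fun n => (f n).f i) n

lemma prodCxLift_π {M : ChMod R} (f : ∀ n, M ⟶ K n) (n : ι) :
    prodCxLift f ≫ prodCxπ K n = f n := rfl

lemma sumCxι_map (f : ∀ n, K n ⟶ L n) (n : ι) :
    sumCxι K n ≫ sumCxMap f = f n ≫ sumCxι L n := by
  ext i : 1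
  exact dsumι_map (fun n => (f n).f i) n

lemma prodCxMap_π (f : ∀ n, K n ⟶ L n) (n : ι) :
    prodCxMap f ≫ prodCxπ L n = prodCxπ K n ≫ f n := rfl

lemma quasiIso_sumCxMap (f : ∀ n, K n ⟶ L n) (hf : ∀ n, QuasiIso (f n)) :
    QuasiIso (sumCxMap f) := by
  rw [quasiIso_elem_iff]
  intro i j k hi hk
  have H := fun n => (quasiIso_elem_iff (f n)).1 (hf n) i j k hi hk
  constructor
  · intro x hx ⟨y, hy⟩
    have h1 : ∀ n, ∃ z, dsumApp x n = (K n).d i j z := fun n => (H n).1 (dsumApp x n)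
      (congrArg (fun t => dsumApp t n) hx) ⟨dsumApp y n, congrArg (fun t => dsumApp t n) hy⟩
    choose z hz using h1
    obtain ⟨w, hw⟩ := exists_dsum_supported x z
    refine ⟨w, dsum_ext fun n => ?_⟩
    change dsumApp x n = (K n).d i j (dsumApp w n)
    by_cases h : dsumApp x n = 0
    · rw [(hw n).1 h, map_zero, h]
    · rw [(hw n).2 h, hz n]
  · intro y hy
    have h1 := fun n => (H n).2 (dsumApp y n) (congrArg (fun t => dsumApp t n) hy)
    choose x hx z hz using h1
    obtain ⟨u, hu⟩ := exists_dsum_supported y x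
    obtain ⟨w, hw⟩ := exists_dsum_supported y z
    refine ⟨u, dsum_ext fun n => ?_, w, dsum_ext fun n => ?_⟩
    · refine (dsumMap_app _ u n).trans ?_
      by_cases h : dsumApp y n = 0
      · rw [(hu n).1 h, map_zero]; rfl
      · rw [(hu n).2 h, hx n]; rfl
    · change dsumApp y n = (f n).f j (dsumApp u n) + (L n).d i j (dsumApp w n)
      by_cases h : dsumApp y n = 0
      · rw [(hu n).1 h, (hw n).1 h, map_zero, map_zero, h, add_zero]
      · rw [(hu n).2 h, (hw n).2 h, ← hz n]

lemma quasiIso_prodCxMap (f : ∀ n, K n ⟶ L n) (hf : ∀ n, QuasiIso (f n)) :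
    QuasiIso (prodCxMap f) := by
  rw [quasiIso_elem_iff]
  intro i j k hi hk
  have H := fun n => (quasiIso_elem_iff (f n)).1 (hf n) i j k hi hk
  constructor
  · rintro (x : ∀ n, (K n).X j) hx ⟨(y : ∀ n, (L n).X i), hy⟩
    have h1 : ∀ n, ∃ z, x n = (K n).d i j z := fun n => (H n).1 (x n)
      (congrFun hx n) ⟨y n, congrFun hy n⟩
    choose z hz using h1
    exact ⟨z, funext hz⟩
  · rintro (y : ∀ n, (L n).X j) hy
    have h1 := fun n => (H n).2 (y n) (congrFun hy n)
    choose x hx z hz using h1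
    exact ⟨x, funext hx, z, funext hz⟩

/-- A family of null homotopies assembles to a null homotopy on the direct sum. -/
def sumCxHomotopy {M : ChMod R} (f : sumCx K ⟶ M)
    (h : ∀ n, Homotopy (sumCxι K n ≫ f) 0) : Homotopy f 0 where
  hom i j := dsumDesc fun n => (h n).hom i j
  zero i j hij := dsum_hom_ext fun n => by
    rw [dsumι_desc, (h n).zero i j hij, comp_zero]
  comm i := by
    refine dsum_hom_ext fun n => ?_
    have h1 := (h n).comm i
    rw [dNext_eq _ (show (ComplexShape.up ℤ).Rel i (i+1) by simp),
      prevD_eq _ (show (ComplexShape.up ℤ).Rel (i-1) i by simp)] at h1 ⊢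
    refine h1.trans ?_
    change _ + _ + 0 = _ ≫ (dsumMap (fun n => (K n).d i (i+1)) ≫ _ + _ + 0)
    rw [add_zero, add_zero, Preadditive.comp_add, ← Category.assoc _ (dsumMap _), dsumι_map,
      Category.assoc, dsumι_desc, ← Category.assoc (dsumι _ n), dsumι_desc]

end SumProd
end

section
variable {R : Type} [Ring R] [HasDMod R]

open DerivedCategory

lemma exists_qis_homotopy_of_Q_map_eq_zero {K L : ChMod R} (f : K ⟶ L)
    (h : Q.map f = 0) :
    ∃ (K' : ChMod R) (s : K' ⟶ K), QuasiIso s ∧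
      Nonempty (Homotopy (s ≫ f) 0) := by
  have h1 : Qh.map ((HomotopyCategory.quotient _ _).map f) =
      Qh.map (0 : (HomotopyCategory.quotient _ (ComplexShape.up ℤ)).obj K ⟶
        (HomotopyCategory.quotient _ _).obj L) := by
    have := (quotientCompQhIso (RMod R)).hom.naturality f
    rw [h, comp_zero] at this
    rw [Functor.map_zero]
    exact (cancel_mono ((quotientCompQhIso (RMod R)).hom.app L)).1
      (this.trans zero_comp.symm)
  rw [MorphismProperty.map_eq_iff_precomp Qh
    (HomotopyCategory.quasiIso (RMod R) (ComplexShape.up ℤ))] at h1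
  obtain ⟨Z, s, hs, h2⟩ := h1
  obtain ⟨Z, rfl⟩ := HomotopyCategory.quotient_obj_surjective Z
  obtain ⟨s, rfl⟩ := (HomotopyCategory.quotient _ _).map_surjective s
  refine ⟨Z, s, ?_, ⟨HomotopyCategory.homotopyOfEq _ _ ?_⟩⟩
  · rwa [HomotopyCategory.quotient_map_mem_quasiIso_iff] at hs
  · rw [Functor.map_comp, h2, comp_zero, Functor.map_zero]

section Coproduct
variable {ι : Type} (K : ι → ChMod R)

lemma sumCx_Q_hom_ext {Y : DMod R} {f g : Q.obj (sumCx K) ⟶ Y}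
    (h : ∀ n, Q.map (sumCxι K n) ≫ f = Q.map (sumCxι K n) ≫ g) : f = g := by
  rw [← sub_eq_zero]
  have h' : ∀ n, Q.map (sumCxι K n) ≫ (f - g) = 0 := fun n => by
    rw [Preadditive.comp_sub, h n, sub_self]
  generalize f - g = d at h'
  obtain ⟨L, ⟨e⟩⟩ : ∃ L, Nonempty (Y ≅ Q.obj L) := ⟨_, ⟨(Q.objObjPreimageIso Y).symm⟩⟩
  obtain ⟨L', φ, s, hs, hd⟩ := left_fac (d ≫ e.hom)
  have h2 : ∀ n, Q.map (sumCxι K n ≫ φ) = 0 := fun n => by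
    have : Q.map φ = d ≫ e.hom ≫ Q.map s := by
      rw [← Category.assoc, hd, Category.assoc, IsIso.inv_hom_id, Category.comp_id]
    rw [Functor.map_comp, this, ← Category.assoc, h' n, zero_comp]
  choose K' t ht H using fun n => exists_qis_homotopy_of_Q_map_eq_zero _ (h2 n)
  have := quasiIso_sumCxMap t ht
  have h3 : Q.map (sumCxMap t ≫ φ) = 0 := by
    rw [← Functor.map_zero Q]
    refine Q_map_eq_of_homotopy _ (sumCxHomotopy _ fun n => (Homotopy.ofEq ?_).trans (H n).some)
    rw [← Category.assoc, sumCxι_map, Category.assoc]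
  have h4 : Q.map φ = 0 := by
    rw [Functor.map_comp] at h3
    exact (cancel_epi (Q.map (sumCxMap t))).1 (h3.trans comp_zero.symm)
  rw [← cancel_mono e.hom, hd, h4, zero_comp, zero_comp]

lemma exists_sumCx_Q_desc {Y : DMod R} (f : ∀ n, Q.obj (K n) ⟶ Y) :
    ∃ g : Q.obj (sumCx K) ⟶ Y, ∀ n, Q.map (sumCxι K n) ≫ g = f n := by
  obtain ⟨L, ⟨e⟩⟩ : ∃ L, Nonempty (Y ≅ Q.obj L) := ⟨_, ⟨(Q.objObjPreimageIso Y).symm⟩⟩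
  choose K' s hs g hg using fun n => right_fac (f n ≫ e.hom)
  have := quasiIso_sumCxMap s fun n => (isIso_Q_map_iff_quasiIso (RMod R) _).1 (hs n)
  refine ⟨inv (Q.map (sumCxMap s)) ≫ Q.map (sumCxDesc g) ≫ e.inv, fun n => ?_⟩
  have h1 : Q.map (sumCxι K n) = inv (Q.map (s n)) ≫ Q.map (sumCxι K' n) ≫ Q.map (sumCxMap s) := by
    rw [← Functor.map_comp, sumCxι_map, Functor.map_comp, IsIso.inv_hom_id_assoc]
  rw [h1, Category.assoc, Category.assoc, IsIso.hom_inv_id_assoc, ← Functor.map_comp_assoc,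
    sumCxι_desc, ← Category.assoc, ← hg, Category.assoc, e.hom_inv_id, Category.comp_id]

/-- The direct sum of complexes is a coproduct in the derived category. -/
def sumCofanIsColimit : IsColimit (Cofan.mk (Q.obj (sumCx K)) fun n => Q.map (sumCxι K n)) :=
  Cofan.IsColimit.mk _ (fun s => (exists_sumCx_Q_desc K s.inj).choose)
    (fun s => (exists_sumCx_Q_desc K s.inj).choose_spec)
    (fun s _ hm => sumCx_Q_hom_ext K fun n =>
      (hm n).trans ((exists_sumCx_Q_desc K s.inj).choose_spec n).symm)

lemma exists_prodCx_Q_lift {Y : DMod R} (f : ∀ n, Y ⟶ Q.obj (K n)) :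
    ∃ g : Y ⟶ Q.obj (prodCx K), ∀ n, g ≫ Q.map (prodCxπ K n) = f n := by
  obtain ⟨L, ⟨e⟩⟩ : ∃ L, Nonempty (Y ≅ Q.obj L) := ⟨_, ⟨(Q.objObjPreimageIso Y).symm⟩⟩
  choose K' g s hs hg using fun n => left_fac (e.inv ≫ f n)
  have := quasiIso_prodCxMap s fun n => (isIso_Q_map_iff_quasiIso (RMod R) _).1 (hs n)
  refine ⟨e.hom ≫ Q.map (prodCxLift g) ≫ inv (Q.map (prodCxMap s)), fun n => ?_⟩
  have h1 : Q.map (prodCxπ K n) = Q.map (prodCxMap s) ≫ Q.map (prodCxπ K' n) ≫ inv (Q.map (s n)) := by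
    rw [← Functor.map_comp_assoc, prodCxMap_π, Functor.map_comp, Category.assoc,
      IsIso.hom_inv_id, Category.comp_id]
  rw [h1, Category.assoc, Category.assoc, IsIso.inv_hom_id_assoc, ← Functor.map_comp_assoc,
    prodCxLift_π, ← hg, e.hom_inv_id_assoc]

end Coproduct
end

section Compact
variable {𝒟 : Type*} [Category* 𝒟] [Preadditive 𝒟]

/-- `Z` is compact: every map from `Z` to a coproduct is a finite sum of maps to the summands. -/
def IsCpt (Z : 𝒟) : Prop :=
  ∀ (ι : Type) (W : ι → 𝒟) (c : Cofan W) (_ : IsColimit c) (f : Z ⟶ c.pt),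
    ∃ (s : Finset ι) (g : ∀ i, Z ⟶ W i), f = ∑ i ∈ s, g i ≫ c.inj i

lemma IsCpt.of_iso {Z Z' : 𝒟} (h : IsCpt Z) (e : Z ≅ Z') : IsCpt Z' := fun ι W c hc f => by
  obtain ⟨s, g, hg⟩ := h ι W c hc (e.hom ≫ f)
  refine ⟨s, fun i => e.inv ≫ g i, ?_⟩
  simp only [Category.assoc, ← Preadditive.comp_sum, ← hg, e.inv_hom_id_assoc]

lemma IsCpt.map_equiv {𝒟' : Type*} [Category* 𝒟'] [Preadditive 𝒟'] {Z : 𝒟} (h : IsCpt Z)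
    (e : 𝒟 ≌ 𝒟') [e.functor.Additive] : IsCpt (e.functor.obj Z) := fun ι W c hc f => by
  obtain ⟨s, g, hg⟩ := h ι _ _ (isColimitCofanMkObjOfIsColimit e.inverse W c.inj
    (hc.ofIsoColimit (Cofan.ext (Iso.refl _) fun _ => Category.comp_id _)))
    (e.unit.app Z ≫ e.inverse.map f)
  refine ⟨s, fun i => e.functor.map (g i) ≫ e.counit.app (W i), ?_⟩
  have h1 : f = e.functor.map (e.unit.app Z ≫ e.inverse.map f) ≫ e.counit.app c.pt := by
    simp
  rw [h1, hg, Functor.map_sum, Preadditive.sum_comp]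
  refine Finset.sum_congr rfl fun i _ => ?_
  simp only [Functor.map_comp, Category.assoc]
  congr 1
  exact e.counit.naturality (c.inj i)

lemma exists_cofan_proj {ι : Type} {W : ι → 𝒟} {c : Cofan W} (hc : IsColimit c) (j : ι) :
    ∃ p : c.pt ⟶ W j, c.inj j ≫ p = 𝟙 _ ∧ ∀ i, i ≠ j → c.inj i ≫ p = 0 := by
  classical
  refine ⟨Cofan.IsColimit.desc hc fun i => if h : i = j then eqToHom (by rw [h]) else 0, ?_, ?_⟩
  · simp
  · intro i hi
    simp [hi]

variable [HasZeroObject 𝒟] [HasShift 𝒟 ℤ] [∀ n : ℤ, (shiftFunctor 𝒟 n).Additive]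

omit [HasZeroObject 𝒟] in
lemma IsCpt.shift {Z : 𝒟} (h : IsCpt Z) (n : ℤ) : IsCpt (Z⟦n⟧) :=
  haveI : (shiftEquiv 𝒟 n).functor.Additive := inferInstanceAs (shiftFunctor 𝒟 n).Additive
  h.map_equiv (shiftEquiv 𝒟 n)

open Pretriangulated

lemma IsCpt.cone [Pretriangulated 𝒟] {T : Triangle 𝒟} (hT : T ∈ distTriang 𝒟)
    (h1 : IsCpt T.obj₁) (h2 : IsCpt T.obj₂) : IsCpt T.obj₃ := fun ι W c hc f => by
  classical
  obtain ⟨s, g, hg⟩ := h2 ι W c hc (T.mor₂ ≫ f)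
  have h0 : ∀ i ∈ s, T.mor₁ ≫ g i = 0 := fun j hj => by
    obtain ⟨p, hp, hp'⟩ := exists_cofan_proj hc j
    have : T.mor₁ ≫ (∑ i ∈ s, g i ≫ c.inj i) ≫ p = 0 := by
      rw [← hg, Category.assoc, comp_distTriang_mor_zero₁₂_assoc _ hT, zero_comp]
    rw [Preadditive.sum_comp, Finset.sum_eq_single j, Category.assoc, hp, Category.comp_id] at this
    · exact this
    · intro i _ hi
      rw [Category.assoc, hp' i hi, comp_zero]
    · exact fun h => (h hj).elim
  have hex : ∀ i, ∃ g' : T.obj₃ ⟶ W i, i ∈ s → g i = T.mor₂ ≫ g' := fun i => by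
    by_cases hi : i ∈ s
    · obtain ⟨g', hg'⟩ := Triangle.yoneda_exact₂ T hT (g i) (h0 i hi)
      exact ⟨g', fun _ => hg'⟩
    · exact ⟨0, fun h => (hi h).elim⟩
  choose g' hg' using hex
  obtain ⟨d, hd⟩ := Triangle.yoneda_exact₃ T hT (f - ∑ i ∈ s, g' i ≫ c.inj i) (by
    rw [Preadditive.comp_sub, hg, Preadditive.comp_sum, sub_eq_zero]
    exact Finset.sum_congr rfl fun i hi => by rw [hg' i hi, Category.assoc])
  obtain ⟨t, u, hu⟩ := h1.shift 1 ι W c hc d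
  refine ⟨s ∪ t, fun i => (if i ∈ s then g' i else 0) + if i ∈ t then T.mor₃ ≫ u i else 0, ?_⟩
  simp only [Preadditive.add_comp, Finset.sum_add_distrib, ite_comp, zero_comp,
    Finset.sum_ite_mem, Finset.union_inter_cancel_left, Finset.union_inter_cancel_right]
  rw [sub_eq_iff_eq_add.1 hd, hu, Preadditive.comp_sum, add_comm]
  simp only [Category.assoc]

end Compact

section
variable {R : Type} [Ring R]
variable {ι : Type} (K : ι → ChMod R)

/-- The comparison map from the direct sum to the direct product. -/
@[reducible] def sumToProd : sumCx K ⟶ prodCx K where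
  f i := ModuleCat.ofHom (DFinsupp.coeFnLinearMap R)

lemma sumCxι_toProd_π_of_ne {m n : ι} (h : m ≠ n) :
    sumCxι K m ≫ sumToProd K ≫ prodCxπ K n = 0 := by
  ext i x
  exact dsumι_app_of_ne (M := fun n => (K n).X i) h x

lemma isIso_sumToProd (h : ∀ i, ∃ n₀, ∀ n, n ≠ n₀ → Subsingleton ((K n).X i)) :
    IsIso (sumToProd K) := by
  classical
  have : ∀ i, IsIso ((sumToProd K).f i) := fun i => by
    rw [ConcreteCategory.isIso_iff_bijective]
    refine ⟨fun x y hxy => dsum_ext fun n => congrFun hxy n, fun y => ?_⟩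
    obtain ⟨n₀, hn⟩ := h i
    let y' : ∀ n, (K n).X i := y
    refine ⟨dsumι (fun n => (K n).X i) n₀ (y' n₀), funext fun n => ?_⟩
    by_cases hh : n = n₀
    · subst hh; exact dsumι_app_same (M := fun n => (K n).X i) _ _
    · have := hn n hh
      exact Subsingleton.elim _ _
  exact HomologicalComplex.Hom.isIso_of_components _

variable [HasDMod R]
open DerivedCategory

lemma IsCpt.finite_ne_zero {Z : DMod R} (hZ : IsCpt Z)
    (h : ∀ i, ∃ n₀, ∀ n, n ≠ n₀ → Subsingleton ((K n).X i)) (f : ∀ n, Z ⟶ Q.obj (K n)) :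
    {n | f n ≠ 0}.Finite := by
  have := isIso_sumToProd K h
  obtain ⟨g, hg⟩ := exists_prodCx_Q_lift K f
  obtain ⟨s, u, hu⟩ := hZ _ _ _ (sumCofanIsColimit K) (g ≫ Q.map (inv (sumToProd K)))
  refine s.finite_toSet.subset fun n hn => ?_
  by_contra hns
  refine hn ?_
  have h1 : f n = (g ≫ Q.map (inv (sumToProd K))) ≫ Q.map (sumToProd K ≫ prodCxπ K n) := by
    rw [Category.assoc, ← Functor.map_comp, IsIso.inv_hom_id_assoc, hg]
  rw [h1, hu, Preadditive.sum_comp]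
  refine Finset.sum_eq_zero fun i hi => ?_
  have hin : i ≠ n := fun h => hns (h ▸ hi)
  rw [Category.assoc]
  change _ ≫ Q.map (sumCxι K i) ≫ _ = _
  rw [← Functor.map_comp, sumCxι_toProd_π_of_ne K hin, Functor.map_zero, comp_zero]

omit [HasDMod R] in
lemma isKProjective_single (P : RMod R) [Projective P] (m : ℤ) :
    CochainComplex.IsKProjective ((HomologicalComplex.single _ (ComplexShape.up ℤ) m).obj P) := by
  have : ∀ n : ℤ, Projective (((HomologicalComplex.single _ (ComplexShape.up ℤ) m).obj P).X n) :=
    fun n => by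
      by_cases h : n = m
      · subst h; exact Projective.of_iso (HomologicalComplex.singleObjXSelf _ n P).symm inferInstance
      · exact Projective.of_iso (HomologicalComplex.isZero_single_obj_X _ m P n h).isoZero.symm inferInstance
  exact CochainComplex.isKProjective_of_projective _ m

lemma exists_Q_map_eq {K L : ChMod R} [K.IsKProjective]
    (f : Q.obj K ⟶ Q.obj L) : ∃ g, Q.map g = f := by
  obtain ⟨g, hg⟩ := (CochainComplex.IsKProjective.Qh_map_bijective K
    ((HomotopyCategory.quotient _ _).obj L)).2 f
  obtain ⟨g, rfl⟩ := (HomotopyCategory.quotient _ _).map_surjective g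
  exact ⟨g, hg⟩

lemma isCpt_Q_single (P : RMod R) [Projective P] [Module.Finite R P] (m : ℤ) :
    IsCpt (Q.obj ((HomologicalComplex.single _ (ComplexShape.up ℤ) m).obj P)) := by
  classical
  intro ι W c hc f
  have := isKProjective_single P m
  obtain ⟨L, ⟨e⟩⟩ : ∃ L, Nonempty (c.pt ≅ Q.obj L) := ⟨_, ⟨(Q.objObjPreimageIso _).symm⟩⟩
  choose K hK using fun i => (⟨_, ⟨(Q.objObjPreimageIso (W i)).symm⟩⟩ : ∃ L, Nonempty (W i ≅ Q.obj L))
  choose K' s hs g hg using fun i => right_fac ((hK i).some.inv ≫ c.inj i ≫ e.hom)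
  let r : c.pt ⟶ Q.obj (sumCx K') := Cofan.IsColimit.desc hc fun i =>
    (hK i).some.hom ≫ inv (Q.map (s i)) ≫ Q.map (sumCxι K' i)
  have hr : r ≫ Q.map (sumCxDesc g) = e.hom := by
    refine Cofan.IsColimit.hom_ext hc _ _ fun i => ?_
    rw [← Category.assoc, Cofan.IsColimit.fac, Category.assoc, Category.assoc, ← Functor.map_comp,
      sumCxι_desc, ← hg, Iso.hom_inv_id_assoc]
  obtain ⟨φ, hφ⟩ := exists_Q_map_eq
    (K := (HomologicalComplex.single _ (ComplexShape.up ℤ) m).obj P) (f ≫ r)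
  have hfin : ∃ t : Finset ι, φ = ∑ i ∈ t, φ ≫ sumToProd K' ≫ prodCxπ K' i ≫ sumCxι K' i := by
    obtain ⟨t, ht⟩ := exists_dsum_eq_sum (M := fun n => (K' n).X m) P
      ((HomologicalComplex.singleObjXSelf (ComplexShape.up ℤ) m P).inv ≫ φ.f m)
    refine ⟨t, HomologicalComplex.from_single_hom_ext ?_⟩
    rw [← cancel_epi (HomologicalComplex.singleObjXSelf (ComplexShape.up ℤ) m P).inv]
    rw [← Preadditive.comp_sum, HomologicalComplex.comp_f, ← Category.assoc]
    ext x
    refine (ht x).trans ?_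
    generalize ((HomologicalComplex.singleObjXSelf (ComplexShape.up ℤ) m P).inv ≫ φ.f m) = ψ
    have h1 : (∑ j ∈ t, sumToProd K' ≫ prodCxπ K' j ≫ sumCxι K' j).f m =
        ∑ j ∈ t, (sumToProd K' ≫ prodCxπ K' j ≫ sumCxι K' j).f m :=
      map_sum (HomologicalComplex.Hom.fAddMonoidHom m) _ _
    rw [h1, Preadditive.comp_sum, ModuleCat.hom_sum, LinearMap.sum_apply]
    rfl
  obtain ⟨t, ht⟩ := hfin
  refine ⟨t, fun i => Q.map (φ ≫ sumToProd K' ≫ prodCxπ K' i) ≫ Q.map (s i) ≫ (hK i).some.inv, ?_⟩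
  rw [← cancel_mono e.hom, ← hr, ← Category.assoc, ← hφ]
  conv_lhs => rw [ht]
  rw [← Functor.map_comp, Preadditive.sum_comp, Functor.map_sum, Preadditive.sum_comp]
  refine Finset.sum_congr rfl fun i _ => ?_
  have h1 : Q.map (g i) = Q.map (s i) ≫ (hK i).some.inv ≫ c.inj i ≫ e.hom := by
    rw [hg, IsIso.hom_inv_id_assoc]
  rw [Category.assoc _ (c.inj i), hr]
  simp only [Category.assoc, sumCxι_desc, ← h1, Functor.map_comp]

lemma isCpt_single (P : RMod R) [Projective P] [Module.Finite R P] (m : ℤ) :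
    IsCpt ((singleFunctor (RMod R) m).obj P) := isCpt_Q_single P m

end

section
open DerivedCategory
variable {R : Type} [Ring R] [HasDMod R]

/-- The module `M` as a complex in degree `m`. -/
abbrev sg (m : ℤ) (M : RMod R) : DMod R :=
  (singleFunctor (RMod R) m).obj M

lemma sg_hom_eq_zero_of_isLE (P : RMod R) [Projective P] {m n : ℤ} (h : n < m)
    (W : DMod R) [W.IsLE n] (f : sg m P ⟶ W) : f = 0 := by
  obtain ⟨K, hK, ⟨e⟩⟩ := exists_iso_Q_obj_of_isLE W n
  have := isKProjective_single P m
  obtain ⟨g, hg⟩ := exists_Q_map_eq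
    (K := (HomologicalComplex.single _ (ComplexShape.up ℤ) m).obj P) (f ≫ e.hom)
  have : g = 0 := by
    apply HomologicalComplex.from_single_hom_ext
    exact (K.isZero_of_isStrictlyLE n m h).eq_of_tgt _ _
  have h0 : f ≫ e.hom = 0 := by
    refine hg.symm.trans ?_
    rw [this, Functor.map_zero]
    rfl
  exact (cancel_mono e.hom).1 (h0.trans zero_comp.symm)

lemma sg_hom_eq_zero_of_ne (P : RMod R) [Projective P] {m n : ℤ} (h : m ≠ n)
    (L : RMod R) (f : sg m P ⟶ sg n L) : f = 0 := by
  rcases lt_or_gt_of_ne h with h | h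
  · exact TStructure.t.zero f m n h
  · exact sg_hom_eq_zero_of_isLE P h _ f

lemma IsCpt.finite_hom_Q_single {Z : DMod R} (hZ : IsCpt Z)
    (M : ℤ → RMod R) : {s : ℤ | ∃ f : Z ⟶ Q.obj
      ((HomologicalComplex.single _ (ComplexShape.up ℤ) s).obj (M s)), f ≠ 0}.Finite := by
  classical
  refine (hZ.finite_ne_zero
    (fun s : ℤ => (HomologicalComplex.single _ (ComplexShape.up ℤ) s).obj (M s))
    (fun i => ⟨i, fun n hn => ?_⟩)
    (fun s => if h : ∃ f : Z ⟶ Q.obj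
      ((HomologicalComplex.single _ (ComplexShape.up ℤ) s).obj (M s)), f ≠ 0
      then h.choose else 0)).subset ?_
  · exact ModuleCat.subsingleton_of_isZero
      (HomologicalComplex.isZero_single_obj_X _ n (M n) i (Ne.symm hn))
  · intro s hs
    simp only [Set.mem_ofPred_eq] at hs ⊢
    rw [dif_pos hs]
    exact hs.choose_spec

lemma IsCpt.finite_hom_sg {Z : DMod R} (hZ : IsCpt Z)
    (M : ℤ → RMod R) : {s : ℤ | ∃ f : Z ⟶ sg s (M s), f ≠ 0}.Finite :=
  hZ.finite_hom_Q_single M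

lemma homologyMap_eq_zero_of_Q_map_eq_zero {K L : ChMod R}
    (f : K ⟶ L) (h : Q.map f = 0) (s : ℤ) : HomologicalComplex.homologyMap f s = 0 := by
  have h3 := (homologyFunctorFactors (RMod R) s).hom.naturality f
  have h2 : (homologyFunctor (RMod R) s).map (Q.map f) = 0 := by
    rw [h, Functor.map_zero]
  refine (cancel_epi ((homologyFunctorFactors (RMod R) s).hom.app K)).1 ?_
  refine h3.symm.trans (Eq.trans ?_ comp_zero.symm)
  rw [Functor.comp_map, h2, zero_comp]

lemma isZero_homology_of_Q_map_eq_zero (K : ChMod R) (s : ℤ)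
    (h : Q.map (HomologicalComplex.mkHomToSingle (j := s) (K.pOpcycles s) (fun i _ =>
      HomologicalComplex.d_pOpcycles K i s)) = 0) : IsZero (K.homology s) := by
  set f : K ⟶ (HomologicalComplex.single _ (ComplexShape.up ℤ) s).obj (K.opcycles s) :=
    HomologicalComplex.mkHomToSingle (j := s) (K.pOpcycles s) (fun i _ =>
      HomologicalComplex.d_pOpcycles K i s) with hf
  have h1 := homologyMap_eq_zero_of_Q_map_eq_zero f h s
  have h4 := HomologicalComplex.homologyπ_naturality f s
  rw [h1, comp_zero] at h4
  have h5 : HomologicalComplex.cyclesMap f s = 0 := by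
    have : IsIso (((HomologicalComplex.single _ (ComplexShape.up ℤ) s).obj
      (K.opcycles s)).homologyπ s) :=
      HomologicalComplex.isIso_homologyπ _ _ _ rfl (by simp)
    rw [← cancel_mono (HomologicalComplex.homologyπ _ s), zero_comp, ← h4]
  have h6 : K.iCycles s ≫ K.pOpcycles s = 0 := by
    have h7 := HomologicalComplex.cyclesMap_i f s
    rw [h5, zero_comp, hf, HomologicalComplex.mkHomToSingle_f, ← Category.assoc] at h7
    rw [← cancel_mono (HomologicalComplex.singleObjXSelf (ComplexShape.up ℤ) s (K.opcycles s)).inv,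
      zero_comp]
    exact h7.symm
  rw [← HomologicalComplex.homology_π_ι] at h6
  have h8 : K.homologyι s = 0 := by
    rw [← cancel_epi (K.homologyπ s), h6, comp_zero]
  rw [IsZero.iff_id_eq_zero, ← cancel_mono (K.homologyι s), h8, comp_zero, comp_zero]

lemma IsCpt.exists_isLE {Z : DMod R} (hZ : IsCpt Z) :
    ∃ m : ℤ, Z.IsLE m := by
  obtain ⟨K, ⟨e⟩⟩ : ∃ K, Nonempty (Q.obj K ≅ Z) := ⟨_, ⟨Q.objObjPreimageIso Z⟩⟩
  have hfin := hZ.finite_hom_sg (fun s => K.opcycles s)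
  obtain ⟨m, hm⟩ := hfin.bddAbove
  refine ⟨m, ?_⟩
  have : (Q.obj K).IsLE m := by
    rw [isLE_iff]
    intro i hi
    refine IsZero.of_iso ?_ ((homologyFunctorFactors (RMod R) i).app K)
    apply isZero_homology_of_Q_map_eq_zero
    by_contra hne
    have : i ≤ m := hm ⟨e.inv ≫ Q.map (HomologicalComplex.mkHomToSingle (j := i) (K.pOpcycles i)
      (fun j _ => HomologicalComplex.d_pOpcycles K j i)), fun h0 => hne ?_⟩
    · omega
    · rw [← cancel_epi e.inv, comp_zero]
      exact h0
  exact TStructure.t.isLE_of_iso e m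

end

section coinduced
variable (k R : Type) [Field k] [Ring R] [Algebra k R]

/-- The injective cogenerator `Hom_k(R, k)`. -/
def Coind : Type := R →ₗ[k] k

instance : AddCommGroup (Coind k R) := inferInstanceAs (AddCommGroup (R →ₗ[k] k))
instance : Module k (Coind k R) := inferInstanceAs (Module k (R →ₗ[k] k))

variable {k R} in
/-- Evaluation of an element of the coinduced module. -/
def Coind.app (f : Coind k R) (r : R) : k := DFunLike.coe (F := R →ₗ[k] k) f r

variable {k R} in
lemma Coind.ext {f g : Coind k R} (h : ∀ r, f.app r = g.app r) : f = g :=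
  LinearMap.ext (f := (show R →ₗ[k] k from f)) h

instance : SMul R (Coind k R) where
  smul r f := LinearMap.comp (show R →ₗ[k] k from f) (LinearMap.mulRight k r)

variable {k R} in
lemma Coind.smul_app (r : R) (f : Coind k R) (x : R) : (r • f).app x = f.app (x * r) := rfl

variable {k R} in
lemma Coind.add_app (f g : Coind k R) (x : R) : (f + g).app x = f.app x + g.app x := rfl

variable {k R} in
lemma Coind.app_add (f : Coind k R) (x y : R) : f.app (x + y) = f.app x + f.app y :=
  map_add (show R →ₗ[k] k from f) x y

variable {k R} in
lemma Coind.app_smul (f : Coind k R) (c : k) (y : R) : f.app (c • y) = c • f.app y :=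
  map_smul (show R →ₗ[k] k from f) c y

instance : Module R (Coind k R) where
  one_smul f := Coind.ext fun x => by rw [Coind.smul_app, mul_one]
  mul_smul r s f := Coind.ext fun x => by simp only [Coind.smul_app, mul_assoc]
  smul_zero r := rfl
  smul_add r f g := rfl
  add_smul r s f := Coind.ext fun x => by
    rw [Coind.smul_app, mul_add, Coind.app_add, Coind.add_app, Coind.smul_app, Coind.smul_app]
  zero_smul f := Coind.ext fun x => by
    rw [Coind.smul_app, mul_zero]
    exact map_zero (show R →ₗ[k] k from f)

variable {k R}

instance : IsScalarTower k R (Coind k R) where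
  smul_assoc c r f := Coind.ext fun x => by
    rw [Coind.smul_app, mul_smul_comm, Coind.app_smul]
    rfl

instance [FiniteDimensional k R] : Module.Finite R (Coind k R) :=
  haveI : Module.Finite k (Coind k R) := inferInstanceAs (Module.Finite k (R →ₗ[k] k))
  Module.Finite.of_restrictScalars_finite k R _

/-- Every module embeds into a direct sum of copies of the coinduced module. -/
lemma exists_coind_embedding [FiniteDimensional k R] (H : Type) [AddCommGroup H] [Module R H] :
    ∃ (I : Type) (Φ : H →ₗ[R] (Π₀ _ : I, Coind k R)), Function.Injective Φ := by
  classical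
  let _ : Module k H := Module.restrictScalars k R H
  have : IsScalarTower k R H := IsScalarTower.restrictScalars k R H
  let b := Module.Basis.ofVectorSpace k H
  let I := Module.Basis.ofVectorSpaceIndex k H
  let c := Module.finBasis k R
  -- the finite support of the coordinates of `R h`
  let S : H → Finset I := fun h => Finset.univ.biUnion fun j => (b.repr (c j • h)).support
  have hS : ∀ h i, i ∉ S h → ∀ r : R, b.repr (r • h) i = 0 := fun h i hi r => by
    have h1 : ∀ j, b.repr (c j • h) i = 0 := fun j => by
      by_contra h2
      exact hi (Finset.mem_biUnion.2 ⟨j, Finset.mem_univ _, Finsupp.mem_support_iff.2 h2⟩)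
    rw [← c.sum_repr r, Finset.sum_smul, map_sum, Finsupp.finsetSum_apply]
    exact Finset.sum_eq_zero fun j _ => by rw [smul_assoc, map_smul, Finsupp.smul_apply, h1, smul_zero]
  let φ : H → I → Coind k R := fun h i =>
    ((Finsupp.lapply i ∘ₗ b.repr.toLinearMap) ∘ₗ
      (LinearMap.toSpanSingleton R H h).restrictScalars k : R →ₗ[k] k)
  have hφ : ∀ h i r, (φ h i).app r = b.repr (r • h) i := fun h i r => rfl
  have hS' : ∀ h i, i ∉ S h → φ h i = 0 := fun h i hi => Coind.ext fun r => hS h i hi r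
  let ψ : H → (Π₀ _ : I, Coind k R) := fun h => DFinsupp.mk (S h) fun i => φ h i
  have hψ : ∀ h i, ψ h i = φ h i := fun h i => by
    by_cases hi : i ∈ S h
    · simp only [ψ, DFinsupp.mk_apply, dif_pos hi]
    · simp only [ψ, DFinsupp.mk_apply, dif_neg hi, hS' h i hi]
  refine ⟨I, ⟨⟨ψ, fun x y => ?_⟩, fun r x => ?_⟩, ?_⟩
  · ext i : 1
    rw [DFinsupp.add_apply, hψ, hψ, hψ]
    refine Coind.ext fun s => ?_
    change (φ _ i).app s = (φ x i).app s + (φ y i).app s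
    rw [hφ, hφ, hφ, smul_add, map_add, Finsupp.add_apply]
  · ext i : 1
    rw [RingHom.id_apply, DFinsupp.smul_apply, hψ, hψ]
    refine Coind.ext fun s => ?_
    rw [Coind.smul_app, hφ, hφ, mul_smul]
  · refine (injective_iff_map_eq_zero _).2 fun h hh => ?_
    have h1 : ∀ i, φ h i = 0 := fun i => by
      rw [← hψ]
      exact DFunLike.congr_fun hh i
    apply b.repr.injective
    ext i
    have h2 := hφ h i 1
    rw [one_smul, h1] at h2
    rw [map_zero]
    exact h2.symm

end coinduced

section
open Pretriangulated
variable {𝒞 : Type*} [Category* 𝒞] [Preadditive 𝒞] [HasZeroObject 𝒞] [HasShift 𝒞 ℤ]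
  [∀ n : ℤ, (shiftFunctor 𝒞 n).Additive] [Pretriangulated 𝒞]

lemma dist_of_iso {X Y Z X' Y' Z' : 𝒞} {f : X ⟶ Y} {g : Y ⟶ Z} {h : Z ⟶ X⟦(1 : ℤ)⟧}
    (hT : Triangle.mk f g h ∈ distTriang 𝒞) (a : X ≅ X') (b : Y ≅ Y') (c : Z ≅ Z') :
    Triangle.mk (a.inv ≫ f ≫ b.hom) (b.inv ≫ g ≫ c.hom) (c.inv ≫ h ≫ a.hom⟦(1 : ℤ)⟧') ∈
      distTriang 𝒞 := by
  refine isomorphic_distinguished _ hT _ (Triangle.isoMk _ _ a.symm b.symm c.symm ?_ ?_ ?_)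
  · change (a.inv ≫ f ≫ b.hom) ≫ b.inv = a.inv ≫ f
    simp
  · change (b.inv ≫ g ≫ c.hom) ≫ c.inv = b.inv ≫ g
    simp
  · change (c.inv ≫ h ≫ a.hom⟦(1 : ℤ)⟧') ≫ a.inv⟦(1 : ℤ)⟧' = c.inv ≫ h
    simp [← Functor.map_comp]

variable {X Y Z : 𝒞} {f : X ⟶ Y} {g : Y ⟶ Z} {h : Z ⟶ X⟦(1 : ℤ)⟧}
  (hT : Triangle.mk f g h ∈ distTriang 𝒞) {W : 𝒞}
include hT

lemma dist_comp₁₂ : f ≫ g = 0 := comp_distTriang_mor_zero₁₂ _ hT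
lemma dist_comp₂₃ : g ≫ h = 0 := comp_distTriang_mor_zero₂₃ _ hT
lemma dist_comp₃₁ : h ≫ f⟦(1 : ℤ)⟧' = 0 := comp_distTriang_mor_zero₃₁ _ hT

lemma dist_yo₂ (u : Y ⟶ W) (hu : f ≫ u = 0) : ∃ v : Z ⟶ W, u = g ≫ v :=
  Triangle.yoneda_exact₂ _ hT u hu

lemma dist_yo₃ (u : Z ⟶ W) (hu : g ≫ u = 0) : ∃ v : X⟦(1 : ℤ)⟧ ⟶ W, u = h ≫ v :=
  Triangle.yoneda_exact₃ _ hT u hu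

lemma dist_yo₁ (u : X⟦(1 : ℤ)⟧ ⟶ W) (hu : h ≫ u = 0) :
    ∃ v : Y⟦(1 : ℤ)⟧ ⟶ W, u = f⟦(1 : ℤ)⟧' ≫ v := by
  obtain ⟨v, hv⟩ : ∃ v : Y⟦(1 : ℤ)⟧ ⟶ W, u = (-f⟦(1 : ℤ)⟧') ≫ v :=
    Triangle.yoneda_exact₃ _ (rot_of_distTriang _ hT) u hu
  exact ⟨-v, by rw [hv, Preadditive.neg_comp, Preadditive.comp_neg]⟩

lemma dist_co₂ (u : W ⟶ Y) (hu : u ≫ g = 0) : ∃ v : W ⟶ X, u = v ≫ f :=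
  Triangle.coyoneda_exact₂ _ hT u hu

lemma dist_co₃ (u : W ⟶ Z) (hu : u ≫ h = 0) : ∃ v : W ⟶ Y, u = v ≫ g :=
  Triangle.coyoneda_exact₃ _ hT u hu

lemma dist_co₁ (u : W ⟶ X⟦(1 : ℤ)⟧) (hu : u ≫ f⟦(1 : ℤ)⟧' = 0) :
    ∃ v : W ⟶ Z, u = v ≫ h :=
  Triangle.coyoneda_exact₁ _ hT u hu

end

section
open DerivedCategory Pretriangulated
variable {R : Type} [Ring R] [HasDMod R]

lemma isLE_obj₃ {T : Triangle (DMod R)} (hT : T ∈ distTriang _)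
    (m : ℤ) (h1 : T.obj₁.IsLE (m + 1)) (h2 : T.obj₂.IsLE m) : T.obj₃.IsLE m := by
  rw [isLE_iff] at *
  intro i hi
  exact (HomologySequence.exact₃ _ hT i (i + 1) rfl).isZero_of_both_zeros
    ((h2 i hi).eq_of_src _ _) ((h1 (i + 1) (by omega)).eq_of_tgt _ _)

lemma isLE_obj₂ {T : Triangle (DMod R)} (hT : T ∈ distTriang _)
    (m : ℤ) (h1 : T.obj₁.IsLE m) (h2 : T.obj₃.IsLE m) : T.obj₂.IsLE m := by
  rw [isLE_iff] at *
  intro i hi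
  exact (HomologySequence.exact₂ _ hT i).isZero_of_both_zeros
    ((h1 i hi).eq_of_src _ _) ((h2 i (by omega)).eq_of_tgt _ _)

lemma exists_top_triangle (Z : DMod R) (m : ℤ) [hZ : Z.IsLE m] :
    ∃ (X : DMod R) (H : RMod R) (f : X ⟶ Z)
      (g : Z ⟶ sg m H) (h : sg m H ⟶ X⟦(1 : ℤ)⟧), X.IsLE (m - 1) ∧
      Triangle.mk f g h ∈ distTriang _ := by
  obtain ⟨X, Y, hX, hY, f, g, h, hT⟩ := TStructure.t.exists_triangle Z (m - 1) m (by omega)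
  have hX' : X.IsLE (m - 1) := ⟨hX⟩
  have hX'' : X.IsLE (m + 1) := TStructure.t.isLE_of_le X (m - 1) (m + 1)
  have hY' : Y.IsGE m := ⟨hY⟩
  have hY'' : Y.IsLE m := isLE_obj₃ hT m hX'' hZ
  obtain ⟨H, ⟨e⟩⟩ := exists_iso_singleFunctor_obj_of_isGE_of_isLE Y m
  exact ⟨X, H, _, _, _, hX', dist_of_iso hT (Iso.refl _) (Iso.refl _) e⟩

section top
variable {Z : DMod R} {m : ℤ}
    {X : DMod R} {H : RMod R} {f : X ⟶ Z}
    {g : Z ⟶ sg m H} {h : sg m H ⟶ X⟦(1 : ℤ)⟧}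

lemma exists_top_factor (hX : X.IsLE (m - 1)) (hT : Triangle.mk f g h ∈ distTriang _)
    {M : RMod R} (u : Z ⟶ sg m M) :
    ∃ φ : H ⟶ M, u = g ≫ (singleFunctor (RMod R) m).map φ := by
  obtain ⟨v, hv⟩ := dist_yo₂ hT u (TStructure.t.zero _ (m - 1) m)
  obtain ⟨φ, rfl⟩ := (singleFunctor (RMod R) m).map_surjective v
  exact ⟨φ, hv⟩

lemma top_factor_unique (hX : X.IsLE (m - 1)) (hT : Triangle.mk f g h ∈ distTriang _)
    {M : RMod R} {φ ψ : H ⟶ M} (hh : g ≫ (singleFunctor (RMod R) m).map φ =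
      g ≫ (singleFunctor (RMod R) m).map ψ) : φ = ψ := by
  apply (singleFunctor (RMod R) m).map_injective
  rw [← sub_eq_zero]
  obtain ⟨v, hv⟩ := dist_yo₃ hT ((singleFunctor (RMod R) m).map φ -
    (singleFunctor (RMod R) m).map ψ) (by
      rw [Preadditive.comp_sub, hh, sub_self])
  have : (X⟦(1 : ℤ)⟧).IsLE (m - 2) := TStructure.t.isLE_shift X (m - 1) 1 (m - 2)
  rw [hv, TStructure.t.zero v (m - 2) m, comp_zero]

variable {ι : Type} (W : ι → RMod R)

/-- The comparison map from the direct sum in a single degree. -/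
def singleToSum (m : ℤ) : (HomologicalComplex.single _ (ComplexShape.up ℤ) m).obj (dsum W) ⟶
    sumCx (fun i => (HomologicalComplex.single _ (ComplexShape.up ℤ) m).obj (W i)) :=
  HomologicalComplex.mkHomFromSingle (dsumMap fun i =>
    (HomologicalComplex.singleObjXSelf (ComplexShape.up ℤ) m (W i)).inv) (fun j _ =>
    dsum_hom_ext fun n => by
      change _ ≫ _ ≫ dsumMap _ = _
      rw [← Category.assoc, dsumι_map, Category.assoc, dsumι_map]
      simp)

omit [HasDMod R] in
lemma singleToSum_desc (m : ℤ) : singleToSum W m ≫ sumCxDesc (fun i =>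
    (HomologicalComplex.single _ (ComplexShape.up ℤ) m).map (dsumι W i)) = 𝟙 _ := by
  apply HomologicalComplex.from_single_hom_ext
  rw [← cancel_epi (HomologicalComplex.singleObjXSelf (ComplexShape.up ℤ) m (dsum W)).inv,
    ← cancel_mono (HomologicalComplex.singleObjXSelf (ComplexShape.up ℤ) m (dsum W)).hom]
  apply dsum_hom_ext
  intro n
  rw [HomologicalComplex.comp_f, singleToSum, HomologicalComplex.mkHomFromSingle_f]
  change dsumι W n ≫ (_ ≫ (_ ≫ dsumMap _) ≫ dsumDesc _) ≫ _ = _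
  simp only [Category.assoc, Iso.inv_hom_id_assoc]
  rw [← Category.assoc, dsumι_map, Category.assoc, ← Category.assoc (dsumι _ n), dsumι_desc]
  simp [HomologicalComplex.single_map_f_self]

lemma IsCpt.exists_top_sum (hZ : IsCpt Z) (hX : X.IsLE (m - 1))
    (hT : Triangle.mk f g h ∈ distTriang _) (Φ : H ⟶ dsum W) :
    ∃ (s : Finset ι) (φ : ∀ i, H ⟶ W i), Φ = ∑ i ∈ s, φ i ≫ dsumι W i := by
  let K : ι → ChMod R := fun i =>
    (HomologicalComplex.single _ (ComplexShape.up ℤ) m).obj (W i)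
  obtain ⟨s, p, hp⟩ := hZ ι _ _ (sumCofanIsColimit K)
    ((g ≫ (singleFunctor (RMod R) m).map Φ) ≫ Q.map (singleToSum W m))
  have hp' : ∀ i, ∃ φ : H ⟶ W i, p i = g ≫ (singleFunctor (RMod R) m).map φ :=
    fun i => exists_top_factor hX hT (p i)
  choose φ hφ using hp'
  refine ⟨s, φ, ?_⟩
  apply top_factor_unique hX hT
  have h1 := congrArg (fun q => q ≫ Q.map (sumCxDesc (fun i =>
    (HomologicalComplex.single _ (ComplexShape.up ℤ) m).map (dsumι W i)))) hp
  have h2 : Q.map (singleToSum W m) ≫ Q.map (sumCxDesc (fun i =>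
    (HomologicalComplex.single _ (ComplexShape.up ℤ) m).map (dsumι W i))) = 𝟙 _ := by
    rw [← Functor.map_comp, singleToSum_desc, CategoryTheory.Functor.map_id]
  refine Eq.trans ?_ (h1.trans ?_)
  · erw [Category.assoc, h2, Category.comp_id]
  · erw [Preadditive.sum_comp]
    rw [Functor.map_sum, Preadditive.comp_sum]
    refine Finset.sum_congr rfl fun i _ => ?_
    rw [hφ, Functor.map_comp]
    erw [Category.assoc, Category.assoc]
    congr 2
    change Q.map _ ≫ Q.map _ = Q.map _
    rw [← Functor.map_comp, sumCxι_desc]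
    rfl

omit [HasDMod R] in
lemma moduleCat_sum_apply {M N : RMod R} {ι : Type*} (s : Finset ι) (φ : ι → (M ⟶ N))
    (x : M) : (∑ i ∈ s, φ i) x = ∑ i ∈ s, φ i x := by
  have h : (∑ i ∈ s, φ i).hom = ∑ i ∈ s, (φ i).hom := ModuleCat.hom_sum _ _
  exact (LinearMap.congr_fun h x).trans (LinearMap.sum_apply _ _ _)

lemma IsCpt.finite_top (k : Type) [Field k] [Algebra k R] [FiniteDimensional k R]
    (hZ : IsCpt Z) (hX : X.IsLE (m - 1))
    (hT : Triangle.mk f g h ∈ distTriang _) : Module.Finite R H := by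
  classical
  obtain ⟨I, Φ, hΦ⟩ := exists_coind_embedding (k := k) (R := R) H
  obtain ⟨s, φ, hφ⟩ := hZ.exists_top_sum (fun _ : I => ModuleCat.of R (Coind k R)) hX hT
    (ModuleCat.ofHom Φ)
  have : IsNoetherianRing R := isNoetherian_of_tower k inferInstance
  let ψ : H →ₗ[R] (s → Coind k R) := LinearMap.pi fun i => (φ i).hom
  refine Module.Finite.of_injective ψ ((injective_iff_map_eq_zero _).2 fun x hx => ?_)
  apply hΦ
  rw [map_zero]
  have h1 : Φ x = (∑ i ∈ s, φ i ≫ dsumι (fun _ : I => ModuleCat.of R (Coind k R)) i) x :=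
    ConcreteCategory.congr_hom hφ x
  rw [h1, moduleCat_sum_apply]
  refine Finset.sum_eq_zero fun i hi => ?_
  have h2 : φ i x = 0 := congrFun hx ⟨i, hi⟩
  have h3 : (φ i ≫ dsumι (fun _ : I => ModuleCat.of R (Coind k R)) i) x =
      (dsumι (fun _ : I => ModuleCat.of R (Coind k R)) i).hom (φ i x) := rfl
  exact h3.trans ((congrArg _ h2).trans (map_zero _))

end top

end

/-- Indecomposable projectives with their simple tops. -/
structure ProjData (k R : Type) [Field k] [Ring R] [Algebra k R] (ι : Type) where
  P : ι → RMod R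
  L : ι → RMod R
  p : ∀ i, P i ⟶ L i
  proj : ∀ i, Projective (P i)
  fin : ∀ i, Module.Finite R (P i)
  simple : ∀ i, IsSimpleModule R (L i)
  p_surj : ∀ i, Function.Surjective (p i)
  exists_iso : ∀ (M : Type) [AddCommGroup M] [Module R M] [IsSimpleModule R M],
    ∃ i, Nonempty (M ≃ₗ[R] L i)
  hom_ne : ∀ i j (f : P i ⟶ L j), i ≠ j → f = 0
  hom_eq : ∀ i (f : P i ⟶ L i), ∃ c : k, f = c • p i

section
open DerivedCategory Pretriangulated
variable {R : Type} [Ring R] [HasDMod R]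
variable {k : Type} [Field k] [Algebra k R] {ι : Type}

/-- Objects built from the shifted projectives in degrees between `a` and `b`. -/
inductive Built (D : ProjData k R ι) (a b : ℤ) : DMod R → Prop
  | zero (Z : DMod R) : IsZero Z → Built D a b Z
  | step (s : ℤ) (l : ι) (X Y : DMod R) (f : sg s (D.P l) ⟶ X)
      (g : X ⟶ Y) (h : Y ⟶ (sg s (D.P l))⟦(1 : ℤ)⟧) :
      Triangle.mk f g h ∈ distTriang (DMod R) → a ≤ s → s ≤ b →
      Built D a b Y → Built D a b X

lemma Built.mono {D : ProjData k R ι} {a b a' b' : ℤ} {Z : DMod R}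
    (hZ : Built D a b Z) (ha : a' ≤ a) (hb : b ≤ b') : Built D a' b' Z := by
  induction hZ with
  | zero Z h => exact .zero Z h
  | step s l X Y f g h hT has hsb _ ih => exact .step s l X Y f g h hT (by omega) (by omega) ih

lemma isZero_of_forall_isLE (Z : DMod R) (h : ∀ m, Z.IsLE m) :
    IsZero Z := by
  rw [IsZero.iff_id_eq_zero]
  have h0 := h 0
  have h1 : Z.IsGE 1 := (isGE_iff Z 1).2 fun i _ => (isLE_iff Z (i - 1)).1 (h _) i (by omega)
  exact TStructure.t.zero _ 0 1

lemma exists_sg_shift_hom {m : ℤ} {P L : RMod R}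
    (v : (sg m P)⟦(1 : ℤ)⟧ ⟶ sg (m - 1) L) : ∃ (φ : P ⟶ L) (e : (sg m L)⟦(1 : ℤ)⟧ ⟶ sg (m - 1) L),
      v = ((singleFunctor (RMod R) m).map φ)⟦(1 : ℤ)⟧' ≫ e := by
  let e := (singleFunctors (RMod R)).shiftIso 1 (m - 1) m (by omega)
  obtain ⟨φ, hφ⟩ : ∃ φ : P ⟶ L, (singleFunctor (RMod R) (m - 1)).map φ =
      e.inv.app P ≫ v := (singleFunctor (RMod R) (m - 1)).map_surjective _
  refine ⟨φ, e.hom.app L, ?_⟩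
  have h1 : ((singleFunctor (RMod R) m).map φ)⟦(1 : ℤ)⟧' ≫ e.hom.app L =
      e.hom.app P ≫ (singleFunctor (RMod R) (m - 1)).map φ := e.hom.naturality φ
  rw [h1, hφ]
  exact (e.hom_inv_id_app_assoc P v).symm

section peel
variable (D : ProjData k R ι)

omit [HasDMod R] in
lemma ProjData.exists_hom (H : RMod R) [Module.Finite R H] [Nontrivial H] :
    ∃ l, ∃ φ : H ⟶ D.L l, Function.Surjective φ := by
  obtain ⟨N, hN, -⟩ := (eq_top_or_exists_le_coatom (⊥ : Submodule R H)).resolve_left bot_ne_top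
  have : IsSimpleModule R (H ⧸ N) := isSimpleModule_iff_isCoatom.2 hN
  obtain ⟨l, ⟨e⟩⟩ := D.exists_iso (H ⧸ N)
  refine ⟨l, ModuleCat.ofHom (e.toLinearMap ∘ₗ N.mkQ), ?_⟩
  exact e.surjective.comp N.mkQ_surjective

variable {Z : DMod R} {m : ℤ}

lemma isLE_pred_of_hom_eq_zero [FiniteDimensional k R] (hZ : IsCpt Z) (hm : Z.IsLE m)
    (h0 : ∀ l (u : Z ⟶ sg m (D.L l)), u = 0) : Z.IsLE (m - 1) := by
  obtain ⟨X, H, f, g, h, hX, hT⟩ := exists_top_triangle Z m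
  have hH : Module.Finite R H := hZ.finite_top k hX hT
  have h1 : Subsingleton H := by
    rw [← not_nontrivial_iff_subsingleton]
    intro hn
    obtain ⟨l, φ, hφ⟩ := D.exists_hom H
    have h2 : φ = 0 := top_factor_unique hX hT (by
      rw [h0 l (g ≫ (singleFunctor (RMod R) m).map φ), Functor.map_zero, comp_zero])
    have := D.simple l
    have h3 := IsSimpleModule.nontrivial R (D.L l)
    obtain ⟨y, hy⟩ := exists_ne (0 : D.L l)
    obtain ⟨x, rfl⟩ := hφ y
    exact hy (by rw [h2]; rfl)
  have h2 : IsZero (sg m H) := (singleFunctor (RMod R) m).map_isZero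
    (ModuleCat.isZero_of_subsingleton H)
  refine isLE_obj₂ hT (m - 1) hX ?_
  rw [isLE_iff]
  intro i _
  exact (homologyFunctor (RMod R) i).map_isZero h2

/-- Removing a projective from the top degree. -/
lemma exists_peel {X : DMod R} {H : RMod R} {f : X ⟶ Z}
    {g : Z ⟶ sg m H} {h : sg m H ⟶ X⟦(1 : ℤ)⟧} [Module.Finite R H] [Nontrivial H]
    [IsArtinianRing R] [IsNoetherianRing R] (hZ : IsCpt Z) (hm : Z.IsLE m) (hX : X.IsLE (m - 1))
    (hT : Triangle.mk f g h ∈ distTriang _) :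
    ∃ (l : ι) (Z' : DMod R) (u : sg m (D.P l) ⟶ Z) (v : Z ⟶ Z')
      (w : Z' ⟶ (sg m (D.P l))⟦(1 : ℤ)⟧), Triangle.mk u v w ∈ distTriang _ ∧ IsCpt Z' ∧ Z'.IsLE m ∧
      (∀ s j, s < m → (∀ x : Z ⟶ sg s (D.L j), x = 0) → ∀ x : Z' ⟶ sg s (D.L j), x = 0) ∧
      ∀ {X' : DMod R} {H' : RMod R} {f' : X' ⟶ Z'}
        {g' : Z' ⟶ sg m H'} {h' : sg m H' ⟶ X'⟦(1 : ℤ)⟧}, X'.IsLE (m - 1) →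
        Triangle.mk f' g' h' ∈ distTriang _ → Module.length R H' < Module.length R H := by
  obtain ⟨l, φ, hφ⟩ := D.exists_hom H
  have hproj := D.proj l
  have hepi : Epi φ := (ModuleCat.epi_iff_surjective φ).2 hφ
  let q : D.P l ⟶ H := Projective.factorThru (D.p l) φ
  have hq : q ≫ φ = D.p l := Projective.factorThru_comp _ _
  obtain ⟨u, hu⟩ := dist_co₃ hT ((singleFunctor (RMod R) m).map q) (by
    have : (X⟦(1 : ℤ)⟧).IsLE (m - 2) := TStructure.t.isLE_shift X (m - 1) 1 (m - 2)
    exact sg_hom_eq_zero_of_isLE (D.P l) (by omega : m - 2 < m) _ _)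
  obtain ⟨Z', v, w, hT'⟩ := distinguished_cocone_triangle u
  have hsgle : (sg m (D.P l)).IsLE m := inferInstance
  have hfac : (singleFunctor (RMod R) m).map (D.p l) =
      u ≫ g ≫ (singleFunctor (RMod R) m).map φ := by
    rw [← hq, Functor.map_comp, hu, Category.assoc]
  have hshift : ((sg m (D.P l))⟦(1 : ℤ)⟧).IsLE (m - 1) :=
    TStructure.t.isLE_shift _ m 1 (m - 1)
  have hfinP := D.fin l
  refine ⟨l, Z', u, v, w, hT', IsCpt.cone hT' (isCpt_single (D.P l) m) hZ,
    isLE_obj₃ hT' m (TStructure.t.isLE_of_le (sg m (D.P l)) m (m + 1)) hm, fun s j hs h0 x => ?_, ?_⟩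
  · obtain ⟨y, rfl⟩ := dist_yo₃ hT' x (h0 _)
    obtain hs | rfl : s < m - 1 ∨ s = m - 1 := by omega
    · let e := ((singleFunctors (RMod R)).shiftIso 1 (m - 1) m (by omega)).app (D.P l)
      have h1 : e.inv ≫ y = 0 :=
        sg_hom_eq_zero_of_isLE (D.P l) (n := s) (by omega) _ _
      have h2 : y = 0 := by
        refine (cancel_epi e.inv).1 (h1.trans comp_zero.symm)
      rw [h2, comp_zero]
    · obtain ⟨ψ, e, rfl⟩ := exists_sg_shift_hom y
      by_cases hlj : l = j
      · subst hlj
        obtain ⟨c, rfl⟩ := D.hom_eq l ψ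
        have h1 : c • D.p l = D.p l ≫ (c • 𝟙 _) := by rw [Linear.comp_smul, Category.comp_id]
        rw [h1, Functor.map_comp, hfac, Category.assoc, Functor.map_comp, Category.assoc,
          ← Category.assoc, dist_comp₃₁ hT', zero_comp]
      · rw [D.hom_ne l j ψ hlj, Functor.map_zero, Functor.map_zero, zero_comp, comp_zero]
  · intro X' H' f' g' h' hX' hT''
    obtain ⟨χ, hχ⟩ := exists_top_factor hX hT (v ≫ g')
    have hqχ : q ≫ χ = 0 := by
      apply (singleFunctor (RMod R) m).map_injective
      rw [Functor.map_comp, hu, Category.assoc, ← hχ, ← Category.assoc, dist_comp₁₂ hT',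
        zero_comp, Functor.map_zero]
    have hepiχ : Epi χ := by
      refine Preadditive.epi_of_cancel_zero _ fun {W} ψ hψ => ?_
      apply top_factor_unique hX' hT''
      have h1 : v ≫ g' ≫ (singleFunctor (RMod R) m).map ψ = 0 := by
        rw [← Category.assoc, hχ, Category.assoc, ← Functor.map_comp, hψ, Functor.map_zero,
          comp_zero]
      obtain ⟨y, hy⟩ := dist_yo₃ hT' _ h1
      rw [hy, TStructure.t.zero y (m - 1) m, comp_zero, Functor.map_zero, comp_zero]
    have hsurj := (ModuleCat.epi_iff_surjective χ).1 hepiχ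
    have h1 : LinearMap.ker χ.hom ≠ ⊥ := by
      intro h1
      have h2 : ∀ x, q x = 0 := fun x => LinearMap.ker_eq_bot.1 h1 (by
        have : χ (q x) = (q ≫ χ) x := rfl
        rw [map_zero]
        exact this.trans (by rw [hqχ]; rfl))
      have := D.simple l
      have h3 := IsSimpleModule.nontrivial R (D.L l)
      obtain ⟨y, hy⟩ := exists_ne (0 : D.L l)
      obtain ⟨x, rfl⟩ := D.p_surj l y
      refine hy ?_
      rw [← hq]
      exact (congrArg φ (h2 x)).trans (map_zero φ.hom)
    rw [← (LinearMap.quotKerEquivOfSurjective χ.hom hsurj).length_eq]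
    exact Submodule.length_quotient_lt _ h1

lemma isZero_of_isLE_of_lt [FiniteDimensional k R] {a : ℤ} (hZ : IsCpt Z) (hm : Z.IsLE m)
    (h0 : ∀ s l, s < a → ∀ u : Z ⟶ sg s (D.L l), u = 0) (hma : m < a) : IsZero Z := by
  refine isZero_of_forall_isLE Z ?_
  have h1 : ∀ n : ℕ, Z.IsLE (m - n) := fun n => by
    induction n with
    | zero => simpa using hm
    | succ n ih =>
      have := isLE_pred_of_hom_eq_zero D hZ ih fun l u => h0 _ l (by omega) u
      convert this using 1
      push_cast
      ring
  intro n
  by_cases hn : m ≤ n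
  · exact TStructure.t.isLE_of_le Z m n
  · convert h1 (m - n).toNat using 1
    rw [Int.toNat_of_nonneg (by omega)]
    ring

lemma built_of_isLE [FiniteDimensional k R] (a : ℤ) (hZ : IsCpt Z) (hm : Z.IsLE m)
    (h0 : ∀ s l, s < a → ∀ u : Z ⟶ sg s (D.L l), u = 0) : Built D a m Z := by
  have hart : IsArtinianRing R := isArtinian_of_tower k inferInstance
  have hnoe : IsNoetherianRing R := isNoetherian_of_tower k inferInstance
  by_cases hma : m < a
  · exact .zero Z (isZero_of_isLE_of_lt D hZ hm h0 hma)
  · obtain ⟨n, hn⟩ : ∃ n : ℕ, m - a = n := ⟨(m - a).toNat, by omega⟩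
    induction n using Nat.strong_induction_on generalizing Z m with
    | _ n ihn =>
    obtain ⟨X, H, f, g, h, hX, hT⟩ := exists_top_triangle Z m
    have hH : Module.Finite R H := hZ.finite_top k hX hT
    obtain ⟨r, hr⟩ : ∃ r : ℕ, Module.length R H = r :=
      ⟨_, (ENat.natCast_toNat Module.length_ne_top).symm⟩
    induction r using Nat.strong_induction_on generalizing Z X H with
    | _ r ihr =>
    rcases subsingleton_or_nontrivial H with h1 | h1
    · have h2 : IsZero (sg m H) := (singleFunctor (RMod R) m).map_isZero
        (ModuleCat.isZero_of_subsingleton H)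
      have hm' : Z.IsLE (m - 1) := isLE_obj₂ hT (m - 1) hX ((isLE_iff _ _).2 fun i _ =>
        (homologyFunctor (RMod R) i).map_isZero h2)
      by_cases hma' : m - 1 < a
      · exact .zero Z (isZero_of_isLE_of_lt D hZ hm' h0 hma')
      · exact (ihn (n - 1) (by omega) hZ hm' h0 hma' (by omega)).mono le_rfl (by omega)
    · obtain ⟨l, Z', u, v, w, hT', hZ', hm', hv, hlen⟩ := exists_peel D hZ hm hX hT
      refine .step m l Z Z' u v w hT' (by omega) le_rfl ?_
      obtain ⟨X', H', f', g', h', hX', hT''⟩ := exists_top_triangle Z' m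
      have hlt := hlen hX' hT''
      rw [hr] at hlt
      have hH' : Module.Finite R H' := hZ'.finite_top k hX' hT''
      obtain ⟨r', hr'⟩ : ∃ r : ℕ, Module.length R H' = r :=
        ⟨_, (ENat.natCast_toNat Module.length_ne_top).symm⟩
      exact ihr r' (by rw [hr'] at hlt; exact_mod_cast hlt) hZ' hm'
        (fun s l hs => hv s l (by omega) (h0 s l hs)) X' H' f' g' h' hX' hT'' hH' hr'

lemma IsCpt.exists_built [FiniteDimensional k R] [Finite ι] (hZ : IsCpt Z) :
    ∃ a b, Built D a b Z := by
  obtain ⟨m, hm⟩ := hZ.exists_isLE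
  have h1 : {s : ℤ | ∃ l, ∃ u : Z ⟶ sg s (D.L l), u ≠ 0}.Finite := by
    refine (Set.finite_iUnion fun l => hZ.finite_hom_sg fun _ => D.L l).subset ?_
    rintro s ⟨l, hu⟩
    exact Set.mem_iUnion.2 ⟨l, hu⟩
  obtain ⟨a, ha⟩ := h1.bddBelow
  exact ⟨a, m, built_of_isLE D a hZ hm fun s l hs u => by
    by_contra hu
    exact (ha ⟨l, u, hu⟩).not_gt hs⟩

lemma Built.isCpt {D : ProjData k R ι} {a b : ℤ} (hZ : Built D a b Z) : IsCpt Z := by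
  induction hZ with
  | zero Z h =>
    intro ι' W c hc f
    exact ⟨∅, fun _ => 0, h.eq_of_src _ _⟩
  | step s l X Y f g h hT _ _ _ ih =>
    have := D.proj l
    have := D.fin l
    exact IsCpt.cone (inv_rot_of_distTriang _ hT) (ih.shift (-1)) (isCpt_single (D.P l) s)

lemma Built.hom_eq_zero {D : ProjData k R ι} {a b : ℤ} (hZ : Built D a b Z)
    {W : DMod R} (hW : W.IsLE (a - 1)) (f : Z ⟶ W) : f = 0 := by
  induction hZ with
  | zero Z h => exact h.eq_of_src _ _
  | step s l X Y u v w hT ha _ _ ih =>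
    have := D.proj l
    obtain ⟨y, rfl⟩ := dist_yo₂ hT f (sg_hom_eq_zero_of_isLE (D.P l) (by omega : a - 1 < s) _ _)
    rw [ih y, comp_zero]

lemma Built.isLE {D : ProjData k R ι} {a b : ℤ} (hZ : Built D a b Z) : Z.IsLE b := by
  induction hZ with
  | zero Z h => exact (isLE_iff _ _).2 fun i _ => (homologyFunctor (RMod R) i).map_isZero h
  | step s l X Y u v w hT _ hb _ ih =>
    exact isLE_obj₂ hT b (TStructure.t.isLE_of_le (sg s (D.P l)) s b) ih

end peel
end

section
section local_objects
variable {𝒞 : Type*} [Category* 𝒞] [Preadditive 𝒞]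

/-- Objects with local endomorphism ring. -/
def LocalObj (X : 𝒞) : Prop := 𝟙 X ≠ 0 ∧ ∀ f : X ⟶ X, IsIso f ∨ IsIso (𝟙 X - f)

/-- The radical of a preadditive category. -/
def IsRad {X Y : 𝒞} (f : X ⟶ Y) : Prop := ∀ g : Y ⟶ X, IsIso (𝟙 X - f ≫ g)

lemma isIso_one_sub_comp {X Y : 𝒞} (f : X ⟶ Y) (g : Y ⟶ X) (h : IsIso (𝟙 X - f ≫ g)) :
    IsIso (𝟙 Y - g ≫ f) := by
  obtain ⟨i, h1, h2⟩ := h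
  refine ⟨𝟙 Y + g ≫ i ≫ f, ?_, ?_⟩
  · have h3 : i = 𝟙 X + f ≫ g ≫ i := by
      rw [Preadditive.sub_comp, Category.id_comp, Category.assoc, sub_eq_iff_eq_add] at h1
      exact h1
    have h4 : g ≫ i ≫ f = g ≫ f + g ≫ f ≫ g ≫ i ≫ f := by
      conv_lhs => rw [h3]
      simp
    simp only [Preadditive.sub_comp, Preadditive.comp_add, Category.comp_id, Category.id_comp,
      Category.assoc]
    rw [← sub_eq_zero] at h4 ⊢
    rw [← h4]
    abel
  · have h3 : i = 𝟙 X + i ≫ f ≫ g := by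
      rw [Preadditive.comp_sub, Category.comp_id, sub_eq_iff_eq_add] at h2
      exact h2
    have h4 : g ≫ i ≫ f = g ≫ f + g ≫ i ≫ f ≫ g ≫ f := by
      conv_lhs => rw [h3]
      simp
    simp only [Preadditive.comp_sub, Preadditive.add_comp, Category.comp_id, Category.id_comp,
      Category.assoc]
    rw [← sub_eq_zero] at h4 ⊢
    rw [← h4]
    abel

namespace IsRad
variable {W X Y Z : 𝒞}

lemma comp_right {f : X ⟶ Y} (h : IsRad f) (g : Y ⟶ Z) : IsRad (f ≫ g) := fun u => by
  rw [Category.assoc]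
  exact h _

lemma comp_left {f : X ⟶ Y} (h : IsRad f) (g : W ⟶ X) : IsRad (g ≫ f) := fun u => by
  have := isIso_one_sub_comp f (u ≫ g) (h _)
  rw [Category.assoc] at this ⊢
  have := isIso_one_sub_comp u (g ≫ f) this
  rwa [Category.assoc] at this

lemma add {f g : X ⟶ Y} (hf : IsRad f) (hg : IsRad g) : IsRad (f + g) := fun u => by
  have h1 := hf u
  have h2 : IsIso (𝟙 X - inv (𝟙 X - f ≫ u) ≫ g ≫ u) := by
    have := hg.comp_left (inv (𝟙 X - f ≫ u)) u
    rwa [Category.assoc] at this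
  have h3 : 𝟙 X - (f + g) ≫ u = (𝟙 X - f ≫ u) ≫ (𝟙 X - inv (𝟙 X - f ≫ u) ≫ g ≫ u) := by
    rw [Preadditive.comp_sub, IsIso.hom_inv_id_assoc, Category.comp_id, Preadditive.add_comp]
    abel
  rw [h3]
  infer_instance

lemma zero : IsRad (0 : X ⟶ Y) := fun u => by
  rw [zero_comp, sub_zero]
  infer_instance

lemma sum {α : Type*} (s : Finset α) (f : α → (X ⟶ Y)) (h : ∀ a ∈ s, IsRad (f a)) :
    IsRad (∑ a ∈ s, f a) := by
  classical
  induction s using Finset.induction_on with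
  | empty => simpa using zero
  | insert a s ha ih =>
    rw [Finset.sum_insert ha]
    exact (h a (Finset.mem_insert_self _ _)).add
      (ih fun b hb => h b (Finset.mem_insert_of_mem hb))

end IsRad

lemma LocalObj.isIso_of_comp {X Y : 𝒞} (hX : 𝟙 X ≠ 0) (hY : LocalObj Y) (f : X ⟶ Y) (g : Y ⟶ X)
    (h : IsIso (f ≫ g)) : IsIso f := by
  let r := g ≫ inv (f ≫ g)
  have hr : f ≫ r = 𝟙 X := by
    rw [← Category.assoc, IsIso.hom_inv_id]
  have he : (r ≫ f) ≫ (r ≫ f) = r ≫ f := by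
    rw [Category.assoc, ← Category.assoc f, hr, Category.id_comp]
  rcases hY.2 (r ≫ f) with h1 | h1
  · exact ⟨r, hr, by rw [← cancel_epi (r ≫ f), he, Category.comp_id]⟩
  · exfalso
    have h2 : r ≫ f = 0 := by
      rw [← cancel_mono (𝟙 Y - r ≫ f), Preadditive.comp_sub, he, Category.comp_id, sub_self,
        zero_comp]
    apply hX
    calc 𝟙 X = f ≫ (r ≫ f) ≫ r := by rw [Category.assoc, hr, Category.comp_id, hr]
      _ = 0 := by rw [h2, zero_comp, comp_zero]

lemma LocalObj.isRad {X Y : 𝒞} (hX : LocalObj X) (hY : LocalObj Y) (f : X ⟶ Y) (h : ¬ IsIso f) :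
    IsRad f := fun g =>
  (hX.2 (f ≫ g)).resolve_left fun h1 => h (LocalObj.isIso_of_comp hX.1 hY f g h1)

lemma LocalObj.of_iso {X Y : 𝒞} (hX : LocalObj X) (e : X ≅ Y) : LocalObj Y := by
  refine ⟨fun h => hX.1 ?_, fun f => ?_⟩
  · rw [← e.hom_inv_id, ← Category.comp_id e.hom, h, comp_zero, zero_comp]
  · have h1 : f = e.inv ≫ (e.hom ≫ f ≫ e.inv) ≫ e.hom := by simp
    have h2 : 𝟙 Y - f = e.inv ≫ (𝟙 X - e.hom ≫ f ≫ e.inv) ≫ e.hom := by simp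
    rcases hX.2 (e.hom ≫ f ≫ e.inv) with h | h
    · left
      rw [h1]
      infer_instance
    · right
      rw [h2]
      infer_instance

variable {k : Type*} [Field k] [Linear k 𝒞]

lemma isIso_smul {X Y : 𝒞} {c : k} (hc : c ≠ 0) (f : X ⟶ Y) [IsIso f] : IsIso (c • f) :=
  ⟨c⁻¹ • inv f, by simp [smul_smul, hc], by simp [smul_smul, hc]⟩

lemma LocalObj.finite_not_isIso {X Y : 𝒞} (hX : LocalObj X) (f g : X ⟶ Y) [IsIso g] :
    {c : k | ¬ IsIso (f + c • g)}.Finite := by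
  refine Set.Subsingleton.finite fun a ha b hb => ?_
  by_contra hab
  have hba : b - a ≠ 0 := sub_ne_zero.2 (Ne.symm hab)
  rcases hX.2 ((b - a)⁻¹ • ((f + b • g) ≫ inv g)) with h | h
  · refine hb ?_
    have h1 := isIso_smul hba ((b - a)⁻¹ • ((f + b • g) ≫ inv g))
    rw [smul_smul, mul_inv_cancel₀ hba, one_smul] at h1
    exact IsIso.of_isIso_comp_right _ (inv g)
  · refine ha ?_
    have h0 : 𝟙 X = (b - a)⁻¹ • ((b • g - a • g) ≫ inv g) := by
      rw [← sub_smul, Linear.smul_comp, IsIso.hom_inv_id, smul_smul, inv_mul_cancel₀ hba, one_smul]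
    have h2 : 𝟙 X - (b - a)⁻¹ • ((f + b • g) ≫ inv g) =
        (-(b - a)⁻¹) • ((f + a • g) ≫ inv g) := by
      rw [h0, ← smul_sub, ← Preadditive.sub_comp, neg_smul, ← smul_neg, ← Preadditive.neg_comp]
      congr 2
      abel
    rw [h2] at h
    have h1 := isIso_smul (neg_ne_zero.2 hba) ((-(b - a)⁻¹) • ((f + a • g) ≫ inv g))
    rw [smul_smul, neg_mul_neg, mul_inv_cancel₀ hba, one_smul] at h1
    exact IsIso.of_isIso_comp_right _ (inv g)

end local_objects

/-- A surjection onto a finite-dimensional space remains surjective after almost every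
perturbation along a line. -/
lemma finite_not_surjective {k V W : Type*} [Field k] [AddCommGroup V] [Module k V]
    [AddCommGroup W] [Module k W] [Module.Finite k W] (A B : V →ₗ[k] W)
    (hA : Function.Surjective A) : {c : k | ¬ Function.Surjective (A + c • B)}.Finite := by
  obtain ⟨C, hC⟩ := A.exists_rightInverse_of_surjective (LinearMap.range_eq_top.2 hA)
  have h1 : {c : k | c ∈ spectrum k (B ∘ₗ C : Module.End k W)}.Finite := by
    simp only [← Module.End.hasEigenvalue_iff_mem_spectrum]
    exact Module.End.finite_hasEigenvalue _
  refine (h1.preimage (f := fun c : k => -c⁻¹) ?_).subset ?_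
  · intro a _ b _ h
    simpa using h
  · intro c hc
    by_contra h2
    apply hc
    by_cases hc0 : c = 0
    · rw [hc0, zero_smul, add_zero]
      exact hA
    have h3 : IsUnit (algebraMap k (Module.End k W) (-c⁻¹) - B ∘ₗ C) := by
      by_contra h4
      exact h2 h4
    have h5 : Function.Surjective (algebraMap k (Module.End k W) (-c⁻¹) - B ∘ₗ C) :=
      ((Module.End.isUnit_iff _).1 h3).2
    intro w
    obtain ⟨x, hx⟩ := h5 (-c⁻¹ • w)
    refine ⟨C x, ?_⟩
    have h6 : A (C x) = x := LinearMap.congr_fun hC x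
    have h7 : (-c⁻¹) • x - B (C x) = -c⁻¹ • w := hx
    have h8 := congrArg (fun y => (-c) • y) h7
    simp only [smul_sub, smul_smul, neg_mul_neg, mul_inv_cancel₀ hc0, one_smul] at h8
    rw [LinearMap.add_apply, LinearMap.smul_apply, h6, ← h8]
    simp
end

section
open Pretriangulated

/-- There is no nonzero morphism. -/
def NoHom {𝒞 : Type*} [Category* 𝒞] [Preadditive 𝒞] (X Y : 𝒞) : Prop := ∀ f : X ⟶ Y, f = 0

section
variable {𝒞 : Type*} [Category* 𝒞] [Preadditive 𝒞] [HasFiniteBiproducts 𝒞] {J : Type}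

/-- A family of morphisms from `S i` to other members through which all others factor. -/
structure IsApprox (S : J → 𝒞) (i : J) {ε : Type} [Fintype ε] (d : ε → J)
    (f : ∀ e, S i ⟶ S (d e)) : Prop where
  ne : ∀ e, d e ≠ i
  fac : ∀ j, j ≠ i → ∀ g : S i ⟶ S j, ∃ w : ∀ e, S (d e) ⟶ S j, g = ∑ e, f e ≫ w e

lemma isRad_of_components {ε : Type} [Fintype ε] (X : ε → 𝒞) (θ : ⨁ X ⟶ ⨁ X)
    (h : ∀ a b, IsRad (biproduct.ι X a ≫ θ ≫ biproduct.π X b)) : IsRad θ := by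
  classical
  have h1 : θ = ∑ a, ∑ b, biproduct.π X a ≫ (biproduct.ι X a ≫ θ ≫ biproduct.π X b) ≫
      biproduct.ι X b := by
    conv_lhs => rw [← Category.id_comp θ, ← Category.comp_id θ, ← biproduct.total]
    simp only [Preadditive.sum_comp, Preadditive.comp_sum, Category.assoc]
    rw [Finset.sum_comm]
  rw [h1]
  exact IsRad.sum _ _ fun a _ => IsRad.sum _ _ fun b _ => ((h a b).comp_right _).comp_left _

omit [HasFiniteBiproducts 𝒞] in
lemma IsApprox.drop {S : J → 𝒞} {i : J} {ε : Type} [Fintype ε] {d : ε → J}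
    {f : ∀ e, S i ⟶ S (d e)} (h : IsApprox S i d f) (a : ε) [Fintype {e // e ≠ a}]
    (w : ∀ e : {e // e ≠ a}, S (d e) ⟶ S (d a)) (hw : f a = ∑ e : {e // e ≠ a}, f e ≫ w e) :
    IsApprox S i (fun e : {e // e ≠ a} => d e) (fun e => f e) := by
  classical
  refine ⟨fun e => h.ne _, fun j hj g => ?_⟩
  obtain ⟨v, rfl⟩ := h.fac j hj g
  refine ⟨fun e => v e + w e ≫ v a, ?_⟩
  rw [← Fintype.sum_subtype_add_sum_subtype (fun e => e ≠ a)]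
  have h1 : ∑ e : {e // ¬ (e ≠ a)}, f e ≫ v e = f a ≫ v a := by
    rw [Fintype.sum_eq_single ⟨a, fun h => h rfl⟩]
    rintro ⟨b, hb⟩ hne
    exact absurd (Subtype.ext (not_not.1 hb)) hne
  rw [h1, hw]
  simp only [Preadditive.comp_add, Finset.sum_add_distrib, Preadditive.sum_comp, Category.assoc]
  congr 1
  exact Finset.sum_congr (by ext; simp) fun _ _ => rfl

lemma IsApprox.isIso {S : J → 𝒞} {i : J} {ε : Type} [Fintype ε] {d : ε → J}
    {f : ∀ e, S i ⟶ S (d e)} (h : IsApprox S i d f) (hS : ∀ j, LocalObj (S j))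
    (hmin : ∀ (ε' : Type) (_ : Fintype ε') (d' : ε' → J) (f' : ∀ e, S i ⟶ S (d' e)),
      IsApprox S i d' f' → Fintype.card ε ≤ Fintype.card ε')
    (ψ : (⨁ fun e => S (d e)) ⟶ ⨁ fun e => S (d e))
    (hψ : biproduct.lift f ≫ ψ = biproduct.lift f) : IsIso ψ := by
  classical
  let θ := 𝟙 _ - ψ
  have hθ : biproduct.lift f ≫ θ = 0 := by
    rw [Preadditive.comp_sub, hψ, Category.comp_id, sub_self]
  by_cases hr : ∀ a b, ¬ IsIso (biproduct.ι (fun e => S (d e)) a ≫ θ ≫ biproduct.π _ b)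
  · have h1 : IsRad θ := isRad_of_components _ _ fun a b => (hS _).isRad (hS _) _ (hr a b)
    have h2 := h1 (𝟙 _)
    rwa [Category.comp_id, sub_sub_cancel] at h2
  · exfalso
    push Not at hr
    obtain ⟨a, b, hab⟩ := hr
    let t : ∀ c, S (d c) ⟶ S (d b) := fun c => biproduct.ι (fun e => S (d e)) c ≫ θ ≫ biproduct.π _ b
    have hab' : IsIso (t a) := hab
    have h0 : ∑ c, f c ≫ t c = 0 := by
      have h1 : biproduct.lift f ≫ θ ≫ biproduct.π _ b = 0 := by
        rw [← Category.assoc, hθ, zero_comp]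
      rw [biproduct.lift_eq, Preadditive.sum_comp] at h1
      simpa only [Category.assoc] using h1
    have h2 : f a = ∑ e : {e // e ≠ a}, f e ≫ (-(t e ≫ inv (t a))) := by
      rw [← Fintype.sum_subtype_add_sum_subtype (fun e => e ≠ a)] at h0
      have h1 : ∑ e : {e // ¬ (e ≠ a)}, f e ≫ t e = f a ≫ t a := by
        rw [Fintype.sum_eq_single ⟨a, fun h => h rfl⟩]
        rintro ⟨b, hb⟩ hne
        exact absurd (Subtype.ext (not_not.1 hb)) hne
      rw [h1, add_comm, ← eq_neg_iff_add_eq_zero] at h0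
      rw [← cancel_mono (t a), h0]
      simp only [Preadditive.comp_neg, Finset.sum_neg_distrib, Preadditive.neg_comp,
        Preadditive.sum_comp, Category.assoc, IsIso.inv_hom_id, Category.comp_id]
    have h3 := hmin _ _ _ _ (h.drop a _ h2)
    have h4 := Fintype.card_subtype_lt (p := fun e => e ≠ a) (x := a) (by simp)
    omega

omit [HasFiniteBiproducts 𝒞] in
lemma exists_minimal_approx {k : Type*} [Field k] [Linear k 𝒞] [Fintype J] (S : J → 𝒞) (i : J)
    (hfin : ∀ j, Module.Finite k (S i ⟶ S j)) :
    ∃ (ε : Type) (_ : Fintype ε) (d : ε → J) (f : ∀ e, S i ⟶ S (d e)), IsApprox S i d f ∧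
      ∀ (ε' : Type) (_ : Fintype ε') (d' : ε' → J) (f' : ∀ e, S i ⟶ S (d' e)),
      IsApprox S i d' f' → Fintype.card ε ≤ Fintype.card ε' := by
  classical
  let Q : ℕ → Prop := fun n => ∃ (ε : Type) (_ : Fintype ε) (d : ε → J)
    (f : ∀ e, S i ⟶ S (d e)), IsApprox S i d f ∧ Fintype.card ε = n
  have hQ : ∃ n, Q n := by
    let ε := Σ j : {j // j ≠ i}, Fin (Module.finrank k (S i ⟶ S j.1))
    let b : ∀ j, Module.Basis (Fin (Module.finrank k (S i ⟶ S j))) k (S i ⟶ S j) :=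
      fun j => Module.finBasis k _
    refine ⟨_, ε, inferInstance, fun e => e.1, fun e => b e.1 e.2, ⟨fun e => e.1.2, ?_⟩, rfl⟩
    intro j hj g
    refine ⟨fun e => if h : e.1.1 = j then
      (b e.1).repr (g ≫ eqToHom (by rw [h])) e.2 • eqToHom (by rw [h]) else 0, ?_⟩
    rw [Fintype.sum_sigma, Fintype.sum_eq_single ⟨j, hj⟩]
    · simp only [dite_true, eqToHom_refl, Category.comp_id, Linear.comp_smul]
      exact ((b j).sum_repr g).symm
    · intro j' hj'
      refine Finset.sum_eq_zero fun e _ => ?_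
      dsimp only
      rw [dif_neg (fun h => hj' (Subtype.ext h)), comp_zero]
  obtain ⟨ε, hε, d, f, hf, hc⟩ := Nat.find_spec hQ
  exact ⟨ε, hε, d, f, hf, fun ε' hε' d' f' hf' =>
    hc.le.trans (Nat.find_min' hQ ⟨ε', hε', d', f', hf', rfl⟩)⟩

end
end

section
open Pretriangulated

section
variable {𝒞 : Type*} [Category* 𝒞] [Preadditive 𝒞] [HasZeroObject 𝒞] [HasShift 𝒞 ℤ]
  [∀ n : ℤ, (shiftFunctor 𝒞 n).Additive] [Pretriangulated 𝒞]

lemma dist_co₃_shift {X Y Z : 𝒞} {f : X ⟶ Y} {g : Y ⟶ Z} {h : Z ⟶ X⟦(1 : ℤ)⟧}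
    (hT : Triangle.mk f g h ∈ distTriang 𝒞) {W : 𝒞} (u : W ⟶ Z⟦(1 : ℤ)⟧)
    (hu : u ≫ h⟦(1 : ℤ)⟧' = 0) : ∃ v : W ⟶ Y⟦(1 : ℤ)⟧, u = v ≫ g⟦(1 : ℤ)⟧' := by
  obtain ⟨v, hv⟩ : ∃ v : W ⟶ Y⟦(1 : ℤ)⟧, u = v ≫ (-g⟦(1 : ℤ)⟧') :=
    Triangle.coyoneda_exact₃ _ (rot_of_distTriang _ (rot_of_distTriang _
      (rot_of_distTriang _ hT))) u (by
        change u ≫ (-h⟦(1 : ℤ)⟧') = 0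
        rw [Preadditive.comp_neg, hu, neg_zero])
  exact ⟨-v, by rw [hv, Preadditive.neg_comp, Preadditive.comp_neg]⟩

lemma noHom_of_dist_right {X Y Z : 𝒞} {f : X ⟶ Y} {g : Y ⟶ Z} {h : Z ⟶ X⟦(1 : ℤ)⟧}
    (hT : Triangle.mk f g h ∈ distTriang 𝒞) {W : 𝒞} (h1 : NoHom W (Y⟦(1 : ℤ)⟧))
    (h2 : NoHom W (X⟦(1 : ℤ)⟧⟦(1 : ℤ)⟧)) : NoHom W (Z⟦(1 : ℤ)⟧) := fun u => by
  obtain ⟨v, rfl⟩ := dist_co₃_shift hT u (h2 _)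
  rw [h1 v, zero_comp]

lemma exists_dist_hom₁ {X Y Z X' Y' Z' : 𝒞} {f : X ⟶ Y} {g : Y ⟶ Z} {h : Z ⟶ X⟦(1 : ℤ)⟧}
    {f' : X' ⟶ Y'} {g' : Y' ⟶ Z'} {h' : Z' ⟶ X'⟦(1 : ℤ)⟧}
    (hT : Triangle.mk f g h ∈ distTriang 𝒞) (hT' : Triangle.mk f' g' h' ∈ distTriang 𝒞)
    (b : Y ⟶ Y') (c : Z ⟶ Z') (hbc : g ≫ c = b ≫ g') :
    ∃ a : X ⟶ X', f ≫ b = a ≫ f' ∧ h ≫ a⟦(1 : ℤ)⟧' = c ≫ h' :=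
  complete_distinguished_triangle_morphism₁ _ _ hT hT' b c hbc

lemma dist_isIso₃ {X Y Z X' Y' Z' : 𝒞} {f : X ⟶ Y} {g : Y ⟶ Z} {h : Z ⟶ X⟦(1 : ℤ)⟧}
    {f' : X' ⟶ Y'} {g' : Y' ⟶ Z'} {h' : Z' ⟶ X'⟦(1 : ℤ)⟧}
    (hT : Triangle.mk f g h ∈ distTriang 𝒞) (hT' : Triangle.mk f' g' h' ∈ distTriang 𝒞)
    (a : X ⟶ X') (b : Y ⟶ Y') (c : Z ⟶ Z') (h1 : f ≫ b = a ≫ f') (h2 : g ≫ c = b ≫ g')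
    (h3 : h ≫ a⟦(1 : ℤ)⟧' = c ≫ h') [IsIso a] [IsIso b] : IsIso c :=
  isIso₃_of_isIso₁₂ ⟨a, b, c, h1, h2, h3⟩ hT hT' ‹_› ‹_›

/-- The ambient data for two-term silting mutation. `L` is a family of test objects and `R` is a
finite family of objects used to bound the length of mutation sequences. -/
structure MutCtx (k : Type*) (𝒞 : Type*) [Field k] [Category* 𝒞] [Preadditive 𝒞]
    [HasZeroObject 𝒞] [HasShift 𝒞 ℤ] [∀ n : ℤ, (shiftFunctor 𝒞 n).Additive]
    [Pretriangulated 𝒞] [Linear k 𝒞] (ι : Type) where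
  Tw : 𝒞 → Prop
  tw_iso : ∀ {X Y}, Nonempty (X ≅ Y) → Tw X → Tw Y
  L : ι → 𝒞
  tw_hom : ∀ {X Y}, Tw X → Tw Y → NoHom X (Y⟦(1 : ℤ)⟧⟦(1 : ℤ)⟧)
  tw_biproduct : ∀ {ε : Type} [Fintype ε] (X : ε → 𝒞), (∀ e, Tw (X e)) → Tw (⨁ X)
  tw_cone : ∀ {X Y Z : 𝒞} {f : X ⟶ Y} {g : Y ⟶ Z} {h : Z ⟶ X⟦(1 : ℤ)⟧},
    Triangle.mk f g h ∈ distTriang 𝒞 → Tw X → Tw Y →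
    (∀ l (x : X ⟶ L l), ∃ y : Y ⟶ L l, x = f ≫ y) → Tw Z
  finite_hom : ∀ {X Y}, Tw X → Tw Y → Module.Finite k (X ⟶ Y)
  finite_hom_L : ∀ {X} l, Tw X → Module.Finite k (X ⟶ L l)

variable {k : Type*} [Field k] [Linear k 𝒞] {ι J : Type}

/-- A two-term silting family. -/
structure IsSilt (M : MutCtx k 𝒞 ι) (S : J → 𝒞) : Prop where
  tw : ∀ j, M.Tw (S j)
  loc : ∀ j, LocalObj (S j)
  not_iso : ∀ i j, Nonempty (S i ≅ S j) → i = j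
  noHom : ∀ i j, NoHom (S i) ((S j)⟦(1 : ℤ)⟧)

lemma lift_fac {ε : Type} [Fintype ε] {X Y : 𝒞} {E : ε → 𝒞} (f : ∀ e, X ⟶ E e)
    (w : ∀ e, E e ⟶ Y) : biproduct.lift f ≫ biproduct.desc w = ∑ e, f e ≫ w e :=
  biproduct.lift_desc

variable [Fintype J] [DecidableEq J]

/-- The result of a left mutation. -/
structure IsMutation (M : MutCtx k 𝒞 ι) (S : J → 𝒞) (i : J) {ε : Type} [Fintype ε]
    (d : ε → J) (S' : 𝒞) (f : ∀ e, S i ⟶ S (d e)) (g : (⨁ fun e => S (d e)) ⟶ S')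
    (δ : S' ⟶ (S i)⟦(1 : ℤ)⟧) : Prop where
  dist : Triangle.mk (biproduct.lift f) g δ ∈ distTriang 𝒞
  approx : IsApprox S i d f
  tw : M.Tw S'
  ne_zero : δ ≠ 0
  silt : IsSilt M (Function.update S i S')

lemma exists_mutation (M : MutCtx k 𝒞 ι) {S : J → 𝒞} (hS : IsSilt M S) (i : J)
    (hi : ∀ l (x : S i ⟶ M.L l), ∃ (τ : Type) (_ : Fintype τ) (c : τ → J)
      (a : ∀ t, S i ⟶ S (c t)) (b : ∀ t, S (c t) ⟶ M.L l), (∀ t, c t ≠ i) ∧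
      x = ∑ t, a t ≫ b t) :
    ∃ (ε : Type) (_ : Fintype ε) (d : ε → J) (S' : 𝒞) (f : ∀ e, S i ⟶ S (d e))
      (g : (⨁ fun e => S (d e)) ⟶ S') (δ : S' ⟶ (S i)⟦(1 : ℤ)⟧), IsMutation M S i d S' f g δ := by
  obtain ⟨ε, _, d, f, hf, hmin⟩ := exists_minimal_approx (k := k) S i
    fun j => M.finite_hom (hS.tw i) (hS.tw j)
  obtain ⟨S', g, δ, hT⟩ := distinguished_cocone_triangle (biproduct.lift f)
  have hTE : M.Tw (⨁ fun e => S (d e)) := M.tw_biproduct _ fun e => hS.tw _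
  have happ : ∀ {W : 𝒞} {j : J}, j ≠ i → ∀ (a : S i ⟶ S j) (b : S j ⟶ W),
      ∃ y : (⨁ fun e => S (d e)) ⟶ W, a ≫ b = biproduct.lift f ≫ y := by
    intro W j hj a b
    obtain ⟨w, rfl⟩ := hf.fac j hj a
    exact ⟨biproduct.desc w ≫ b, by rw [← Category.assoc, lift_fac]⟩
  have htw : M.Tw S' := by
    refine M.tw_cone hT (hS.tw i) hTE fun l x => ?_
    obtain ⟨τ, _, c, a, b, hc, rfl⟩ := hi l x
    choose y hy using fun t => happ (hc t) (a t) (b t)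
    exact ⟨∑ t, y t, by rw [Preadditive.comp_sum]; exact Finset.sum_congr rfl fun t _ => hy t⟩
  have hE : ∀ j, NoHom (⨁ fun e => S (d e)) ((S j)⟦(1 : ℤ)⟧) := fun j u =>
    biproduct.hom_ext' _ _ fun e =>
      (hS.noHom _ _ (biproduct.ι (fun e => S (d e)) e ≫ u)).trans comp_zero.symm
  have hEr : ∀ W, (∀ j, j ≠ i → NoHom W ((S j)⟦(1 : ℤ)⟧)) →
      NoHom W ((⨁ fun e => S (d e))⟦(1 : ℤ)⟧) := fun W hW u => by
    have h1 : (𝟙 (⨁ fun e => S (d e)))⟦(1 : ℤ)⟧' =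
        ∑ e, (biproduct.π (fun e => S (d e)) e)⟦(1 : ℤ)⟧' ≫ (biproduct.ι (fun e => S (d e)) e)⟦(1 : ℤ)⟧' := by
      rw [← biproduct.total, Functor.map_sum]
      simp only [Functor.map_comp]
    rw [← Category.comp_id u, ← (shiftFunctor 𝒞 (1 : ℤ)).map_id, h1, Preadditive.comp_sum]
    refine Finset.sum_eq_zero fun e _ => ?_
    rw [← Category.assoc, hW _ (hf.ne e) (u ≫ _), zero_comp]
  have hδ : δ ≠ 0 := by
    intro h0
    -- the approximation would be a split monomorphism
    obtain ⟨r, hr⟩ : ∃ r : (⨁ fun e => S (d e)) ⟶ S i, 𝟙 (S i) = biproduct.lift f ≫ r := by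
      obtain ⟨v, hv⟩ := dist_yo₁ hT (𝟙 _) (by rw [h0, zero_comp])
      obtain ⟨r, rfl⟩ := (shiftFunctor 𝒞 (1 : ℤ)).map_surjective v
      refine ⟨r, (shiftFunctor 𝒞 (1 : ℤ)).map_injective ?_⟩
      rw [CategoryTheory.Functor.map_id, hv, Functor.map_comp]
    rw [biproduct.lift_eq, Preadditive.sum_comp] at hr
    have h1 : IsRad (𝟙 (S i)) := by
      rw [hr]
      refine IsRad.sum _ _ fun e _ => ?_
      rw [Category.assoc]
      refine IsRad.comp_right ((hS.loc i).isRad (hS.loc _) _ fun he => ?_) _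
      exact hf.ne e (hS.not_iso _ _ ⟨(asIso (f e)).symm⟩)
    have h2 := h1 (𝟙 _)
    rw [Category.comp_id, sub_self] at h2
    have h3 := IsIso.hom_inv_id (0 : S i ⟶ S i)
    rw [zero_comp] at h3
    exact (hS.loc i).1 h3.symm
  have hS'j : ∀ j, j ≠ i → NoHom S' ((S j)⟦(1 : ℤ)⟧) := fun j hj u => by
    obtain ⟨v, rfl⟩ := dist_yo₃ hT u (hE j _)
    obtain ⟨v', rfl⟩ := (shiftFunctor 𝒞 (1 : ℤ)).map_surjective v
    obtain ⟨y, hy⟩ := happ hj v' (𝟙 _)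
    rw [Category.comp_id] at hy
    rw [hy, Functor.map_comp, ← Category.assoc, dist_comp₃₁ hT, zero_comp]
  have hjS' : ∀ j, NoHom (S j) (S'⟦(1 : ℤ)⟧) := fun j =>
    noHom_of_dist_right hT (hEr _ fun l _ => hS.noHom j l) (M.tw_hom (hS.tw _) (hS.tw _))
  have hS'S' : NoHom S' (S'⟦(1 : ℤ)⟧) :=
    noHom_of_dist_right hT (hEr _ hS'j) (M.tw_hom htw (hS.tw _))
  have hloc : LocalObj S' := by
    refine ⟨fun h => hδ (by rw [← Category.id_comp δ, h, zero_comp]), fun φ => ?_⟩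
    obtain ⟨ψ, hψ⟩ := dist_co₃ hT (g ≫ φ) (hE i _)
    obtain ⟨a, ha, ha'⟩ := exists_dist_hom₁ hT hT ψ φ hψ
    have key : ∀ (a : S i ⟶ S i) (ψ : (⨁ fun e => S (d e)) ⟶ ⨁ fun e => S (d e)) (φ : S' ⟶ S'),
        biproduct.lift f ≫ ψ = a ≫ biproduct.lift f → g ≫ φ = ψ ≫ g →
        δ ≫ a⟦(1 : ℤ)⟧' = φ ≫ δ → IsIso a → IsIso φ := by
      intro a ψ φ h1 h2 h3 hia
      have hex : ∃ ρ : (⨁ fun e => S (d e)) ⟶ ⨁ fun e => S (d e),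
          inv a ≫ biproduct.lift f = biproduct.lift f ≫ ρ := by
        choose y hy using fun e => happ (hf.ne e) (inv a ≫ f e) (𝟙 _)
        refine ⟨biproduct.lift y, biproduct.hom_ext _ _ fun e => ?_⟩
        rw [Category.assoc, biproduct.lift_π, Category.assoc, biproduct.lift_π, ← hy,
          Category.comp_id]
      obtain ⟨ρ, hρ⟩ := hex
      have i1 : IsIso (ψ ≫ ρ) := hf.isIso hS.loc hmin _ (by
        rw [← Category.assoc, h1, Category.assoc, ← hρ, IsIso.hom_inv_id_assoc])
      have i2 : IsIso (ρ ≫ ψ) := hf.isIso hS.loc hmin _ (by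
        rw [← Category.assoc, ← hρ, Category.assoc, h1, IsIso.inv_hom_id_assoc])
      have i3 : IsIso ψ := by
        have h4 : ψ ≫ ρ ≫ inv (ψ ≫ ρ) = 𝟙 _ := by rw [← Category.assoc, IsIso.hom_inv_id]
        have h5 : (inv (ρ ≫ ψ) ≫ ρ) ≫ ψ = 𝟙 _ := by rw [Category.assoc, IsIso.inv_hom_id]
        refine ⟨_, h4, ?_⟩
        rw [← h5]
        congr 1
        calc ρ ≫ inv (ψ ≫ ρ) = ((inv (ρ ≫ ψ) ≫ ρ) ≫ ψ) ≫ ρ ≫ inv (ψ ≫ ρ) := by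
              rw [h5, Category.id_comp]
          _ = _ := by rw [Category.assoc, h4, Category.comp_id]
      exact dist_isIso₃ hT hT a ψ φ h1 h2 h3
    rcases (hS.loc i).2 a with h | h
    · exact Or.inl (key a ψ φ ha hψ ha' h)
    · refine Or.inr (key _ (𝟙 _ - ψ) _ ?_ ?_ ?_ h)
      · rw [Preadditive.comp_sub, Preadditive.sub_comp, ha, Category.comp_id, Category.id_comp]
      · rw [Preadditive.comp_sub, Preadditive.sub_comp, hψ, Category.comp_id, Category.id_comp]
      · rw [Functor.map_sub, Preadditive.comp_sub, Preadditive.sub_comp, ha',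
          CategoryTheory.Functor.map_id, Category.comp_id, Category.id_comp]
  have hne : ∀ j, Nonempty (S' ≅ S j) → False := by
    rintro j ⟨e⟩
    apply hδ
    rw [← e.hom_inv_id_assoc δ, hS.noHom j i (e.inv ≫ δ), comp_zero]
  refine ⟨ε, _, d, S', f, g, δ, hT, hf, htw, hδ, ?_, ?_, ?_, ?_⟩
  · intro j
    rcases eq_or_ne j i with rfl | hj
    · rwa [Function.update_self]
    · rw [Function.update_of_ne hj]
      exact hS.tw j
  · intro j
    rcases eq_or_ne j i with rfl | hj
    · rwa [Function.update_self]
    · rw [Function.update_of_ne hj]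
      exact hS.loc j
  · intro j l
    rcases eq_or_ne j i with hj | hj <;> rcases eq_or_ne l i with hl | hl
    · exact fun _ => hj.trans hl.symm
    · rw [hj, Function.update_self, Function.update_of_ne hl]
      exact fun h => (hne l h).elim
    · rw [hl, Function.update_self, Function.update_of_ne hj]
      exact fun h => (hne j ⟨h.some.symm⟩).elim
    · rw [Function.update_of_ne hj, Function.update_of_ne hl]
      exact hS.not_iso j l
  · intro j l
    rcases eq_or_ne j i with hj | hj <;> rcases eq_or_ne l i with hl | hl
    · rw [hj, hl, Function.update_self]
      exact hS'S'
    · rw [hj, Function.update_self, Function.update_of_ne hl]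
      exact hS'j l hl
    · rw [hl, Function.update_self, Function.update_of_ne hj]
      exact hjS' j
    · rw [Function.update_of_ne hj, Function.update_of_ne hl]
      exact hS.noHom j l

end
end

section
open Pretriangulated

section
variable {𝒞 : Type*} [Category* 𝒞] [Preadditive 𝒞] [HasZeroObject 𝒞] [HasShift 𝒞 ℤ]
  [∀ n : ℤ, (shiftFunctor 𝒞 n).Additive] [Pretriangulated 𝒞]

/-- Integer valued functions additive on distinguished triangles of objects satisfying `P`. -/
structure IsAddFun (P : 𝒞 → Prop) (lam : 𝒞 → ℤ) : Prop where
  iso : ∀ {X Y : 𝒞}, Nonempty (X ≅ Y) → lam X = lam Y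
  biproduct : ∀ {ε : Type} [Fintype ε] (X : ε → 𝒞), (∀ e, P (X e)) →
    lam (⨁ X) = ∑ e, lam (X e)
  add : ∀ {X Y Z : 𝒞} {f : X ⟶ Y} {g : Y ⟶ Z} {h : Z ⟶ X⟦(1 : ℤ)⟧},
    Triangle.mk f g h ∈ distTriang 𝒞 → P X → P Y → P Z → lam Y = lam X + lam Z

variable {k : Type*} [Field k] [Linear k 𝒞] {ι J : Type}

/-- A presentation, by sums of members of a silting family, of a formal difference of objects. -/
structure IsPres (M : MutCtx k 𝒞 ι) (S : J → 𝒞) {σ1 σ0 : Type} [Fintype σ0] (X1 : σ1 → 𝒞)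
    (X0 : σ0 → 𝒞) (c1 : σ1 → J) (c0 : σ0 → J) (h : ∀ s t, X1 s ⟶ X0 t) : Prop where
  iso1 : ∀ s, Nonempty (X1 s ≅ S (c1 s))
  iso0 : ∀ t, Nonempty (X0 t ≅ S (c0 t))
  fac : ∀ l (x : ∀ s, X1 s ⟶ M.L l), ∃ χ : ∀ t, X0 t ⟶ M.L l, ∀ s, x s = ∑ t, h s t ≫ χ t

/-- Composition of a matrix of morphisms with a vector of morphisms. -/
def matComp (k : Type*) [Field k] [Linear k 𝒞] {σ1 σ0 : Type} [Fintype σ0] {X1 : σ1 → 𝒞}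
    {X0 : σ0 → 𝒞} (h : ∀ s t, X1 s ⟶ X0 t) (W : 𝒞) :
    (∀ t, X0 t ⟶ W) →ₗ[k] (∀ s, X1 s ⟶ W) where
  toFun χ s := ∑ t, h s t ≫ χ t
  map_add' a b := by
    funext s
    simp only [Pi.add_apply, Preadditive.comp_add, Finset.sum_add_distrib]
  map_smul' c a := by
    funext s
    simp only [Pi.smul_apply, Linear.comp_smul, Finset.smul_sum, RingHom.id_apply]

lemma IsPres.exists_isIso_entry [Infinite k] [Finite ι] {M : MutCtx k 𝒞 ι} {S : J → 𝒞}
    (hS : IsSilt M S) {σ1 σ0 : Type} [Fintype σ1] [Fintype σ0]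
    {X1 : σ1 → 𝒞} {X0 : σ0 → 𝒞} {c1 : σ1 → J} {c0 : σ0 → J} {h : ∀ s t, X1 s ⟶ X0 t}
    (H : IsPres M S X1 X0 c1 c0 h) (s0 : σ1) (t0 : σ0) (hc : c1 s0 = c0 t0) :
    ∃ h' : ∀ s t, X1 s ⟶ X0 t, IsPres M S X1 X0 c1 c0 h' ∧ IsIso (h' s0 t0) := by
  classical
  obtain ⟨e1⟩ := H.iso1 s0
  obtain ⟨e0⟩ := H.iso0 t0
  let g : X1 s0 ≅ X0 t0 := e1 ≪≫ eqToIso (by rw [hc]) ≪≫ e0.symm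
  let G : ∀ s t, X1 s ⟶ X0 t :=
    Function.update (fun _ _ => 0) s0 (Function.update (fun _ => 0) t0 g.hom)
  have hG : G s0 t0 = g.hom := by simp [G]
  have hloc : LocalObj (X1 s0) := (hS.loc _).of_iso e1.symm
  have hf1 := hloc.finite_not_isIso (k := k) (h s0 t0) g.hom
  have hf2 : ∀ l, {c : k | ¬ Function.Surjective
      (matComp k h (M.L l) + c • matComp k G (M.L l))}.Finite := fun l => by
    have : Module.Finite k (∀ s, X1 s ⟶ M.L l) := by
      have : ∀ s, Module.Finite k (X1 s ⟶ M.L l) := fun s => by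
        obtain ⟨e⟩ := H.iso1 s
        have := M.finite_hom_L l (hS.tw (c1 s))
        exact Module.Finite.equiv (Linear.homCongr k e.symm (Iso.refl (M.L l)))
      infer_instance
    refine finite_not_surjective _ _ fun x => ?_
    obtain ⟨χ, hχ⟩ := H.fac l x
    exact ⟨χ, (funext hχ).symm⟩
  obtain ⟨c, hc⟩ := (hf1.union (Set.finite_iUnion hf2)).infinite_compl.nonempty
  simp only [Set.mem_compl_iff, Set.mem_union, Set.mem_iUnion, Set.mem_ofPred_eq, not_or,
    not_exists, not_not] at hc
  refine ⟨fun s t => h s t + c • G s t, ⟨H.iso1, H.iso0, fun l x => ?_⟩, ?_⟩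
  · obtain ⟨χ, hχ⟩ := hc.2 l x
    refine ⟨χ, fun s => ?_⟩
    rw [← hχ]
    simp only [matComp, LinearMap.add_apply, LinearMap.smul_apply, LinearMap.coe_mk,
      AddHom.coe_mk, Pi.add_apply, Pi.smul_apply, Preadditive.add_comp, Linear.smul_comp,
      Finset.sum_add_distrib, Finset.smul_sum]
  · change IsIso (h s0 t0 + c • G s0 t0)
    rw [hG]
    exact hc.1

omit [HasZeroObject 𝒞] in
lemma sum_eq_add_sum_ne {A σ : Type*} [AddCommMonoid A] [Fintype σ] (t0 : σ)
    [Fintype {t // t ≠ t0}] (f : σ → A) : ∑ t, f t = f t0 + ∑ t : {t // t ≠ t0}, f t := by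
  classical
  rw [← Fintype.sum_subtype_add_sum_subtype (fun e => e ≠ t0), add_comm]
  congr 1
  · rw [Fintype.sum_eq_single ⟨t0, fun h => h rfl⟩]
    rintro ⟨b, hb⟩ hne
    exact absurd (Subtype.ext (not_not.1 hb)) hne
  · exact Finset.sum_congr (by ext; simp) fun _ _ => rfl

lemma IsPres.eliminate {M : MutCtx k 𝒞 ι} {S : J → 𝒞} {σ1 σ0 : Type} [Fintype σ0]
    {X1 : σ1 → 𝒞} {X0 : σ0 → 𝒞} {c1 : σ1 → J} {c0 : σ0 → J} {h : ∀ s t, X1 s ⟶ X0 t}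
    (H : IsPres M S X1 X0 c1 c0 h) (s0 : σ1) (t0 : σ0) [IsIso (h s0 t0)]
    [Fintype {t // t ≠ t0}] :
    IsPres M S (fun s : {s // s ≠ s0} => X1 s) (fun t : {t // t ≠ t0} => X0 t)
      (fun s => c1 s) (fun t => c0 t)
      (fun s t => h s t - h s t0 ≫ inv (h s0 t0) ≫ h s0 t) := by
  classical
  refine ⟨fun s => H.iso1 s, fun t => H.iso0 t, fun l x => ?_⟩
  obtain ⟨χ, hχ⟩ := H.fac l fun s => if hs : s = s0 then 0 else x ⟨s, hs⟩
  refine ⟨fun t => χ t, fun s => ?_⟩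
  have h1 := hχ s0
  rw [dif_pos rfl, sum_eq_add_sum_ne t0] at h1
  have h2 := hχ s
  rw [dif_neg s.2, sum_eq_add_sum_ne t0] at h2
  have h3 : ∑ t : {t // t ≠ t0}, h s0 t ≫ χ t = - (h s0 t0 ≫ χ t0) :=
    (neg_eq_of_add_eq_zero_right h1.symm).symm
  rw [h2]
  simp only [Preadditive.sub_comp, Finset.sum_sub_distrib, Category.assoc]
  rw [← Preadditive.comp_sum, ← Preadditive.comp_sum, h3]
  simp only [Preadditive.comp_neg, IsIso.inv_hom_id_assoc, sub_neg_eq_add]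
  rw [add_comm]

variable [Fintype J] [DecidableEq J]

lemma IsPres.exists_mutation {M : MutCtx k 𝒞 ι} {S : J → 𝒞} (hS : IsSilt M S)
    {σ1 σ0 : Type} [Fintype σ0]
    {X1 : σ1 → 𝒞} {X0 : σ0 → 𝒞} {c1 : σ1 → J} {c0 : σ0 → J} {h : ∀ s t, X1 s ⟶ X0 t}
    (H : IsPres M S X1 X0 c1 c0 h) (hc : ∀ s t, c1 s ≠ c0 t) (s0 : σ1) :
    ∃ (ε : Type) (_ : Fintype ε) (d : ε → J) (S' : 𝒞) (f : ∀ e, S (c1 s0) ⟶ S (d e))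
      (g : (⨁ fun e => S (d e)) ⟶ S') (δ : S' ⟶ (S (c1 s0))⟦(1 : ℤ)⟧),
      IsMutation M S (c1 s0) d S' f g δ := by
  classical
  refine DerivedTools.exists_mutation M hS _ fun l x => ?_
  obtain ⟨e1⟩ := H.iso1 s0
  have e0 := fun t => (H.iso0 t).some
  obtain ⟨χ, hχ⟩ := H.fac l (Function.update (fun _ => 0) s0 (e1.hom ≫ x))
  have h1 := hχ s0
  rw [Function.update_self] at h1
  refine ⟨σ0, inferInstance, c0, fun t => e1.inv ≫ h s0 t ≫ (e0 t).hom,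
    fun t => (e0 t).inv ≫ χ t, fun t => (hc s0 t).symm, ?_⟩
  simp only [Category.assoc, Iso.hom_inv_id_assoc]
  rw [← Preadditive.comp_sum, ← h1, Iso.inv_hom_id_assoc]

omit [Fintype J] in
/-- The presentation obtained by a mutation. -/
lemma IsPres.mutate {M : MutCtx k 𝒞 ι} {S : J → 𝒞}
    {σ1 σ0 : Type} [Fintype σ1] [Fintype σ0]
    {X1 : σ1 → 𝒞} {X0 : σ0 → 𝒞} {c1 : σ1 → J} {c0 : σ0 → J} {h : ∀ s t, X1 s ⟶ X0 t}
    (H : IsPres M S X1 X0 c1 c0 h) {i : J} (hi : ∀ t, c0 t ≠ i) {ε : Type} [Fintype ε]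
    {d : ε → J} {S' : 𝒞} {f : ∀ e, S i ⟶ S (d e)} {g : (⨁ fun e => S (d e)) ⟶ S'}
    {δ : S' ⟶ (S i)⟦(1 : ℤ)⟧} (hm : IsMutation M S i d S' f g δ) :
    ∃ h', IsPres M (Function.update S i S')
      (Sum.elim (fun s : {s // c1 s ≠ i} => X1 s) (fun q : {s // c1 s = i} × ε => S (d q.2)))
      (Sum.elim X0 (fun _ : {s // c1 s = i} => S'))
      (Sum.elim (fun s => c1 s) (fun q => d q.2)) (Sum.elim c0 (fun _ => i)) h' := by
  classical
  have e1 := fun s => (H.iso1 s).some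
  have e0 := fun t => (H.iso0 t).some
  have hw : ∀ s : {s // c1 s = i}, ∀ t, ∃ w : ∀ e, S (d e) ⟶ X0 t,
      h s t = ((e1 s).hom ≫ eqToHom (by rw [s.2])) ≫ ∑ e, f e ≫ w e := by
    intro s t
    obtain ⟨w, hw⟩ := hm.approx.fac _ (hi t)
      (eqToHom (by rw [s.2]) ≫ (e1 s).inv ≫ h s t ≫ (e0 t).hom)
    refine ⟨fun e => w e ≫ (e0 t).inv, ?_⟩
    simp only [← Category.assoc]
    rw [← Preadditive.sum_comp, ← hw]
    simp
  choose w hw using hw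
  let h' : ∀ s t, Sum.elim (fun s : {s // c1 s ≠ i} => X1 s)
      (fun q : {s // c1 s = i} × ε => S (d q.2)) s ⟶
      Sum.elim X0 (fun _ : {s // c1 s = i} => S') t := fun s t =>
    match s, t with
    | Sum.inl s, Sum.inl t => h s t
    | Sum.inl _, Sum.inr _ => 0
    | Sum.inr q, Sum.inl t => w q.1 t q.2
    | Sum.inr q, Sum.inr s => if q.1 = s then biproduct.ι (fun e => S (d e)) q.2 ≫ g else 0
  refine ⟨h', ?_, ?_, fun l x => ?_⟩
  · rintro (s | q)
    · exact ⟨e1 s ≪≫ eqToIso (by dsimp; rw [Function.update_of_ne s.2])⟩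
    · exact ⟨eqToIso (by dsimp; rw [Function.update_of_ne (hm.approx.ne _)])⟩
  · rintro (t | s)
    · exact ⟨e0 t ≪≫ eqToIso (by dsimp; rw [Function.update_of_ne (hi t)])⟩
    · exact ⟨eqToIso (by dsimp; rw [Function.update_self])⟩
  · let u : ∀ s : {s // c1 s = i}, X1 s ⟶ S i := fun s => (e1 s).hom ≫ eqToHom (by rw [s.2])
    let xR : ∀ s : {s // c1 s ≠ i}, X1 s ⟶ M.L l := fun s => x (Sum.inl s)
    let xI : ∀ (_ : {s // c1 s = i}) (e : ε), S (d e) ⟶ M.L l := fun s e => x (Sum.inr (s, e))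
    have hu : ∀ s, IsIso (u s) := fun s => by dsimp only [u]; infer_instance
    obtain ⟨χ, hχ⟩ := H.fac l fun s => if hs : c1 s = i then
      u ⟨s, hs⟩ ≫ ∑ e, f e ≫ xI ⟨s, hs⟩ e else xR ⟨s, hs⟩
    have hψ : ∀ s : {s // c1 s = i}, ∃ ψ : S' ⟶ M.L l,
        ∀ e, xI s e - ∑ t, w s t e ≫ χ t =
          biproduct.ι (fun e => S (d e)) e ≫ g ≫ ψ := by
      intro s
      have h1 := hχ s
      rw [dif_pos s.2] at h1
      simp only [hw s] at h1
      change u s ≫ _ = ∑ t, (u s ≫ _) ≫ χ t at h1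
      simp only [Category.assoc] at h1
      rw [← Preadditive.comp_sum] at h1
      have h2 := (cancel_epi (u s)).1 h1
      obtain ⟨ψ, hψ⟩ := dist_yo₂ hm.dist (biproduct.desc fun e =>
        xI s e - ∑ t, w s t e ≫ χ t) (by
          rw [lift_fac]
          simp only [Preadditive.comp_sub, Finset.sum_sub_distrib]
          rw [h2, sub_eq_zero]
          simp only [Preadditive.sum_comp, Preadditive.comp_sum, Category.assoc]
          exact Finset.sum_comm)
      refine ⟨ψ, fun e => ?_⟩
      rw [← hψ]
      exact (biproduct.ι_desc (fun e => xI s e - ∑ t, w s t e ≫ χ t) e).symm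
    choose ψ hψ using hψ
    let χ' : ∀ t, Sum.elim X0 (fun _ : {s // c1 s = i} => S') t ⟶ M.L l := fun t => match t with
      | Sum.inl t => χ t
      | Sum.inr s => ψ s
    refine ⟨χ', ?_⟩
    rintro (s | ⟨s, e⟩)
    · have h1 := hχ s
      rw [dif_neg s.2] at h1
      have h2 : ∑ a, (0 : X1 s ⟶ S') ≫ ψ a = 0 := Finset.sum_eq_zero fun _ _ => zero_comp
      have h3 : xR s = ∑ t, h s t ≫ χ t + ∑ a, (0 : X1 s ⟶ S') ≫ ψ a := by
        rw [h2, add_zero]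
        exact h1
      exact h3.trans (Fintype.sum_sum_type fun t => h' (Sum.inl s) t ≫ χ' t).symm
    · have h1 := hψ s e
      rw [sub_eq_iff_eq_add] at h1
      have h2 : ∑ s', (if s = s' then biproduct.ι (fun e => S (d e)) e ≫ g else 0) ≫ ψ s' =
          biproduct.ι (fun e => S (d e)) e ≫ g ≫ ψ s := by
        rw [Fintype.sum_eq_single s]
        · rw [if_pos rfl, Category.assoc]
        · intro s' hs'
          rw [if_neg hs'.symm, zero_comp]
      rw [← h2, add_comm] at h1
      exact h1.trans (Fintype.sum_sum_type fun t => h' (Sum.inr (s, e)) t ≫ χ' t).symm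

end
end

section
open Pretriangulated

section
variable {𝒞 : Type*} [Category* 𝒞] [Preadditive 𝒞] [HasZeroObject 𝒞] [HasShift 𝒞 ℤ]
  [∀ n : ℤ, (shiftFunctor 𝒞 n).Additive] [Pretriangulated 𝒞]
  {k : Type*} [Field k] [Linear k 𝒞] {ι J : Type} [Fintype J] [DecidableEq J]

/-- The number of members of `R` receiving no morphism from a family. -/
def numOrth {N : ℕ} (R : Fin N → 𝒞) (S : J → 𝒞) : ℕ := by
  classical exact (Finset.univ.filter fun m : Fin N => ∀ j, NoHom (S j) (R m)).card

lemma IsMutation.numOrth_lt {M : MutCtx k 𝒞 ι} {N : ℕ} {R : Fin N → 𝒞}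
    (h1 : ∀ {X} m, M.Tw X → NoHom X ((R m)⟦(1 : ℤ)⟧)) {S : J → 𝒞}
    (h2 : ∃ m, (∀ j, NoHom (S j) (R m)) ∧
      ∀ (X : 𝒞) (j : J), M.Tw X → ∀ δ : X ⟶ (S j)⟦(1 : ℤ)⟧, δ ≠ 0 → ∃ f : X ⟶ R m, f ≠ 0)
    {i : J} {ε : Type} [Fintype ε]
    {d : ε → J} {S' : 𝒞} {f : ∀ e, S i ⟶ S (d e)} {g : (⨁ fun e => S (d e)) ⟶ S'}
    {δ : S' ⟶ (S i)⟦(1 : ℤ)⟧} (hm : IsMutation M S i d S' f g δ) :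
    numOrth R (Function.update S i S') < numOrth R S := by
  classical
  unfold numOrth
  refine Finset.card_lt_card ((Finset.ssubset_iff_of_subset ?_).2 ?_)
  · intro m hm'
    rw [Finset.mem_filter] at hm' ⊢
    refine ⟨Finset.mem_univ _, fun j => ?_⟩
    by_cases hj : j = i
    · subst hj
      intro u
      obtain ⟨v, hv⟩ := dist_yo₁ hm.dist (u⟦(1 : ℤ)⟧') (h1 m hm.tw _)
      obtain ⟨v', rfl⟩ := (shiftFunctor 𝒞 (1 : ℤ)).map_surjective v
      have h3 : v' = 0 := biproduct.hom_ext' _ _ fun e => by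
        have h4 := hm'.2 (d e)
        rw [Function.update_of_ne (hm.approx.ne e)] at h4
        exact (h4 (biproduct.ι (fun e => S (d e)) e ≫ v')).trans comp_zero.symm
      rw [h3, Functor.map_zero, comp_zero] at hv
      exact (shiftFunctor 𝒞 (1 : ℤ)).map_injective (hv.trans (Functor.map_zero _ _ _).symm)
    · have h4 := hm'.2 j
      rwa [Function.update_of_ne hj] at h4
  · obtain ⟨m, hm1, hm2⟩ := h2
    obtain ⟨u, hu⟩ := hm2 S' i hm.tw δ hm.ne_zero
    refine ⟨m, by simpa using hm1, fun h => hu ?_⟩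
    have h3 := (Finset.mem_filter.1 h).2 i
    rw [Function.update_self] at h3
    exact h3 u

/-- Repeated cancellation and mutation turn a presentation into one without negative part. -/
theorem IsPres.exists_presilting [Infinite k] [Finite ι] {M : MutCtx k 𝒞 ι} {N : ℕ}
    {R : Fin N → 𝒞}
    (h1 : ∀ {X} m, M.Tw X → NoHom X ((R m)⟦(1 : ℤ)⟧))
    (h2 : ∀ S : J → 𝒞, IsSilt M S → ∃ m, (∀ j, NoHom (S j) (R m)) ∧
      ∀ (X : 𝒞) (j : J), M.Tw X → ∀ δ : X ⟶ (S j)⟦(1 : ℤ)⟧, δ ≠ 0 → ∃ f : X ⟶ R m, f ≠ 0)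
    {S : J → 𝒞} (hS : IsSilt M S) {σ1 σ0 : Type} [Fintype σ1] [Fintype σ0]
    {X1 : σ1 → 𝒞} {X0 : σ0 → 𝒞} {c1 : σ1 → J} {c0 : σ0 → J} {h : ∀ s t, X1 s ⟶ X0 t}
    (H : IsPres M S X1 X0 c1 c0 h) :
    ∃ (σ : Type) (_ : Fintype σ) (X : σ → 𝒞), (∀ s, M.Tw (X s)) ∧
      (∀ s t, NoHom (X s) ((X t)⟦(1 : ℤ)⟧)) ∧
      ∀ lam : 𝒞 → ℤ, IsAddFun M.Tw lam →
        ∑ s, lam (X s) = ∑ t, lam (X0 t) - ∑ s, lam (X1 s) := by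
  classical
  induction hn : numOrth R S using Nat.strong_induction_on generalizing S σ1 σ0 with
  | _ n ih =>
  induction hq : Fintype.card σ1 using Nat.strong_induction_on generalizing σ1 σ0 with
  | _ q ihq =>
  by_cases hσ : IsEmpty σ1
  · refine ⟨σ0, inferInstance, X0, fun t => ?_, fun s t => ?_, fun lam _ => by simp⟩
    · exact M.tw_iso ⟨(H.iso0 t).some.symm⟩ (hS.tw _)
    · obtain ⟨e⟩ := H.iso0 s
      obtain ⟨e'⟩ := H.iso0 t
      intro u
      have h3 := hS.noHom _ _ (e.inv ≫ u ≫ e'.hom⟦(1 : ℤ)⟧')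
      rw [← cancel_epi e.inv, ← cancel_mono (e'.hom⟦(1 : ℤ)⟧'), Category.assoc, h3, comp_zero,
        zero_comp]
  rw [not_isEmpty_iff] at hσ
  by_cases hc : ∃ s t, c1 s = c0 t
  · obtain ⟨s0, t0, hst⟩ := hc
    obtain ⟨h', H', hiso⟩ := H.exists_isIso_entry hS s0 t0 hst
    obtain ⟨σ, hσ, X, hX1, hX2, hX3⟩ := ihq _
      (by rw [← hq]; exact Fintype.card_subtype_lt (x := s0) (by simp)) (H'.eliminate s0 t0) rfl
    refine ⟨σ, hσ, X, hX1, hX2, fun lam hlam => ?_⟩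
    rw [hX3 lam hlam, sum_eq_add_sum_ne t0 fun t => lam (X0 t),
      sum_eq_add_sum_ne s0 fun t => lam (X1 t), hlam.iso ⟨asIso (h' s0 t0)⟩]
    abel
  · push Not at hc
    obtain ⟨s0⟩ := hσ
    obtain ⟨ε, _, d, S', f, g, δ, hm⟩ := H.exists_mutation hS hc s0
    obtain ⟨h', H'⟩ := H.mutate (fun t => (hc s0 t).symm) hm
    obtain ⟨σ, hσ, X, hX1, hX2, hX3⟩ := ih _ (hn ▸ hm.numOrth_lt h1 (h2 S hS)) hm.silt H' rfl
    refine ⟨σ, hσ, X, hX1, hX2, fun lam hlam => ?_⟩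
    have h3 := hlam.add hm.dist (hS.tw _) (M.tw_biproduct _ fun e => hS.tw _) hm.tw
    rw [hlam.biproduct _ fun e => hS.tw _] at h3
    have h4 : ∑ s, lam (X1 s) = ∑ s : {s // c1 s ≠ c1 s0}, lam (X1 s) +
        ∑ s : {s // c1 s = c1 s0}, lam (S (c1 s0)) := by
      rw [← Fintype.sum_subtype_add_sum_subtype (fun s => c1 s = c1 s0), add_comm]
      congr 1
      refine Finset.sum_congr rfl fun s _ => ?_
      rw [hlam.iso (H.iso1 s), s.2]
    rw [hX3 lam hlam, h4]
    simp only [Fintype.sum_sum_type, Sum.elim_inl, Sum.elim_inr, Fintype.sum_prod_type, h3,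
      Finset.sum_add_distrib]
    abel

end
end

section
open Pretriangulated

lemma biproduct_induction {𝒞 : Type*} (Q : ∀ {ε : Type} [Fintype ε] (_ : ε → 𝒞), Prop)
    (h0 : ∀ X : PEmpty → 𝒞, Q X)
    (he : ∀ {α β : Type} [Fintype α] [Fintype β] (e : α ≃ β) (X : β → 𝒞), Q (fun a => X (e a)) → Q X)
    (ho : ∀ {α : Type} [Fintype α] (X : Option α → 𝒞), Q (fun a => X (some a)) → Q X)
    {ε : Type} [Fintype ε] (X : ε → 𝒞) : Q X := by
  classical
  have key := Fintype.induction_empty_option (P := fun ε _ => ∀ X : ε → 𝒞, Q X)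
    (fun α β _ e h X => by
      let _ := Fintype.ofEquiv _ e.symm
      exact he e X (h _)) h0 (fun α _ h X => ho X (h _)) ε
  exact key X

section
variable {𝒞 : Type*} [Category* 𝒞] [Preadditive 𝒞] [HasZeroObject 𝒞] [HasShift 𝒞 ℤ]
  [∀ n : ℤ, (shiftFunctor 𝒞 n).Additive] [Pretriangulated 𝒞]

/-- Splitting off one summand from a biproduct. -/
def biproductOption {α : Type} [Fintype α] (X : Option α → 𝒞) :
    (X none ⊞ ⨁ fun a => X (some a)) ≅ ⨁ X where
  hom := biprod.desc (biproduct.ι X none) (biproduct.desc fun a => biproduct.ι X (some a))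
  inv := biprod.lift (biproduct.π X none) (biproduct.lift fun a => biproduct.π X (some a))
  hom_inv_id := by
    ext
    · simp
    · simp
    · simp
    · rename_i a b
      by_cases hab : a = b
      · subst hab
        simp
      · simp [hab]
  inv_hom_id := by
    rw [biprod.lift_desc, biproduct.lift_desc,
      ← Fintype.sum_option fun o => biproduct.π X o ≫ biproduct.ι X o]
    exact biproduct.total

lemma exists_dist_option {α : Type} [Fintype α] (X : Option α → 𝒞) :
    ∃ (f : X none ⟶ ⨁ X) (g : (⨁ X) ⟶ ⨁ fun a => X (some a)) (h : _ ⟶ (X none)⟦(1 : ℤ)⟧),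
      Triangle.mk f g h ∈ distTriang 𝒞 := by
  exact ⟨_, _, _, dist_of_iso (binaryBiproductTriangle_distinguished (X none) (⨁ fun a => X (some a)))
    (Iso.refl _) (biproductOption X) (Iso.refl _)⟩

/-- Classes of objects containing zero and closed under isomorphisms and extensions. -/
structure ExtClosed (P : 𝒞 → Prop) : Prop where
  iso : ∀ {X Y : 𝒞}, Nonempty (X ≅ Y) → P X → P Y
  zero : ∀ {X : 𝒞}, IsZero X → P X
  ext : ∀ {X Y Z : 𝒞} {f : X ⟶ Y} {g : Y ⟶ Z} {h : Z ⟶ X⟦(1 : ℤ)⟧},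
    Triangle.mk f g h ∈ distTriang 𝒞 → P X → P Z → P Y

lemma isZero_biproduct_pempty (X : PEmpty.{1} → 𝒞) : IsZero (⨁ X) := by
  rw [IsZero.iff_id_eq_zero]
  exact biproduct.hom_ext' _ _ fun o => o.elim

lemma ExtClosed.biproduct {P : 𝒞 → Prop} (hP : ExtClosed P) {ε : Type} [Fintype ε] (X : ε → 𝒞)
    (h : ∀ e, P (X e)) : P (⨁ X) := by
  revert h
  refine biproduct_induction (fun X => (∀ e, P (X e)) → P (⨁ X)) (fun X _ => hP.zero
    (isZero_biproduct_pempty X)) (fun e X ih h => ?_) (fun X ih h => ?_) X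
  · exact hP.iso ⟨biproduct.whiskerEquiv e fun _ => Iso.refl _⟩ (ih fun a => h (e a))
  · obtain ⟨f, g, h', hT⟩ := exists_dist_option X
    exact hP.ext hT (h none) (ih fun a => h _)

lemma IsAddFun.of_add {P : 𝒞 → Prop} (hP : ExtClosed P) {lam : 𝒞 → ℤ}
    (iso : ∀ {X Y : 𝒞}, Nonempty (X ≅ Y) → lam X = lam Y)
    (zero : ∀ {X : 𝒞}, IsZero X → lam X = 0)
    (add : ∀ {X Y Z : 𝒞} {f : X ⟶ Y} {g : Y ⟶ Z} {h : Z ⟶ X⟦(1 : ℤ)⟧},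
      Triangle.mk f g h ∈ distTriang 𝒞 → P X → P Y → P Z → lam Y = lam X + lam Z) :
    IsAddFun P lam where
  iso := iso
  add := add
  biproduct X h := by
    revert h
    refine biproduct_induction (fun X => (∀ e, P (X e)) → lam (⨁ X) = ∑ e, lam (X e))
      (fun X _ => ?_) (fun e X ih h => ?_) (fun X ih h => ?_) X
    · rw [zero (isZero_biproduct_pempty X)]
      rfl
    · rw [← e.sum_comp, ← ih fun a => h (e a)]
      exact (iso ⟨biproduct.whiskerEquiv e fun _ => Iso.refl _⟩).symm
    · obtain ⟨f, g, h', hT⟩ := exists_dist_option X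
      rw [Fintype.sum_option, ← ih fun a => h _]
      exact add hT (h none) (hP.biproduct X h) (hP.biproduct _ fun a => h _)

end
end

lemma finite_of_ker_le_range {k U V W : Type*} [Field k] [AddCommGroup U] [AddCommGroup V]
    [AddCommGroup W] [Module k U] [Module k V] [Module k W] (f : U →ₗ[k] V) (g : V →ₗ[k] W)
    (h : ∀ x, g x = 0 → ∃ y, x = f y) [Module.Finite k U] [Module.Finite k W] :
    Module.Finite k V := by
  have h1 : Module.Finite k (LinearMap.range g) := inferInstance
  have h2 : Module.Finite k (LinearMap.ker g) := by
    have : LinearMap.ker g ≤ LinearMap.range f := fun x hx => by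
      obtain ⟨y, rfl⟩ := h x hx
      exact ⟨y, rfl⟩
    exact Module.Finite.of_injective (Submodule.inclusion this) (Submodule.inclusion_injective this)
  have h3 : Module.Finite k (V ⧸ LinearMap.ker g) := Module.Finite.equiv g.quotKerEquivRange.symm
  exact Module.Finite.of_submodule_quotient (LinearMap.ker g)

section
open scoped ModuleCat
variable {k R : Type} [Field k] [Ring R] [Algebra k R] [FiniteDimensional k R]

lemma finite_moduleCat (N : RMod R) [Module.Finite R N] : Module.Finite k N :=
  Module.Finite.trans R N

lemma finite_moduleCat_hom (M N : RMod R) [Module.Finite R M] [Module.Finite R N] :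
    Module.Finite k (M ⟶ N) := by
  obtain ⟨s, hs⟩ := Module.Finite.fg_top (R := R) (M := M)
  have := finite_moduleCat (k := k) N
  let φ : (M ⟶ N) →ₗ[k] (s → N) :=
    { toFun := fun f x => f x.1
      map_add' := fun f g => rfl
      map_smul' := fun c f => by
        ext x
        rfl }
  refine Module.Finite.of_injective φ fun f g h => ?_
  ext x
  refine LinearMap.congr_fun (LinearMap.ext_on hs (f := f.hom) (g := g.hom) fun x hx => ?_) x
  exact congrFun h ⟨x, hx⟩
end

section
open Pretriangulated
variable {𝒞 : Type*} [Category* 𝒞] [Preadditive 𝒞] [HasZeroObject 𝒞] [HasShift 𝒞 ℤ]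
  [∀ n : ℤ, (shiftFunctor 𝒞 n).Additive] [Pretriangulated 𝒞] {k : Type*} [Field k] [Linear k 𝒞]

lemma finite_hom_of_dist_left {X Y Z W : 𝒞} {f : X ⟶ Y} {g : Y ⟶ Z} {h : Z ⟶ X⟦(1 : ℤ)⟧}
    (hT : Triangle.mk f g h ∈ distTriang 𝒞) [Module.Finite k (X ⟶ W)] [Module.Finite k (Z ⟶ W)] :
    Module.Finite k (Y ⟶ W) :=
  finite_of_ker_le_range (Linear.leftComp k W g) (Linear.leftComp k W f) fun x hx =>
    dist_yo₂ hT x hx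

lemma finite_hom_of_dist_right {X Y Z W : 𝒞} {f : X ⟶ Y} {g : Y ⟶ Z} {h : Z ⟶ X⟦(1 : ℤ)⟧}
    (hT : Triangle.mk f g h ∈ distTriang 𝒞) [Module.Finite k (W ⟶ X)] [Module.Finite k (W ⟶ Z)] :
    Module.Finite k (W ⟶ Y) :=
  finite_of_ker_le_range (Linear.rightComp k W f) (Linear.rightComp k W g) fun x hx =>
    dist_co₂ hT x hx

omit [HasZeroObject 𝒞] [∀ n : ℤ, (shiftFunctor 𝒞 n).Additive] [HasShift 𝒞 ℤ] [Pretriangulated 𝒞] in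
lemma finite_hom_of_isZero_left {X W : 𝒞} (hX : IsZero X) : Module.Finite k (X ⟶ W) :=
  have : Subsingleton (X ⟶ W) := ⟨fun _ _ => hX.eq_of_src _ _⟩
  inferInstance

omit [HasZeroObject 𝒞] [∀ n : ℤ, (shiftFunctor 𝒞 n).Additive] [HasShift 𝒞 ℤ] [Pretriangulated 𝒞] in
lemma finite_hom_of_isZero_right {X W : 𝒞} (hX : IsZero W) : Module.Finite k (X ⟶ W) :=
  have : Subsingleton (X ⟶ W) := ⟨fun _ _ => hX.eq_of_tgt _ _⟩
  inferInstance

end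

section
open DerivedCategory Pretriangulated
variable {k R : Type} [Field k] [Ring R] [Algebra k R] [HasDMod R]
  {ι : Type} {D : ProjData k R ι}

lemma finite_sg_hom_sg [FiniteDimensional k R] (P M : RMod R) [Projective P]
    [Module.Finite R P] [Module.Finite R M] (m n : ℤ) : Module.Finite k (sg m P ⟶ sg n M) := by
  rcases eq_or_ne m n with h | h
  · subst h
    have := finite_moduleCat_hom (k := k) P M
    refine Module.Finite.of_surjective ((singleFunctor (ModuleCat R) m).mapLinearMap k) ?_
    exact (singleFunctor (ModuleCat R) m).map_surjective
  · have : Subsingleton (sg m P ⟶ sg n M) :=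
      ⟨fun f g => (sg_hom_eq_zero_of_ne P h M f).trans (sg_hom_eq_zero_of_ne P h M g).symm⟩
    infer_instance

omit [HasDMod R] in
lemma ProjData.finite_L (D : ProjData k R ι) (l : ι) : Module.Finite R (D.L l) :=
  have := D.fin l
  Module.Finite.of_surjective (D.p l).hom (D.p_surj l)

lemma Built.finite_hom [FiniteDimensional k R] {a b : ℤ} {X : DMod R}
    (hX : Built D a b X) (M : RMod R) [Module.Finite R M] (n : ℤ) :
    Module.Finite k (X ⟶ sg n M) := by
  induction hX with
  | zero Z h => exact finite_hom_of_isZero_left h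
  | step s l X Y f g h hT _ _ _ ih =>
    have := D.proj l
    have := D.fin l
    have := finite_sg_hom_sg (k := k) (D.P l) M s n
    exact finite_hom_of_dist_left hT

lemma Built.finite_hom_built [FiniteDimensional k R] {a b a' b' : ℤ}
    {X Y : DMod R} (hX : Built D a b X) (hY : Built D a' b' Y) :
    Module.Finite k (X ⟶ Y) := by
  induction hY with
  | zero Z h => exact finite_hom_of_isZero_right h
  | step s l X Y f g h hT _ _ _ ih =>
    have := D.fin l
    have := hX.finite_hom (D.P l) s
    exact finite_hom_of_dist_right hT

variable [FiniteDimensional k R]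

lemma Built.iff_isLE {a b : ℤ} {Z : DMod R} :
    Built D a b Z ↔ IsCpt Z ∧ Z.IsLE b ∧ ∀ s l, s < a → ∀ u : Z ⟶ sg s (D.L l), u = 0 :=
  ⟨fun h => ⟨h.isCpt, h.isLE, fun s _ hs u => h.hom_eq_zero
      (TStructure.t.isLE_of_le (sg s _) s (a - 1)) u⟩,
    fun h => built_of_isLE D a h.1 h.2.1 h.2.2⟩

lemma extClosed_built (D : ProjData k R ι) (a b : ℤ) : ExtClosed (Built D a b) where
  iso := fun ⟨e⟩ hX => by
    obtain ⟨h1, h2, h3⟩ := Built.iff_isLE.1 hX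
    refine Built.iff_isLE.2 ⟨h1.of_iso e, TStructure.t.isLE_of_iso e b, fun s l hs u => ?_⟩
    exact (cancel_epi e.hom).1 ((h3 s l hs _).trans comp_zero.symm)
  zero hX := .zero _ hX
  ext hT hX hZ := by
    obtain ⟨h1, h2, h3⟩ := Built.iff_isLE.1 hX
    obtain ⟨h1', h2', h3'⟩ := Built.iff_isLE.1 hZ
    refine Built.iff_isLE.2 ⟨IsCpt.cone (inv_rot_of_distTriang _ hT) (h1'.shift (-1)) h1,
      isLE_obj₂ hT b h2 h2', fun s l hs u => ?_⟩
    obtain ⟨y, rfl⟩ := dist_yo₂ hT u (h3 s l hs _)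
    rw [h3' s l hs y, comp_zero]

/-- The mutation context of two-term complexes of projectives. -/
def mutCtx (D : ProjData k R ι) : MutCtx k (DMod R) ι where
  Tw := Built D (-1) 0
  tw_iso := (extClosed_built D (-1) 0).iso
  L l := sg (-1) (D.L l)
  tw_hom {X Y} hX hY f := by
    have h1 := hY.isLE
    have h2 : (Y⟦(1 : ℤ)⟧).IsLE (-1) := TStructure.t.isLE_shift Y 0 1 (-1)
    exact hX.hom_eq_zero (TStructure.t.isLE_shift (Y⟦(1 : ℤ)⟧) (-1) 1 (-2)) f
  tw_biproduct X h := (extClosed_built D (-1) 0).biproduct X h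
  tw_cone {X Y Z f g h} hT hX hY hfac := by
    have hY1 := Built.iff_isLE.1 hY
    refine Built.iff_isLE.2 ⟨IsCpt.cone hT hX.isCpt hY.isCpt, isLE_obj₃ hT 0
      (have := hX.isLE; TStructure.t.isLE_of_le X 0 1) hY.isLE, fun s l hs u => ?_⟩
    obtain ⟨v, rfl⟩ := dist_yo₃ hT u (hY1.2.2 s l hs _)
    let e := ((singleFunctors (RMod R)).shiftIso 1 s (s + 1) (by omega)).app (D.L l)
    obtain ⟨x, hx⟩ : ∃ x : X ⟶ sg (s + 1) (D.L l), x⟦(1 : ℤ)⟧' = v ≫ e.inv :=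
      (shiftFunctor (DMod R) (1 : ℤ)).map_surjective _
    have hx' : v = x⟦(1 : ℤ)⟧' ≫ e.hom := by
      rw [hx]
      simp
    obtain ⟨y, hy⟩ : ∃ y : Y ⟶ sg (s + 1) (D.L l), x = f ≫ y := by
      obtain hs' | rfl : s + 1 < -1 ∨ s = -2 := by omega
      · exact ⟨0, by rw [comp_zero]; exact (Built.iff_isLE.1 hX).2.2 _ l hs' x⟩
      · exact hfac l x
    rw [hx', hy, Functor.map_comp, Category.assoc, ← Category.assoc, dist_comp₃₁ hT, zero_comp]
  finite_hom hX hY := hX.finite_hom_built hY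
  finite_hom_L l hX := have := D.finite_L l; hX.finite_hom _ _

end

section
variable {k : Type*} [Field k]

/-- The alternating sum of dimensions. -/
def altSum (a : ℤ → ℤ) : ℤ := ∑ᶠ s : ℤ, (s.negOnePow : ℤ) * a s

lemma altSum_shift (d : ℤ → ℤ) : altSum (fun s => d (s - 1)) = - altSum d := by
  unfold altSum
  rw [← finsum_comp_equiv (Equiv.addRight (1 : ℤ)), ← finsum_neg_distrib]
  refine finsum_congr fun s => ?_
  simp [Int.negOnePow_succ]

lemma altSum_add {a b : ℤ → ℤ} (ha : a.support.Finite) (hb : b.support.Finite) :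
    altSum (fun s => a s + b s) = altSum a + altSum b := by
  unfold altSum
  rw [← finsum_add_distrib (ha.subset fun s => by simp) (hb.subset fun s => by simp)]
  simp [mul_add]

variable {A B C : ℤ → Type*} [∀ s, AddCommGroup (A s)] [∀ s, AddCommGroup (B s)]
  [∀ s, AddCommGroup (C s)] [∀ s, Module k (A s)] [∀ s, Module k (B s)] [∀ s, Module k (C s)]

/-- Finite dimensionality of a graded vector space. -/
def GrFin (k : Type*) [Field k] (A : ℤ → Type*) [∀ s, AddCommGroup (A s)] [∀ s, Module k (A s)] :
    Prop :=
  (∀ s, Module.Finite k (A s)) ∧ {s | Nontrivial (A s)}.Finite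

lemma GrFin.support {A : ℤ → Type*} [∀ s, AddCommGroup (A s)] [∀ s, Module k (A s)]
    (h : GrFin k A) (a : ℤ → ℕ) (ha : ∀ s, a s ≤ Module.finrank k (A s)) :
    (fun s => (a s : ℤ)).support.Finite := by
  refine h.2.subset fun s hs => ?_
  by_contra h1
  have : Subsingleton (A s) := not_nontrivial_iff_subsingleton.1 h1
  have h2 := ha s
  rw [Module.finrank_zero_of_subsingleton] at h2
  exact hs (by simpa using h2)

lemma GrFin.mid (f : ∀ s, A s →ₗ[k] B s) (g : ∀ s, B s →ₗ[k] C s)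
    (hg : ∀ s x, g s x = 0 → ∃ y, x = f s y) (hA : GrFin k A) (hC : GrFin k C) : GrFin k B := by
  refine ⟨fun s => ?_, (hA.2.union hC.2).subset fun s hs => ?_⟩
  · have := hA.1 s
    have := hC.1 s
    exact finite_of_ker_le_range (f s) (g s) (hg s)
  · by_contra h1
    rw [Set.mem_union, not_or] at h1
    have h2 : Subsingleton (A s) := not_nontrivial_iff_subsingleton.1 h1.1
    have h3 : Subsingleton (C s) := not_nontrivial_iff_subsingleton.1 h1.2
    refine not_nontrivial_iff_subsingleton.2 ⟨fun x y => ?_⟩ hs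
    obtain ⟨u, rfl⟩ := hg s x (Subsingleton.elim _ _)
    obtain ⟨v, rfl⟩ := hg s y (Subsingleton.elim _ _)
    rw [Subsingleton.elim u v]

lemma finrank_eq_of_exact {U V W : Type*} [AddCommGroup U] [AddCommGroup V] [AddCommGroup W]
    [Module k U] [Module k V] [Module k W] [Module.Finite k V] (f : U →ₗ[k] V) (g : V →ₗ[k] W)
    (hfg : ∀ x, g (f x) = 0) (h : ∀ x, g x = 0 → ∃ y, x = f y) : Module.finrank k V =
      Module.finrank k (LinearMap.range f) + Module.finrank k (LinearMap.range g) := by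
  have h1 : LinearMap.ker g = LinearMap.range f := by
    ext x
    constructor
    · intro hx
      obtain ⟨y, rfl⟩ := h x hx
      exact ⟨y, rfl⟩
    · rintro ⟨y, rfl⟩
      exact hfg y
  rw [← h1, add_comm, LinearMap.finrank_range_add_finrank_ker]

lemma altSum_exact (f : ∀ s, A s →ₗ[k] B s) (g : ∀ s, B s →ₗ[k] C s)
    (d : ∀ s, C s →ₗ[k] A (s + 1)) (hfg : ∀ s x, g s (f s x) = 0) (hgd : ∀ s x, d s (g s x) = 0)
    (hdf : ∀ s x, f (s + 1) (d s x) = 0) (hg : ∀ s x, g s x = 0 → ∃ y, x = f s y)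
    (hd : ∀ s x, d s x = 0 → ∃ y, x = g s y) (hf : ∀ s x, f (s + 1) x = 0 → ∃ y, x = d s y)
    (hA : GrFin k A) (hC : GrFin k C) :
    altSum (fun s => Module.finrank k (B s)) =
      altSum (fun s => Module.finrank k (A s)) + altSum (fun s => Module.finrank k (C s)) := by
  have hB := GrFin.mid f g hg hA hC
  have iA := hA.1
  have iB := hB.1
  have iC := hC.1
  have h1 : ∀ s, Module.finrank k (B s) = Module.finrank k (LinearMap.range (f s)) +
    Module.finrank k (LinearMap.range (g s)) := fun s =>
      finrank_eq_of_exact (f s) (g s) (hfg s) (hg s)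
  have h2 : ∀ s, Module.finrank k (C s) = Module.finrank k (LinearMap.range (g s)) +
    Module.finrank k (LinearMap.range (d s)) := fun s =>
      finrank_eq_of_exact (g s) (d s) (hgd s) (hd s)
  have h3 : ∀ s, Module.finrank k (A s) = Module.finrank k (LinearMap.range (d (s - 1))) +
      Module.finrank k (LinearMap.range (f s)) := fun s => by
    obtain ⟨t, rfl⟩ : ∃ t, s = t + 1 := ⟨s - 1, by ring⟩
    have := finrank_eq_of_exact (d t) (f (t + 1)) (hdf t) (hf t)
    rw [this, show t + 1 - 1 = t by ring]
  have sf := hA.support (fun s => Module.finrank k (LinearMap.range (f s))) fun s => by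
    rw [h3]
    exact Nat.le_add_left _ _
  have sg := hC.support (fun s => Module.finrank k (LinearMap.range (g s))) fun s => by
    rw [h2]
    exact Nat.le_add_right _ _
  have sd := hC.support (fun s => Module.finrank k (LinearMap.range (d s))) fun s => by
    rw [h2]
    exact Nat.le_add_left _ _
  have sd' := hA.support (fun s => Module.finrank k (LinearMap.range (d (s - 1)))) fun s => by
    rw [h3]
    exact Nat.le_add_right _ _
  have e1 := altSum_add sf sg
  have e2 := altSum_add sg sd
  have e3 := altSum_add sd' sf
  have e4 := altSum_shift fun s => (Module.finrank k (LinearMap.range (d s)) : ℤ)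
  simp only [h1, h2, h3, Nat.cast_add]
  rw [e1, e2, e3]
  have e5 : altSum (fun s => (Module.finrank k (LinearMap.range (d (s - 1))) : ℤ)) =
    - altSum fun s => (Module.finrank k (LinearMap.range (d s)) : ℤ) := e4
  rw [e5]
  ring

end

section
open Pretriangulated
variable {𝒞 : Type*} [Category* 𝒞] [Preadditive 𝒞] [HasZeroObject 𝒞] [HasShift 𝒞 ℤ]
  [∀ n : ℤ, (shiftFunctor 𝒞 n).Additive] [Pretriangulated 𝒞] {k : Type*} [Field k] [Linear k 𝒞]

/-- The Euler form. -/
def euler (k : Type*) [Field k] [Linear k 𝒞] (X W : 𝒞) : ℤ :=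
  altSum fun s => Module.finrank k (X ⟶ W⟦s⟧)

/-- Finite dimensionality of the total graded morphism space. -/
def HomFin (k : Type*) [Field k] [Linear k 𝒞] (X W : 𝒞) : Prop :=
  GrFin k fun s : ℤ => X ⟶ W⟦s⟧

variable {X Y Z W : 𝒞} {f : X ⟶ Y} {g : Y ⟶ Z} {h : Z ⟶ X⟦(1 : ℤ)⟧}

lemma HomFin.dist_left (hT : Triangle.mk f g h ∈ distTriang 𝒞) (hX : HomFin k X W)
    (hZ : HomFin k Z W) : HomFin k Y W :=
  GrFin.mid (fun s => Linear.leftComp k (W⟦s⟧) g) (fun s => Linear.leftComp k (W⟦s⟧) f)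
    (fun _ x hx => dist_yo₂ hT x hx) hZ hX

lemma euler_dist_left [∀ n : ℤ, (shiftFunctor 𝒞 n).Linear k] (hT : Triangle.mk f g h ∈ distTriang 𝒞) (hX : HomFin k X W)
    (hZ : HomFin k Z W) : euler k Y W = euler k X W + euler k Z W := by
  rw [add_comm]
  let e (s : ℤ) : W⟦s + 1⟧ ≅ W⟦s⟧⟦(1 : ℤ)⟧ := (shiftFunctorAdd 𝒞 s 1).app W
  refine altSum_exact (fun s => Linear.leftComp k (W⟦s⟧) g) (fun s => Linear.leftComp k (W⟦s⟧) f)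
    (fun s => Linear.rightComp k Z (e s).inv ∘ₗ Linear.leftComp k _ h ∘ₗ
      (shiftFunctor 𝒞 (1 : ℤ)).mapLinearMap k) (fun s x => ?_) (fun s x => ?_) (fun s x => ?_)
    (fun _ x hx => dist_yo₂ hT x hx) (fun s x hx => ?_) (fun s x hx => ?_) hZ hX
  · change f ≫ g ≫ x = 0
    rw [← Category.assoc, dist_comp₁₂ hT, zero_comp]
  · change (h ≫ (f ≫ x)⟦(1 : ℤ)⟧') ≫ (e s).inv = 0
    rw [Functor.map_comp, ← Category.assoc h, dist_comp₃₁ hT, zero_comp, zero_comp]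
  · change g ≫ (h ≫ x⟦(1 : ℤ)⟧') ≫ (e s).inv = 0
    rw [Category.assoc, ← Category.assoc g, dist_comp₂₃ hT, zero_comp]
  · have hx' : (h ≫ x⟦(1 : ℤ)⟧') ≫ (e s).inv = 0 := hx
    obtain ⟨v, hv⟩ := dist_yo₁ hT (x⟦(1 : ℤ)⟧')
      ((cancel_mono (e s).inv).1 (hx'.trans zero_comp.symm))
    obtain ⟨y, rfl⟩ := (shiftFunctor 𝒞 (1 : ℤ)).map_surjective v
    refine ⟨y, (shiftFunctor 𝒞 (1 : ℤ)).map_injective ?_⟩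
    exact hv.trans (Functor.map_comp _ _ _).symm
  · obtain ⟨v, rfl⟩ := dist_yo₃ hT x hx
    obtain ⟨y, hy⟩ := (shiftFunctor 𝒞 (1 : ℤ)).map_surjective (v ≫ (e s).hom)
    refine ⟨y, ?_⟩
    change h ≫ v = (h ≫ y⟦(1 : ℤ)⟧') ≫ (e s).inv
    rw [hy]
    simp

lemma dist_shift (hT : Triangle.mk f g h ∈ distTriang 𝒞) (s : ℤ) :
    ∃ h' : Z⟦s⟧ ⟶ X⟦s⟧⟦(1 : ℤ)⟧, Triangle.mk (f⟦s⟧') (g⟦s⟧') h' ∈ distTriang 𝒞 := by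
  have h1 := Triangle.shift_distinguished _ hT s
  refine ⟨s.negOnePow • (h⟦s⟧' ≫ (shiftFunctorComm 𝒞 1 s).hom.app X), ?_⟩
  refine isomorphic_distinguished _ h1 _ ?_
  refine Triangle.isoMk _ _ (Iso.refl _) (s.negOnePow • Iso.refl _) (Iso.refl _) ?_ ?_ ?_
  · change f⟦s⟧' ≫ (s.negOnePow • 𝟙 _) = 𝟙 _ ≫ (s.negOnePow • f⟦s⟧')
    simp
  · change g⟦s⟧' ≫ 𝟙 _ = (s.negOnePow • 𝟙 _) ≫ (s.negOnePow • g⟦s⟧')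
    simp [smul_smul]
  · change (s.negOnePow • (h⟦s⟧' ≫ (shiftFunctorComm 𝒞 1 s).hom.app X)) ≫ (𝟙 _)⟦(1 : ℤ)⟧' =
      𝟙 _ ≫ (s.negOnePow • (h⟦s⟧' ≫ (shiftFunctorComm 𝒞 1 s).hom.app X))
    simp

lemma HomFin.dist_right (hT : Triangle.mk f g h ∈ distTriang 𝒞) (hX : HomFin k W X)
    (hZ : HomFin k W Z) : HomFin k W Y :=
  GrFin.mid (fun s => Linear.rightComp k W (f⟦s⟧')) (fun s => Linear.rightComp k W (g⟦s⟧'))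
    (fun s x hx => (dist_shift hT s).elim fun _ hT' => dist_co₂ hT' x hx) hX hZ

lemma euler_dist_right (hT : Triangle.mk f g h ∈ distTriang 𝒞) (hX : HomFin k W X)
    (hZ : HomFin k W Z) : euler k W Y = euler k W X + euler k W Z := by
  choose h' hT' using dist_shift hT
  let e (V : 𝒞) (s : ℤ) : V⟦s + 1⟧ ≅ V⟦s⟧⟦(1 : ℤ)⟧ := (shiftFunctorAdd 𝒞 s 1).app V
  have hef (s : ℤ) : f⟦s + 1⟧' ≫ (e Y s).hom = (e X s).hom ≫ f⟦s⟧'⟦(1 : ℤ)⟧' :=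
    (shiftFunctorAdd 𝒞 s 1).hom.naturality f
  have hef' (s : ℤ) : (e X s).inv ≫ f⟦s + 1⟧' = f⟦s⟧'⟦(1 : ℤ)⟧' ≫ (e Y s).inv :=
    ((shiftFunctorAdd 𝒞 s 1).inv.naturality f).symm
  refine altSum_exact (fun s => Linear.rightComp k W (f⟦s⟧'))
    (fun s => Linear.rightComp k W (g⟦s⟧'))
    (fun s => Linear.rightComp k W (h' s ≫ (e X s).inv)) (fun s x => ?_) (fun s x => ?_)
    (fun s x => ?_) (fun s x hx => dist_co₂ (hT' s) x hx) (fun s x hx => ?_) (fun s x hx => ?_)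
    hX hZ
  · change (x ≫ f⟦s⟧') ≫ g⟦s⟧' = 0
    rw [Category.assoc, dist_comp₁₂ (hT' s), comp_zero]
  · change (x ≫ g⟦s⟧') ≫ h' s ≫ (e X s).inv = 0
    rw [Category.assoc, ← Category.assoc _ (h' s), dist_comp₂₃ (hT' s), zero_comp, comp_zero]
  · change (x ≫ h' s ≫ (e X s).inv) ≫ f⟦s + 1⟧' = 0
    rw [Category.assoc, Category.assoc, hef', ← Category.assoc (h' s), dist_comp₃₁ (hT' s),
      zero_comp, comp_zero]
  · have hx' : x ≫ h' s ≫ (e X s).inv = 0 := hx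
    rw [← Category.assoc] at hx'
    exact dist_co₃ (hT' s) x ((cancel_mono (e X s).inv).1 (hx'.trans zero_comp.symm))
  · have hx' : x ≫ f⟦s + 1⟧' = 0 := hx
    obtain ⟨v, hv⟩ := dist_co₁ (hT' s) (x ≫ (e X s).hom) (by
      rw [Category.assoc, ← hef, ← Category.assoc, hx', zero_comp])
    refine ⟨v, ?_⟩
    change x = v ≫ h' s ≫ (e X s).inv
    rw [← Category.assoc, ← hv]
    simp

end

section
open Pretriangulated ZeroObject
variable {𝒞 : Type*} [Category* 𝒞] [Preadditive 𝒞] [HasZeroObject 𝒞] [HasShift 𝒞 ℤ]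
  [∀ n : ℤ, (shiftFunctor 𝒞 n).Additive] [Pretriangulated 𝒞]

lemma IsAddFun.mono {P P' : 𝒞 → Prop} {lam : 𝒞 → ℤ} (h : IsAddFun P lam) (hP : ∀ X, P' X → P X) :
    IsAddFun P' lam where
  iso := h.iso
  biproduct X hX := h.biproduct X fun e => hP _ (hX e)
  add hT hX hY hZ := h.add hT (hP _ hX) (hP _ hY) (hP _ hZ)

lemma IsAddFun.zero {P : 𝒞 → Prop} {lam : 𝒞 → ℤ} (h : IsAddFun P lam) {X : 𝒞} (hX : IsZero X) :
    lam X = 0 := by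
  let Y : PEmpty.{1} → 𝒞 := fun _ => X
  rw [h.iso ⟨hX.iso (isZero_biproduct_pempty Y)⟩, h.biproduct Y fun o => o.elim]
  rfl

lemma IsAddFun.shift {P : 𝒞 → Prop} {lam : 𝒞 → ℤ} (h : IsAddFun P lam) {X : 𝒞} (h0 : P X)
    (h1 : P (X⟦(1 : ℤ)⟧)) (hz : ∀ Z, IsZero Z → P Z) : lam (X⟦(1 : ℤ)⟧) = - lam X := by
  have hT := rot_of_distTriang _ (contractible_distinguished X)
  have h2 := h.zero (isZero_zero 𝒞)
  have h3 := h.add hT h0 (hz _ (isZero_zero 𝒞)) h1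
  have h4 : lam (0 : 𝒞) = lam X + lam (X⟦(1 : ℤ)⟧) := h3
  linarith

variable {k : Type*} [Field k] [Linear k 𝒞]

lemma HomFin.of_isZero_left {X W : 𝒞} (hX : IsZero X) : HomFin k X W := by
  have h (s : ℤ) : Subsingleton (X ⟶ W⟦s⟧) := ⟨fun _ _ => hX.eq_of_src _ _⟩
  exact ⟨fun s => inferInstance, by simp [not_nontrivial]⟩

lemma HomFin.of_isZero_right {X W : 𝒞} (hW : IsZero W) : HomFin k X W := by
  have h (s : ℤ) : Subsingleton (X ⟶ W⟦s⟧) :=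
    ⟨fun _ _ => ((shiftFunctor 𝒞 s).map_isZero hW).eq_of_tgt _ _⟩
  exact ⟨fun s => inferInstance, by simp [not_nontrivial]⟩

lemma euler_eq_zero_of_subsingleton {X W : 𝒞} (h : ∀ s : ℤ, Subsingleton (X ⟶ W⟦s⟧)) :
    euler k X W = 0 := by
  unfold euler altSum
  refine (finsum_congr fun s => ?_).trans finsum_zero
  change _ * ((Module.finrank k (X ⟶ W⟦s⟧) : ℕ) : ℤ) = 0
  rw [Module.finrank_zero_of_subsingleton]
  simp

lemma euler_of_isZero_left {X W : 𝒞} (hX : IsZero X) : euler k X W = 0 :=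
  euler_eq_zero_of_subsingleton fun _ => ⟨fun _ _ => hX.eq_of_src _ _⟩

lemma euler_of_isZero_right {X W : 𝒞} (hW : IsZero W) : euler k X W = 0 :=
  euler_eq_zero_of_subsingleton fun s =>
    ⟨fun _ _ => ((shiftFunctor 𝒞 s).map_isZero hW).eq_of_tgt _ _⟩

lemma euler_iso_left {X Y W : 𝒞} (e : X ≅ Y) : euler k X W = euler k Y W := by
  unfold euler
  congr 1
  ext s
  rw [(Linear.homCongr k e (Iso.refl (W⟦s⟧))).finrank_eq]

lemma euler_eq_single {X W : 𝒞} (n : ℤ) (h : ∀ s, s ≠ n → Subsingleton (X ⟶ W⟦s⟧)) :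
    euler k X W = n.negOnePow * Module.finrank k (X ⟶ W⟦n⟧) := by
  unfold euler altSum
  refine finsum_eq_single _ n fun s hs => ?_
  have := h s hs
  change _ * ((Module.finrank k (X ⟶ W⟦s⟧) : ℕ) : ℤ) = 0
  rw [Module.finrank_zero_of_subsingleton]
  simp

end

section
open DerivedCategory Pretriangulated ZeroObject
variable {k R : Type} [Field k] [Ring R] [Algebra k R] [HasDMod R]
  {ι : Type} {D : ProjData k R ι}

/-- Shifting a module placed in one degree. -/
def sgShift (M : RMod R) (n s m : ℤ) (h : s + m = n) : (sg n M)⟦s⟧ ≅ sg m M :=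
  ((singleFunctors (RMod R)).shiftIso s m n h).app M

lemma subsingleton_sg_hom (P M : RMod R) [Projective P] (m n : ℤ) (h : m ≠ n) :
    Subsingleton (sg m P ⟶ sg n M) :=
  ⟨fun f g => (sg_hom_eq_zero_of_ne P h M f).trans (sg_hom_eq_zero_of_ne P h M g).symm⟩

lemma subsingleton_sg_hom_shift (P M : RMod R) [Projective P] (m n s : ℤ)
    (h : s ≠ n - m) : Subsingleton (sg m P ⟶ (sg n M)⟦s⟧) := by
  have := subsingleton_sg_hom P M m (n - s) (by omega)
  exact (Linear.homCongr ℤ (Iso.refl (sg m P)) (sgShift M n s (n - s) (by ring))).toEquiv.subsingleton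

lemma finrank_sg_hom (P M : RMod R) (n : ℤ) :
    Module.finrank k (sg n P ⟶ sg n M) = Module.finrank k (P ⟶ M) := by
  refine (LinearEquiv.finrank_eq (LinearEquiv.ofBijective
    ((singleFunctor (ModuleCat R) n).mapLinearMap k) ?_)).symm
  exact ⟨(singleFunctor (ModuleCat R) n).map_injective, (singleFunctor (ModuleCat R) n).map_surjective⟩

lemma euler_sg_sg (P M : RMod R) [Projective P] (n : ℤ) :
    euler k (sg 0 P) (sg n M) = n.negOnePow * Module.finrank k (P ⟶ M) := by
  rw [euler_eq_single n fun s hs => subsingleton_sg_hom_shift P M 0 n s (by omega),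
    (Linear.homCongr k (Iso.refl (sg 0 P)) (sgShift M n n 0 (by ring))).finrank_eq, finrank_sg_hom]

variable [FiniteDimensional k R]

lemma homFin_sg_sg (P M : RMod R) [Projective P] [Module.Finite R P] [Module.Finite R M]
    (m n : ℤ) : HomFin k (sg m P) (sg n M) := by
  refine ⟨fun s => ?_, (Set.finite_singleton (n - m)).subset fun s hs => ?_⟩
  · have := finite_sg_hom_sg (k := k) P M m (n - s)
    exact Module.Finite.equiv
      (Linear.homCongr k (Iso.refl (sg m P)) (sgShift M n s (n - s) (by ring))).symm
  · by_contra h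
    have h1 := subsingleton_sg_hom_shift P M m n s h
    exact not_nontrivial_iff_subsingleton.2 h1 hs

lemma Built.homFin_sg {a b : ℤ} {X : DMod R} (hX : Built D a b X)
    (M : RMod R) [Module.Finite R M] (n : ℤ) : HomFin k X (sg n M) := by
  induction hX with
  | zero Z h => exact HomFin.of_isZero_left h
  | step s l X Y f g h hT _ _ _ ih =>
    have := D.proj l
    have := D.fin l
    exact HomFin.dist_left hT (homFin_sg_sg (D.P l) M s n) ih

lemma Built.homFin {a b a' b' : ℤ} {X Y : DMod R}
    (hX : Built D a b X) (hY : Built D a' b' Y) : HomFin k X Y := by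
  induction hY with
  | zero Z h => exact HomFin.of_isZero_right h
  | step s l X Y f g h hT _ _ _ ih =>
    have := D.fin l
    exact HomFin.dist_right hT (hX.homFin_sg (D.P l) s) ih

omit [FiniteDimensional k R] in
lemma isCpt_P (D : ProjData k R ι) (l : ι) (s : ℤ) : IsCpt (sg s (D.P l)) :=
  have := D.proj l
  have := D.fin l
  isCpt_single (D.P l) s

omit [FiniteDimensional k R] in
lemma built_sg (D : ProjData k R ι) (l : ι) (s : ℤ) : Built D s s (sg s (D.P l)) :=
  .step s l _ 0 (𝟙 _) 0 0 (contractible_distinguished _) le_rfl le_rfl (.zero 0 (isZero_zero _))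

lemma Built.sum_euler_eq_zero [Fintype ι] (δ : ι → ℤ)
    (hδ : ∀ j, ∑ v, δ v * Module.finrank k (D.P v ⟶ D.P j) = 0) {a b : ℤ}
    {W : DMod R} (hW : Built D a b W) :
    ∑ v, δ v * euler k (sg 0 (D.P v)) W = 0 := by
  induction hW with
  | zero Z h => exact Finset.sum_eq_zero fun v _ => by rw [euler_of_isZero_right h, mul_zero]
  | step s l X Y f g h hT _ _ hY ih =>
    have h1 : ∀ v, euler k (sg 0 (D.P v)) X =
        s.negOnePow * Module.finrank k (D.P v ⟶ D.P l) + euler k (sg 0 (D.P v)) Y := fun v => by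
      have := D.proj v
      have := D.fin l
      rw [euler_dist_right hT ((built_sg D v 0).homFin_sg (D.P l) s) ((built_sg D v 0).homFin hY),
        euler_sg_sg]
    have h2 : ∑ v, δ v * ((s.negOnePow : ℤ) * Module.finrank k (D.P v ⟶ D.P l)) = 0 := by
      have := congrArg (fun x => (s.negOnePow : ℤ) * x) (hδ l)
      simp only [mul_zero, Finset.mul_sum] at this
      rw [← this]
      exact Finset.sum_congr rfl fun v _ => by ring
    simp only [h1, mul_add, Finset.sum_add_distrib, h2, ih, add_zero]

omit [FiniteDimensional k R] in
lemma isCpt_of_isZero {Z : DMod R} (h : IsZero Z) : IsCpt Z :=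
  fun _ _ _ _ _ => ⟨∅, fun _ => 0, h.eq_of_src _ _⟩

omit [FiniteDimensional k R] in
lemma IsAddFun.sg_pred {lam : DMod R → ℤ} (h : IsAddFun IsCpt lam)
    (D : ProjData k R ι) (l : ι) (s : ℤ) : lam (sg (s - 1) (D.P l)) = - lam (sg s (D.P l)) := by
  rw [← h.shift (isCpt_P D l s) ((isCpt_P D l s).shift 1) fun _ => isCpt_of_isZero]
  exact h.iso ⟨(sgShift (D.P l) s 1 (s - 1) (by ring)).symm⟩

omit [FiniteDimensional k R] in
lemma IsAddFun.sg {lam : DMod R → ℤ} (h : IsAddFun IsCpt lam)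
    (D : ProjData k R ι) (l : ι) (s : ℤ) :
    lam (sg s (D.P l)) = s.negOnePow * lam (sg 0 (D.P l)) := by
  induction s using Int.induction_on with
  | zero => simp
  | succ i ih =>
    have := h.sg_pred D l (i + 1)
    rw [add_sub_cancel_right] at this
    rw [Int.negOnePow_succ, Units.val_neg, neg_mul, ← ih, this, neg_neg]
  | pred i ih =>
    rw [h.sg_pred, ih, Int.negOnePow_sub]
    simp

omit [FiniteDimensional k R] in
/-- The class of a perfect complex in the Grothendieck group. -/
lemma Built.exists_class [Fintype ι] {a b : ℤ} {X : DMod R}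
    (hX : Built D a b X) : ∃ n : ι → ℤ, ∀ lam : DMod R → ℤ,
      IsAddFun IsCpt lam → lam X = ∑ l, n l * lam (sg 0 (D.P l)) := by
  classical
  induction hX with
  | zero Z h => exact ⟨0, fun lam hl => by simp [hl.zero h]⟩
  | step s l X Y f g h hT _ _ hY ih =>
    obtain ⟨n, hn⟩ := ih
    refine ⟨n + Pi.single l (s.negOnePow : ℤ), fun lam hl => ?_⟩
    have h1 : IsCpt X := IsCpt.cone (inv_rot_of_distTriang _ hT) (hY.isCpt.shift (-1)) (isCpt_P D l s)
    rw [hl.add hT (isCpt_P D l s) h1 hY.isCpt, hn lam hl, hl.sg D l s]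
    simp [add_mul, Finset.sum_add_distrib, Pi.single_apply, add_comm]

end

section
open Pretriangulated
variable {𝒞 𝒟 : Type*} [Category* 𝒞] [Preadditive 𝒞] [HasZeroObject 𝒞] [HasShift 𝒞 ℤ]
  [∀ n : ℤ, (shiftFunctor 𝒞 n).Additive] [Pretriangulated 𝒞]
  [Category* 𝒟] [Preadditive 𝒟] [HasZeroObject 𝒟] [HasShift 𝒟 ℤ]
  [∀ n : ℤ, (shiftFunctor 𝒟 n).Additive] [Pretriangulated 𝒟]

lemma dist_map (G : 𝒞 ⥤ 𝒟) [G.CommShift ℤ] [G.IsTriangulated] {X Y Z : 𝒞} {f : X ⟶ Y}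
    {g : Y ⟶ Z} {h : Z ⟶ X⟦(1 : ℤ)⟧} (hT : Triangle.mk f g h ∈ distTriang 𝒞) :
    Triangle.mk (G.map f) (G.map g) (G.map h ≫ (G.commShiftIso (1 : ℤ)).hom.app X) ∈
      distTriang 𝒟 :=
  G.map_distinguished _ hT

omit [HasZeroObject 𝒞] [∀ n : ℤ, (shiftFunctor 𝒞 n).Additive] [Pretriangulated 𝒞]
  [HasZeroObject 𝒟] [∀ n : ℤ, (shiftFunctor 𝒟 n).Additive] [Pretriangulated 𝒟] in
lemma NoHom.map_shift (G : 𝒞 ⥤ 𝒟) [G.CommShift ℤ] [G.Full] [G.PreservesZeroMorphisms]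
    {X Y : 𝒞} {s : ℤ} (h : NoHom X (Y⟦s⟧)) : NoHom (G.obj X) ((G.obj Y)⟦s⟧) := fun f => by
  obtain ⟨u, hu⟩ := G.map_surjective (f ≫ (G.commShiftIso s).inv.app Y)
  rw [h u, G.map_zero] at hu
  exact (cancel_mono ((G.commShiftIso s).inv.app Y)).1 (hu.symm.trans zero_comp.symm)

lemma NoHom.biproduct_shift {ε : Type} [Fintype ε] {X : ε → 𝒞} {s : ℤ}
    (h : ∀ i j, NoHom (X i) ((X j)⟦s⟧)) : NoHom (⨁ X) ((⨁ X)⟦s⟧) := fun f => by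
  have h1 : f = f ≫ (∑ j, biproduct.π X j ≫ biproduct.ι X j)⟦s⟧' := by
    rw [biproduct.total, CategoryTheory.Functor.map_id, Category.comp_id]
  rw [h1, Functor.map_sum, Preadditive.comp_sum]
  refine Finset.sum_eq_zero fun j _ => ?_
  rw [Functor.map_comp, ← Category.assoc]
  have h2 : f ≫ (biproduct.π X j)⟦s⟧' = 0 :=
    biproduct.hom_ext' _ _ fun i => (h i j _).trans comp_zero.symm
  rw [h2, zero_comp]

lemma isAddFun_euler {k : Type*} [Field k] [Linear k 𝒟] [∀ n : ℤ, (shiftFunctor 𝒟 n).Linear k]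
    (G : 𝒞 ⥤ 𝒟) [G.CommShift ℤ] [G.IsTriangulated] {P : 𝒞 → Prop} (hP : ExtClosed P) {W : 𝒟}
    (hW : ∀ X, P X → HomFin k (G.obj X) W) : IsAddFun P fun X => euler k (G.obj X) W :=
  .of_add hP (fun ⟨e⟩ => euler_iso_left (G.mapIso e))
    (fun hX => euler_of_isZero_left (G.map_isZero hX))
    fun hT hX _ hZ => euler_dist_left (dist_map G hT) (hW _ hX) (hW _ hZ)

end

section
open DerivedCategory Pretriangulated
variable {k R R' : Type} [Field k] [Ring R] [Algebra k R]
  [HasDMod R] [Ring R'] [Algebra k R']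
  [HasDerivedCategory.{1} (RMod R')] {ι ι' : Type}

lemma extClosed_isCpt : ExtClosed (IsCpt (𝒟 := DMod R)) where
  iso := fun ⟨e⟩ h => h.of_iso e
  zero h := isCpt_of_isZero h
  ext hT hX hZ := IsCpt.cone (inv_rot_of_distTriang _ hT) (hZ.shift (-1)) hX

lemma Built.eq_zero_of_isLE {D : ProjData k R ι} {a b : ℤ}
    {Z W : DMod R} (hW : Built D a b W) (hZ : Z.IsLE (a - 1))
    (f : Z ⟶ W) : f = 0 := by
  induction hW with
  | zero Z h => exact h.eq_of_tgt _ _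
  | step s l X Y u v w hT ha _ _ ih =>
    obtain ⟨g, rfl⟩ := dist_co₂ hT f (ih _)
    rw [TStructure.t.zero g (a - 1) s (by omega), zero_comp]

lemma Built.noHom_shift {D : ProjData k R ι} {X : DMod R}
    (hX : Built D (-1) 0 X) {s : ℤ} (hs : s ≠ 0) (h1 : s ≠ 1) (h2 : s ≠ -1) :
    NoHom X (X⟦s⟧) := by
  have h3 := hX.isLE
  intro f
  rcases lt_or_gt_of_ne hs with hs | hs
  · have h4 : (X⟦-s⟧).IsLE (-2) :=
      have := TStructure.t.isLE_shift X 0 (-s) s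
      TStructure.t.isLE_of_le _ s (-2) (by omega)
    let i : X⟦s⟧⟦-s⟧ ≅ X := (shiftFunctorCompIsoId _ s (-s) (by omega)).app X
    have h5 : f⟦-s⟧' ≫ i.hom = 0 := hX.eq_zero_of_isLE h4 _
    refine (shiftFunctor (DMod R) (-s)).map_injective ?_
    rw [Functor.map_zero]
    exact (cancel_mono i.hom).1 (h5.trans zero_comp.symm)
  · have h4 : (X⟦s⟧).IsLE (-2) :=
      have := TStructure.t.isLE_shift X 0 s (-s)
      TStructure.t.isLE_of_le _ (-s) (-2) (by omega)
    exact hX.hom_eq_zero h4 f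

variable [FiniteDimensional k R] [FiniteDimensional k R']

theorem exists_ne_zero_of_symm [Infinite k] [Fintype ι] [Fintype ι'] [DecidableEq ι']
    {D : ProjData k R ι} {D' : ProjData k R' ι'}
    (e : DMod R ≌ DerivedCategory (RMod R'))
    [e.functor.CommShift ℤ] [e.functor.IsTriangulated] {δ : ι → ℤ} {v₀ : ι} (hv₀ : δ v₀ ≠ 0)
    (hδ : ∀ j, ∑ v, δ v * Module.finrank k (D.P v ⟶ D.P j) = 0)
    (dual : ∀ {a b X}, Built D a b X → NoHom X (X⟦(1 : ℤ)⟧) → NoHom X (X⟦(-1 : ℤ)⟧))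
    {N : ℕ} {Q : Fin N → DerivedCategory (RMod R')}
    (h1 : ∀ {X} m, (mutCtx D').Tw X → NoHom X ((Q m)⟦(1 : ℤ)⟧))
    (h2 : ∀ S : ι' → _, IsSilt (mutCtx D') S → ∃ m, (∀ j, NoHom (S j) (Q m)) ∧
      ∀ X j, (mutCtx D').Tw X → ∀ δ : X ⟶ (S j)⟦(1 : ℤ)⟧, δ ≠ 0 → ∃ f : X ⟶ Q m, f ≠ 0)
    (h0 : IsSilt (mutCtx D') fun l => sg 0 (D'.P l)) : False := by
  let _ := e.commShiftInverse ℤ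
  have := e.commShift_of_functor ℤ
  have : e.inverse.IsTriangulated := e.toAdjunction.isTriangulated_rightAdjoint
  have hF : ∀ v, IsCpt (e.functor.obj (sg 0 (D.P v))) := fun v => (isCpt_P D v 0).map_equiv e
  have hG : ∀ X, IsCpt X → IsCpt (e.inverse.obj X) := fun X hX => hX.map_equiv e.symm
  choose c hc using fun v => (hF v).exists_built D'
  choose d hd using hc
  choose n hn using fun v => (hd v).exists_class
  let θ : ι' → ℤ := fun l => ∑ v, δ v * n v l
  have hθ (lam) (hl : IsAddFun IsCpt lam) :
      ∑ v, δ v * lam (e.functor.obj (sg 0 (D.P v))) = ∑ l, θ l * lam (sg 0 (D'.P l)) := by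
    simp only [hn _ lam hl, Finset.mul_sum, θ, Finset.sum_mul]
    rw [Finset.sum_comm]
    exact Finset.sum_congr rfl fun _ _ => Finset.sum_congr rfl fun _ _ => by ring
  have H : IsPres (mutCtx D') (fun l => sg 0 (D'.P l))
      (fun x : (Σ l, Fin (-θ l).toNat) => sg 0 (D'.P x.1))
      (fun x : (Σ l, Fin (θ l).toNat) => sg 0 (D'.P x.1)) Sigma.fst Sigma.fst
      fun _ _ => 0 := by
    refine ⟨fun s => ⟨Iso.refl _⟩, fun s => ⟨Iso.refl _⟩, fun l x => ⟨fun _ => 0, fun s => ?_⟩⟩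
    have := D'.proj s.1
    have h3 : x s = 0 := sg_hom_eq_zero_of_ne (D'.P s.1) (by decide) (D'.L l) _
    simp [h3]
  obtain ⟨σ, _, X, hX1, hX2, hX3⟩ := IsPres.exists_presilting h1 h2 h0 H
  let V := ⨁ X
  have hV : Built D' (-1) 0 V := (extClosed_built D' (-1) 0).biproduct X hX1
  have hV1 : NoHom V (V⟦(1 : ℤ)⟧) := NoHom.biproduct_shift hX2
  let V' := e.inverse.obj V
  obtain ⟨a, b, hV'⟩ := (hG V hV.isCpt).exists_built D
  have hV'1 : NoHom V' (V'⟦(1 : ℤ)⟧) := hV1.map_shift e.inverse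
  have hV's (s : ℤ) (hs : s ≠ 0) : NoHom V' (V'⟦s⟧) := by
    rcases eq_or_ne s 1 with rfl | h3
    · exact hV'1
    rcases eq_or_ne s (-1) with rfl | h4
    · exact dual hV' hV'1
    · exact (hV.noHom_shift hs h3 h4).map_shift e.inverse
  have key (W : DMod R)
      (hW : ∀ Z a b, Built D a b Z → HomFin k Z W) :
      euler k V' W = ∑ v, δ v * euler k (sg 0 (D.P v)) W := by
    have hl : IsAddFun IsCpt fun X => euler k (e.inverse.obj X) W :=
      isAddFun_euler e.inverse extClosed_isCpt fun Z hZ => by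
        obtain ⟨a, b, h⟩ := (hG Z hZ).exists_built D
        exact hW _ a b h
    have h3 : euler k V' W = ∑ s, euler k (e.inverse.obj (X s)) W :=
      hl.biproduct X fun s => (hX1 s).isCpt
    have h4 := hX3 _ (hl.mono fun Z (hZ : Built D' (-1) 0 Z) => hZ.isCpt)
    have h5 := hθ _ hl
    have h6 : ∀ v, euler k (e.inverse.obj (e.functor.obj (sg 0 (D.P v)))) W =
        euler k (sg 0 (D.P v)) W := fun v => euler_iso_left (e.unitIso.symm.app _)
    rw [h3, h4, ← Finset.sum_congr rfl fun v _ => congrArg (δ v * ·) (h6 v), h5]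
    simp only [Fintype.sum_sigma, Finset.sum_const, Finset.card_univ, Fintype.card_fin,
      ← Finset.sum_sub_distrib, nsmul_eq_mul, ← sub_mul, Int.toNat_sub_toNat_neg]
  have h3 : euler k V' V' = 0 := by
    rw [key V' fun Z a b h => h.homFin hV', hV'.sum_euler_eq_zero δ hδ]
  have h4 : IsZero V' := by
    rw [euler_eq_single 0 fun s hs => ⟨fun f g => (hV's s hs f).trans (hV's s hs g).symm⟩] at h3
    have h5 := (hV'.homFin hV').1 0
    simp only [Int.negOnePow_zero, Units.val_one, one_mul, Nat.cast_eq_zero] at h3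
    have h6 : Subsingleton (V' ⟶ V'⟦(0 : ℤ)⟧) := Module.finrank_zero_iff.1 h3
    rw [IsZero.iff_id_eq_zero]
    let i := (shiftFunctorZero (DMod R) ℤ).app V'
    exact (cancel_mono i.inv).1 (Subsingleton.elim _ _)
  have := D.fin v₀
  have hL := D.finite_L v₀
  have h5 := key (sg 0 (D.L v₀)) fun Z a b h => h.homFin_sg _ 0
  rw [euler_of_isZero_left h4, Finset.sum_eq_single v₀] at h5
  · have := D.proj v₀
    rw [euler_sg_sg] at h5
    have h6 := finite_moduleCat_hom (k := k) (D.P v₀) (D.L v₀)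
    have h7 : Module.finrank k (D.P v₀ ⟶ D.L v₀) ≠ 0 := fun h8 => by
      have := Module.finrank_zero_iff.1 h8
      have := D.simple v₀
      have h9 := IsSimpleModule.nontrivial R (D.L v₀)
      obtain ⟨y, hy⟩ := exists_ne (0 : D.L v₀)
      obtain ⟨x, rfl⟩ := D.p_surj v₀ y
      rw [Subsingleton.elim (D.p v₀) 0] at hy
      exact hy rfl
    simp [hv₀, h7] at h5
  · intro v _ hv
    have := D.proj v
    have : Subsingleton (D.P v ⟶ D.L v₀) :=
      ⟨fun f g => (D.hom_ne v v₀ f hv).trans (D.hom_ne v v₀ g hv).symm⟩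
    rw [euler_sg_sg, Module.finrank_zero_of_subsingleton]
    simp
  · simp
end

section
/-- The projective module generated by an idempotent. -/
def idemMod {R : Type} [Ring R] (e : R) : Submodule R R where
  carrier := {x | x * e = x}
  zero_mem' := zero_mul e
  add_mem' {a b} ha hb := by
    simp only [Set.mem_ofPred_eq] at *
    rw [add_mul, ha, hb]
  smul_mem' r x hx := by
    simp only [Set.mem_ofPred_eq, smul_eq_mul] at *
    rw [mul_assoc, hx]

section
variable {R : Type} [Ring R] {e : R}

lemma mem_idemMod {x : R} : x ∈ idemMod e ↔ x * e = x := Iff.rfl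

/-- The projection onto the projective module generated by an idempotent. -/
def toIdemMod (he : IsIdempotentElem e) : R →ₗ[R] idemMod e where
  toFun x := ⟨x * e, by rw [mem_idemMod, mul_assoc, he]⟩
  map_add' x y := Subtype.ext (add_mul x y e)
  map_smul' r x := Subtype.ext (mul_assoc r x e)

lemma toIdemMod_comp (he : IsIdempotentElem e) :
    toIdemMod he ∘ₗ (idemMod e).subtype = LinearMap.id :=
  LinearMap.ext fun x => Subtype.ext x.2

lemma idemMod_projective (he : IsIdempotentElem e) : Module.Projective R (idemMod e) :=
  .of_split _ _ (toIdemMod_comp he)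

lemma idemMod_finite (he : IsIdempotentElem e) : Module.Finite R (idemMod e) :=
  Module.Finite.of_surjective (toIdemMod he) fun x =>
    ⟨x.1, LinearMap.congr_fun (toIdemMod_comp he) x⟩

end

/-- The simple modules of an algebra, with their projective covers, given by idempotents. -/
structure IdemData (k R ι : Type) [Field k] [Ring R] [Algebra k R] extends ProjData k R ι where
  e : ι → R
  orth : OrthogonalIdempotents e
  x : ∀ l, P l
  x_smul : ∀ l, e l • x l = x l
  lift : ∀ l (M : RMod R) (m : M), e l • m = m → ∃ f : P l ⟶ M, f (x l) = m
  hom_ext : ∀ l (M : RMod R) (f g : P l ⟶ M), f (x l) = g (x l) → f = g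
  loc : ∀ l, LocalObj (P l)

lemma localObj_of_nil {k : Type} [Field k] {𝒞 : Type*} [Category* 𝒞] [Preadditive 𝒞]
    [Linear k 𝒞] {M L : 𝒞} (p : M ⟶ L) (hp : p ≠ 0) (h : ∀ f : M ⟶ M, ∃ c : k, f ≫ p = c • p)
    (hn : ∀ f : M ⟶ M, f ≫ p = 0 → IsNilpotent (show End M from f)) : LocalObj M := by
  constructor
  · intro h
    exact hp (by rw [← Category.id_comp p, h, zero_comp])
  · intro f
    obtain ⟨c, hc⟩ := h f
    have h1 : IsNilpotent (show End M from f - c • 𝟙 M) := hn _ (by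
        rw [Preadditive.sub_comp, Linear.smul_comp, Category.id_comp, hc, sub_self])
    rcases eq_or_ne c 0 with rfl | hc0
    · right
      rw [zero_smul, sub_zero] at h1
      exact (isUnit_iff_isIso _).1 h1.isUnit_one_sub
    · left
      have h2 : IsUnit (c • (1 : End M)) :=
        ⟨⟨c • 1, c⁻¹ • 1, by simp [smul_smul, hc0], by simp [smul_smul, hc0]⟩, rfl⟩
      have h3 := h1.isUnit_add_left_of_commute h2 ((Commute.one_right _).smul_right c)
      refine (isUnit_iff_isIso _).1 ?_
      have h4 : c • 𝟙 M + (f - c • 𝟙 M) = f := add_sub_cancel _ _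
      exact h4 ▸ h3

/-- A surjection to a product of matrix algebras, with nil kernel, with idempotents lifting
diagonal matrix units. -/
structure MatData (k R ι : Type) [Field k] [Ring R] [Algebra k R] [DecidableEq ι] where
  m : ι → Type
  [fintype : ∀ l, Fintype (m l)]
  [decEq : ∀ l, DecidableEq (m l)]
  o : ∀ l, m l
  π : R →ₐ[k] ∀ l, Matrix (m l) (m l) k
  surj : Function.Surjective π
  nil : ∀ x, π x = 0 → IsNilpotent x
  e : ι → R
  orth : OrthogonalIdempotents e
  π_e : ∀ l, π (e l) = Pi.single l (Matrix.single (o l) (o l) 1)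

attribute [instance] MatData.fintype MatData.decEq

namespace MatData
variable {k R ι : Type} [Field k] [Ring R] [Algebra k R] [DecidableEq ι] (D : MatData k R ι)

/-- The action on column vectors. -/
def act (l : ι) (r : R) (v : D.m l → k) : D.m l → k := (D.π r l).mulVec v

/-- The simple module attached to a factor. -/
def Simp (l : ι) : Type := D.m l → k

instance (l : ι) : AddCommGroup (D.Simp l) := inferInstanceAs (AddCommGroup (D.m l → k))

variable {D}

lemma act_one {l : ι} (v : D.m l → k) : D.act l 1 v = v := by simp [act]

lemma act_mul {l : ι} (r s : R) (v : D.m l → k) : D.act l (r * s) v = D.act l r (D.act l s v) := by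
  simp [act]

lemma act_add {l : ι} (r s : R) (v : D.m l → k) :
    D.act l (r + s) v = D.act l r v + D.act l s v := by simp [act, Matrix.add_mulVec]

lemma act_zero {l : ι} (v : D.m l → k) : D.act l 0 v = 0 := by simp [act]

instance (l : ι) : Module R (D.Simp l) where
  smul r v := D.act l r v
  one_smul := act_one
  mul_smul := act_mul
  smul_zero _ := Matrix.mulVec_zero _
  smul_add _ := Matrix.mulVec_add _
  add_smul := act_add
  zero_smul := act_zero

lemma act_e {i l : ι} (v : D.m l → k) :
    D.act l (D.e i) v = if i = l then Pi.single (D.o l) (v (D.o l)) else 0 := by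
  rw [act, D.π_e]
  split_ifs with h
  · subst h
    rw [Pi.single_eq_same]
    simp [Matrix.single_mulVec, Pi.single]
  · rw [Pi.single_eq_of_ne (Ne.symm h), Matrix.zero_mulVec]

lemma exists_act {l : ι} {v : D.m l → k} (hv : v ≠ 0) (w : D.m l → k) :
    ∃ r : R, D.act l r v = w := by
  obtain ⟨a, ha⟩ := Function.ne_iff.1 hv
  obtain ⟨r, hr⟩ := D.surj (Pi.single l (Matrix.of fun b c => if c = a then w b * (v a)⁻¹ else 0))
  refine ⟨r, ?_⟩
  rw [act, hr, Pi.single_eq_same]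
  ext b
  have : v a ≠ 0 := ha
  simp [Matrix.mulVec, dotProduct, this]

instance (l : ι) : IsSimpleModule R (D.Simp l) :=
  have : Nonempty (D.m l) := ⟨D.o l⟩
  have : Nontrivial (D.Simp l) := inferInstanceAs (Nontrivial (D.m l → k))
  isSimpleModule_iff_toSpanSingleton_surjective.2 ⟨inferInstance, fun _ hv w => exists_act hv w⟩

lemma act_smul {l : ι} (c : k) (v : D.m l → k) : D.act l (algebraMap k R c) v = c • v := by
  rw [act, AlgHom.commutes, Pi.algebraMap_apply, Algebra.algebraMap_eq_smul_one, Matrix.smul_mulVec,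
    Matrix.one_mulVec]

variable (D)

/-- The first coordinate vector. -/
def vec (l : ι) : D.Simp l := (Pi.single (D.o l) (1 : k) : D.m l → k)

lemma e_smul_vec (l : ι) : D.e l • D.vec l = D.vec l := by
  refine (act_e _).trans ?_
  rw [if_pos rfl, vec, Pi.single_eq_same]

lemma e_smul_of_ne {i l : ι} (h : i ≠ l) (v : D.Simp l) : D.e i • v = 0 :=
  (act_e _).trans (if_neg h)

lemma e_smul_eq (l : ι) (v : D.Simp l) : ∃ c : k, D.e l • v = algebraMap k R c • D.vec l := by
  refine ⟨(show D.m l → k from v) (D.o l), (act_e _).trans ?_⟩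
  rw [if_pos rfl]
  refine Eq.trans ?_ (act_smul _ _).symm
  simp [vec, ← Pi.single_smul]

variable {D} in
lemma smul_eq_zero {x : R} (hx : D.π x = 0) {M : Type} [AddCommGroup M] [Module R M]
    [IsSimpleModule R M] (m : M) : x • m = 0 := by
  by_contra h
  obtain ⟨r, hr⟩ := IsSimpleModule.toSpanSingleton_surjective R h m
  obtain ⟨n, hn⟩ := D.nil (r * x) (by rw [map_mul, hx, mul_zero])
  have h1 : (r * x) • m = m := by rw [mul_smul]; exact hr
  have h2 : ∀ n : ℕ, (r * x) ^ n • m = m := fun n => by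
    induction n with
    | zero => simp
    | succ n ih => rw [pow_succ, mul_smul, h1, ih]
  have h3 := h2 n
  rw [hn, zero_smul] at h3
  exact h (by rw [← h3, smul_zero])

lemma exists_e_smul_ne [Fintype ι] (M : Type) [AddCommGroup M] [Module R M] [IsSimpleModule R M] :
    ∃ l, ∃ y : M, D.e l • y ≠ 0 := by
  by_contra! h
  choose u hu using fun x : (Σ l, D.m l) => D.surj (Pi.single x.1 (Matrix.single x.2 (D.o x.1) 1))
  choose w hw using fun x : (Σ l, D.m l) => D.surj (Pi.single x.1 (Matrix.single (D.o x.1) x.2 1))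
  have h1 : D.π (1 - ∑ x, u x * D.e x.1 * w x) = 0 := by
    rw [map_sub, map_one, map_sum, sub_eq_zero]
    have h2 (x : Σ l, D.m l) : D.π (u x * D.e x.1 * w x) =
        Pi.single x.1 (Matrix.single x.2 x.2 1) := by
      rw [map_mul, map_mul, hu, hw, D.π_e, ← Pi.single_mul, ← Pi.single_mul]
      simp
    simp only [h2, Fintype.sum_sigma]
    ext l : 1
    rw [Finset.sum_apply, Finset.sum_eq_single l]
    · rw [Finset.sum_apply]
      simp only [Pi.single_eq_same]
      exact (Matrix.sum_single_one).symm
    · intro i _ hi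
      rw [Finset.sum_apply]
      exact Finset.sum_eq_zero fun x _ => Pi.single_eq_of_ne (Ne.symm hi) _
    · simp
  have := IsSimpleModule.nontrivial R M
  obtain ⟨y, hy⟩ := exists_ne (0 : M)
  have h3 := smul_eq_zero h1 y
  rw [sub_smul, one_smul, Finset.sum_smul, Finset.sum_eq_zero fun x _ => by
    rw [mul_smul, mul_smul, h, smul_zero], sub_zero] at h3
  exact hy h3

lemma π_eq_zero {l : ι} {x : R} (hx : x * D.e l = x) (h : x • D.vec l = 0) : D.π x = 0 := by
  have h1 : D.π x = D.π x * Pi.single l (Matrix.single (D.o l) (D.o l) 1) := by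
    rw [← D.π_e, ← map_mul, hx]
  ext i : 1
  rcases eq_or_ne i l with rfl | hi
  · have h2 : D.π x i = D.π x i * Matrix.single (D.o i) (D.o i) 1 := by
      conv_lhs => rw [h1]
      simp
    have h3 : (D.π x i).mulVec (Pi.single (D.o i) 1) = 0 := h
    rw [h2]
    ext a b
    rcases eq_or_ne b (D.o i) with rfl | hb
    · simpa using congrFun h3 a
    · exact Matrix.mul_single_apply_of_ne _ _ _ _ _ hb _
  · rw [h1]
    simp [hi]

/-- The projective cover of a simple module. -/
def proj (l : ι) : idemMod (D.e l) →ₗ[R] D.Simp l :=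
  LinearMap.toSpanSingleton R _ (D.vec l) ∘ₗ (idemMod (D.e l)).subtype

lemma proj_surjective (l : ι) : Function.Surjective (D.proj l) := fun w => by
  have : (D.vec l) ≠ 0 := by
    intro h
    have := congrFun (show (Pi.single (D.o l) (1 : k) : D.m l → k) = 0 from h) (D.o l)
    simp at this
  obtain ⟨r, hr⟩ := IsSimpleModule.toSpanSingleton_surjective R this w
  refine ⟨toIdemMod (D.orth.idem l) r, ?_⟩
  change (r * D.e l) • D.vec l = w
  rw [mul_smul, e_smul_vec]
  exact hr

lemma exists_iso [Fintype ι] (M : Type) [AddCommGroup M] [Module R M] [IsSimpleModule R M] :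
    ∃ l, Nonempty (M ≃ₗ[R] D.Simp l) := by
  obtain ⟨l, y, hy⟩ := D.exists_e_smul_ne M
  refine ⟨l, ⟨?_⟩⟩
  let φ : idemMod (D.e l) →ₗ[R] M :=
    LinearMap.toSpanSingleton R _ (D.e l • y) ∘ₗ (idemMod (D.e l)).subtype
  have h : LinearMap.ker (D.proj l) ≤ LinearMap.ker φ := fun x hx =>
    smul_eq_zero (D.π_eq_zero x.2 hx) _
  let q := (D.proj l).quotKerEquivOfSurjective (D.proj_surjective l)
  let g : D.Simp l →ₗ[R] M := (LinearMap.ker (D.proj l)).liftQ φ h ∘ₗ q.symm.toLinearMap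
  have hg : g ≠ 0 := fun h0 => hy <| by
    have h1 : g (D.proj l ⟨D.e l, D.orth.idem l⟩) = φ ⟨D.e l, D.orth.idem l⟩ := by
      have : q.symm (D.proj l ⟨D.e l, D.orth.idem l⟩) = Submodule.Quotient.mk _ :=
        q.symm_apply_eq.2 rfl
      change (LinearMap.ker (D.proj l)).liftQ φ h (q.symm _) = _
      rw [this]
      rfl
    rw [h0] at h1
    have h2 : (0 : M) = D.e l • D.e l • y := h1
    rw [h2, ← mul_smul, D.orth.idem l]
  exact (LinearEquiv.ofBijective g (LinearMap.bijective_of_ne_zero hg)).symm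

lemma hom_of_smul_eq {e : R} (he : IsIdempotentElem e) {M : RMod R} (m : M)
    (hm : e • m = m) : ∃ f : ModuleCat.of R (idemMod e) ⟶ M, f ⟨e, he⟩ = m :=
  ⟨ModuleCat.ofHom (LinearMap.toSpanSingleton R _ m ∘ₗ (idemMod e).subtype), hm⟩

lemma idemMod_hom_ext {e : R} (he : IsIdempotentElem e) {M : RMod R}
    {f g : ModuleCat.of R (idemMod e) ⟶ M} (h : f ⟨e, he⟩ = g ⟨e, he⟩) : f = g := by
  ext x
  have hx : x = x.1 • (⟨e, he⟩ : idemMod e) := Subtype.ext x.2.symm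
  have h1 (u : ModuleCat.of R (idemMod e) ⟶ M) :
      u.hom (x.1 • (⟨e, he⟩ : idemMod e)) = x.1 • u.hom (⟨e, he⟩ : idemMod e) := map_smul u.hom _ _
  rw [hx, h1, h1]
  exact congrArg _ h

lemma e_smul_hom {e : R} (he : IsIdempotentElem e) {M : RMod R}
    (f : ModuleCat.of R (idemMod e) ⟶ M) : f ⟨e, he⟩ = e • f ⟨e, he⟩ := by
  have h1 : f.hom (e • (⟨e, he⟩ : idemMod e)) = e • f.hom (⟨e, he⟩ : idemMod e) :=
    map_smul f.hom _ _
  have h2 : e • (⟨e, he⟩ : idemMod e) = ⟨e, he⟩ := Subtype.ext he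
  rw [h2] at h1
  exact h1

/-- The projective cover of a simple module, as a morphism. -/
def projHom (l : ι) : ModuleCat.of R (idemMod (D.e l)) ⟶ ModuleCat.of R (D.Simp l) :=
  ModuleCat.ofHom (D.proj l)

lemma projHom_e (l : ι) : D.projHom l ⟨D.e l, D.orth.idem l⟩ = D.vec l := D.e_smul_vec l

lemma hom_eq_smul (l : ι) (f : ModuleCat.of R (idemMod (D.e l)) ⟶ ModuleCat.of R (D.Simp l)) :
    ∃ c : k, f = c • D.projHom l := by
  obtain ⟨c, hc⟩ := D.e_smul_eq l (f ⟨D.e l, D.orth.idem l⟩)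
  refine ⟨c, idemMod_hom_ext (D.orth.idem l) ?_⟩
  refine (e_smul_hom _ f).trans (hc.trans ?_)
  rw [← projHom_e]
  rfl

lemma isNilpotent_of_comp_projHom {l : ι}
    (f : ModuleCat.of R (idemMod (D.e l)) ⟶ ModuleCat.of R (idemMod (D.e l)))
    (hf : f ≫ D.projHom l = 0) : IsNilpotent (show End _ from f) := by
  let x : idemMod (D.e l) := f ⟨D.e l, D.orth.idem l⟩
  have hx : D.π x.1 = 0 := D.π_eq_zero x.2 (congrArg (fun g => g ⟨D.e l, D.orth.idem l⟩) hf)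
  obtain ⟨n, hn⟩ := D.nil _ hx
  have h1 (y : idemMod (D.e l)) : (f y : idemMod (D.e l)).1 = y.1 * x.1 := by
    have hy : y = y.1 • (⟨D.e l, D.orth.idem l⟩ : idemMod (D.e l)) := Subtype.ext y.2.symm
    have h1 : f.hom (y.1 • (⟨D.e l, D.orth.idem l⟩ : idemMod (D.e l))) = y.1 • x :=
      map_smul f.hom _ _
    rw [← hy] at h1
    exact congrArg Subtype.val h1
  let f' : End (ModuleCat.of R (idemMod (D.e l))) := f
  have h2 (n : ℕ) (y : idemMod (D.e l)) :
      ((f' ^ n).hom y : idemMod (D.e l)).1 = y.1 * x.1 ^ n := by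
    induction n with
    | zero =>
      rw [pow_zero, pow_zero, mul_one]
      rfl
    | succ n ih =>
      rw [pow_succ', pow_succ, ← mul_assoc, ← ih]
      exact h1 _
  refine ⟨n, ModuleCat.hom_ext (LinearMap.ext fun y => Subtype.ext ?_)⟩
  refine (h2 n y).trans ?_
  rw [hn, mul_zero]
  rfl

lemma localObj_idemMod (l : ι) : LocalObj (ModuleCat.of R (idemMod (D.e l))) := by
  refine localObj_of_nil (k := k) (D.projHom l) (fun h1 => ?_) (fun f => D.hom_eq_smul l _)
    fun f => D.isNilpotent_of_comp_projHom f
  have h2 := D.projHom_e l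
  rw [h1] at h2
  have := congrFun (show (0 : D.m l → k) = Pi.single (D.o l) (1 : k) from h2) (D.o l)
  simp at this

/-- The projective covers of the simple modules. -/
def toIdemData [Fintype ι] : IdemData k R ι where
  P l := ModuleCat.of R (idemMod (D.e l))
  L l := ModuleCat.of R (D.Simp l)
  p := D.projHom
  proj l := (IsProjective.iff_projective _).1 (idemMod_projective (D.orth.idem l))
  fin l := idemMod_finite (D.orth.idem l)
  simple l := inferInstanceAs (IsSimpleModule R (D.Simp l))
  p_surj := D.proj_surjective
  exists_iso M := D.exists_iso M
  hom_ne i _ f h := idemMod_hom_ext (D.orth.idem i) <|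
    (e_smul_hom _ f).trans (D.e_smul_of_ne h _)
  hom_eq := D.hom_eq_smul
  e := D.e
  orth := D.orth
  x l := ⟨D.e l, D.orth.idem l⟩
  x_smul l := Subtype.ext (D.orth.idem l)
  lift l _ m hm := hom_of_smul_eq (D.orth.idem l) m hm
  hom_ext l _ _ _ h := idemMod_hom_ext (D.orth.idem l) h
  loc := D.localObj_idemMod

end MatData

lemma exists_matData (k R : Type) [Field k] [IsAlgClosed k] [Ring R] [Algebra k R]
    [FiniteDimensional k R] : ∃ n : ℕ, Nonempty (MatData k R (Fin n)) := by
  have : IsArtinianRing R := isArtinian_of_tower k inferInstance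
  let q : R →ₐ[k] R ⧸ Ring.jacobson R := Ideal.Quotient.mkₐ k _
  have hq : Function.Surjective q := Ideal.Quotient.mkₐ_surjective k _
  have : FiniteDimensional k (R ⧸ Ring.jacobson R) :=
    Module.Finite.of_surjective q.toLinearMap hq
  obtain ⟨n, d, hd, ⟨φ⟩⟩ := IsSemisimpleRing.exists_algEquiv_pi_matrix_of_isAlgClosed k
    (R ⧸ Ring.jacobson R)
  let π : R →ₐ[k] ∀ l, Matrix (Fin (d l)) (Fin (d l)) k := φ.toAlgHom.comp q
  have hπ : Function.Surjective π := φ.surjective.comp hq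
  have hnil (x : R) (hx : π x = 0) : IsNilpotent x := by
    obtain ⟨N, hN⟩ := IsSemiprimaryRing.isNilpotent (R := R)
    have h1 : q x = 0 := φ.injective (hx.trans (map_zero φ).symm)
    have h2 : x ∈ Ring.jacobson R := Ideal.Quotient.eq_zero_iff_mem.1 h1
    refine ⟨N, ?_⟩
    have h3 := Ideal.pow_mem_pow h2 N
    rw [hN] at h3
    exact h3
  let E (l : Fin n) : ∀ l, Matrix (Fin (d l)) (Fin (d l)) k := Pi.single l (Matrix.single 0 0 1)
  have hE : OrthogonalIdempotents E :=
    { idem := fun l => by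
        change Pi.single _ _ * Pi.single _ _ = Pi.single _ _
        rw [← Pi.single_mul]
        simp
      ortho := fun i j hij => by
        ext l : 1
        change Pi.single (M := fun l => Matrix (Fin (d l)) (Fin (d l)) k) i _ l *
          Pi.single (M := fun l => Matrix (Fin (d l)) (Fin (d l)) k) j _ l = 0
        rcases eq_or_ne l i with rfl | h
        · rw [Pi.single_eq_of_ne hij, mul_zero]
        · rw [Pi.single_eq_of_ne h, zero_mul] }
  obtain ⟨e, he, hπe⟩ := OrthogonalIdempotents.lift_of_isNilpotent_ker π.toRingHom
    (fun x hx => hnil x hx) hE fun i => hπ _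
  exact ⟨n, ⟨{
    m := fun l => Fin (d l)
    o := fun _ => 0
    π := π
    surj := hπ
    nil := hnil
    e := e
    orth := he
    π_e := fun l => congrFun hπe l }⟩⟩
end

section
variable {𝒞 : Type*} [Category* 𝒞] [Preadditive 𝒞] {J : Type} [Fintype J] {N : J → 𝒞}
  (loc : ∀ j, LocalObj (N j)) (hN : ∀ i j, Nonempty (N i ≅ N j) → i = j)

include loc hN

/-- A nonzero retract of a finite sum of objects with local endomorphism rings has one of them as
a retract. -/
lemma exists_isIso_of_sum {L : 𝒞} (i : ∀ j, L ⟶ N j) (p : ∀ j, N j ⟶ L)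
    (h : ∑ j, i j ≫ p j = 𝟙 L) (hL : 𝟙 L ≠ 0) : ∃ j, IsIso (p j ≫ i j) := by
  by_contra! hc
  have h1 (l j : J) : IsRad (p l ≫ i j) := (loc l).isRad (loc j) _ fun hi => by
    obtain rfl := hN l j ⟨asIso (p l ≫ i j)⟩
    exact hc _ hi
  have h2 (j : J) : IsRad (i j) := by
    rw [← Category.id_comp (i j), ← h, Preadditive.sum_comp]
    refine IsRad.sum _ _ fun l _ => ?_
    rw [Category.assoc]
    exact (h1 l j).comp_left _
  have h3 : IsRad (𝟙 L) := by
    rw [← h]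
    exact IsRad.sum _ _ fun j _ => (h2 j).comp_right _
  have h4 := h3 (𝟙 L)
  rw [Category.comp_id, sub_self] at h4
  exact hL (by rw [← IsIso.inv_hom_id (0 : L ⟶ L), comp_zero])

/-- A nonzero object is not a summand with multiplicity two. -/
lemma false_of_two_sums {L : 𝒞} (i : Bool → ∀ j, L ⟶ N j) (p : Bool → ∀ j, N j ⟶ L)
    (h : ∀ s t, ∑ j, i s j ≫ p t j = if s = t then 𝟙 L else 0) (hL : 𝟙 L ≠ 0) : False := by
  classical
  obtain ⟨m, hm⟩ := exists_isIso_of_sum loc hN (i true) (p true) ((h _ _).trans (if_pos rfl)) hL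
  let a : N m ⟶ L := inv (p true m ≫ i true m) ≫ p true m
  let b : L ⟶ N m := i true m
  have hab : a ≫ b = 𝟙 _ := by simp [a, b]
  have h1 (s t) : ∃ r : N m ⟶ N m, IsRad r ∧
      (a ≫ i s m) ≫ (p t m ≫ b) = (if s = t then 𝟙 (N m) else 0) - r := by
    refine ⟨∑ j ∈ Finset.univ.erase m, (a ≫ i s j) ≫ (p t j ≫ b), ?_, ?_⟩
    · refine IsRad.sum _ _ fun j hj => IsRad.comp_right ?_ _
      refine (loc m).isRad (loc j) _ fun hi => ?_
      exact Finset.ne_of_mem_erase hj (hN m j ⟨asIso (a ≫ i s j)⟩).symm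
    · rw [eq_sub_iff_add_eq, Finset.add_sum_erase Finset.univ (fun j => (a ≫ i s j) ≫ (p t j ≫ b))
        (Finset.mem_univ m)]
      have : ∑ j, (a ≫ i s j) ≫ p t j ≫ b = a ≫ (∑ j, i s j ≫ p t j) ≫ b := by
        simp [Preadditive.sum_comp, Preadditive.comp_sum]
      rw [this, h]
      split_ifs <;> simp [hab]
  have h2 (s) : IsIso ((a ≫ i s m) ≫ (p s m ≫ b)) := by
    obtain ⟨r, hr, h3⟩ := h1 s s
    rw [h3, if_pos rfl]
    simpa using hr (𝟙 _)
  have h3 : IsIso (a ≫ i true m) := by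
    by_contra hc
    have := ((loc m).isRad (loc m) _ hc) ((p true m ≫ b) ≫ inv ((a ≫ i true m) ≫ (p true m ≫ b)))
    rw [← Category.assoc, IsIso.hom_inv_id, sub_self] at this
    exact (loc m).1 (by rw [← IsIso.inv_hom_id (0 : N m ⟶ N m), comp_zero])
  have h4 : IsIso (p false m ≫ b) := by
    by_contra hc
    have h5 := (((loc m).isRad (loc m) _ hc).comp_left (a ≫ i false m)).comp_right
      (inv ((a ≫ i false m) ≫ (p false m ≫ b))) (𝟙 _)
    rw [IsIso.hom_inv_id, Category.comp_id, sub_self] at h5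
    exact (loc m).1 (by rw [← IsIso.inv_hom_id (0 : N m ⟶ N m), comp_zero])
  obtain ⟨r, hr, h5⟩ := h1 true false
  have h6 : IsRad ((a ≫ i true m) ≫ (p false m ≫ b)) := by
    rw [h5, if_neg (by decide), zero_sub]
    intro g
    simpa using hr (-g)
  have h7 := h6 (inv ((a ≫ i true m) ≫ (p false m ≫ b)))
  rw [IsIso.hom_inv_id, sub_self] at h7
  exact (loc m).1 (by rw [← IsIso.inv_hom_id (0 : N m ⟶ N m), comp_zero])

end

section
variable {S : Type} [Ring S] {J : Type} [Fintype J] [DecidableEq J] {N : J → RMod S}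

/-- A component of a morphism to a product. -/
def piIn {L : Type} [AddCommGroup L] [Module S L] (u : L →ₗ[S] (∀ j, N j)) (j : J) :
    ModuleCat.of S L ⟶ N j :=
  ModuleCat.ofHom (LinearMap.proj (R := S) (φ := fun j => N j) j ∘ₗ u)

/-- A component of a morphism from a product. -/
def piOut {L : Type} [AddCommGroup L] [Module S L] (v : (∀ j, N j) →ₗ[S] L) (j : J) :
    N j ⟶ ModuleCat.of S L :=
  ModuleCat.ofHom (v ∘ₗ LinearMap.single S (fun j => N j) j)

lemma sum_piIn_piOut {L L' : Type} [AddCommGroup L] [Module S L] [AddCommGroup L'] [Module S L']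
    (u : L →ₗ[S] (∀ j, N j)) (v : (∀ j, N j) →ₗ[S] L') :
    ∑ j, piIn u j ≫ piOut v j = ModuleCat.ofHom (v ∘ₗ u) := by
  ext x
  rw [ModuleCat.hom_sum, LinearMap.sum_apply]
  change ∑ j, v (Pi.single j (u x j)) = v (u x)
  rw [← map_sum, Finset.univ_sum_single]

lemma subsingleton_of_id_eq_zero {L : Type} [AddCommGroup L] [Module S L]
    (h : 𝟙 (ModuleCat.of S L) = 0) : Subsingleton L :=
  ⟨fun x y => by
    have h1 (x : L) : x = 0 := congrArg (fun f => f.hom x) h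
    rw [h1 x, h1 y]⟩

lemma id_ne_zero_of_nontrivial {L : Type} [AddCommGroup L] [Module S L] [Nontrivial L] :
    𝟙 (ModuleCat.of S L) ≠ 0 := fun h => by
  have := subsingleton_of_id_eq_zero h
  exact not_subsingleton L this

lemma false_of_two_pi (loc : ∀ j, LocalObj (N j)) (hN : ∀ i j, Nonempty (N i ≅ N j) → i = j)
    {L : Type} [AddCommGroup L] [Module S L] [Nontrivial L] (u : Bool → L →ₗ[S] (∀ j, N j))
    (v : Bool → (∀ j, N j) →ₗ[S] L)
    (h : ∀ s t, v t ∘ₗ u s = if s = t then LinearMap.id else 0) : False := by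
  refine false_of_two_sums loc hN (fun s => piIn (u s)) (fun s => piOut (v s))
    (fun s t => (sum_piIn_piOut (u s) (v t)).trans ?_) (id_ne_zero_of_nontrivial (S := S) (L := L))
  rw [h]
  split_ifs <;> rfl

lemma exists_bijective_of_pi (loc : ∀ j, LocalObj (N j))
    (hN : ∀ i j, Nonempty (N i ≅ N j) → i = j)
    {L : Type} [AddCommGroup L] [Module S L] [Nontrivial L] (u : L →ₗ[S] (∀ j, N j))
    (v : (∀ j, N j) →ₗ[S] L) (h : v ∘ₗ u = LinearMap.id) :
    ∃ j, Function.Bijective ((LinearMap.proj j ∘ₗ u) ∘ₗ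
      (v ∘ₗ LinearMap.single S (fun j => N j) j)) := by
  obtain ⟨j, hj⟩ := exists_isIso_of_sum loc hN (piIn u) (piOut v)
    ((sum_piIn_piOut u v).trans (by rw [h]; rfl)) (id_ne_zero_of_nontrivial (S := S) (L := L))
  exact ⟨j, (ConcreteCategory.isIso_iff_bijective _).1 hj⟩

end

section
variable {B : Type} [Ring B] {J : Type} [Fintype J] {N : J → RMod Bᵐᵒᵖ}
  (loc : ∀ j, LocalObj (N j)) (hN : ∀ i j, Nonempty (N i ≅ N j) → i = j)

omit [Fintype J] in
include loc in
lemma indecomposableMod_of_localObj (j : J) : IndecomposableMod B (N j) := by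
  constructor
  · by_contra h
    rw [not_nontrivial_iff_subsingleton] at h
    refine (loc j).1 ?_
    ext x
    exact Subsingleton.elim _ _
  · rintro L L' ⟨e⟩
    let f : N j ⟶ N j := ModuleCat.ofHom (e.symm.toLinearMap ∘ₗ
      LinearMap.inl _ L L' ∘ₗ LinearMap.fst _ L L' ∘ₗ e.toLinearMap)
    have hf (x) : f x = e.symm ((e x).1, 0) := rfl
    rcases (loc j).2 f with h | h
    · right
      have h1 := ((ConcreteCategory.isIso_iff_bijective f).1 h).1
      refine ⟨fun a b => ?_⟩
      have h2 : e.symm (0, a) = e.symm (0, b) := h1 (by rw [hf, hf]; simp)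
      simpa using h2
    · left
      have h1 := ((ConcreteCategory.isIso_iff_bijective (𝟙 _ - f)).1 h).1
      refine ⟨fun a b => ?_⟩
      have h3 (x) : (𝟙 (N j) - f) x = x - f x := rfl
      have h2 : e.symm (a, 0) = e.symm (b, 0) := h1 (by rw [h3, h3, hf, hf]; simp)
      simpa using h2

include loc hN in
lemma isBasicMod_pi : IsBasicMod B (ModuleCat.of _ (∀ j, N j)) := by
  classical
  rintro L C ⟨e⟩
  by_contra h
  rw [not_subsingleton_iff_nontrivial] at h
  refine false_of_two_pi loc hN (L := L)
    (fun s => e.symm.toLinearMap ∘ₗ if s then LinearMap.inl _ _ _ else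
      LinearMap.inr _ _ _ ∘ₗ LinearMap.inl _ _ _)
    (fun s => (if s then LinearMap.fst _ _ _ else
      LinearMap.fst _ _ _ ∘ₗ LinearMap.snd _ _ _) ∘ₗ e.toLinearMap) fun s t => ?_
  ext x
  cases s <;> cases t <;> simp

include loc hN in
lemma exists_equiv_of_isIndecSummand {L : RMod Bᵐᵒᵖ}
    (h : IsIndecSummand B L (ModuleCat.of _ (∀ j, N j))) : ∃ j, Nonempty (L ≃ₗ[Bᵐᵒᵖ] N j) := by
  classical
  obtain ⟨⟨h1, h2⟩, L', ⟨e⟩⟩ := h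
  obtain ⟨j, hb⟩ := exists_bijective_of_pi loc hN (e.symm.toLinearMap ∘ₗ LinearMap.inl _ L L')
    (LinearMap.fst _ L L' ∘ₗ e.toLinearMap) (by ext x; simp)
  refine ⟨j, ?_⟩
  let i : L →ₗ[Bᵐᵒᵖ] N j := LinearMap.proj j ∘ₗ (e.symm.toLinearMap ∘ₗ LinearMap.inl _ L L')
  let p : N j →ₗ[Bᵐᵒᵖ] L := (LinearMap.fst _ L L' ∘ₗ e.toLinearMap) ∘ₗ
    LinearMap.single _ (fun j => N j) j
  let w : N j ≃ₗ[Bᵐᵒᵖ] N j := LinearEquiv.ofBijective (i ∘ₗ p) hb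
  have hpi : Function.Surjective i := Function.Surjective.of_comp (g := p) hb.2
  let p' : N j →ₗ[Bᵐᵒᵖ] L := p ∘ₗ w.symm.toLinearMap
  have hip (x) : i (p' x) = x := w.apply_symm_apply x
  let E : L ≃ₗ[Bᵐᵒᵖ] (N j × LinearMap.ker i) :=
    { toFun := fun x => (i x, ⟨x - p' (i x), by rw [LinearMap.mem_ker, map_sub, hip, sub_self]⟩)
      map_add' := fun x y => by
        ext
        · simp
        · simp only [map_add]
          change _ = (x - p' (i x)) + (y - p' (i y))
          abel
      map_smul' := fun c x => by
        ext
        · simp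
        · simp only [map_smul]
          change _ = c • (x - p' (i x))
          rw [smul_sub]
      invFun := fun y => p' y.1 + y.2.1
      left_inv := fun x => by simp
      right_inv := fun y => by
        have hy : i y.2.1 = 0 := y.2.2
        ext
        · simp [hip, hy]
        · simp [hip, hy] }
  rcases h2 (N j) (ModuleCat.of _ (LinearMap.ker i)) ⟨E⟩ with h3 | h3
  · refine absurd ?_ (loc j).1
    ext x
    exact Subsingleton.elim _ _
  · refine ⟨LinearEquiv.ofBijective i ⟨?_, hpi⟩⟩
    rw [← LinearMap.ker_eq_bot]
    exact Submodule.eq_bot_of_subsingleton (p := LinearMap.ker i)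

include loc hN in
lemma numIndecSummandsIs_pi : NumIndecSummandsIs B (ModuleCat.of _ (∀ j, N j)) (Fintype.card J) := by
  classical
  let σ := Fintype.equivFin J
  refine ⟨fun i => N (σ.symm i), fun i => ⟨indecomposableMod_of_localObj loc _, ?_⟩,
    fun i j hij => ⟨fun e => ?_⟩, fun L hL => ?_⟩
  · let j := σ.symm i
    refine ⟨ModuleCat.of _ (∀ l : {l // l ≠ j}, N l.1), ⟨?_⟩⟩
    exact
    { toFun := fun x => (x j, fun l => x l.1)
      map_add' := fun x y => rfl
      map_smul' := fun x y => rfl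
      invFun := fun y l => if h : l = j then cast (by rw [h]) y.1 else y.2 ⟨l, h⟩
      left_inv := fun x => by
        ext l
        by_cases h : l = j
        · subst h
          simp
        · simp [h]
      right_inv := fun y => by
        ext l
        · simp
        · simp [l.2] }
  · exact hij (σ.symm.injective (hN _ _ ⟨e.toModuleIso⟩))
  · obtain ⟨j, hj⟩ := exists_equiv_of_isIndecSummand loc hN hL
    refine ⟨σ j, ?_⟩
    change Nonempty (L ≃ₗ[Bᵐᵒᵖ] N (σ.symm (σ j)))
    rw [σ.symm_apply_apply]
    exact hj

end

lemma finite_of_superfluous {S P M : Type} [Ring S] [AddCommGroup P] [Module S P]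
    [AddCommGroup M] [Module S M] [Module.Finite S M] (g : P →ₗ[S] M)
    (hg : Function.Surjective g) (hs : SuperfluousSubmodule (LinearMap.ker g)) :
    Module.Finite S P := by
  classical
  obtain ⟨s, hs'⟩ := Module.Finite.fg_top (R := S) (M := M)
  choose c hc using hg
  refine ⟨⟨s.image c, hs _ ?_⟩⟩
  rw [sup_comm, ← Submodule.comap_map_eq, Submodule.map_span, Finset.coe_image, Set.image_image]
  simp only [hc, Set.image_id']
  rw [hs', Submodule.comap_top]

/-- Every module morphism to `Y` from the kernel of a surjection onto `M` extends. -/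
def ExtZero (S M Y : Type) [Ring S] [AddCommGroup M] [Module S M] [AddCommGroup Y]
    [Module S Y] : Prop :=
  ∀ (P : Type) [AddCommGroup P] [Module S P] (g : P →ₗ[S] M), Function.Surjective g →
    ∀ u : LinearMap.ker g →ₗ[S] Y, ∃ v : P →ₗ[S] Y, v ∘ₗ (LinearMap.ker g).subtype = u

/-- All `ExtZero` conditions for the quotients of a module. -/
def ExtSurj (S M : Type) [Ring S] [AddCommGroup M] [Module S M] : Prop :=
  ∀ (Y : Type) [AddCommGroup Y] [Module S Y] (q : M →ₗ[S] Y), Function.Surjective q →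
    ExtZero S M Y

lemma ExtSurj.exists_factor {S M P₁ P₀ : Type} [Ring S] [AddCommGroup M] [Module S M]
    [AddCommGroup P₁] [Module S P₁] [AddCommGroup P₀] [Module S P₀] [Module.Projective S P₀]
    (h : ExtSurj S M) {f : P₁ →ₗ[S] P₀} {g : P₀ →ₗ[S] M}
    (hg : Function.Surjective g) (hfg : LinearMap.range f = LinearMap.ker g)
    (hs : SuperfluousSubmodule (LinearMap.ker f)) (u : P₁ →ₗ[S] M) :
    ∃ v : P₀ →ₗ[S] M, v ∘ₗ f = u := by
  let K := (LinearMap.ker f).map u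
  let f' : P₁ →ₗ[S] LinearMap.ker g := f.codRestrict _ fun x => hfg ▸ ⟨x, rfl⟩
  have hf' : Function.Surjective f' := fun ⟨y, hy⟩ => by
    rw [← hfg] at hy
    obtain ⟨x, rfl⟩ := hy
    exact ⟨x, rfl⟩
  have hker : LinearMap.ker f' ≤ LinearMap.ker (K.mkQ ∘ₗ u) := fun x hx => by
    rw [LinearMap.mem_ker, LinearMap.comp_apply, Submodule.mkQ_apply, Submodule.Quotient.mk_eq_zero]
    exact ⟨x, congrArg Subtype.val hx, rfl⟩
  let q := f'.quotKerEquivOfSurjective hf'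
  let w : LinearMap.ker g →ₗ[S] (M ⧸ K) := (LinearMap.ker f').liftQ _ hker ∘ₗ q.symm.toLinearMap
  have hw (x) : w (f' x) = K.mkQ (u x) := by
    have : q.symm (f' x) = Submodule.Quotient.mk x := q.symm_apply_eq.2 rfl
    change (LinearMap.ker f').liftQ _ hker (q.symm (f' x)) = _
    rw [this]
    rfl
  obtain ⟨v', hv'⟩ := h _ K.mkQ K.mkQ_surjective P₀ g hg w
  obtain ⟨v, hv⟩ := Module.projective_lifting_property K.mkQ v' K.mkQ_surjective
  refine ⟨v, ?_⟩
  have h1 (x) : u x - v (f x) ∈ K := by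
    rw [← Submodule.Quotient.mk_eq_zero, ← Submodule.mkQ_apply, map_sub, ← hw, ← hv', sub_eq_zero]
    exact (LinearMap.congr_fun hv (f x)).symm
  have h2 : LinearMap.ker (u - v ∘ₗ f) = ⊤ := by
    refine hs _ (eq_top_iff.2 fun x _ => ?_)
    obtain ⟨y, hy, hyx⟩ := h1 x
    refine Submodule.mem_sup.2 ⟨y, hy, x - y, ?_, by abel⟩
    have hy' : f y = 0 := hy
    rw [LinearMap.mem_ker, LinearMap.sub_apply, LinearMap.comp_apply, map_sub, map_sub, hy', sub_zero,
      hyx]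
    abel
  rw [LinearMap.ker_eq_top, sub_eq_zero] at h2
  exact h2.symm

section
variable {k B : Type} [Field k] [Ring B] [Algebra k B]

lemma exists_dual_basis (P : Type) [AddCommGroup P] [Module Bᵐᵒᵖ P] [Module.Finite Bᵐᵒᵖ P]
    [Module.Projective Bᵐᵒᵖ P] : ∃ (n : ℕ) (x : Fin n → P) (φ : Fin n → (P →ₗ[Bᵐᵒᵖ] B)),
      ∀ p, ∑ i, op (φ i p) • x i = p := by
  obtain ⟨n, π, hπ⟩ := Module.Finite.exists_fin' Bᵐᵒᵖ P
  obtain ⟨s, hs⟩ := Module.projective_lifting_property π LinearMap.id hπ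
  let ψ : Bᵐᵒᵖ →ₗ[Bᵐᵒᵖ] B :=
    { toFun := unop
      map_add' := fun _ _ => rfl
      map_smul' := fun _ _ => rfl }
  refine ⟨n, fun i => π (Pi.single i 1), fun i => ψ ∘ₗ LinearMap.proj i ∘ₗ s, fun p => ?_⟩
  have h1 : π (s p) = p := LinearMap.congr_fun hs p
  conv_rhs => rw [← h1, ← Finset.univ_sum_single (s p), map_sum]
  refine Finset.sum_congr rfl fun i _ => ?_
  rw [← map_smul]
  congr 1
  rw [← Pi.single_smul]
  congr 1
  exact mul_one _

lemma isTauRigid_of_extSurj [IsNoetherianRing Bᵐᵒᵖ] (M : RMod Bᵐᵒᵖ)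
    [Module.Finite Bᵐᵒᵖ M] (h : ExtSurj Bᵐᵒᵖ M) :
    IsTauRigid k B M := by
  rintro P₁ P₀ f g ⟨hP₁, hP₀, hg, hfg, hsg, hsf⟩ β hβ hβf
  have hf₀ : Module.Finite Bᵐᵒᵖ P₀ := finite_of_superfluous g hg hsg
  have hf₁ : Module.Finite Bᵐᵒᵖ P₁ := by
    refine finite_of_superfluous f.rangeRestrict f.surjective_rangeRestrict ?_
    rwa [LinearMap.ker_rangeRestrict]
  obtain ⟨n, x, φ, hφ⟩ := exists_dual_basis (B := B) P₁
  obtain ⟨m, y, ψ, hψ⟩ := exists_dual_basis (B := B) P₀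
  ext a c
  let u : P₁ →ₗ[Bᵐᵒᵖ] M :=
    { toFun := fun p => op (c p) • a
      map_add' := fun p q => by rw [map_add, MulOpposite.op_add, add_smul]
      map_smul' := fun r p => by
        rw [map_smul, RingHom.id_apply, ← mul_smul, MulOpposite.smul_eq_mul_unop, MulOpposite.op_mul, op_unop] }
  obtain ⟨v, hv⟩ := h.exists_factor hg hfg hsf u
  have h1 : c = ∑ j, leftMulHom B (c (x j)) (φ j) := by
    ext p
    rw [LinearMap.sum_apply]
    conv_lhs => rw [← hφ p, map_sum]
    refine Finset.sum_congr rfl fun j _ => ?_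
    rw [map_smul, MulOpposite.smul_eq_mul_unop, unop_op]
    rfl
  have h2 (i) : ψ i ∘ₗ f = ∑ j, leftMulHom B (ψ i (f (x j))) (φ j) := by
    ext p
    rw [LinearMap.sum_apply]
    conv_lhs => rw [← hφ p, map_sum]
    refine Finset.sum_congr rfl fun j _ => ?_
    rw [map_smul, MulOpposite.smul_eq_mul_unop, unop_op]
    rfl
  have h3 (j) : op (c (x j)) • a = ∑ i, op (ψ i (f (x j))) • v (y i) := by
    have h4 : u (x j) = v (f (x j)) := (LinearMap.congr_fun hv (x j)).symm
    refine h4.trans ?_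
    conv_lhs => rw [← hψ (f (x j)), map_sum]
    exact Finset.sum_congr rfl fun i _ => map_smul v _ _
  conv_lhs => rw [h1, map_sum]
  simp only [← hβ, h3, map_sum, LinearMap.sum_apply]
  simp only [hβ]
  rw [Finset.sum_comm]
  refine Finset.sum_eq_zero fun i _ => ?_
  rw [← map_sum, ← h2]
  exact hβf _ _
end

section
variable {A C : Type} [Ring A] [Ring C] {π : A →+* C}

/-- A linear map over the target of a surjective ring morphism. -/
def descLin (hπ : Function.Surjective π) {M N : Type} [AddCommGroup M] [Module A M] [Module C M]
    [AddCommGroup N] [Module A N] [Module C N] (hM : ∀ (a : A) (m : M), π a • m = a • m)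
    (hN : ∀ (a : A) (m : N), π a • m = a • m) (f : M →ₗ[A] N) : M →ₗ[C] N where
  toFun := f
  map_add' := f.map_add
  map_smul' c m := by
    obtain ⟨a, rfl⟩ := hπ c
    rw [hM, f.map_smul, RingHom.id_apply, hN]

/-- Restriction of a linear map along a ring morphism. -/
def resLin {M N : Type} [AddCommGroup M] [Module A M] [Module C M]
    [AddCommGroup N] [Module A N] [Module C N] (hM : ∀ (a : A) (m : M), π a • m = a • m)
    (hN : ∀ (a : A) (m : N), π a • m = a • m) (f : M →ₗ[C] N) : M →ₗ[A] N where
  toFun := f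
  map_add' := f.map_add
  map_smul' a m := by rw [← hM, f.map_smul, RingHom.id_apply, hN]

lemma ExtSurj.desc (hπ : Function.Surjective π) {M : Type} [AddCommGroup M] [Module A M]
    [Module C M] (hM : ∀ (a : A) (m : M), π a • m = a • m) (h : ExtSurj A M) : ExtSurj C M := by
  intro Y _ _ q hq P _ _ g hg u
  let _ : Module A Y := Module.compHom Y π
  let _ : Module A P := Module.compHom P π
  have hY : ∀ (a : A) (m : Y), π a • m = a • m := fun _ _ => rfl
  have hP : ∀ (a : A) (m : P), π a • m = a • m := fun _ _ => rfl
  let g' := resLin hP hM g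
  let u' : LinearMap.ker g' →ₗ[A] Y :=
    { toFun := fun x => u ⟨x.1, x.2⟩
      map_add' := fun x y => u.map_add ⟨x.1, x.2⟩ ⟨y.1, y.2⟩
      map_smul' := fun a x => u.map_smul (π a) ⟨x.1, x.2⟩ }
  obtain ⟨v, hv⟩ := h Y (resLin hM hY q) hq P g' hg u'
  refine ⟨descLin hπ hP hY v, ?_⟩
  ext ⟨x, hx⟩
  exact LinearMap.congr_fun hv ⟨x, hx⟩

lemma isIso_moduleCat_iff {M N : Type} [AddCommGroup M] [Module A M] [AddCommGroup N] [Module A N]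
    (f : M →ₗ[A] N) : IsIso (ModuleCat.ofHom f) ↔ Function.Bijective f :=
  ConcreteCategory.isIso_iff_bijective (ModuleCat.ofHom f)

lemma LocalObj.desc {M : Type} [AddCommGroup M] [Module A M]
    [Module C M] (hM : ∀ (a : A) (m : M), π a • m = a • m) (h : LocalObj (ModuleCat.of A M)) :
    LocalObj (ModuleCat.of C M) := by
  constructor
  · intro h0
    refine h.1 ?_
    ext m
    have := congrArg (fun f : ModuleCat.of C M ⟶ ModuleCat.of C M => f.hom m) h0
    exact this
  · intro f
    have h1 : IsIso f ↔ Function.Bijective f.hom := isIso_moduleCat_iff f.hom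
    have h2 : IsIso (𝟙 _ - f) ↔ Function.Bijective (LinearMap.id - f.hom : M →ₗ[C] M) :=
      isIso_moduleCat_iff (LinearMap.id - f.hom)
    have h3 := (h.2 (ModuleCat.ofHom (resLin hM hM f.hom)))
    have h4 : 𝟙 _ - ModuleCat.ofHom (resLin hM hM f.hom) =
      ModuleCat.ofHom (LinearMap.id - resLin hM hM f.hom) := rfl
    rw [h4, isIso_moduleCat_iff, isIso_moduleCat_iff] at h3
    rw [h1, h2]
    exact h3

end

section
variable {k B ι : Type} [Field k] [Ring B] [Algebra k B]

lemma IdemData.eq_of_iso (D : IdemData k Bᵐᵒᵖ ι) {i j : ι} (h : D.L i ≃ₗ[Bᵐᵒᵖ] D.L j) : i = j := by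
  by_contra hij
  have h1 := D.hom_ne i j (D.p i ≫ h.toModuleIso.hom) hij
  have h2 : D.p i = 0 := by
    rw [← cancel_mono h.toModuleIso.hom, h1, zero_comp]
  have := D.simple i
  have := IsSimpleModule.nontrivial Bᵐᵒᵖ (D.L i)
  obtain ⟨y, hy⟩ := exists_ne (0 : D.L i)
  obtain ⟨x, hx⟩ := D.p_surj i y
  rw [h2] at hx
  exact hy hx.symm

lemma IdemData.p_x_ne_zero (D : IdemData k Bᵐᵒᵖ ι) (i : ι) : D.p i (D.x i) ≠ 0 := by
  intro h
  have h2 : D.p i = 0 := D.hom_ext _ _ _ _ (h.trans rfl)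
  have := D.simple i
  have := IsSimpleModule.nontrivial Bᵐᵒᵖ (D.L i)
  obtain ⟨y, hy⟩ := exists_ne (0 : D.L i)
  obtain ⟨x, hx⟩ := D.p_surj i y
  rw [h2] at hx
  exact hy hx.symm

lemma IdemData.smul_eq_zero (D : IdemData k Bᵐᵒᵖ ι) {i : ι} (M : RMod Bᵐᵒᵖ)
    (h : ∀ f : D.P i ⟶ M, f = 0) (m : M) : D.e i • m = 0 := by
  obtain ⟨f, hf⟩ := D.lift i M (D.e i • m) (by rw [← mul_smul, (D.orth.idem i).eq])
  rw [← hf, h f]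
  rfl

/-- The sum of some of the idempotents. -/
def IdemData.sumE (D : IdemData k Bᵐᵒᵖ ι) (E : Finset ι) : B := unop (∑ l ∈ E, D.e l)

lemma IdemData.sumE_idem (D : IdemData k Bᵐᵒᵖ ι) (E : Finset ι) :
    IsIdempotentElem (D.sumE E) := by
  have h : IsIdempotentElem (∑ l ∈ E, D.e l) := D.orth.isIdempotentElem_sum
  exact congrArg unop h.eq

lemma IdemQuot.mk_surjective (e : B) : Function.Surjective (IdemQuot.mk B e) :=
  fun x => Quotient.inductionOn x fun a => ⟨a, rfl⟩

lemma IdemQuot.mk_self (e : B) : IdemQuot.mk B e e = 0 :=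
  Quotient.sound (TwoSidedIdeal.subset_span (Set.mem_singleton e))

lemma IdemQuot.smul_eq_zero {M : Type} [AddCommGroup M] [Module Bᵐᵒᵖ M] (e : B)
    (he : ∀ m : M, op e • m = 0) (b : B) (hb : IdemQuot.mk B e b = 0) (m : M) : op b • m = 0 := by
  let I : TwoSidedIdeal B := TwoSidedIdeal.mk' {b | ∀ m : M, op b • m = 0}
    (fun m => zero_smul _ m)
    (fun {x y} hx hy m => by rw [MulOpposite.op_add, add_smul, hx, hy, add_zero])
    (fun {x} hx m => by rw [MulOpposite.op_neg, neg_smul, hx, neg_zero])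
    (fun {x y} hy m => by rw [MulOpposite.op_mul, mul_smul, hy])
    (fun {x y} hx m => by rw [MulOpposite.op_mul, mul_smul, hx, smul_zero])
  have h1 : TwoSidedIdeal.span {e} ≤ I := TwoSidedIdeal.span_le.2 fun x hx => by
    rw [Set.mem_singleton_iff.1 hx]
    exact (TwoSidedIdeal.mem_mk' ..).2 he
  have h2 : b ∈ TwoSidedIdeal.span {e} := Quotient.exact hb
  exact (TwoSidedIdeal.mem_mk' ..).1 (h1 h2) m

/-- Modules killed by an idempotent, as modules over the quotient. -/
@[reducible] def idemQuotModule (M : Type) [AddCommGroup M] [Module Bᵐᵒᵖ M] (e : B)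
    (he : ∀ m : M, op e • m = 0) : Module (IdemQuot B e)ᵐᵒᵖ M :=
  have key (a b : B) (m : M) (h : IdemQuot.mk B e a = IdemQuot.mk B e b) : op a • m = op b • m := by
    rw [← sub_eq_zero, ← sub_smul, ← MulOpposite.op_sub]
    exact IdemQuot.smul_eq_zero e he _ (by rw [map_sub, h, sub_self]) m
  let s := Function.surjInv (IdemQuot.mk_surjective e)
  have hs := Function.surjInv_eq (IdemQuot.mk_surjective e)
  { smul := fun c m => op (s (unop c)) • m
    one_smul := fun m => (key _ 1 m (by rw [hs, map_one]; rfl)).trans (one_smul _ m)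
    mul_smul := fun c d m => (key _ (s (unop d) * s (unop c)) m (by
      rw [hs, map_mul, hs, hs]; rfl)).trans (mul_smul (op (s (unop c))) (op (s (unop d))) m)
    smul_zero := fun c => smul_zero (op (s (unop c)))
    smul_add := fun c => smul_add (op (s (unop c)))
    add_smul := fun c d m => (key _ (s (unop c) + s (unop d)) m (by
      rw [hs, map_add, hs, hs]; rfl)).trans (add_smul (op (s (unop c))) (op (s (unop d))) m)
    zero_smul := fun m => (key _ 0 m (by rw [hs, map_zero]; rfl)).trans (zero_smul _ m) }

lemma idemQuotModule_smul (M : Type) [AddCommGroup M] [Module Bᵐᵒᵖ M] (e : B)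
    (he : ∀ m : M, op e • m = 0) (b : Bᵐᵒᵖ) (m : M) :
    let _ := idemQuotModule M e he
    RingHom.op (IdemQuot.mk B e) b • m = b • m := by
  intro _
  refine sub_eq_zero.1 ?_
  change op (Function.surjInv (IdemQuot.mk_surjective e) (IdemQuot.mk B e (unop b))) • m - b • m = 0
  have h := IdemQuot.smul_eq_zero e he
    (Function.surjInv (IdemQuot.mk_surjective e) (IdemQuot.mk B e (unop b)) - unop b)
    (by rw [map_sub, Function.surjInv_eq (IdemQuot.mk_surjective e), sub_self]) m
  rw [MulOpposite.op_sub, sub_smul] at h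
  exact h

lemma isSimpleModule_of_smul {A C : Type} [Ring A] [Ring C] {π : A →+* C}
    (hπ : Function.Surjective π) {M : Type} [AddCommGroup M] [Module A M] [Module C M]
    (hM : ∀ (a : A) (m : M), π a • m = a • m) : IsSimpleModule A M ↔ IsSimpleModule C M := by
  rw [isSimpleModule_iff_toSpanSingleton_surjective, isSimpleModule_iff_toSpanSingleton_surjective]
  refine and_congr_right fun _ => forall₂_congr fun m _ => ?_
  constructor
  · intro h x
    obtain ⟨a, rfl⟩ := h x
    exact ⟨π a, hM a m⟩
  · intro h x
    obtain ⟨c, rfl⟩ := h x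
    obtain ⟨a, rfl⟩ := hπ c
    exact ⟨a, (hM a m).symm⟩

lemma op_mk_surjective (e : B) : Function.Surjective (RingHom.op (IdemQuot.mk B e)) := fun c => by
  obtain ⟨b, hb⟩ := IdemQuot.mk_surjective e (unop c)
  exact ⟨op b, congrArg op hb⟩

lemma IdemData.sumE_smul (D : IdemData k Bᵐᵒᵖ ι) {E : Finset ι} (M : RMod Bᵐᵒᵖ)
    (h : ∀ l ∈ E, ∀ f : D.P l ⟶ M, f = 0) (m : M) : op (D.sumE E) • m = 0 := by
  change (∑ l ∈ E, D.e l) • m = 0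
  rw [Finset.sum_smul]
  exact Finset.sum_eq_zero fun l hl => D.smul_eq_zero M (h l hl) m

variable [DecidableEq ι] [Fintype ι]

lemma IdemData.rankK0Is (D : IdemData k Bᵐᵒᵖ ι) (E : Finset ι) :
    RankK0Is (IdemQuot B (D.sumE E)) (Fintype.card {l // l ∉ E}) := by
  have hL (l) (hl : l ∉ E) (m : D.L l) : op (D.sumE E) • m = 0 :=
    D.sumE_smul (D.L l) (fun i hi f => D.hom_ne i l f fun h => hl (h ▸ hi)) m
  let σ := (Fintype.equivFin {l // l ∉ E}).symm
  let inst (l : {l // l ∉ E}) := idemQuotModule (D.L l.1) (D.sumE E) (hL l.1 l.2)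
  have hs (l : {l // l ∉ E}) (b : Bᵐᵒᵖ) (m : D.L l.1) :
      RingHom.op (IdemQuot.mk B (D.sumE E)) b • m = b • m := idemQuotModule_smul _ _ (hL l.1 l.2) b m
  refine ⟨fun i => ModuleCat.of _ (D.L (σ i).1), fun i => ?_, fun i j hij => ⟨fun f => hij ?_⟩,
    fun T hT => ?_⟩
  · exact (isSimpleModule_of_smul (op_mk_surjective (D.sumE E)) (hs _)).1 (D.simple _)
  · refine σ.injective (Subtype.ext (D.eq_of_iso
      (LinearEquiv.ofBijective (resLin (hs _) (hs _) f.toLinearMap) f.bijective)))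
  · let _ : Module Bᵐᵒᵖ T := Module.compHom T (RingHom.op (IdemQuot.mk B (D.sumE E)))
    have hT' : ∀ (b : Bᵐᵒᵖ) (m : T), RingHom.op (IdemQuot.mk B (D.sumE E)) b • m = b • m :=
      fun _ _ => rfl
    have := (isSimpleModule_of_smul (op_mk_surjective (D.sumE E)) hT').2 hT
    obtain ⟨l, ⟨f⟩⟩ := D.exists_iso T
    have hl : l ∉ E := fun hl => by
      have h1 : D.e l • D.p l (D.x l) = D.p l (D.x l) := by
        rw [← map_smul, D.x_smul]
      obtain ⟨t, ht⟩ := f.surjective (D.p l (D.x l))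
      refine D.p_x_ne_zero l ?_
      rw [← h1, ← ht, ← f.map_smul]
      have h2 : D.e l = op (D.sumE E) * D.e l := by
        change _ = (∑ i ∈ E, D.e i) * D.e l
        rw [Finset.sum_mul, Finset.sum_eq_single l, (D.orth.idem l).eq]
        · exact fun i _ hi => D.orth.ortho hi
        · exact fun h => (h hl).elim
      rw [h2, mul_smul, ← hT' (op (D.sumE E))]
      have h3 : RingHom.op (IdemQuot.mk B (D.sumE E)) (op (D.sumE E)) = 0 :=
        congrArg op (IdemQuot.mk_self _)
      rw [h3, zero_smul, map_zero]
    refine ⟨σ.symm ⟨l, hl⟩, ?_⟩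
    have key : ∀ l' : {l // l ∉ E}, l' = ⟨l, hl⟩ → Nonempty (T ≃ₗ[(IdemQuot B (D.sumE E))ᵐᵒᵖ] D.L l'.1) := by
      rintro _ rfl
      let g := descLin (op_mk_surjective (D.sumE E)) hT' (hs ⟨l, hl⟩) f.toLinearMap
      have hg : Function.Bijective g := f.bijective
      exact ⟨LinearEquiv.ofBijective g hg⟩
    exact key _ (σ.apply_symm_apply _)

theorem IdemData.isSupportTauTilting_pi [FiniteDimensional k B] (D : IdemData k Bᵐᵒᵖ ι)
    (E : Finset ι) {J : Type} [Fintype J] (N : J → RMod Bᵐᵒᵖ)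
    (hfin : ∀ j, Module.Finite Bᵐᵒᵖ (N j)) (loc : ∀ j, LocalObj (N j))
    (hN : ∀ i j, Nonempty (N i ≅ N j) → i = j) (hext : ExtSurj Bᵐᵒᵖ (∀ j, N j))
    (hE : ∀ l ∈ E, ∀ j (f : D.P l ⟶ N j), f = 0) (hc : Fintype.card J = Fintype.card {l // l ∉ E}) :
    IsSupportTauTilting k B (ModuleCat.of Bᵐᵒᵖ (∀ j, N j)) := by
  have hL (j) (m : N j) : op (D.sumE E) • m = 0 := D.sumE_smul (N j) (fun l hl f => hE l hl j f) m
  let inst (j : J) := idemQuotModule (N j) (D.sumE E) (hL j)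
  have hs (j : J) (b : Bᵐᵒᵖ) (m : N j) :
      RingHom.op (IdemQuot.mk B (D.sumE E)) b • m = b • m := idemQuotModule_smul _ _ (hL j) b m
  have hs' (b : Bᵐᵒᵖ) (m : ∀ j, N j) :
      RingHom.op (IdemQuot.mk B (D.sumE E)) b • m = b • m := funext fun j => hs j b (m j)
  have hB : IsNoetherianRing Bᵐᵒᵖ := isNoetherian_of_tower k inferInstance
  have hC : IsNoetherianRing (IdemQuot B (D.sumE E))ᵐᵒᵖ :=
    isNoetherianRing_of_surjective _ _ _ (op_mk_surjective (D.sumE E))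
  have hf : Module.Finite (IdemQuot B (D.sumE E))ᵐᵒᵖ (∀ j, N j) := by
    obtain ⟨s, h⟩ := (inferInstance : Module.Finite Bᵐᵒᵖ (∀ j, N j))
    refine ⟨s, eq_top_iff.2 fun x _ => ?_⟩
    have hx : x ∈ Submodule.span Bᵐᵒᵖ (s : Set (∀ j, N j)) := h ▸ Submodule.mem_top
    induction hx using Submodule.span_induction with
    | mem x hx => exact Submodule.subset_span hx
    | zero => exact zero_mem _
    | add x y _ _ hx hy => exact add_mem (hx trivial) (hy trivial)
    | smul a x _ hx =>
      rw [← hs']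
      exact Submodule.smul_mem _ _ (hx trivial)
  refine ⟨D.sumE E, D.sumE_idem E, ModuleCat.of _ (∀ j, N j), ⟨hf, ?_, _, ?_, D.rankK0Is E⟩, ?_⟩
  · exact isTauRigid_of_extSurj (ModuleCat.of (IdemQuot B (D.sumE E))ᵐᵒᵖ (∀ j, N j))
      (hext.desc (op_mk_surjective (D.sumE E)) hs')
  · rw [← hc]
    refine numIndecSummandsIs_pi (B := IdemQuot B (D.sumE E))
      (N := fun j => ModuleCat.of (IdemQuot B (D.sumE E))ᵐᵒᵖ (N j))
      (fun j => (loc j).desc (hs j)) fun i j ⟨f⟩ => hN i j ⟨?_⟩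
    exact (LinearEquiv.ofBijective (resLin (hs i) (hs j) f.toLinearEquiv.toLinearMap)
      f.toLinearEquiv.bijective).toModuleIso
  · refine ⟨@LinearEquiv.mk _ _ _ _ _ _ _ _ _ _ _ _ _ (Module.compHom _ _)
      (@LinearMap.mk _ _ _ _ _ _ _ _ _ _ (Module.compHom _ _) (AddHom.mk id fun _ _ => rfl)
        fun a m => (hs' a m).symm) id (fun _ => rfl) (fun _ => rfl)⟩

end

section
variable {𝒞 𝒟 : Type*} [Category* 𝒞] [Preadditive 𝒞] [Category* 𝒟] [Preadditive 𝒟]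

lemma LocalObj.map {X : 𝒞} (h : LocalObj X) (F : 𝒞 ⥤ 𝒟) [F.Additive] [F.Full] [F.Faithful] :
    LocalObj (F.obj X) := by
  refine ⟨fun h0 => h.1 (F.map_injective ?_), fun f => ?_⟩
  · rw [CategoryTheory.Functor.map_id, h0, Functor.map_zero]
  · obtain ⟨f, rfl⟩ := F.map_surjective f
    rw [← CategoryTheory.Functor.map_id, ← Functor.map_sub]
    obtain h | h := h.2 f
    · exact .inl inferInstance
    · exact .inr inferInstance

end

section
open DerivedCategory Pretriangulated
variable {R : Type} [Ring R] [HasDMod R]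
variable {k : Type} [Field k] [Algebra k R] {ι : Type}

lemma isLE_pred_of_top {Z X : DMod R} {m : ℤ} {H : RMod R}
    {f : X ⟶ Z} {g : Z ⟶ sg m H} {h : sg m H ⟶ X⟦(1 : ℤ)⟧} (hX : X.IsLE (m - 1))
    (hT : Triangle.mk f g h ∈ distTriang _) (hH : 𝟙 H = 0) : Z.IsLE (m - 1) := by
  have h2 : IsZero (sg m H) := (singleFunctor (RMod R) m).map_isZero
    ((IsZero.iff_id_eq_zero H).2 hH)
  refine isLE_obj₂ hT (m - 1) hX ((isLE_iff _ _).2 fun i _ =>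
    (homologyFunctor (RMod R) i).map_isZero h2)

lemma top_eq_zero {Z X : DMod R} {m : ℤ} {H : RMod R}
    {f : X ⟶ Z} {g : Z ⟶ sg m H} {h : sg m H ⟶ X⟦(1 : ℤ)⟧} (hX : X.IsLE (m - 1))
    (hT : Triangle.mk f g h ∈ distTriang _) (hg : g = 0) : 𝟙 H = 0 :=
  top_factor_unique hX hT (by rw [hg, zero_comp, zero_comp])

/-- Maps from perfect complexes lift through epimorphisms in the lowest degree. -/
lemma Built.exists_lift {D : ProjData k R ι} {m b : ℤ} {Z : DMod R}
    (hZ : Built D m b Z) {P L : RMod R} (p : P ⟶ L) [Epi p] (u : Z ⟶ sg m L) :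
    ∃ v : Z ⟶ sg m P, u = v ≫ (singleFunctor (RMod R) m).map p := by
  obtain ⟨C, a, c, hT⟩ := distinguished_cocone_triangle ((singleFunctor (RMod R) m).map p)
  have hP : (sg m P).IsLE m := inferInstance
  have hL : (sg m L).IsLE m := inferInstance
  have hC : C.IsLE m := isLE_obj₃ hT m (TStructure.t.isLE_of_le (sg m P) m (m + 1)) hL
  have hC' : C.IsLE (m - 1) := by
    obtain ⟨X, H, f, g, h, hX, hT'⟩ := exists_top_triangle C m
    refine isLE_pred_of_top hX hT' (top_eq_zero hX hT' ?_)
    obtain ⟨ψ, hψ⟩ := (singleFunctor (RMod R) m).map_surjective (a ≫ g)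
    have h1 : p ≫ ψ = 0 := (singleFunctor (RMod R) m).map_injective (by
      rw [Functor.map_comp, hψ, ← Category.assoc, dist_comp₁₂ hT, zero_comp, Functor.map_zero])
    have h2 : a ≫ g = 0 := by
      rw [← hψ, (cancel_epi p).1 (h1.trans comp_zero.symm), Functor.map_zero]
    obtain ⟨w, rfl⟩ := dist_yo₃ hT g h2
    have : ((sg m P)⟦(1 : ℤ)⟧).IsLE (m - 1) := TStructure.t.isLE_shift _ m 1 (m - 1)
    rw [TStructure.t.zero w (m - 1) m, comp_zero]
  exact dist_co₂ hT u (hZ.hom_eq_zero hC' _)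

/-- A two-term complex with its top homology. -/
structure TopTri (S : DMod R) where
  X : DMod R
  N : RMod R
  f : X ⟶ S
  g : S ⟶ sg 0 N
  h : sg 0 N ⟶ X⟦(1 : ℤ)⟧
  isLE : X.IsLE (-1)
  dist : Triangle.mk f g h ∈ distTriang _

variable {D : ProjData k R ι} {S S' W : DMod R}

lemma Built.exists_topTri (hS : Built D (-1) 0 S) : Nonempty (TopTri S) := by
  have := hS.isLE
  obtain ⟨X, H, f, g, h, hX, hT⟩ := exists_top_triangle S 0
  exact ⟨⟨X, H, f, g, h, hX, hT⟩⟩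

lemma TopTri.factor (T : TopTri S) {M : RMod R} (u : S ⟶ sg 0 M) :
    ∃ φ : T.N ⟶ M, u = T.g ≫ (singleFunctor (RMod R) 0).map φ :=
  exists_top_factor T.isLE T.dist u

lemma TopTri.factor_unique (T : TopTri S) {M : RMod R} {φ ψ : T.N ⟶ M}
    (h : T.g ≫ (singleFunctor (RMod R) 0).map φ =
      T.g ≫ (singleFunctor (RMod R) 0).map ψ) : φ = ψ :=
  top_factor_unique T.isLE T.dist h

lemma TopTri.isLE_shift (T : TopTri S) : (T.X⟦(1 : ℤ)⟧).IsLE (-2) :=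
  have := T.isLE
  TStructure.t.isLE_shift T.X (-1) 1 (-2)

lemma TopTri.exists_lift (T : TopTri S) (hW : Built D (-1) 0 W) (u : W ⟶ sg 0 T.N) :
    ∃ v : W ⟶ S, u = v ≫ T.g :=
  dist_co₃ T.dist u (hW.hom_eq_zero T.isLE_shift _)

lemma TopTri.exists_lift_shift (T : TopTri S) (hW : Built D (-1) 0 W)
    (u : W ⟶ (sg 0 T.N)⟦(1 : ℤ)⟧) : ∃ v : W ⟶ S⟦(1 : ℤ)⟧, u = v ≫ T.g⟦(1 : ℤ)⟧' := by
  have h1 : (T.X⟦(1 : ℤ)⟧⟦(1 : ℤ)⟧).IsLE (-2) := by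
    have := T.isLE_shift
    have := TStructure.t.isLE_shift (T.X⟦(1 : ℤ)⟧) (-2) 1 (-3)
    exact TStructure.t.isLE_of_le _ (-3) (-2)
  obtain ⟨v, hv⟩ := dist_co₁ (rot_of_distTriang _ (rot_of_distTriang _ T.dist)) u
    (hW.hom_eq_zero h1 _)
  refine ⟨-(show W ⟶ S⟦(1 : ℤ)⟧ from v), hv.trans ?_⟩
  exact (Preadditive.comp_neg _ _).trans (Preadditive.neg_comp _ _).symm

lemma TopTri.comp_shift_injective (T : TopTri S) (hW : Built D (-1) 0 W) (v : W ⟶ S⟦(1 : ℤ)⟧)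
    (hv : v ≫ T.g⟦(1 : ℤ)⟧' = 0) : v = 0 := by
  obtain ⟨w, hw⟩ := dist_co₁ (rot_of_distTriang _ T.dist) v hv
  have h0 : w = 0 := hW.hom_eq_zero T.isLE_shift w
  exact hw.trans ((congrArg (· ≫ _) h0).trans zero_comp)

lemma TopTri.isIso_of_isIso (T : TopTri S) (T' : TopTri S') (v : S ≅ S') (φ : T.N ⟶ T'.N)
    (h : v.hom ≫ T'.g = T.g ≫ (singleFunctor (RMod R) 0).map φ) : IsIso φ := by
  obtain ⟨ψ, hψ⟩ := T'.factor (v.inv ≫ T.g)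
  refine ⟨ψ, T.factor_unique ?_, T'.factor_unique ?_⟩
  · rw [Functor.map_comp, ← Category.assoc, ← h, Category.assoc, ← hψ, v.hom_inv_id_assoc]
    simp
  · rw [Functor.map_comp, ← Category.assoc, ← hψ, Category.assoc, ← h, v.inv_hom_id_assoc]
    simp

lemma TopTri.localObj (T : TopTri S) (hS : Built D (-1) 0 S) (hl : LocalObj S) (h0 : 𝟙 T.N ≠ 0) :
    LocalObj T.N := by
  refine ⟨h0, fun φ => ?_⟩
  obtain ⟨v, hv⟩ := T.exists_lift hS (T.g ≫ (singleFunctor (RMod R) 0).map φ)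
  obtain h | h := hl.2 v
  · exact .inl (T.isIso_of_isIso T (asIso v) φ hv.symm)
  refine .inr (T.isIso_of_isIso T (asIso (𝟙 S - v)) (𝟙 _ - φ) ?_)
  rw [Functor.map_sub, Preadditive.comp_sub, hv, asIso_hom, Preadditive.sub_comp]
  simp

lemma TopTri.nonempty_iso (T : TopTri S) (T' : TopTri S') (hS : Built D (-1) 0 S)
    (hS' : Built D (-1) 0 S') (hl : LocalObj S) (hl' : LocalObj S') (h0 : 𝟙 T.N ≠ 0)
    (φ : T.N ≅ T'.N) : Nonempty (S ≅ S') := by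
  obtain ⟨v, hv⟩ := T'.exists_lift hS (T.g ≫ (singleFunctor (RMod R) 0).map φ.hom)
  obtain ⟨w, hw⟩ := T.exists_lift hS' (T'.g ≫ (singleFunctor (RMod R) 0).map φ.inv)
  have h1 : (v ≫ w) ≫ T.g = T.g := by
    rw [Category.assoc, ← hw, ← Category.assoc, ← hv, Category.assoc, ← Functor.map_comp]
    simp
  obtain h | h := hl.2 (v ≫ w)
  · have := LocalObj.isIso_of_comp hl.1 hl' v w h
    exact ⟨asIso v⟩
  · refine (h0 (top_eq_zero T.isLE T.dist ?_)).elim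
    refine (cancel_epi (𝟙 S - v ≫ w)).1 ?_
    rw [Preadditive.sub_comp, h1, Category.id_comp, sub_self, comp_zero]

end

section
open DerivedCategory Pretriangulated
variable {R : Type} [Ring R] [HasDMod R]
variable {k : Type} [Field k] [Algebra k R] {ι : Type}

omit [HasDMod R] in
lemma ProjData.p_ne_zero (D : ProjData k R ι) (l : ι) : D.p l ≠ 0 := by
  intro h
  have := D.simple l
  have h3 := IsSimpleModule.nontrivial R (D.L l)
  obtain ⟨y, hy⟩ := exists_ne (0 : D.L l)
  obtain ⟨x, rfl⟩ := D.p_surj l y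
  exact hy (by rw [h]; rfl)

lemma IdemData.exists_iso_of_top [FiniteDimensional k R] (D : IdemData k R ι)
    {S : DMod R} (T : TopTri S)
    (hS : Built D.toProjData (-1) 0 S) (hl : LocalObj S) (h0 : 𝟙 T.N = 0) :
    ∃ l, Nonempty (S ≅ sg (-1) (D.P l)) := by
  have h1 : S.IsLE (-1) := isLE_pred_of_top T.isLE T.dist h0
  have hb : Built D.toProjData (-1) (-1) S :=
    Built.iff_isLE.2 ⟨hS.isCpt, h1, (Built.iff_isLE.1 hS).2.2⟩
  obtain ⟨X, H, f, g, h, hX, hT⟩ := exists_top_triangle S (-1)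
  have hH : Module.Finite R H := hS.isCpt.finite_top k hX hT
  have hn : Nontrivial H := by
    rw [← not_subsingleton_iff_nontrivial]
    intro hs
    have h2 : S.IsLE (-2) := isLE_pred_of_top hX hT
      ((IsZero.iff_id_eq_zero H).1 (ModuleCat.isZero_of_subsingleton H))
    exact hl.1 (hS.hom_eq_zero h2 _)
  obtain ⟨l, φ, hφ⟩ := D.exists_hom H
  have hproj := D.proj l
  have hepi : Epi φ := (ModuleCat.epi_iff_surjective φ).2 hφ
  have hepi' : Epi (D.p l) := (ModuleCat.epi_iff_surjective _).2 (D.p_surj l)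
  let q : D.P l ⟶ H := Projective.factorThru (D.p l) φ
  have hq : q ≫ φ = D.p l := Projective.factorThru_comp _ _
  obtain ⟨w, hw⟩ := dist_co₃ hT ((singleFunctor (RMod R) (-1)).map q) (by
    have : (X⟦(1 : ℤ)⟧).IsLE (-3) := TStructure.t.isLE_shift X (-1 - 1) 1 (-3)
    exact sg_hom_eq_zero_of_isLE (D.P l) (by omega : (-3 : ℤ) < -1) _ _)
  obtain ⟨v, hv⟩ := hb.exists_lift (D.p l) (g ≫ (singleFunctor (RMod R) (-1)).map φ)
  have hwv : (w ≫ v) ≫ (singleFunctor (RMod R) (-1)).map (D.p l) =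
      (singleFunctor (RMod R) (-1)).map (D.p l) := by
    rw [Category.assoc, ← hv, ← Category.assoc, ← hw, ← Functor.map_comp, hq]
  have hP : LocalObj (sg (-1) (D.P l)) := (D.loc l).map _
  obtain hi | hi := hP.2 (w ≫ v)
  · have := LocalObj.isIso_of_comp hP.1 hl w v hi
    exact ⟨l, ⟨(asIso w).symm⟩⟩
  · refine (D.p_ne_zero l ((singleFunctor (RMod R) (-1)).map_injective ?_)).elim
    refine (cancel_epi (𝟙 _ - w ≫ v)).1 ?_
    rw [Preadditive.sub_comp, hwv, Category.id_comp, sub_self, Functor.map_zero, comp_zero]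

variable {S : DMod R}

lemma TopTri.id_eq_zero (T : TopTri S) {P : RMod R} (e : S ≅ sg (-1) P) :
    𝟙 T.N = 0 := by
  refine top_eq_zero T.isLE T.dist ((cancel_epi e.inv).1 ?_)
  have h1 : (sg (-1) P).IsLE (-1) := inferInstance
  have h2 : (sg 0 T.N).IsGE 0 := inferInstance
  exact (TStructure.t.zero (show sg (-1) P ⟶ sg 0 T.N from _) (-1) 0).trans comp_zero.symm

lemma IdemData.eq_of_sg_iso (D : IdemData k R ι) {m : ℤ} {i j : ι}
    (e : sg m (D.P i) ≅ sg m (D.P j)) : i = j := by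
  by_contra h
  obtain ⟨f, hf⟩ := (singleFunctor (RMod R) m).map_surjective e.hom
  refine D.p_ne_zero j ((singleFunctor (RMod R) m).map_injective ?_)
  refine (cancel_epi e.hom).1 ?_
  rw [← hf, ← Functor.map_comp, D.hom_ne i j (f ≫ D.p j) h, Functor.map_zero, Functor.map_zero, comp_zero]

lemma isSilt_sg [FiniteDimensional k R] (D : IdemData k R ι) :
    IsSilt (mutCtx D.toProjData) fun l => sg 0 (D.P l) where
  tw l := (built_sg D.toProjData l 0).mono (by omega) le_rfl
  loc l := (D.loc l).map _
  not_iso i j := fun ⟨e⟩ => D.eq_of_sg_iso e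
  noHom i j f := by
    have := D.proj i
    have : ((sg 0 (D.P j))⟦(1 : ℤ)⟧).IsLE (-1) := TStructure.t.isLE_shift _ 0 1 (-1)
    exact sg_hom_eq_zero_of_isLE (D.P i) (by omega : (-1 : ℤ) < 0) _ f

section silt
variable [FiniteDimensional k R] {D : IdemData k R ι}
  {S : ι → DMod R} (hS : IsSilt (mutCtx D.toProjData) S)
include hS

lemma IsSilt.card_eq [Fintype ι] [DecidableEq ι] (T : ∀ j, TopTri (S j)) (E : Finset ι)
    (hE : ∀ l, l ∈ E ↔ ∃ j, Nonempty (S j ≅ sg (-1) (D.P l)))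
    [Fintype {j // 𝟙 (T j).N ≠ 0}] :
    Fintype.card {j // 𝟙 (T j).N ≠ 0} = Fintype.card {l // l ∉ E} := by
  classical
  have h1 : Fintype.card {j // 𝟙 (T j).N = 0} = Fintype.card {l // l ∈ E} := by
    choose l hl using fun j : {j // 𝟙 (T j).N = 0} =>
      D.exists_iso_of_top (T j.1) (hS.tw j.1) (hS.loc j.1) j.2
    refine Fintype.card_of_bijective (f := fun j => ⟨l j, (hE _).2 ⟨j.1, hl j⟩⟩) ⟨?_, ?_⟩
    · intro i j hij
      have hij' : l i = l j := congrArg Subtype.val hij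
      obtain ⟨a⟩ := hl i
      obtain ⟨b⟩ := hl j
      exact Subtype.ext (hS.not_iso _ _ ⟨a ≪≫ eqToIso (by rw [hij']) ≪≫ b.symm⟩)
    · rintro ⟨i, hi⟩
      obtain ⟨j, ⟨a⟩⟩ := (hE _).1 hi
      let j' : {j // 𝟙 (T j).N = 0} := ⟨j, (T j).id_eq_zero a⟩
      obtain ⟨b⟩ := hl j'
      exact ⟨j', Subtype.ext (D.eq_of_sg_iso (b.symm ≪≫ a))⟩
  have h2 := Fintype.card_subtype_compl (fun j => 𝟙 (T j).N = 0)
  have h3 := Fintype.card_subtype_compl (fun l => l ∈ E)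
  have h4 : Fintype.card {j // 𝟙 (T j).N ≠ 0} = Fintype.card {j // ¬ 𝟙 (T j).N = 0} := by
    convert rfl
  rw [h4, h2, h3, h1]

lemma IsSilt.hom_top_eq_zero {l i : ι} (a : S i ≅ sg (-1) (D.P l)) {j : ι} (T : TopTri (S j))
    (f : D.P l ⟶ T.N) : f = 0 := by
  have := D.proj l
  apply (singleFunctor (RMod R) 0).map_injective
  obtain ⟨v, hv⟩ := dist_co₃ T.dist ((singleFunctor (RMod R) 0).map f)
    (have := T.isLE_shift; sg_hom_eq_zero_of_isLE (D.P l) (by omega : (-2 : ℤ) < 0) _ _)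
  let b := sgShift (D.P l) 0 1 (-1) (by omega)
  have h1 : v⟦(1 : ℤ)⟧' = 0 := by
    refine (cancel_epi (a ≪≫ b.symm).hom).1 ?_
    exact (hS.noHom _ _ _).trans comp_zero.symm
  have h2 : v = 0 := (shiftFunctor (DMod R) (1 : ℤ)).map_injective
    (h1.trans (Functor.map_zero _ _ _).symm)
  rw [hv, h2, zero_comp, Functor.map_zero]

end silt
end

section
open DerivedCategory Pretriangulated
variable {R : Type} [Ring R] [HasDMod R]

lemma extZero_of_hom_eq_zero {M Y : Type} [AddCommGroup M] [Module R M] [AddCommGroup Y]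
    [Module R Y] (h0 : ∀ w : sg 0 (ModuleCat.of R M) ⟶ (sg 0 (ModuleCat.of R Y))⟦(1 : ℤ)⟧, w = 0) :
    ExtZero R M Y := by
  intro P _ _ g hg u
  let S : ShortComplex (RMod R) := ShortComplex.mk
    (ModuleCat.ofHom (LinearMap.ker g).subtype) (ModuleCat.ofHom g) (by ext x; exact x.2)
  have hS : S.ShortExact :=
    { exact := (ShortComplex.moduleCat_exact_iff _).2 fun x hx => ⟨⟨x, hx⟩, rfl⟩
      mono_f := (ModuleCat.mono_iff_injective _).2 (LinearMap.ker g).injective_subtype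
      epi_g := (ModuleCat.epi_iff_surjective _).2 hg }
  obtain ⟨v, hv⟩ := dist_yo₁ hS.singleTriangle_distinguished
    (((singleFunctor (RMod R) 0).map (ModuleCat.ofHom u))⟦(1 : ℤ)⟧') (h0 _)
  obtain ⟨v, rfl⟩ := (shiftFunctor (DMod R) (1 : ℤ)).map_surjective v
  obtain ⟨v, rfl⟩ := (singleFunctor (RMod R) 0).map_surjective v
  refine ⟨v.hom, ?_⟩
  have h1 : ModuleCat.ofHom u = S.f ≫ v := by
    apply (singleFunctor (RMod R) 0).map_injective
    apply (shiftFunctor (DMod R) (1 : ℤ)).map_injective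
    exact hv.trans (by rw [← Functor.map_comp, ← Functor.map_comp])
  exact (congrArg ModuleCat.Hom.hom h1).symm

variable {k : Type} [Field k] [Algebra k R] {ι : Type} {D : ProjData k R ι}

lemma Built.exists_lift_shift {W : DMod R} (hW : Built D (-1) 0 W)
    {P L : RMod R} (p : P ⟶ L) [Epi p] (u : W ⟶ (sg 0 L)⟦(1 : ℤ)⟧) :
    ∃ v : W ⟶ (sg 0 P)⟦(1 : ℤ)⟧, u = v ≫ ((singleFunctor (RMod R) 0).map p)⟦(1 : ℤ)⟧' := by
  let e (M : RMod R) := sgShift M 0 1 (-1) (by omega)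
  have he : ((singleFunctor (RMod R) 0).map p)⟦(1 : ℤ)⟧' ≫ (e L).hom =
      (e P).hom ≫ (singleFunctor (RMod R) (-1)).map p :=
    ((singleFunctors (RMod R)).shiftIso 1 (-1) 0 (by omega)).hom.naturality p
  obtain ⟨v, hv⟩ := hW.exists_lift p (u ≫ (e L).hom)
  refine ⟨v ≫ (e P).inv, (cancel_mono (e L).hom).1 ?_⟩
  rw [hv, Category.assoc, Category.assoc, he, Iso.inv_hom_id_assoc]

section pi
variable {J : Type} [Fintype J] [DecidableEq J] (N : J → RMod R)

/-- The inclusion of a factor of a finite product of modules. -/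
def piIncl (j : J) : N j ⟶ ModuleCat.of R (∀ j, N j) := ModuleCat.ofHom
  (LinearMap.single R (fun j => N j) j)

/-- The projection to a factor of a product of modules. -/
def piProj (j : J) : ModuleCat.of R (∀ j, N j) ⟶ N j := ModuleCat.ofHom
  (LinearMap.proj (φ := fun j => N j) j)

omit [HasDMod R] in
lemma sum_piProj_piIncl : ∑ j, piProj N j ≫ piIncl N j = 𝟙 _ := by
  refine ModuleCat.hom_ext (LinearMap.ext fun x => ?_)
  refine (moduleCat_sum_apply _ _ x).trans ?_
  exact (LinearMap.sum_single_apply (fun j => N j) x)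

variable {𝒟 : Type*} [Category* 𝒟] [Preadditive 𝒟] (F : RMod R ⥤ 𝒟) [F.Additive]

omit [HasDMod R] in
lemma sum_map_piProj_piIncl : ∑ j, F.map (piProj N j) ≫ F.map (piIncl N j) = 𝟙 _ := by
  simp only [← Functor.map_comp]
  rw [← Functor.map_sum, sum_piProj_piIncl, CategoryTheory.Functor.map_id]

omit [HasDMod R] in
lemma eq_zero_of_piProj {W : 𝒟} (v : W ⟶ F.obj (ModuleCat.of R (∀ j, N j)))
    (h : ∀ j, v ≫ F.map (piProj N j) = 0) : v = 0 := by
  rw [← Category.comp_id v, ← sum_map_piProj_piIncl, Preadditive.comp_sum]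
  exact Finset.sum_eq_zero fun j _ => by rw [← Category.assoc, h, zero_comp]

omit [HasDMod R] in
lemma eq_zero_of_piIncl {W : 𝒟} (v : F.obj (ModuleCat.of R (∀ j, N j)) ⟶ W)
    (h : ∀ j, F.map (piIncl N j) ≫ v = 0) : v = 0 := by
  rw [← Category.id_comp v, ← sum_map_piProj_piIncl, Preadditive.sum_comp]
  exact Finset.sum_eq_zero fun j _ => by rw [Category.assoc, h, comp_zero]

end pi

section silt
variable {J : Type} [Fintype J] [DecidableEq J]
  {S : J → DMod R} (hS : ∀ j, Built D (-1) 0 (S j))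
  (T : ∀ j, TopTri (S j))

lemma noHom_shift_pi {W : DMod R} (hW : Built D (-1) 0 W)
    (h0 : ∀ j, NoHom W ((S j)⟦(1 : ℤ)⟧)) :
    NoHom W ((sg 0 (ModuleCat.of R (∀ j, (T j).N)))⟦(1 : ℤ)⟧) := by
  intro u
  refine eq_zero_of_piProj (fun j => (T j).N) (singleFunctor (RMod R) 0 ⋙
    shiftFunctor (DMod R) (1 : ℤ)) u fun j => ?_
  obtain ⟨v, hv⟩ := (T j).exists_lift_shift hW (u ≫
    ((singleFunctor (RMod R) 0).map (piProj (fun j => (T j).N) j))⟦(1 : ℤ)⟧')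
  refine hv.trans ?_
  rw [h0 j v, zero_comp]

include hS in
lemma extSurj_pi (h0 : ∀ i j, NoHom (S i) ((S j)⟦(1 : ℤ)⟧)) :
    ExtSurj R (∀ j, (T j).N) := by
  intro Y _ _ q hq
  refine extZero_of_hom_eq_zero fun w => ?_
  refine eq_zero_of_piIncl (fun j => (T j).N) (singleFunctor (RMod R) 0) w fun j => ?_
  have h1 (u : S j ⟶ (sg 0 (ModuleCat.of R Y))⟦(1 : ℤ)⟧) : u = 0 := by
    have : Epi (ModuleCat.ofHom q) := (ModuleCat.epi_iff_surjective _).2 hq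
    obtain ⟨v, rfl⟩ := (hS j).exists_lift_shift (ModuleCat.ofHom q) u
    rw [noHom_shift_pi T (hS j) (h0 j) v, zero_comp]
  obtain ⟨v, hv⟩ := dist_yo₃ (T j).dist ((singleFunctor (RMod R) 0).map
    (piIncl (fun j => (T j).N) j) ≫ w) (h1 _)
  have h2 := (T j).isLE_shift
  have h3 : (sg 0 (ModuleCat.of R Y)).IsGE 0 := inferInstance
  have h4 : ((sg 0 (ModuleCat.of R Y))⟦(1 : ℤ)⟧).IsGE (-1) :=
    TStructure.t.isGE_shift _ 0 1 (-1)
  rw [hv, TStructure.t.zero v (-2) (-1), comp_zero]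

end silt
end

section
open DerivedCategory Pretriangulated
variable {R : Type} [Ring R] [HasDMod R]
variable {k : Type} [Field k] [Algebra k R] {ι : Type}

omit [HasDMod R] in
lemma piIncl_piProj {J : Type} [Fintype J] [DecidableEq J] (N : J → RMod R) (j : J) :
    piIncl N j ≫ piProj N j = 𝟙 _ := by
  refine ModuleCat.hom_ext (LinearMap.ext fun x => ?_)
  exact Pi.single_eq_same (M := fun j => N j) j x

/-- The top homologies of a two-term silting family detect maps into its shift. -/
lemma exists_ne_zero_pi {D : ProjData k R ι} {S : ι → DMod R}
    (T : ∀ j, TopTri (S j)) [Fintype {j // 𝟙 (T j).N ≠ 0}]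
    {X : DMod R} (hX : Built D (-1) 0 X) (j : ι)
    (δ : X ⟶ (S j)⟦(1 : ℤ)⟧) (hδ : δ ≠ 0) :
    ∃ f : X ⟶ (sg 0 (ModuleCat.of R (∀ j : {j // 𝟙 (T j).N ≠ 0}, (T j.1).N)))⟦(1 : ℤ)⟧, f ≠ 0 := by
  classical
  have h1 : δ ≫ (T j).g⟦(1 : ℤ)⟧' ≠ 0 := fun h => hδ ((T j).comp_shift_injective hX δ h)
  have hj : 𝟙 (T j).N ≠ 0 := fun hj => h1 (by
    have h2 : IsZero (sg 0 (T j).N) := (singleFunctor (RMod R) 0).map_isZero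
      ((IsZero.iff_id_eq_zero _).2 hj)
    exact (((shiftFunctor (DMod R) (1 : ℤ)).map_isZero h2).eq_of_tgt _ _))
  let N : {j // 𝟙 (T j).N ≠ 0} → RMod R := fun j => (T j.1).N
  let F := singleFunctor (RMod R) 0 ⋙
    shiftFunctor (DMod R) (1 : ℤ)
  refine ⟨(δ ≫ (T j).g⟦(1 : ℤ)⟧') ≫ F.map (piIncl N ⟨j, hj⟩), fun h => h1 ?_⟩
  have h2 : F.map (piIncl N ⟨j, hj⟩) ≫ F.map (piProj N ⟨j, hj⟩) = 𝟙 _ := by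
    rw [← Functor.map_comp, piIncl_piProj, CategoryTheory.Functor.map_id]
  have h3 := congrArg (· ≫ F.map (piProj N ⟨j, hj⟩)) h
  rw [Category.assoc, h2, zero_comp] at h3
  exact (Category.comp_id _).symm.trans h3

end

section
open DerivedCategory Pretriangulated
variable {k B R : Type} [Field k] [Ring B] [Algebra k B] [Ring R] [Algebra k R]
  [HasDMod R] [HasDerivedCategory.{1} (RMod Bᵐᵒᵖ)]
  [FiniteDimensional k B] {ι ι' : Type}

omit [HasDMod R] [Ring R] [Algebra k R] in
/-- A two-term silting family yields a basic support τ-tilting module. -/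
lemma IsSilt.exists_supportTauTilting [Fintype ι'] [DecidableEq ι'] {D : IdemData k Bᵐᵒᵖ ι'}
    {S : ι' → DerivedCategory (RMod Bᵐᵒᵖ)} (hS : IsSilt (mutCtx D.toProjData) S) :
    ∃ M : RMod Bᵐᵒᵖ, IsSupportTauTilting k B M ∧ IsBasicMod B M ∧
      (∀ j, NoHom (S j) ((sg 0 M)⟦(1 : ℤ)⟧)) ∧
      ∀ X j, Built D.toProjData (-1) 0 X → ∀ δ : X ⟶ (S j)⟦(1 : ℤ)⟧, δ ≠ 0 →
        ∃ f : X ⟶ (sg 0 M)⟦(1 : ℤ)⟧, f ≠ 0 := by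
  classical
  let T (j) : TopTri (S j) := (Built.exists_topTri (hS.tw j)).some
  let J := {j // 𝟙 (T j).N ≠ 0}
  let N (j : J) : RMod Bᵐᵒᵖ := (T j.1).N
  have loc (j : J) : LocalObj (N j) := (T j.1).localObj (hS.tw _) (hS.loc _) j.2
  have hN (i j : J) (h : Nonempty (N i ≅ N j)) : i = j := by
    obtain ⟨a⟩ := h
    exact Subtype.ext (hS.not_iso _ _ ((T i.1).nonempty_iso (T j.1) (hS.tw _) (hS.tw _)
      (hS.loc _) (hS.loc _) i.2 a))
  let E : Finset ι' := Finset.univ.filter fun l => ∃ j, Nonempty (S j ≅ sg (-1) (D.P l))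
  have hE (l) : l ∈ E ↔ ∃ j, Nonempty (S j ≅ sg (-1) (D.P l)) := by simp [E]
  refine ⟨ModuleCat.of Bᵐᵒᵖ (∀ j, N j), ?_, isBasicMod_pi loc hN, fun j =>
    noHom_shift_pi (fun j : J => T j.1) (hS.tw j) fun i => hS.noHom j i.1,
    fun X j hX δ hδ => exists_ne_zero_pi T hX j δ hδ⟩
  refine D.isSupportTauTilting_pi E N (fun j => ?_) loc hN
    (extSurj_pi (fun j : J => hS.tw j.1) (fun j : J => T j.1) fun i j => hS.noHom i.1 j.1)
    (fun l hl j f => ?_) (hS.card_eq T E hE)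
  · exact (hS.tw j.1).isCpt.finite_top k (T j.1).isLE (T j.1).dist
  · obtain ⟨i, ⟨a⟩⟩ := (hE l).1 hl
    exact hS.hom_top_eq_zero a (T j.1) f

/-- An algebra derived equivalent to a symmetric algebra with singular Cartan matrix has
infinitely many support τ-tilting modules. -/
theorem not_tauTiltingFinite_of_equiv [FiniteDimensional k R] [IsAlgClosed k] [Fintype ι]
    {D : ProjData k R ι}
    (e : DMod R ≌ DerivedCategory (RMod Bᵐᵒᵖ))
    [e.functor.CommShift ℤ] [e.functor.IsTriangulated] {δ : ι → ℤ} {v₀ : ι} (hv₀ : δ v₀ ≠ 0)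
    (hδ : ∀ j, ∑ v, δ v * Module.finrank k (D.P v ⟶ D.P j) = 0)
    (dual : ∀ {a b X}, Built D a b X → NoHom X (X⟦(1 : ℤ)⟧) → NoHom X (X⟦(-1 : ℤ)⟧)) :
    ¬ TauTiltingFinite k B := by
  rintro ⟨N, Rm, hR⟩
  obtain ⟨n, ⟨A⟩⟩ := exists_matData k Bᵐᵒᵖ
  let D' := A.toIdemData
  have : Infinite k := IsAlgClosed.instInfinite
  refine exists_ne_zero_of_symm (D' := D'.toProjData) e hv₀ hδ dual
    (Q := fun m => (sg 0 (Rm m))⟦(1 : ℤ)⟧) (fun {X} m hX => ?_) (fun S hS => ?_) (isSilt_sg D')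
  · have h1 : ((sg 0 (Rm m))⟦(1 : ℤ)⟧).IsLE (-1) := TStructure.t.isLE_shift _ 0 1 (-1)
    have hX' : Built D'.toProjData (-1) 0 X := hX
    exact hX'.hom_eq_zero (TStructure.t.isLE_shift _ (-1) 1 (-2))
  · obtain ⟨M, hM, hb, h1, h2⟩ := hS.exists_supportTauTilting
    obtain ⟨m, ⟨a⟩⟩ := hR M hM hb
    let b : (sg 0 M)⟦(1 : ℤ)⟧ ≅ (sg 0 (Rm m))⟦(1 : ℤ)⟧ :=
      (shiftFunctor _ (1 : ℤ)).mapIso ((singleFunctor _ 0).mapIso a.toModuleIso)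
    refine ⟨m, fun j f => (cancel_mono b.inv).1 ((h1 j _).trans zero_comp.symm),
      fun X j hX δ hδ => ?_⟩
    obtain ⟨f, hf⟩ := h2 X j hX δ hδ
    exact ⟨f ≫ b.hom, fun h => hf ((cancel_mono b.hom).1 (h.trans zero_comp.symm))⟩

end

/-- A nondegenerate symmetrizing linear form. -/
structure SymForm (k R : Type) [Field k] [Ring R] [Algebra k R] where
  lam : R →ₗ[k] k
  comm : ∀ r s, lam (r * s) = lam (s * r)
  nondeg : ∀ r, r ≠ 0 → ∃ s, lam (s * r) ≠ 0

section
variable {k R : Type} [Field k] [Ring R] [Algebra k R]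

/-- A dual basis of a finitely generated projective module. -/
structure DualBasis (P : RMod R) where
  n : ℕ
  x : Fin n → P
  c : Fin n → P →ₗ[R] R
  eq : ∀ y, ∑ a, c a y • x a = y

lemma exists_dualBasis (P : RMod R) [Projective P] [Module.Finite R P] :
    Nonempty (DualBasis P) := by
  obtain ⟨n, f, hf⟩ := Module.Finite.exists_fin' R P
  have : Module.Projective R P := (IsProjective.iff_projective P).2 inferInstance
  obtain ⟨g, hg⟩ := Module.projective_lifting_property f LinearMap.id hf
  refine ⟨⟨n, fun a => f (Pi.single a 1), fun a => LinearMap.proj a ∘ₗ g, fun y => ?_⟩⟩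
  have h := LinearMap.congr_fun hg y
  refine Eq.trans ?_ h
  change _ = f (g y)
  conv_rhs => rw [pi_eq_sum_univ' (g y)]
  rw [map_sum]
  refine Finset.sum_congr rfl fun a _ => ?_
  rw [map_smul]
  rfl

namespace SymForm
variable (S : SymForm k R) {P Q : RMod R} (B : DualBasis P) (C : DualBasis Q)

/-- The trace of an endomorphism of a finitely generated projective module. -/
def tr : (P ⟶ P) →ₗ[k] k where
  toFun f := ∑ a, S.lam (B.c a (f (B.x a)))
  map_add' f g := by
    rw [← Finset.sum_add_distrib]
    refine Finset.sum_congr rfl fun a _ => ?_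
    rw [← map_add, ← map_add]
    rfl
  map_smul' t f := by
    rw [RingHom.id_apply, Finset.smul_sum]
    refine Finset.sum_congr rfl fun a _ => ?_
    rw [← map_smul, Algebra.smul_def, ← smul_eq_mul, ← map_smul]
    rfl

lemma lam_expand (d : P →ₗ[R] R) (y : P) (r : R) :
    ∑ a, S.lam (r * (B.c a y * d (B.x a))) = S.lam (r * d y) := by
  conv_rhs => rw [← B.eq y]
  simp only [map_sum, map_smul, smul_eq_mul, Finset.mul_sum]

lemma tr_comm (f : P ⟶ Q) (g : Q ⟶ P) : S.tr B (f ≫ g) = S.tr C (g ≫ f) := by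
  have h1 (a) : S.lam (B.c a (g (f (B.x a)))) =
      ∑ b, S.lam (C.c b (f (B.x a)) * B.c a (g (C.x b))) := by
    have := S.lam_expand C (B.c a ∘ₗ g.hom) (f (B.x a)) 1
    simp only [one_mul] at this
    exact this.symm
  have h2 (b) : S.lam (C.c b (f (g (C.x b)))) =
      ∑ a, S.lam (B.c a (g (C.x b)) * C.c b (f (B.x a))) := by
    have := S.lam_expand B (C.c b ∘ₗ f.hom) (g (C.x b)) 1
    simp only [one_mul] at this
    exact this.symm
  change ∑ a, S.lam (B.c a (g (f (B.x a)))) = ∑ b, S.lam (C.c b (f (g (C.x b))))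
  simp only [h1, h2]
  rw [Finset.sum_comm]
  exact Finset.sum_congr rfl fun b _ => Finset.sum_congr rfl fun a _ => S.comm _ _

include C in
lemma exists_tr_ne_zero (f : P ⟶ Q) (hf : f ≠ 0) : ∃ g : Q ⟶ P, S.tr B (f ≫ g) ≠ 0 := by
  have h1 : ∃ y, f y ≠ 0 := by
    by_contra! h
    exact hf (ModuleCat.hom_ext (LinearMap.ext h))
  obtain ⟨y, hy⟩ := h1
  have h2 : ∃ b, C.c b (f y) ≠ 0 := by
    by_contra! h
    apply hy
    rw [← C.eq (f y)]
    exact Finset.sum_eq_zero fun b _ => by rw [h, zero_smul]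
  obtain ⟨b, hb⟩ := h2
  obtain ⟨s, hs⟩ := S.nondeg _ hb
  refine ⟨ModuleCat.ofHom ((LinearMap.toSpanSingleton R P (s • y)) ∘ₗ C.c b), fun h => hs ?_⟩
  refine Eq.trans (Eq.trans (S.lam_expand B (C.c b ∘ₗ f.hom) y s).symm ?_) h
  refine Finset.sum_congr rfl fun a _ => ?_
  change _ = S.lam (B.c a (C.c b (f (B.x a)) • s • y))
  rw [(B.c a).map_smul, (B.c a).map_smul, smul_eq_mul, smul_eq_mul, S.comm (C.c b (f (B.x a))), mul_assoc]
  rfl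

end SymForm
end

section
open CochainComplex.HomComplex
variable {k R : Type} [Field k] [Ring R] [Algebra k R]

/-- A bounded complex of finitely generated projective modules. -/
structure PerfCx (K : ChMod R) (lo : ℤ) (N : ℕ) : Prop where
  proj : ∀ n, Projective (K.X n)
  fin : ∀ n, Module.Finite R (K.X n)
  zero_le : ∀ n ≤ lo, IsZero (K.X n)
  zero_ge : ∀ n ≥ lo + N, IsZero (K.X n)

namespace PerfCx
variable {K : ChMod R} {lo : ℤ} {N : ℕ} (hK : PerfCx K lo N)

include hK in
lemma exists_index {n : ℤ} (hn : ¬ IsZero (K.X n)) : ∃ i ∈ Finset.range N, lo + (i : ℤ) = n := by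
  have h1 : lo < n := not_le.1 fun h => hn (hK.zero_le n h)
  have h2 : n < lo + N := not_le.1 fun h => hn (hK.zero_ge n h)
  exact ⟨(n - lo).toNat, Finset.mem_range.2 (by omega), by omega⟩

/-- A chosen dual basis of a term. -/
def basis (n : ℤ) : DualBasis (K.X n) :=
  have := hK.proj n
  have := hK.fin n
  (exists_dualBasis (K.X n)).some

variable (S : SymForm k R)

/-- The supertrace of a cochain of degree zero. -/
def str : Cochain K K 0 →ₗ[k] k where
  toFun z := ∑ i ∈ Finset.range N, (-1) ^ i *
    S.tr (hK.basis (lo + i)) (z.v (lo + i) (lo + i) (add_zero _))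
  map_add' z w := by
    simp only [Cochain.add_v, map_add, mul_add, Finset.sum_add_distrib]
  map_smul' t z := by
    simp only [Cochain.smul_v, map_smul, smul_eq_mul, RingHom.id_apply, Finset.mul_sum]
    exact Finset.sum_congr rfl fun i _ => by ring

lemma str_apply (z : Cochain K K 0) : hK.str S z = ∑ i ∈ Finset.range N, (-1) ^ i *
    S.tr (hK.basis (lo + i)) (z.v (lo + i) (lo + i) (add_zero _)) := rfl

lemma str_δ (z : Cochain K K (-1)) : hK.str S (δ (-1) 0 z) = 0 := by
  let A (i : ℕ) : k := (-1) ^ i * S.tr (hK.basis (lo + i))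
    (z.v (lo + i) (lo + i - 1) (by omega) ≫ K.d (lo + i - 1) (lo + i))
  have hA (i : ℕ) (h : IsZero (K.X (lo + i))) : A i = 0 := by
    have : z.v (lo + i) (lo + i - 1) (by omega) ≫ K.d (lo + i - 1) (lo + i) = 0 := h.eq_of_src _ _
    simp only [A, this, map_zero, mul_zero]
  have h1 (i : ℕ) : (-1) ^ i *
      S.tr (hK.basis (lo + i)) ((δ (-1) 0 z).v (lo + i) (lo + i) (add_zero _)) =
      A i - A (i + 1) := by
    rw [δ_v (-1) 0 (by omega) z (lo + i) (lo + i) _ (lo + i - 1) (lo + (i + 1 : ℕ))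
      (by omega) (by push_cast; omega), Int.negOnePow_zero, one_smul, map_add,
      S.tr_comm _ (hK.basis (lo + (i + 1 : ℕ)))]
    have h2 : ∀ (m n : ℤ) (h : m = n - 1) , S.tr (hK.basis n) (z.v n m (by omega) ≫ K.d m n) =
      S.tr (hK.basis n) (z.v n (n - 1) (by omega) ≫ K.d (n - 1) n) := by
      rintro m n rfl; rfl
    rw [h2 (lo + i) (lo + (i + 1 : ℕ)) (by push_cast; omega)]
    simp only [A, pow_succ]
    ring
  rw [str_apply, Finset.sum_congr rfl fun i _ => h1 i, Finset.sum_range_sub',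
    hA 0 (hK.zero_le _ (by simp)), hA N (hK.zero_ge _ le_rfl), sub_zero]

lemma str_comp_single {n m : ℤ} (h : n + m = 0) (z : Cochain K K n) (p q : ℤ) (hpq : p + n = q)
    (g : K.X q ⟶ K.X p) (i : ℕ) (hi : i ∈ Finset.range N) (hp : lo + (i : ℤ) = p) :
    hK.str S (z.comp (Cochain.single g m) h) =
      (-1) ^ i * S.tr (hK.basis p) (z.v p q hpq ≫ g) := by
  subst hp
  rw [str_apply, Finset.sum_eq_single i]
  · rw [Cochain.comp_v _ _ h _ q _ hpq (by omega), Cochain.single_v]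
  · intro j _ hj
    rw [Cochain.comp_v _ _ h _ (lo + j + n) _ rfl (by omega),
      Cochain.single_v_eq_zero _ _ _ _ _ (by omega), comp_zero, map_zero, mul_zero]
  · intro h; exact absurd hi h

lemma str_single_comp {n m : ℤ} (h : n + m = 0) (z : Cochain K K m) (p q : ℤ) (hpq : p + m = q)
    (g : K.X q ⟶ K.X p) (i : ℕ) (hi : i ∈ Finset.range N) (hq : lo + (i : ℤ) = q) :
    hK.str S ((Cochain.single g n).comp z h) =
      (-1) ^ i * S.tr (hK.basis q) (g ≫ z.v p q hpq) := by
  subst hq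
  rw [str_apply, Finset.sum_eq_single i]
  · rw [Cochain.comp_v _ _ h _ p _ (by omega) hpq, Cochain.single_v]
  · intro j _ hj
    rw [Cochain.comp_v _ _ h _ (lo + j + n) _ rfl (by omega),
      Cochain.single_v_eq_zero _ _ _ _ _ (by omega), zero_comp, map_zero, mul_zero]
  · intro h; exact absurd hi h

include hK in
lemma eq_zero_of_str_comp {n m : ℤ} (h : n + m = 0) (z : Cochain K K n)
    (hz : ∀ w : Cochain K K m, hK.str S (z.comp w h) = 0) : z = 0 := by
  refine Cochain.ext _ _ fun p q hpq => ?_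
  by_contra h0
  obtain ⟨g, hg⟩ := S.exists_tr_ne_zero (hK.basis p) (hK.basis q) _ h0
  obtain ⟨i, hi, hp⟩ := hK.exists_index (n := p) fun h => h0 (h.eq_of_src _ _)
  have := hK.str_comp_single S h z p q hpq g i hi hp
  rw [hz] at this
  exact mul_ne_zero (pow_ne_zero _ (by simp)) hg this.symm

include hK in
lemma eq_zero_of_str_comp' {n m : ℤ} (h : n + m = 0) (z : Cochain K K m)
    (hz : ∀ w : Cochain K K n, hK.str S (w.comp z h) = 0) : z = 0 := by
  refine Cochain.ext _ _ fun p q hpq => ?_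
  by_contra h0
  obtain ⟨g, hg⟩ := S.exists_tr_ne_zero (hK.basis p) (hK.basis q) _ h0
  rw [S.tr_comm _ (hK.basis q)] at hg
  obtain ⟨i, hi, hq⟩ := hK.exists_index (n := q) fun h => h0 (h.eq_of_tgt _ _)
  have := hK.str_single_comp S h z p q hpq g i hi hq
  rw [hz] at this
  exact mul_ne_zero (pow_ne_zero _ (by simp)) hg this.symm

/-- The supertrace pairing. -/
def pairing {n m : ℤ} (h : n + m = 0) : Cochain K K n →ₗ[k] Cochain K K m →ₗ[k] k :=
  LinearMap.mk₂ k (fun z w => hK.str S (z.comp w h))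
    (fun _ _ _ => by rw [Cochain.add_comp, map_add])
    (fun _ _ _ => by rw [Cochain.smul_comp, map_smul])
    (fun _ _ _ => by rw [Cochain.comp_add, map_add])
    (fun _ _ _ => by rw [Cochain.comp_smul, map_smul])

include hK in
lemma finite_cochain [FiniteDimensional k R] (n : ℤ) : Module.Finite k (Cochain K K n) := by
  let F : Cochain K K n →ₗ[k] ∀ i : Finset.range N, K.X (lo + (i : ℕ)) ⟶ K.X (lo + (i : ℕ) + n) :=
    { toFun := fun z i => z.v _ _ rfl
      map_add' := fun _ _ => rfl
      map_smul' := fun _ _ => rfl }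
  have (i : Finset.range N) :
      Module.Finite k (K.X (lo + (i : ℕ)) ⟶ K.X (lo + (i : ℕ) + n)) := by
    have := hK.fin (lo + (i : ℕ))
    have := hK.fin (lo + (i : ℕ) + n)
    exact finite_moduleCat_hom _ _
  refine Module.Finite.of_injective F ((injective_iff_map_eq_zero F).2 fun z hz => ?_)
  refine Cochain.ext _ _ fun p q hpq => ?_
  by_contra h0
  obtain ⟨i, hi, hp⟩ := hK.exists_index (n := p) fun h => h0 (h.eq_of_src _ _)
  subst hp hpq
  exact h0 (congrFun hz ⟨i, hi⟩)

include hK S in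
lemma exists_coboundary [FiniteDimensional k R]
    (h1 : ∀ c : Cochain K K 1, δ 1 2 c = 0 → ∃ b : Cochain K K 0, δ 0 1 b = c)
    (z : Cochain K K (-1)) (hz : δ (-1) 0 z = 0) :
    ∃ w : Cochain K K (-2), δ (-2) (-1) w = z := by
  by_contra h0
  have := hK.finite_cochain (k := k) 1
  have := hK.finite_cochain (k := k) (-1)
  obtain ⟨ξ, hξ, hξ'⟩ := Submodule.exists_le_ker_of_notMem
    (p := LinearMap.range (δ_hom k K K (-2) (-1))) (v := z) (by simpa using h0)
  have : (hK.pairing S (n := 1) (m := -1) (by omega)).IsPerfPair :=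
    .of_injective ((injective_iff_map_eq_zero _).2 fun c hc =>
        hK.eq_zero_of_str_comp S _ c fun w => LinearMap.congr_fun hc w)
      ((injective_iff_map_eq_zero _).2 fun c hc =>
        hK.eq_zero_of_str_comp' S _ c fun w => LinearMap.congr_fun hc w)
  obtain ⟨c, rfl⟩ := (LinearMap.IsPerfPair.bijective_left
    (hK.pairing S (n := 1) (m := -1) rfl)).2 ξ
  obtain ⟨b, rfl⟩ := h1 c (hK.eq_zero_of_str_comp S (m := -2) (by omega) _ fun w => by
    have h2 := δ_comp c w (n₁₂ := -1) (by omega) 2 (-1) 0 (by omega) (by omega) (by omega)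
    have h3 := congrArg (hK.str S) h2
    have h4 : hK.str S (c.comp (δ (-2) (-1) w) (by omega)) = 0 := hξ' ⟨w, rfl⟩
    rw [str_δ, map_add, h4, zero_add, Int.negOnePow_even (-2) (by decide), one_smul] at h3
    exact h3.symm)
  apply hξ
  have h2 := δ_comp b z (n₁₂ := -1) (by omega) 1 0 0 (by omega) (by omega) (by omega)
  have h3 := congrArg (hK.str S) h2
  rw [str_δ, hz, Cochain.comp_zero, zero_add, Int.negOnePow_odd (-1) (by decide), Units.neg_smul,
    one_smul, map_neg, eq_comm, neg_eq_zero] at h3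
  exact h3

end PerfCx
end

section
section
open DerivedCategory Pretriangulated CochainComplex.HomComplex ZeroObject
variable {k R : Type} [Field k] [Ring R] [Algebra k R]

namespace PerfCx
variable {K L : ChMod R} {lo lo' : ℤ} {N N' : ℕ}

lemma mono (hK : PerfCx K lo N) (h1 : lo' ≤ lo) (h2 : lo + N ≤ lo' + N') : PerfCx K lo' N' :=
  ⟨hK.proj, hK.fin, fun n hn => hK.zero_le n (by omega), fun n hn => hK.zero_ge n (by omega)⟩

lemma isKProjective (hK : PerfCx K lo N) : K.IsKProjective := by
  have := hK.proj
  have : K.IsStrictlyLE (lo + N) := by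
    rw [CochainComplex.isStrictlyLE_iff]
    exact fun i hi => hK.zero_ge i hi.le
  exact CochainComplex.isKProjective_of_projective K (lo + N)

lemma shift (hK : PerfCx K lo N) (n : ℤ) :
    PerfCx ((CategoryTheory.shiftFunctor (ChMod R) n).obj K) (lo - n) N :=
  ⟨fun i => hK.proj (i + n), fun i => hK.fin (i + n), fun i hi => hK.zero_le (i + n) (by omega),
    fun i hi => hK.zero_ge (i + n) (by omega)⟩

lemma cone (hK : PerfCx K lo N) (hL : PerfCx L lo N) (φ : K ⟶ L) :
    PerfCx (CochainComplex.mappingCone φ) (lo - 1) (N + 1) := by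
  have e (i : ℤ) : (CochainComplex.mappingCone φ).X i ≅ K.X (i + 1) ⊞ L.X i :=
    HomologicalComplex.homotopyCofiber.XIsoBiprod φ i (i + 1) rfl
  have hz (i : ℤ) (h1 : IsZero (K.X (i + 1))) (h2 : IsZero (L.X i)) :
      IsZero ((CochainComplex.mappingCone φ).X i) :=
    IsZero.of_iso ((biprod_isZero_iff _ _).2 ⟨h1, h2⟩) (e i)
  refine ⟨fun i => ?_, fun i => ?_, fun i hi => ?_, fun i hi => ?_⟩
  · have := hK.proj (i + 1)
    have := hL.proj i
    exact Projective.of_iso (e i).symm inferInstance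
  · have := hK.fin (i + 1)
    have := hL.fin i
    exact Module.Finite.equiv
      ((e i) ≪≫ ModuleCat.biprodIsoProd _ _).toLinearEquiv.symm
  · exact hz i (hK.zero_le _ (by omega)) (hL.zero_le _ (by omega))
  · exact hz i (hK.zero_ge _ (by push_cast at hi; omega)) (hL.zero_ge _ (by push_cast at hi; omega))

lemma single (P : RMod R) [Projective P] [Module.Finite R P] (m : ℤ) :
    PerfCx ((CochainComplex.singleFunctor (RMod R) m).obj P) (m - 1) 2 := by
  have hz (n : ℤ) (h : n ≠ m) :
      IsZero (((CochainComplex.singleFunctor (RMod R) m).obj P).X n) :=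
    HomologicalComplex.isZero_single_obj_X _ m P n h
  refine ⟨fun n => ?_, fun n => ?_, fun n hn => hz n (by omega), fun n hn => hz n (by push_cast at hn; omega)⟩
  · by_cases h : n = m
    · subst h; exact Projective.of_iso (HomologicalComplex.singleObjXSelf _ n P).symm inferInstance
    · exact Projective.of_iso (hz n h).isoZero.symm inferInstance
  · by_cases h : n = m
    · subst h
      exact Module.Finite.equiv (HomologicalComplex.singleObjXSelf _ n P).toLinearEquiv.symm
    · have := ModuleCat.subsingleton_of_isZero (hz n h)
      infer_instance

end PerfCx

variable [HasDMod R]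

/-- An object represented by a bounded complex of finitely generated projectives. -/
def IsPerf (X : DMod R) : Prop :=
  ∃ (K : ChMod R) (lo : ℤ) (N : ℕ),
    PerfCx K lo N ∧ Nonempty (X ≅ Q.obj K)

namespace IsPerf
variable {X Y Z : DMod R}

lemma shift (hX : IsPerf X) (n : ℤ) : IsPerf (X⟦n⟧) := by
  obtain ⟨K, lo, N, hK, ⟨i⟩⟩ := hX
  exact ⟨_, _, _, hK.shift n,
    ⟨(CategoryTheory.shiftFunctor _ n).mapIso i ≪≫ ((Q.commShiftIso n).app K).symm⟩⟩

lemma exists_Q_map {K L : ChMod R} [K.IsKProjective]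
    (f : Q.obj K ⟶ Q.obj L) : ∃ φ : K ⟶ L, Q.map φ = f := by
  obtain ⟨g, hg⟩ := (CochainComplex.IsKProjective.Qh_map_bijective K _).2
    ((quotientCompQhIso (RMod R)).hom.app K ≫ f ≫
      (quotientCompQhIso (RMod R)).inv.app L)
  obtain ⟨φ, rfl⟩ := (HomotopyCategory.quotient _ _).map_surjective g
  refine ⟨φ, ?_⟩
  have h := (quotientCompQhIso (RMod R)).hom.naturality φ
  refine (cancel_epi ((quotientCompQhIso (RMod R)).hom.app K)).1 (h.symm.trans ?_)
  refine (congrArg (· ≫ (quotientCompQhIso (RMod R)).hom.app L) hg).trans ?_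
  simp

lemma cone {f : X ⟶ Y} {g : Y ⟶ Z} {h : Z ⟶ X⟦(1 : ℤ)⟧}
    (hT : Triangle.mk f g h ∈ distTriang (DMod R))
    (hX : IsPerf X) (hY : IsPerf Y) : IsPerf Z := by
  obtain ⟨K, lo, N, hK, ⟨i⟩⟩ := hX
  obtain ⟨L, lo', N', hL, ⟨j⟩⟩ := hY
  have := hK.isKProjective
  obtain ⟨φ, hφ⟩ := exists_Q_map (i.inv ≫ f ≫ j.hom)
  let lo₀ := min lo lo'
  let N₀ := (max (lo + N) (lo' + N') - lo₀).toNat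
  refine ⟨_, _, _, PerfCx.cone (lo := lo₀) (N := N₀)
    (hK.mono (by omega) (by omega)) (hL.mono (by omega) (by omega)) φ, ⟨?_⟩⟩
  exact Triangle.π₃.mapIso (isoTriangleOfIso₁₂ (Triangle.mk f g h) _ hT
    (mappingCone_triangle_distinguished φ) i j (by
      change f ≫ j.hom = i.hom ≫ Q.map φ
      rw [hφ, Iso.hom_inv_id_assoc]))

lemma zero (h : IsZero X) : IsPerf X := by
  have h0 : IsZero (0 : RMod R) := isZero_zero _
  have : Module.Finite R (0 : RMod R) := by
    have := ModuleCat.subsingleton_of_isZero h0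
    infer_instance
  refine ⟨_, _, _, PerfCx.single (0 : RMod R) 0, ⟨h.iso ?_⟩⟩
  exact (singleFunctor (RMod R) 0).map_isZero h0

end IsPerf

lemma Built.isPerf {ι : Type} {D : ProjData k R ι} {a b : ℤ}
    {X : DMod R} (hX : Built D a b X) : IsPerf X := by
  induction hX with
  | zero Z h => exact .zero h
  | step s l X Y f g h hT _ _ _ ih =>
    have := D.proj l
    have := D.fin l
    exact .cone (inv_rot_of_distTriang _ hT) (ih.shift (-1))
      ⟨_, _, _, PerfCx.single (D.P l) s, ⟨Iso.refl _⟩⟩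

lemma noHom_Q_iff (K L : ChMod R) [K.IsKProjective] (n : ℤ) :
    NoHom (Q.obj K) ((Q.obj L)⟦n⟧) ↔ ∀ z : Cocycle K L n, z ∈ coboundaries K L n := by
  let e := Iso.homCongr ((quotientCompQhIso (RMod R)).symm.app K)
      ((Q.commShiftIso n).symm.app L ≪≫ (quotientCompQhIso (RMod R)).symm.app (L⟦n⟧))
  have h0 : e 0 = 0 := by simp [e]
  have hb := (CochainComplex.IsKProjective.Qh_map_bijective K
    ((HomotopyCategory.quotient _ _).obj (L⟦n⟧)))
  constructor
  · intro h z
    rw [← CohomologyClass.toHom_mk_eq_zero_iff]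
    apply hb.1
    rw [Functor.map_zero]
    obtain ⟨f, hf⟩ := e.surjective (Qh.map (CohomologyClass.toHom (CohomologyClass.mk z)))
    rw [h f, h0] at hf
    exact hf.symm
  · intro h f
    apply e.injective
    rw [h0]
    obtain ⟨g, hg⟩ := hb.2 (e f)
    obtain ⟨x, rfl⟩ := (CohomologyClass.toHom_bijective K L n).2 g
    obtain ⟨z, rfl⟩ := x.mk_surjective
    rw [← hg, (CohomologyClass.toHom_mk_eq_zero_iff z).2 (h z)]
    exact Functor.map_zero _ _ _

lemma NoHom.of_iso {𝒞 : Type*} [Category* 𝒞] [Preadditive 𝒞] {X X' Y Y' : 𝒞} (h : NoHom X Y)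
    (e : X ≅ X') (e' : Y ≅ Y') : NoHom X' Y' := fun f => by
  have := h (e.hom ≫ f ≫ e'.inv)
  rwa [← Category.assoc, Preadditive.IsIso.comp_right_eq_zero,
    Preadditive.IsIso.comp_left_eq_zero] at this

/-- Rigid perfect complexes over a symmetric algebra have no negative self-extensions of
degree one. -/
lemma Built.noHom_neg_one [FiniteDimensional k R] (S : SymForm k R) {ι : Type} {D : ProjData k R ι}
    {a b : ℤ} {X : DMod R} (hX : Built D a b X)
    (h : NoHom X (X⟦(1 : ℤ)⟧)) : NoHom X (X⟦(-1 : ℤ)⟧) := by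
  obtain ⟨K, lo, N, hK, ⟨i⟩⟩ := hX.isPerf
  have := hK.isKProjective
  refine NoHom.of_iso ?_ i.symm ((CategoryTheory.shiftFunctor _ (-1 : ℤ)).mapIso i.symm)
  have h := (noHom_Q_iff K K 1).1
    (h.of_iso i ((CategoryTheory.shiftFunctor _ (1 : ℤ)).mapIso i))
  rw [noHom_Q_iff]
  intro z
  rw [mem_coboundaries_iff z (-2) (by omega)]
  refine hK.exists_coboundary S (fun c hc => ?_) z (z.δ_eq_zero 0)
  exact (mem_coboundaries_iff _ 0 (by omega)).1 (h (Cocycle.mk c 2 (by omega) hc))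

end
end

section
/-- A quiver whose arrows are organised in oriented cycles: `s x` is the arrow following `x` on its
cycle, `v x` its source, `ℓ x` the length of the cycle, and `c w` an arrow starting at `w`. -/
structure CycData (V X : Type) where
  s : X → X
  v : X → V
  ℓ : X → ℕ
  c : V → X
  two_le : ∀ x, 2 ≤ ℓ x
  ℓ_s : ∀ x, ℓ (s x) = ℓ x
  iter : ∀ x, s^[ℓ x] x = x
  v_c : ∀ w, v (c w) = w

/-- The product of `n` successive arrows on a cycle, starting with `x`. -/
def cycWord {A X : Type} [Ring A] (a : X → A) (s : X → X) (x : X) : ℕ → A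
  | 0 => 1
  | n + 1 => a x * cycWord a s (s x) n

lemma cycWord_add {A X : Type} [Ring A] (a : X → A) (s : X → X) (x : X) (m n : ℕ) :
    cycWord a s x (m + n) = cycWord a s x m * cycWord a s (s^[m] x) n := by
  induction m generalizing x with
  | zero => rw [zero_add, cycWord, one_mul, Function.iterate_zero_apply]
  | succ m ih => rw [Nat.succ_add, cycWord, cycWord, ih, mul_assoc, Function.iterate_succ_apply]

namespace CycData
variable {V X : Type} [Fintype V] [DecidableEq V] (D : CycData V X)

/-- The relations of the symmetric special biserial algebra in which all cycles at a vertex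
agree. -/
structure Rels {A : Type} [Ring A] (e : V → A) (a : X → A) : Prop where
  mul_e : ∀ v w, e v * e w = if v = w then e v else 0
  sum_e : ∑ v, e v = 1
  e_mul : ∀ x, e (D.v x) * a x = a x
  a_mul : ∀ x, a x * e (D.v (D.s x)) = a x
  a_mul_a : ∀ x y, y ≠ D.s x → a x * a y = 0
  cyc : ∀ x y, D.v x = D.v y → cycWord a D.s x (D.ℓ x) = cycWord a D.s y (D.ℓ y)
  long : ∀ x, cycWord a D.s x (D.ℓ x + 1) = 0

lemma ℓ_iter (x : X) (n : ℕ) : D.ℓ (D.s^[n] x) = D.ℓ x := by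
  induction n generalizing x with
  | zero => rfl
  | succ n ih => rw [Function.iterate_succ_apply, ih, D.ℓ_s]

/-- The partial action of the generators on the paths of the quiver. -/
inductive State (V X : Type)
  | start (v : V)
  | mid (x : X) (n : ℕ)
  | fin (v : V)

/-- The state in which `n` arrows of a cycle are left, beginning with `x`. -/
def left (x : X) (n : ℕ) : State V X := if n = 0 then .fin (D.v x) else .mid x n

variable [DecidableEq X]

/-- The action of an arrow on a state. -/
def step (x : X) : State V X → Option (State V X)
  | .start w => if w = D.v x then some (D.left (D.s x) (D.ℓ x - 1)) else none
  | .mid y n => if y = x ∧ n < D.ℓ y then some (D.left (D.s y) (n - 1)) else none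
  | .fin _ => none

/-- The current vertex. -/
def pos : State V X → V
  | .start v => v
  | .mid x _ => D.v x
  | .fin v => v

variable (k : Type) [Field k]

/-- The operator given by an arrow. -/
def repA (x : X) : Module.End k (State V X → k) where
  toFun f t := (D.step x t).elim 0 f
  map_add' f g := funext fun t => by cases h : D.step x t <;> simp [h]
  map_smul' c f := funext fun t => by cases h : D.step x t <;> simp [h]

/-- The operator given by a vertex. -/
def repE (v : V) : Module.End k (State V X → k) where
  toFun f t := if D.pos t = v then f t else 0
  map_add' f g := funext fun t => by simp only [Pi.add_apply]; split_ifs <;> simp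
  map_smul' c f := funext fun t => by simp

variable {k}

lemma repA_apply (x : X) (f : State V X → k) (t : State V X) :
    D.repA k x f t = (D.step x t).elim 0 f := rfl

lemma repE_apply (v : V) (f : State V X → k) (t : State V X) :
    D.repE k v f t = if D.pos t = v then f t else 0 := rfl

lemma pos_left (x : X) (n : ℕ) : D.pos (D.left x n) = D.v x := by
  rw [left]; split_ifs <;> rfl

lemma pos_of_step {x : X} {t u : State V X} (h : D.step x t = some u) :
    D.pos t = D.v x ∧ D.pos u = D.v (D.s x) := by
  cases t with
  | start w =>
    rw [step] at h
    split_ifs at h with h1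
    cases h
    exact ⟨h1, D.pos_left _ _⟩
  | mid y n =>
    rw [step] at h
    split_ifs at h with h1
    cases h
    obtain ⟨rfl, -⟩ := h1
    exact ⟨rfl, D.pos_left _ _⟩
  | fin w => cases h

lemma step_left {x y : X} {n : ℕ} (h : y ≠ x) : D.step y (D.left x n) = none := by
  rw [left]
  split_ifs
  · rfl
  · exact if_neg fun h1 => h h1.1.symm

lemma word_left (x : X) (n r : ℕ) (hr : r < D.ℓ x) (h : n ≤ r) (f : State V X → k) :
    cycWord (D.repA k) D.s x n f (D.left x r) = f (D.left (D.s^[n] x) (r - n)) := by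
  induction n generalizing x r with
  | zero => rfl
  | succ n ih =>
    rw [cycWord, Module.End.mul_apply, repA_apply, left, if_neg (by omega), step, if_pos ⟨rfl, hr⟩,
      Option.elim_some, ih _ _ (by rw [ℓ_s]; omega) (by omega), Function.iterate_succ_apply,
      Nat.sub_sub, Nat.add_comm]

lemma word_left_eq_zero (x : X) (n r : ℕ) (h : r < n) (f : State V X → k) :
    cycWord (D.repA k) D.s x n f (D.left x r) = 0 := by
  induction n generalizing x r with
  | zero => omega
  | succ n ih =>
    rw [cycWord, Module.End.mul_apply, repA_apply, left]
    split_ifs with h1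
    · rfl
    · rw [step]
      split_ifs
      · exact ih _ _ (by omega)
      · rfl

lemma word_mid {x : X} {n : ℕ} (h : D.ℓ x ≤ n) (f : State V X → k) (y : X) (r : ℕ) :
    cycWord (D.repA k) D.s x n f (.mid y r) = 0 := by
  have := D.two_le x
  obtain ⟨n, rfl⟩ : ∃ m, n = m + 1 := ⟨n - 1, by omega⟩
  rw [cycWord, Module.End.mul_apply, repA_apply, step]
  split_ifs with h1
  · obtain ⟨rfl, h2⟩ := h1
    exact D.word_left_eq_zero _ _ _ (by omega) _
  · rfl

lemma word_fin (x : X) (n : ℕ) (f : State V X → k) (w : V) :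
    cycWord (D.repA k) D.s x (n + 1) f (.fin w) = 0 := rfl

lemma word_start_of_ne {x : X} {w : V} (h : w ≠ D.v x) (n : ℕ) (f : State V X → k) :
    cycWord (D.repA k) D.s x (n + 1) f (.start w) = 0 := by
  rw [cycWord, Module.End.mul_apply, repA_apply, step, if_neg h]
  rfl

lemma word_start (x : X) (n : ℕ) (h : n + 1 ≤ D.ℓ x) (f : State V X → k) :
    cycWord (D.repA k) D.s x (n + 1) f (.start (D.v x)) =
      f (D.left (D.s^[n + 1] x) (D.ℓ x - (n + 1))) := by
  rw [cycWord, Module.End.mul_apply, repA_apply, step, if_pos rfl, Option.elim_some,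
    D.word_left _ _ _ (by rw [ℓ_s]; omega) (by omega), Function.iterate_succ_apply, Nat.sub_sub,
    Nat.add_comm]

lemma word_start_cyc (x : X) (f : State V X → k) (w : V) :
    cycWord (D.repA k) D.s x (D.ℓ x) f (.start w) = if w = D.v x then f (.fin w) else 0 := by
  have := D.two_le x
  have h1 : D.ℓ x = D.ℓ x - 1 + 1 := by omega
  split_ifs with h
  · subst h
    rw [h1, D.word_start _ _ (by omega), ← h1, Nat.sub_self, D.iter]
    rfl
  · rw [h1, D.word_start_of_ne h]

lemma rels_rep : D.Rels (D.repE k) (D.repA k) where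
  mul_e v w := by
    refine LinearMap.ext fun f => funext fun t => ?_
    rw [Module.End.mul_apply, repE_apply, repE_apply]
    by_cases h : v = w
    · subst h
      rw [if_pos rfl, repE_apply]
      split_ifs <;> rfl
    · rw [if_neg h]
      by_cases h1 : D.pos t = v
      · rw [if_pos h1, if_neg (h1.symm ▸ h)]
        rfl
      · rw [if_neg h1]
        rfl
  sum_e := by
    refine LinearMap.ext fun f => funext fun t => ?_
    rw [LinearMap.sum_apply, Finset.sum_apply]
    simp only [repE_apply]
    simp
  e_mul x := by
    refine LinearMap.ext fun f => funext fun t => ?_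
    rw [Module.End.mul_apply, repE_apply, repA_apply]
    cases h : D.step x t with
    | none => simp
    | some u => rw [if_pos (D.pos_of_step h).1]
  a_mul x := by
    refine LinearMap.ext fun f => funext fun t => ?_
    rw [Module.End.mul_apply, repA_apply, repA_apply]
    cases h : D.step x t with
    | none => rfl
    | some u => exact if_pos (D.pos_of_step h).2
  a_mul_a x y hxy := by
    refine LinearMap.ext fun f => funext fun t => ?_
    have key : ∀ n, (D.repA k y f) (D.left (D.s x) n) = 0 := fun n => by
      rw [repA_apply, D.step_left hxy]
      rfl
    rw [Module.End.mul_apply, repA_apply]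
    cases t with
    | start w => rw [step]; split_ifs; exacts [key _, rfl]
    | mid z n =>
      rw [step]
      split_ifs with h
      · obtain ⟨rfl, -⟩ := h
        exact key _
      · rfl
    | fin w => rfl
  cyc x y h := by
    refine LinearMap.ext fun f => funext fun t => ?_
    cases t with
    | start w => rw [word_start_cyc, word_start_cyc, h]
    | mid z n => rw [D.word_mid le_rfl, D.word_mid le_rfl]
    | fin w =>
      obtain ⟨n, hn⟩ : ∃ m, D.ℓ x = m + 1 := ⟨D.ℓ x - 1, by have := D.two_le x; omega⟩
      obtain ⟨m, hm⟩ : ∃ m, D.ℓ y = m + 1 := ⟨D.ℓ y - 1, by have := D.two_le y; omega⟩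
      rw [hn, hm, word_fin, word_fin]
  long x := by
    refine LinearMap.ext fun f => funext fun t => ?_
    cases t with
    | start w =>
      by_cases h : w = D.v x
      · rw [cycWord, Module.End.mul_apply, repA_apply, step, if_pos h]
        exact D.word_left_eq_zero _ _ _ (by have := D.two_le x; omega) _
      · exact D.word_start_of_ne h _ _
    | mid z n => exact D.word_mid (by omega) _ _ _
    | fin w => rfl

variable (k) in
/-- The operators used to detect the socle: sum of the coefficients of the maximal paths. -/
def socTr : Module.End k (State V X → k) →ₗ[k] k where
  toFun φ := ∑ v, φ (fun t => match t with | .fin _ => 1 | _ => 0) (.start v)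
  map_add' φ ψ := by simp [Finset.sum_add_distrib]
  map_smul' c φ := by simp [Finset.mul_sum]

lemma socTr_e (v : V) : socTr k (D.repE k v) = 0 :=
  Finset.sum_eq_zero fun w _ => by
    rw [repE_apply]
    exact ite_self _

lemma socTr_word (x : X) (n : ℕ) :
    socTr k (cycWord (D.repA k) D.s x (n + 1)) = if n + 1 = D.ℓ x then 1 else 0 := by
  refine (Finset.sum_eq_single (D.v x) (fun w _ hw => D.word_start_of_ne hw _ _)
    fun h => absurd (Finset.mem_univ _) h).trans ?_
  rcases lt_trichotomy (n + 1) (D.ℓ x) with h | h | h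
  · rw [D.word_start _ _ h.le, if_neg h.ne, left, if_neg (by omega)]
  · rw [D.word_start _ _ h.le, if_pos h, left, if_pos (by omega)]
  · rw [if_neg h.ne', cycWord, Module.End.mul_apply, repA_apply, step, if_pos rfl]
    exact D.word_left_eq_zero _ _ _ (by have := D.two_le x; omega) _

end CycData
end

section
lemma cycWord_one {A X : Type} [Ring A] (a : X → A) (s : X → X) (x : X) :
    cycWord a s x 1 = a x := mul_one _

namespace CycData
variable {V X : Type} [Fintype V] [DecidableEq V] (D : CycData V X)

lemma ℓ_pos (x : X) : 0 < D.ℓ x := by have := D.two_le x; omega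

lemma s_injective : Function.Injective D.s := fun x y h => by
  have h1 : D.ℓ x = D.ℓ y := by rw [← D.ℓ_s, h, D.ℓ_s]
  have h2 : D.ℓ x = D.ℓ x - 1 + 1 := by have := D.ℓ_pos x; omega
  rw [← D.iter x, ← D.iter y, ← h1, h2, Function.iterate_succ_apply, Function.iterate_succ_apply, h]

namespace Rels
variable {D} {A : Type} [Ring A] {e : V → A} {a : X → A} (h : D.Rels e a)
include h

lemma e_word {x : X} {n : ℕ} (hn : 0 < n) (w : V) :
    e w * cycWord a D.s x n = if w = D.v x then cycWord a D.s x n else 0 := by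
  obtain ⟨n, rfl⟩ : ∃ m, n = m + 1 := ⟨n - 1, by omega⟩
  rw [cycWord, ← h.e_mul x, ← mul_assoc, ← mul_assoc, h.mul_e]
  split_ifs with h1
  · rw [h1]
  · rw [zero_mul, zero_mul]

lemma word_succ (x : X) (n : ℕ) :
    cycWord a D.s x (n + 1) = cycWord a D.s x n * a (D.s^[n] x) := by
  rw [cycWord_add, cycWord, cycWord, mul_one]

lemma word_e {x : X} {n : ℕ} (hn : 0 < n) (w : V) :
    cycWord a D.s x n * e w = if D.v (D.s^[n] x) = w then cycWord a D.s x n else 0 := by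
  obtain ⟨n, rfl⟩ : ∃ m, n = m + 1 := ⟨n - 1, by omega⟩
  rw [h.word_succ, ← h.a_mul, mul_assoc, mul_assoc, h.mul_e, Function.iterate_succ_apply']
  split_ifs with h1
  · rfl
  · rw [mul_zero, mul_zero]

lemma word_mul [DecidableEq X] {x y : X} {m n : ℕ} (hm : 0 < m) (hn : 0 < n) :
    cycWord a D.s x m * cycWord a D.s y n =
      if y = D.s^[m] x then cycWord a D.s x (m + n) else 0 := by
  split_ifs with h1
  · rw [cycWord_add, h1]
  · obtain ⟨m, rfl⟩ : ∃ m', m = m' + 1 := ⟨m - 1, by omega⟩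
    obtain ⟨n, rfl⟩ : ∃ m, n = m + 1 := ⟨n - 1, by omega⟩
    rw [Function.iterate_succ_apply'] at h1
    rw [h.word_succ, cycWord, mul_assoc, ← mul_assoc (a _) (a y), h.a_mul_a _ _ h1, zero_mul,
      mul_zero]

lemma word_eq_zero {x : X} {n : ℕ} (hn : D.ℓ x < n) : cycWord a D.s x n = 0 := by
  obtain ⟨m, rfl⟩ : ∃ m, n = D.ℓ x + 1 + m := ⟨n - (D.ℓ x + 1), by omega⟩
  rw [cycWord_add, h.long, zero_mul]

variable {k : Type} [Field k] [Algebra k A]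

lemma mem_span_words [DecidableEq X] (hg : Algebra.adjoin k (Set.range e ∪ Set.range a) = ⊤) (r : A) :
    r ∈ Submodule.span k (Set.range e ∪ {y | ∃ x n, 0 < n ∧ y = cycWord a D.s x n}) := by
  set S := Submodule.span k (Set.range e ∪ {y | ∃ x n, 0 < n ∧ y = cycWord a D.s x n})
  have he (v) : e v ∈ S := Submodule.subset_span (Or.inl ⟨v, rfl⟩)
  have hw (x n) (hn : 0 < n) : cycWord a D.s x n ∈ S :=
    Submodule.subset_span (Or.inr ⟨x, n, hn, rfl⟩)
  have ha (x) : a x ∈ S := by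
    have := hw x 1 one_pos
    rwa [cycWord_one] at this
  have hr : r ∈ Subalgebra.toSubmodule (Algebra.adjoin k (Set.range e ∪ Set.range a)) := by
    rw [hg]; trivial
  rw [Algebra.adjoin_eq_span] at hr
  refine Submodule.span_le.2 (fun r hr => ?_) hr
  induction hr using Submonoid.closure_induction_right with
  | one =>
    change (1 : A) ∈ S
    rw [← h.sum_e]
    exact Submodule.sum_mem _ fun v _ => he v
  | mul_right r hr y hy ih =>
    clear hr
    replace ih : r ∈ Submodule.span k
      (Set.range e ∪ {y | ∃ x n, 0 < n ∧ y = cycWord a D.s x n}) := ih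
    change r * y ∈ S
    induction ih using Submodule.span_induction with
    | mem r hr =>
      rcases hr with ⟨v, rfl⟩ | ⟨x, n, hn, rfl⟩ <;> rcases hy with ⟨w, rfl⟩ | ⟨z, rfl⟩
      · rw [h.mul_e]
        split_ifs
        exacts [he _, zero_mem _]
      · rw [← h.e_mul, ← mul_assoc, h.mul_e]
        split_ifs with h1
        · rw [h1, h.e_mul]
          exact ha _
        · rw [zero_mul]
          exact zero_mem _
      · rw [h.word_e hn]
        split_ifs
        exacts [hw _ _ hn, zero_mem _]
      · have h1 := h.word_mul (x := x) (y := z) hn one_pos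
        rw [cycWord_one] at h1
        rw [h1]
        split_ifs
        exacts [hw _ _ (by omega), zero_mem _]
    | zero => rw [zero_mul]; exact zero_mem _
    | add r s _ _ h1 h2 => rw [add_mul]; exact add_mem h1 h2
    | smul c r _ h1 => rw [smul_mul_assoc]; exact Submodule.smul_mem _ _ h1

end Rels

/-- A universal presentation of an algebra by the relations of `D`. -/
structure Pres (k A : Type) [Field k] [Ring A] [Algebra k A] where
  e : V → A
  a : X → A
  rels : D.Rels e a
  gen : Algebra.adjoin k (Set.range e ∪ Set.range a) = ⊤
  lift : ∀ (E : Type) [Ring E] [Algebra k E] (e' : V → E) (a' : X → E), D.Rels e' a' →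
    ∃ φ : A →ₐ[k] E, (∀ v, φ (e v) = e' v) ∧ ∀ x, φ (a x) = a' x

namespace Pres
variable {D} {k A : Type} [Field k] [Ring A] [Algebra k A] (P : D.Pres k A)

/-- A path on a cycle. -/
abbrev W (x : X) (n : ℕ) : A := cycWord P.a D.s x n

lemma map_W {E : Type} [Ring E] [Algebra k E] (φ : A →ₐ[k] E) {a' : X → E}
    (h : ∀ x, φ (P.a x) = a' x) (x : X) (n : ℕ) : φ (P.W x n) = cycWord a' D.s x n := by
  induction n generalizing x with
  | zero => exact map_one φ
  | succ n ih => rw [W, cycWord, map_mul, h, cycWord, ← ih]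

variable [DecidableEq X]

/-- The symmetrizing functional, given by the coefficients of the maximal paths. -/
def lam : A →ₗ[k] k :=
  socTr k ∘ₗ (P.lift (Module.End k (State V X → k)) _ _ D.rels_rep).choose.toLinearMap

lemma lam_e (v : V) : P.lam (P.e v) = 0 := by
  refine (congrArg (socTr k) ((P.lift _ _ _ D.rels_rep).choose_spec.1 v)).trans (D.socTr_e v)

lemma lam_W {x : X} {n : ℕ} (hn : 0 < n) : P.lam (P.W x n) = if n = D.ℓ x then 1 else 0 := by
  obtain ⟨n, rfl⟩ : ∃ m, n = m + 1 := ⟨n - 1, by omega⟩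
  exact (congrArg (socTr k) (P.map_W _ (P.lift _ _ _ D.rels_rep).choose_spec.2 x (n + 1))).trans
    (D.socTr_word x n)

lemma lam_e_e (v w : V) : P.lam (P.e v * P.e w) = 0 := by
  rw [P.rels.mul_e]
  split_ifs
  exacts [P.lam_e _, map_zero _]

lemma lam_e_W {x : X} {n : ℕ} (hn : 0 < n) (w : V) :
    P.lam (P.e w * P.W x n) = if w = D.v x ∧ n = D.ℓ x then 1 else 0 := by
  rw [P.rels.e_word hn, apply_ite P.lam, P.lam_W hn, map_zero, ite_and]

lemma lam_W_e {x : X} {n : ℕ} (hn : 0 < n) (w : V) :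
    P.lam (P.W x n * P.e w) = if w = D.v x ∧ n = D.ℓ x then 1 else 0 := by
  rw [P.rels.word_e hn, apply_ite P.lam, P.lam_W hn, map_zero, ← ite_and]
  refine if_congr ⟨fun h => ?_, fun h => ?_⟩ rfl rfl
  · rw [← h.1, h.2, D.iter]
    exact ⟨rfl, rfl⟩
  · rw [h.1, h.2, D.iter]
    exact ⟨rfl, rfl⟩

lemma lam_W_W {x y : X} {m n : ℕ} (hm : 0 < m) (hn : 0 < n) :
    P.lam (P.W x m * P.W y n) = if y = D.s^[m] x ∧ m + n = D.ℓ x then 1 else 0 := by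
  rw [P.rels.word_mul hm hn, apply_ite P.lam, P.lam_W (by omega), map_zero, ite_and]

lemma lam_comm (r s : A) : P.lam (r * s) = P.lam (s * r) := by
  induction P.rels.mem_span_words P.gen r using Submodule.span_induction with
  | mem r hr =>
    induction P.rels.mem_span_words P.gen s using Submodule.span_induction with
    | mem s hs =>
      rcases hr with ⟨v, rfl⟩ | ⟨x, n, hn, rfl⟩ <;> rcases hs with ⟨w, rfl⟩ | ⟨z, m, hm, rfl⟩
      · rw [lam_e_e, lam_e_e]
      · exact (P.lam_e_W hm v).trans (P.lam_W_e hm v).symm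
      · exact (P.lam_W_e hn w).trans (P.lam_e_W hn w).symm
      · refine (P.lam_W_W hn hm).trans (Eq.trans ?_ (P.lam_W_W hm hn).symm)
        have key {x z : X} {m n : ℕ} (h1 : z = D.s^[n] x) (h2 : n + m = D.ℓ x) :
            x = D.s^[m] z ∧ m + n = D.ℓ z := by
          rw [h1, ← Function.iterate_add_apply, Nat.add_comm m n, h2, D.iter, D.ℓ_iter]
          exact ⟨rfl, rfl⟩
        exact if_congr ⟨fun h => key h.1 h.2, fun h => key h.1 h.2⟩ rfl rfl
    | zero => rw [mul_zero, zero_mul]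
    | add s t _ _ h1 h2 => rw [add_mul, mul_add, map_add, map_add, h1, h2]
    | smul c s _ h1 => rw [smul_mul_assoc, mul_smul_comm, map_smul, map_smul, h1]
  | zero => rw [mul_zero, zero_mul]
  | add s t _ _ h1 h2 => rw [add_mul, mul_add, map_add, map_add, h1, h2]
  | smul c s _ h1 => rw [smul_mul_assoc, mul_smul_comm, map_smul, map_smul, h1]

variable (D) in
/-- The index set of the path basis: trivial paths, maximal paths, and proper paths on cycles. -/
abbrev Idx : Type := V ⊕ V ⊕ Σ x : X, Fin (D.ℓ x - 1)

/-- The path basis. -/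
def b : Idx D → A
  | .inl v => P.e v
  | .inr (.inl v) => P.W (D.c v) (D.ℓ (D.c v))
  | .inr (.inr ⟨x, i⟩) => P.W x (i + 1)

/-- The dual path basis. -/
def b' : Idx D → A
  | .inl v => P.W (D.c v) (D.ℓ (D.c v))
  | .inr (.inl v) => P.e v
  | .inr (.inr ⟨x, i⟩) => P.W (D.s^[i + 1] x) (D.ℓ x - (i + 1))

lemma lam_b (s t : Idx D) : P.lam (P.b s * P.b' t) = if s = t then 1 else 0 := by
  rcases s with v | v | ⟨x, i⟩ <;> rcases t with w | w | ⟨y, j⟩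
  · refine (P.lam_e_W (D.ℓ_pos _) _).trans (if_congr ?_ rfl rfl)
    simp [D.v_c]
  · exact (P.lam_e_e v w).trans (if_neg (by simp)).symm
  · refine (P.lam_e_W (by omega) _).trans ?_
    rw [if_neg (by rw [D.ℓ_iter]; omega), if_neg (by simp)]
  · refine (P.lam_W_W (D.ℓ_pos _) (D.ℓ_pos _)).trans ?_
    rw [if_neg (by have := D.ℓ_pos (D.c w); omega), if_neg (by simp)]
  · refine (P.lam_W_e (D.ℓ_pos _) _).trans (if_congr ?_ rfl rfl)
    simp [D.v_c, eq_comm]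
  · refine (P.lam_W_W (D.ℓ_pos _) (by omega)).trans ?_
    rw [if_neg (by omega), if_neg (by simp)]
  · refine (P.lam_W_W (by omega) (D.ℓ_pos _)).trans ?_
    rw [if_neg, if_neg (by simp)]
    rintro ⟨h1, h2⟩
    rw [h1, D.ℓ_iter] at h2
    omega
  · refine (P.lam_W_e (by omega) _).trans ?_
    rw [if_neg (by omega), if_neg (by simp)]
  · refine (P.lam_W_W (by omega) (by omega)).trans (if_congr ⟨fun h => ?_, fun h => ?_⟩ rfl rfl)
    · obtain ⟨h1, h2⟩ := h
      have h3 : D.ℓ y = D.ℓ x := by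
        have := congrArg D.ℓ h1
        rwa [D.ℓ_iter, D.ℓ_iter] at this
      have h4 : (j : ℕ) = i := by omega
      rw [h4] at h1
      have h5 : y = x := D.s_injective.iterate _ h1
      subst h5
      have h6 : j = i := Fin.ext h4
      rw [h6]
    · cases h
      exact ⟨rfl, by have := i.2; omega⟩

lemma linearIndependent_b [Fintype X] : LinearIndependent k P.b := by
  rw [Fintype.linearIndependent_iff]
  intro g hg t
  have h1 := congrArg (fun r => P.lam (r * P.b' t)) hg
  simpa [-Fintype.sum_sum_type, Finset.sum_mul, lam_b] using h1

lemma span_b : Submodule.span k (Set.range P.b) = ⊤ := by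
  refine eq_top_iff.2 fun r _ => Submodule.span_le.2 ?_ (P.rels.mem_span_words P.gen r)
  rintro _ (⟨v, rfl⟩ | ⟨x, n, hn, rfl⟩)
  · exact Submodule.subset_span ⟨.inl v, rfl⟩
  · rcases lt_trichotomy n (D.ℓ x) with h | h | h
    · refine Submodule.subset_span ⟨.inr (.inr ⟨x, n - 1, by omega⟩), ?_⟩
      change P.W x (n - 1 + 1) = _
      rw [Nat.sub_add_cancel hn]
    · subst h
      refine Submodule.subset_span ⟨.inr (.inl (D.v x)), ?_⟩
      exact P.rels.cyc _ _ (D.v_c _)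
    · rw [P.rels.word_eq_zero h]
      exact zero_mem _

/-- The path basis, as a basis. -/
def basis [Fintype X] : Module.Basis (Idx D) k A := .mk P.linearIndependent_b P.span_b.ge

lemma lam_basis [Fintype X] (r : A) (t : Idx D) : P.lam (r * P.b' t) = P.basis.repr r t := by
  conv_lhs => rw [← P.basis.sum_repr r]
  simp [-Fintype.sum_sum_type, Finset.sum_mul, basis, lam_b]

/-- The symmetrizing form of the opposite algebra. -/
def symForm [Fintype X] : SymForm k Aᵐᵒᵖ where
  lam := P.lam ∘ₗ (opLinearEquiv k).symm.toLinearMap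
  comm r s := P.lam_comm _ _
  nondeg r hr := by
    have h1 : P.basis.repr r.unop ≠ 0 := by simpa using hr
    obtain ⟨t, ht⟩ := Finsupp.ne_iff.1 h1
    refine ⟨MulOpposite.op (P.b' t), ?_⟩
    change P.lam (r.unop * P.b' t) ≠ 0
    rw [lam_basis]
    exact ht

end Pres
end CycData
end

section
open MatData

/-- Morphisms between the projective modules given by idempotents. -/
lemma finrank_hom_eq {k A : Type} [Field k] [Ring A] [Algebra k A] {e f : A}
    (he : e * e = e) (hf : f * f = f) {P Q : RMod Aᵐᵒᵖ} (x : P)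
    (hx : MulOpposite.op e • x = x)
    (hl : ∀ m : Q, MulOpposite.op e • m = m → ∃ g : P ⟶ Q, g x = m)
    (hext : ∀ g h : P ⟶ Q, g x = h x → g = h) (i : Q →ₗ[Aᵐᵒᵖ] Aᵐᵒᵖ)
    (hi : Function.Injective i) (hr : ∀ y, y ∈ LinearMap.range i ↔ y * MulOpposite.op f = y) :
    Module.finrank k (P ⟶ Q) =
      Module.finrank k (LinearMap.range (LinearMap.mulLeft k f ∘ₗ LinearMap.mulRight k e)) := by
  have h0 (c : k) (g : P ⟶ Q) : (c • g) x = algebraMap k Aᵐᵒᵖ c • g x := rfl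
  let φ : (P ⟶ Q) →ₗ[k] A :=
    { toFun g := (i (g x)).unop
      map_add' g h := congrArg MulOpposite.unop (map_add i (g x) (h x))
      map_smul' c g := by
        rw [h0, map_smul, smul_eq_mul, ← Algebra.smul_def]
        rfl }
  have hφ : Function.Injective φ := fun g h hgh => hext _ _ (hi (MulOpposite.unop_injective hgh))
  have hφr : LinearMap.range φ =
      LinearMap.range (LinearMap.mulLeft k f ∘ₗ LinearMap.mulRight k e) := by
    ext y
    constructor
    · rintro ⟨g, rfl⟩
      refine ⟨(i (g x)).unop, ?_⟩
      have h1 : (i (g x)).unop * e = (i (g x)).unop := by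
        have h1 : MulOpposite.op e • g x = g x :=
          (map_smul g.hom (MulOpposite.op e) x).symm.trans (congrArg g.hom hx)
        have h2 := congrArg i h1
        rw [map_smul] at h2
        exact congrArg MulOpposite.unop h2
      have h2 : f * (i (g x)).unop = (i (g x)).unop :=
        congrArg MulOpposite.unop ((hr _).1 ⟨_, rfl⟩)
      change f * ((i (g x)).unop * e) = (i (g x)).unop
      rw [h1, h2]
    · rintro ⟨z, rfl⟩
      obtain ⟨q, hq⟩ := (hr (MulOpposite.op (f * (z * e)))).2 (by
        rw [← MulOpposite.op_mul, ← mul_assoc f, hf])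
      obtain ⟨g, hg⟩ := hl q (hi (by
        rw [map_smul, hq, smul_eq_mul, ← MulOpposite.op_mul, mul_assoc, mul_assoc, he]))
      exact ⟨g, congrArg MulOpposite.unop ((congrArg i hg).trans hq)⟩
  rw [← hφr, LinearMap.finrank_range_of_inj hφ]

lemma finrank_range_of_basis {k A I : Type} [Field k] [AddCommGroup A] [Module k A] [Fintype I]
    (b : Module.Basis I k A) (T : A →ₗ[k] A) (p : I → Prop) [DecidablePred p]
    (h : ∀ i, T (b i) = if p i then b i else 0) :
    Module.finrank k (LinearMap.range T) = Fintype.card {i // p i} := by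
  have h1 : LinearMap.range T = Submodule.span k (Set.range fun i : {i // p i} => b i) := by
    rw [LinearMap.range_eq_map, ← b.span_eq, Submodule.map_span]
    refine le_antisymm (Submodule.span_le.2 ?_) (Submodule.span_le.2 ?_)
    · rintro _ ⟨_, ⟨i, rfl⟩, rfl⟩
      rw [h]
      split_ifs with hi
      · exact Submodule.subset_span ⟨⟨i, hi⟩, rfl⟩
      · exact zero_mem _
    · rintro _ ⟨⟨i, hi⟩, rfl⟩
      exact Submodule.subset_span ⟨_, ⟨i, rfl⟩, by rw [h, if_pos hi]⟩
  rw [h1]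
  exact finrank_span_eq_card (b.linearIndependent.comp _ Subtype.val_injective)

namespace CycData
variable {V X : Type} [Fintype V] [DecidableEq V] {D : CycData V X}
namespace Pres
variable {k A : Type} [Field k] [Ring A] [Algebra k A] (P : D.Pres k A)

lemma orth : OrthogonalIdempotents (fun v => MulOpposite.op (P.e v)) where
  idem v := congrArg MulOpposite.op ((P.rels.mul_e v v).trans (if_pos rfl))
  ortho v w h := congrArg MulOpposite.op ((P.rels.mul_e w v).trans (if_neg h.symm))

variable (D k) in
lemma rels_char : D.Rels (fun v => (Pi.single v 1 : V → k)) (fun _ => 0) where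
  mul_e v w := by
    ext u
    split_ifs with h
    · subst h
      rcases eq_or_ne u v with rfl | h <;> simp [*]
    · rcases eq_or_ne u v with rfl | h1
      · simp [h]
      · simp [h1]
  sum_e := by
    ext u
    simp [Finset.sum_apply, Pi.single_apply]
  e_mul _ := mul_zero _
  a_mul _ := zero_mul _
  a_mul_a _ _ _ := mul_zero _
  cyc x y _ := by
    obtain ⟨m, hm⟩ : ∃ m, D.ℓ x = m + 1 := ⟨_, (Nat.sub_add_cancel (D.ℓ_pos x)).symm⟩
    obtain ⟨n, hn⟩ : ∃ m, D.ℓ y = m + 1 := ⟨_, (Nat.sub_add_cancel (D.ℓ_pos y)).symm⟩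
    rw [hm, hn, cycWord, cycWord, zero_mul, zero_mul]
  long _ := zero_mul _

/-- The characters given by the vertices. -/
def char : A →ₐ[k] V → k := (P.lift _ _ _ (rels_char D k)).choose

lemma char_e (v : V) : P.char (P.e v) = Pi.single v 1 :=
  (P.lift _ _ _ (rels_char D k)).choose_spec.1 v

lemma char_W (x : X) {n : ℕ} (hn : 0 < n) : P.char (P.W x n) = 0 := by
  obtain ⟨m, rfl⟩ : ∃ m, n = m + 1 := ⟨_, (Nat.sub_add_cancel hn).symm⟩
  rw [W, cycWord, map_mul]
  exact (congrArg (· * _) ((P.lift _ _ _ (rels_char D k)).choose_spec.2 x)).trans (zero_mul _)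

variable [Fintype X] [DecidableEq X]

lemma isNilpotent (r : A) (hr : P.char r = 0) : IsNilpotent r := by
  let J (n : ℕ) : Submodule k A := Submodule.span k {y | ∃ x m, n < m ∧ y = P.W x m}
  have h0 : ∃ c : V → k, r - ∑ v, c v • P.e v ∈ J 0 := by
    refine Submodule.span_induction (p := fun r _ => ∃ c : V → k, r - ∑ v, c v • P.e v ∈ J 0)
      ?_ ⟨0, by simp⟩ ?_ ?_ (P.rels.mem_span_words P.gen r)
    · rintro _ (⟨v, rfl⟩ | ⟨x, n, hn, rfl⟩)
      · exact ⟨Pi.single v 1, by simp [Pi.single_apply]⟩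
      · exact ⟨0, by
          simpa using (Submodule.subset_span ⟨x, n, hn, rfl⟩ : P.W x n ∈ J 0)⟩
    · rintro r s - - ⟨c, hc⟩ ⟨d, hd⟩
      refine ⟨c + d, ?_⟩
      have := add_mem hc hd
      simp only [Pi.add_apply, add_smul, Finset.sum_add_distrib]
      rwa [add_sub_add_comm]
    · rintro t r - ⟨c, hc⟩
      refine ⟨t • c, ?_⟩
      have := Submodule.smul_mem _ t hc
      rw [smul_sub, Finset.smul_sum] at this
      simpa [smul_smul] using this
  have hJ {y : A} (hy : y ∈ J 0) : P.char y = 0 := by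
    induction hy using Submodule.span_induction with
    | mem y hy =>
      obtain ⟨x, m, hm, rfl⟩ := hy
      exact P.char_W x hm
    | zero => exact map_zero _
    | add y z _ _ h1 h2 => rw [map_add, h1, h2, add_zero]
    | smul t y _ h1 => rw [map_smul, h1, smul_zero]
  have hr0 : r ∈ J 0 := by
    obtain ⟨c, hc⟩ := h0
    have h1 := hJ hc
    rw [map_sub, hr, zero_sub, neg_eq_zero, map_sum] at h1
    have h2 (v) : c v = 0 := by
      have := congrFun h1 v
      simpa [char_e, Finset.sum_apply, Pi.single_apply] using this
    simpa [h2] using hc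
  have hpow (n : ℕ) : r ^ (n + 1) ∈ J n := by
    induction n with
    | zero => rwa [zero_add, pow_one]
    | succ n ih =>
      rw [pow_succ]
      generalize r ^ (n + 1) = y at ih
      induction ih using Submodule.span_induction with
      | mem y hy =>
        obtain ⟨x, m, hm, rfl⟩ := hy
        clear hr h0
        induction hr0 using Submodule.span_induction with
        | mem z hz =>
          obtain ⟨x', m', hm', rfl⟩ := hz
          rw [P.rels.word_mul (by omega) hm']
          split_ifs
          · exact Submodule.subset_span ⟨_, m + m', by omega, rfl⟩
          · exact zero_mem _
        | zero => rw [mul_zero]; exact zero_mem _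
        | add y z _ _ h1 h2 => rw [mul_add]; exact add_mem h1 h2
        | smul t y _ h1 => rw [mul_smul_comm]; exact Submodule.smul_mem _ _ h1
      | zero => rw [zero_mul]; exact zero_mem _
      | add y z _ _ h1 h2 => rw [add_mul]; exact add_mem h1 h2
      | smul t y _ h1 => rw [smul_mul_assoc]; exact Submodule.smul_mem _ _ h1
  refine ⟨∑ x, D.ℓ x + 1, (Submodule.mem_bot k).1 (?_ : _ ∈ (⊥ : Submodule k A))⟩
  refine Submodule.span_le.2 ?_ (hpow _)
  rintro _ ⟨x, m, hm, rfl⟩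
  exact P.rels.word_eq_zero
    ((Finset.single_le_sum (fun _ _ => Nat.zero_le _) (Finset.mem_univ x)).trans_lt hm)

/-- The simple modules of the opposite algebra. -/
def matData : MatData k Aᵐᵒᵖ V where
  m _ := Unit
  o _ := ()
  π :=
    { toFun r l := Matrix.of fun _ _ => P.char r.unop l
      map_one' := by ext l i j; simp
      map_mul' r s := by ext l i j; simp [Matrix.mul_apply, mul_comm]
      map_zero' := by ext l i j; simp
      map_add' r s := by ext l i j; simp
      commutes' c := by
        ext l i j
        simp [MulOpposite.algebraMap_apply, Matrix.algebraMap_matrix_apply] }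
  surj f := by
    refine ⟨MulOpposite.op (∑ v, f v () () • P.e v), ?_⟩
    ext l i j
    change P.char (∑ v, f v () () • P.e v) l = f l () ()
    simp [char_e, Finset.sum_apply, Pi.single_apply]
  nil r hr := by
    obtain ⟨n, hn⟩ := P.isNilpotent r.unop (funext fun l => congrFun (congrFun (congrFun hr l) ()) ())
    exact ⟨n, MulOpposite.unop_injective hn⟩
  e v := MulOpposite.op (P.e v)
  orth := P.orth
  π_e l := by
    ext v i j
    rcases eq_or_ne v l with rfl | h <;> simp [char_e, *]

variable (D) in
/-- The source of a basis path. -/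
def src : Idx D → V
  | .inl v => v
  | .inr (.inl v) => v
  | .inr (.inr x) => D.v x.1

variable (D) in
/-- The target of a basis path. -/
def tgt : Idx D → V
  | .inl v => v
  | .inr (.inl v) => v
  | .inr (.inr x) => D.v (D.s^[x.2 + 1] x.1)

lemma e_b_e (i : Idx D) (v w : V) :
    P.e v * (P.b i * P.e w) = if src D i = v ∧ tgt D i = w then P.b i else 0 := by
  have key {y : A} {t u : V} (h1 : P.e v * y = if v = t then y else 0)
      (h2 : y * P.e w = if u = w then y else 0) :
      P.e v * (y * P.e w) = if t = v ∧ u = w then y else 0 := by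
    rw [h2]
    by_cases h3 : u = w
    · rw [if_pos h3, h1]
      exact if_congr ⟨fun h => ⟨h.symm, h3⟩, fun h => h.1.symm⟩ rfl rfl
    · rw [if_neg h3, if_neg fun h => h3 h.2, mul_zero]
  rcases i with u | u | ⟨x, i⟩
  · refine key (t := u) ?_ (P.rels.mul_e u w)
    rw [b, P.rels.mul_e]
    split_ifs with h
    · rw [h]
    · rfl
  · have h1 := P.rels.word_e (x := D.c u) (D.ℓ_pos (D.c u)) w
    have h2 := P.rels.e_word (x := D.c u) (D.ℓ_pos (D.c u)) v
    rw [D.iter, D.v_c] at h1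
    rw [D.v_c] at h2
    exact key h2 h1
  · exact key (P.rels.e_word (by omega) v) (P.rels.word_e (by omega) w)

lemma finrank_hom (v w : V) :
    Module.finrank k (P.matData.toIdemData.P w ⟶ P.matData.toIdemData.P v) =
      Fintype.card {i : Idx D // src D i = v ∧ tgt D i = w} := by
  have he (u) : P.e u * P.e u = P.e u := (P.rels.mul_e u u).trans (if_pos rfl)
  refine (finrank_hom_eq (he w) (he v) (P.matData.toIdemData.x w) (P.matData.toIdemData.x_smul w)
    (P.matData.toIdemData.lift w _) (P.matData.toIdemData.hom_ext w _)
    (idemMod (MulOpposite.op (P.e v))).subtype Subtype.val_injective fun y => ?_).trans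
    (finrank_range_of_basis P.basis _ _ fun i => ?_)
  · exact ⟨fun ⟨z, hz⟩ => hz ▸ z.2, fun h => ⟨⟨y, h⟩, rfl⟩⟩
  · rw [basis, Module.Basis.mk_apply]
    exact P.e_b_e i v w

include P in
/-- Algebras derived equivalent to a cycle algebra with singular Cartan matrix are τ-tilting
infinite. -/
theorem not_tauTiltingFinite [IsAlgClosed k] (δ : V → ℤ) {v₀ : V} (hv₀ : δ v₀ ≠ 0)
    (hδ : ∀ v, 2 * δ v + ∑ x with D.v x = v,
      ∑ i ∈ Finset.range (D.ℓ x - 1), δ (D.v (D.s^[i + 1] x)) = 0)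
    {B : Type} [Ring B] [Algebra k B] [FiniteDimensional k B] (h : DerivedEquivalent A B) :
    ¬ TauTiltingFinite k B := by
  let _ : HasDerivedCategory (RMod Aᵐᵒᵖ) := HasDerivedCategory.standard _
  let _ : HasDerivedCategory (RMod Bᵐᵒᵖ) := HasDerivedCategory.standard _
  obtain ⟨e, h1, h2⟩ := h
  have : FiniteDimensional k A := Module.Finite.of_basis P.basis
  have : FiniteDimensional k Aᵐᵒᵖ := Module.Finite.equiv (opLinearEquiv k)
  refine not_tauTiltingFinite_of_equiv (D := P.matData.toIdemData.toProjData) e hv₀ (fun v => ?_)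
    fun hX => hX.noHom_neg_one P.symForm
  rw [← hδ v]
  have h3 (w : V) : δ w * (Module.finrank k (P.matData.toIdemData.P w ⟶
      P.matData.toIdemData.P v) : ℤ) =
      ∑ i : Idx D, if src D i = v ∧ tgt D i = w then δ w else 0 := by
    rw [finrank_hom, Fintype.card_subtype, Finset.sum_ite, Finset.sum_const_zero, add_zero,
      Finset.sum_const, nsmul_eq_mul, mul_comm]
  rw [Finset.sum_congr rfl fun w _ => h3 w, Finset.sum_comm]
  have h4 (i : Idx D) : (∑ w, if src D i = v ∧ tgt D i = w then δ w else 0) =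
      if src D i = v then δ (tgt D i) else 0 := by
    simp [ite_and]
  rw [Finset.sum_congr rfl fun i _ => h4 i, Fintype.sum_sum_type, Fintype.sum_sum_type,
    Fintype.sum_sigma, Finset.sum_filter, two_mul, add_assoc]
  refine congrArg₂ _ ((Finset.sum_ite_eq' _ v δ).trans (if_pos (Finset.mem_univ v)))
    (congrArg₂ _ ((Finset.sum_ite_eq' _ v δ).trans (if_pos (Finset.mem_univ v)))
    (Finset.sum_congr rfl fun x _ => ?_))
  split_ifs with hx
  · rw [← Fin.sum_univ_eq_sum_range fun i => δ (D.v (D.s^[i + 1] x))]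
    exact Finset.sum_congr rfl fun i _ => if_pos hx
  · exact Finset.sum_eq_zero fun i _ => if_neg hx

end Pres
end CycData
end

section
lemma cycWord_eq_prod_range {A X : Type} [Ring A] (a : X → A) (s : X → X) (x : X) (n : ℕ) :
    cycWord a s x n = ((List.range n).map fun u => a (s^[u] x)).prod := by
  induction n generalizing x with
  | zero => rfl
  | succ n ih =>
    rw [cycWord, ih, List.range_succ_eq_map, List.map_cons, List.prod_cons, List.map_map]
    rfl

lemma forall_eq_and_eq {α : Type} {a b : α} {P : α → α → Prop} :
    (∀ x y, x = a ∧ y = b → P x y) ↔ P a b :=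
  ⟨fun h => h a b ⟨rfl, rfl⟩, fun h _ _ ⟨h1, h2⟩ => h1 ▸ h2 ▸ h⟩

lemma forall_exists_eq_and_eq {α : Type} {m : ℕ} {f : ℕ → α} {b : α} {P : α → α → Prop} :
    (∀ x y, (∃ i : ℕ, 2 ≤ i ∧ i ≤ m ∧ x = f i ∧ y = b) → P x y) ↔
      ∀ i, 2 ≤ i → i ≤ m → P (f i) b :=
  ⟨fun h i h1 h2 => h _ _ ⟨i, h1, h2, rfl, rfl⟩, fun h _ _ ⟨i, h1, h2, h3, h4⟩ =>
    h3 ▸ h4 ▸ h i h1 h2⟩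

section Bound
variable {k : Type} [Field k] {V X : Type}

/-- The evaluation of words at given elements of an algebra. -/
abbrev ev {A : Type} [Ring A] [Algebra k A] (e : V → A) (a : X → A) :
    FreeAlgebra k (V ⊕ X) →ₐ[k] A :=
  FreeAlgebra.lift k (Sum.elim e a)

lemma ev_arrWord {A : Type} [Ring A] [Algebra k A] (e : V → A) (a : X → A) (l : List X) :
    ev e a (arrWord k l) = (l.map a).prod := by
  rw [arrWord, map_list_prod, List.map_map]
  congr 2
  ext x
  exact FreeAlgebra.lift_ι_apply _ _

lemma ev_inl {A : Type} [Ring A] [Algebra k A] (e : V → A) (a : X → A) (v : V) :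
    ev e a (FreeAlgebra.ι k (Sum.inl v)) = e v := FreeAlgebra.lift_ι_apply _ _

lemma ev_inr {A : Type} [Ring A] [Algebra k A] (e : V → A) (a : X → A) (x : X) :
    ev e a (FreeAlgebra.ι k (Sum.inr x)) = a x := FreeAlgebra.lift_ι_apply _ _

variable [Fintype V] [DecidableEq V]

/-- The relations of the path algebra of a quiver. -/
structure PathRels (s t : X → V) {A : Type} [Ring A] (e : V → A) (a : X → A) : Prop where
  mul_e : ∀ v w, e v * e w = if v = w then e v else 0
  sum_e : ∑ v, e v = 1
  e_mul : ∀ x, e (s x) * a x = a x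
  a_mul : ∀ x, a x * e (t x) = a x

variable {s t : X → V} {extra : FreeAlgebra k (V ⊕ X) → FreeAlgebra k (V ⊕ X) → Prop}

lemma quivRel_iff {A : Type} [Ring A] [Algebra k A] (e : V → A) (a : X → A) :
    (∀ x y, quivRel k s t extra x y → ev e a x = ev e a y) ↔
      PathRels s t e a ∧ ∀ x y, extra x y → ev e a x = ev e a y := by
  constructor
  · intro h
    refine ⟨⟨fun v w => ?_, ?_, fun x => ?_, fun x => ?_⟩, fun x y hxy => h x y (by
      unfold quivRel; tauto)⟩
    · have := h _ _ (.inl ⟨v, w, rfl, rfl⟩)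
      rw [map_mul, ev_inl, ev_inl, apply_ite (ev e a), ev_inl, map_zero] at this
      exact this
    · have := h _ _ (.inr (.inl ⟨rfl, rfl⟩))
      simpa only [map_sum, ev_inl, map_one] using this
    · have := h _ _ (.inr (.inr (.inl ⟨x, rfl, rfl⟩)))
      simpa only [map_mul, ev_inl, ev_inr] using this
    · have := h _ _ (.inr (.inr (.inr (.inl ⟨x, rfl, rfl⟩))))
      simpa only [map_mul, ev_inl, ev_inr] using this
  · rintro ⟨h, h'⟩ x y (⟨v, w, rfl, rfl⟩ | ⟨rfl, rfl⟩ | ⟨x, rfl, rfl⟩ | ⟨x, rfl, rfl⟩ | hxy)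
    · rw [map_mul, ev_inl, ev_inl, apply_ite (ev e a), ev_inl, map_zero, h.mul_e]
    · simpa only [map_sum, ev_inl, map_one] using h.sum_e
    · simpa only [map_mul, ev_inl, ev_inr] using h.e_mul x
    · simpa only [map_mul, ev_inl, ev_inr] using h.a_mul x
    · exact h' x y hxy

/-- The projection onto a bound quiver algebra. -/
def boundMk (s t : X → V) (extra : FreeAlgebra k (V ⊕ X) → FreeAlgebra k (V ⊕ X) → Prop) :
    FreeAlgebra k (V ⊕ X) →ₐ[k] BoundQuiverAlg k s t extra :=
  RingQuot.mkAlgHom k (quivRel k s t extra)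

/-- The generators of a bound quiver algebra. -/
def boundGen (s t : X → V) (extra : FreeAlgebra k (V ⊕ X) → FreeAlgebra k (V ⊕ X) → Prop)
    (i : V ⊕ X) : BoundQuiverAlg k s t extra :=
  boundMk s t extra (FreeAlgebra.ι k i)

lemma ev_boundGen : ev (fun v => boundGen s t extra (.inl v))
    (fun x => boundGen s t extra (.inr x)) = boundMk s t extra := by
  refine FreeAlgebra.hom_ext (funext fun i => ?_)
  rcases i with v | x
  · exact ev_inl _ _ v
  · exact ev_inr _ _ x

lemma boundGen_rels : PathRels s t (fun v => boundGen s t extra (.inl v))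
      (fun x => boundGen s t extra (.inr x)) ∧
    ∀ x y, extra x y → ev (fun v => boundGen s t extra (.inl v))
      (fun x => boundGen s t extra (.inr x)) x =
      ev (fun v => boundGen s t extra (.inl v)) (fun x => boundGen s t extra (.inr x)) y := by
  refine (quivRel_iff _ _).1 fun x y hxy => ?_
  rw [ev_boundGen]
  exact RingQuot.mkAlgHom_rel k hxy

lemma boundGen_lift {A : Type} [Ring A] [Algebra k A] {e : V → A} {a : X → A}
    (h : PathRels s t e a) (h' : ∀ x y, extra x y → ev e a x = ev e a y) :
    ∃ φ : BoundQuiverAlg k s t extra →ₐ[k] A, (∀ v, φ (boundGen s t extra (.inl v)) = e v) ∧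
      ∀ x, φ (boundGen s t extra (.inr x)) = a x := by
  have h1 := (quivRel_iff (extra := extra) e a).2 ⟨h, h'⟩
  refine ⟨RingQuot.liftAlgHom k ⟨ev e a, fun {x y} => h1 x y⟩, fun v => ?_, fun x => ?_⟩
  · exact (RingQuot.liftAlgHom_mkAlgHom_apply ..).trans (ev_inl e a v)
  · exact (RingQuot.liftAlgHom_mkAlgHom_apply ..).trans (ev_inr e a x)

/-- A bound quiver algebra whose relations are equivalent to those of `D`. -/
def boundPres (D : CycData V X)
    (h : ∀ (A : Type) [Ring A] [Algebra k A] (e : V → A) (a : X → A),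
      (PathRels s t e a ∧ ∀ x y, extra x y → ev e a x = ev e a y) ↔ D.Rels e a) :
    D.Pres k (BoundQuiverAlg k s t extra) where
  e v := boundGen s t extra (.inl v)
  a x := boundGen s t extra (.inr x)
  rels := (h _ _ _).1 boundGen_rels
  gen := by
    have h1 := FreeAlgebra.adjoin_range_ι k (V ⊕ X)
    have h2 := congrArg (Subalgebra.map (boundMk s t extra)) h1
    rw [AlgHom.map_adjoin, Algebra.map_top, (AlgHom.range_eq_top (boundMk s t extra)).2
      (RingQuot.mkAlgHom_surjective k _), ← Set.range_comp] at h2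
    rw [← h2]
    refine congrArg _ (Set.ext fun z => ?_)
    simp only [Set.mem_union, Set.mem_range, Sum.exists]
    rfl
  lift A _ _ e a H := boundGen_lift ((h _ _ _).2 H).1 ((h _ _ _).2 H).2

end Bound

namespace CycData
variable {V X : Type} [Fintype V] [DecidableEq V] (D : CycData V X)

lemma Rels.pathRels {t : X → V} (ht : ∀ x, t x = D.v (D.s x)) {A : Type} [Ring A] {e : V → A}
    {a : X → A} (h : D.Rels e a) : PathRels D.v t e a :=
  ⟨h.mul_e, h.sum_e, h.e_mul, fun x => by rw [ht, h.a_mul]⟩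

lemma Rels.of_pathRels {t : X → V} (ht : ∀ x, t x = D.v (D.s x)) {A : Type} [Ring A] {e : V → A}
    {a : X → A} (h : PathRels D.v t e a)
    (cross : ∀ x y, D.v (D.s x) = D.v y → y ≠ D.s x → a x * a y = 0)
    (cyc : ∀ x y, D.v x = D.v y → cycWord a D.s x (D.ℓ x) = cycWord a D.s y (D.ℓ y))
    (long : ∀ x, (∀ y, D.v y = D.v x → y = x) → (∀ y, D.v y = D.v (D.s x) → y = D.s x) →
      cycWord a D.s x (D.ℓ x + 1) = 0) : D.Rels e a := by
  have h0 : ∀ x y, y ≠ D.s x → a x * a y = 0 := fun x y hxy => by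
    by_cases h1 : D.v (D.s x) = D.v y
    · exact cross x y h1 hxy
    · rw [← h.a_mul x, ← h.e_mul y, mul_assoc, ← mul_assoc (e _), h.mul_e, ht, if_neg h1, zero_mul,
        mul_zero]
  refine ⟨h.mul_e, h.sum_e, h.e_mul, fun x => ht x ▸ h.a_mul x, h0, cyc, fun x => ?_⟩
  by_cases h1 : ∀ y, D.v y = D.v x → y = x
  · by_cases h2 : ∀ y, D.v y = D.v (D.s x) → y = D.s x
    · exact long x h1 h2
    · push Not at h2
      obtain ⟨y, h3, h4⟩ := h2
      rw [cycWord, ← D.ℓ_s x, cyc _ y h3.symm, ← Nat.sub_add_cancel (D.ℓ_pos y), cycWord,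
        ← mul_assoc, h0 x y h4, zero_mul]
  · push Not at h1
    obtain ⟨y, h3, h4⟩ := h1
    rw [cycWord_add, cyc x y h3.symm, D.iter, cycWord_one]
    obtain ⟨n, hn⟩ := Nat.exists_eq_add_of_le' (D.ℓ_pos y)
    rw [hn, cycWord_add, cycWord_one, mul_assoc, h0 _ x, mul_zero]
    intro h5
    apply h4
    rw [h5, ← Function.iterate_succ_apply' D.s, Nat.succ_eq_add_one, ← hn, D.iter]

end CycData
end

section Tri
variable (p q r : ℕ)

instance : DecidableEq (TriE p q r) := inferInstanceAs (DecidableEq (ZMod p ⊕ ZMod q ⊕ ZMod r))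
instance [NeZero p] [NeZero q] [NeZero r] : Fintype (TriE p q r) :=
  inferInstanceAs (Fintype (ZMod p ⊕ ZMod q ⊕ ZMod r))

/-- The arrow following a given one on its cycle. -/
def triS : TriE p q r → TriE p q r
  | .inl i => .inl (i + 1)
  | .inr (.inl i) => .inr (.inl (i + 1))
  | .inr (.inr i) => .inr (.inr (i + 1))

/-- The length of the cycle of an arrow. -/
def triL : TriE p q r → ℕ
  | .inl _ => p
  | .inr (.inl _) => q
  | .inr (.inr _) => r

/-- An arrow starting at a given vertex. -/
def triC : TriV p q r → TriE p q r
  | none => .inl 0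
  | some (.inl i) => .inl i.1
  | some (.inr (.inl i)) => .inr (.inl i.1)
  | some (.inr (.inr i)) => .inr (.inr i.1)

variable {p q r}

/-- The arrows of the first cycle. -/
def tA (i : ZMod p) : TriE p q r := Sum.inl i
/-- The arrows of the second cycle. -/
def tB (i : ZMod q) : TriE p q r := Sum.inr (Sum.inl i)
/-- The arrows of the third cycle. -/
def tC (i : ZMod r) : TriE p q r := Sum.inr (Sum.inr i)

lemma triS_iter₁ (n : ℕ) (i : ZMod p) : (triS p q r)^[n] (tA i) = tA (i + (n : ZMod p)) := by
  induction n generalizing i with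
  | zero => rw [Nat.cast_zero, add_zero]; rfl
  | succ n ih => exact (ih (i + 1)).trans (congrArg tA (by push_cast; ring))

lemma triS_iter₂ (n : ℕ) (i : ZMod q) :
    (triS p q r)^[n] (tB i) = tB (i + (n : ZMod q)) := by
  induction n generalizing i with
  | zero => rw [Nat.cast_zero, add_zero]; rfl
  | succ n ih => exact (ih (i + 1)).trans (congrArg tB (by push_cast; ring))

lemma triS_iter₃ (n : ℕ) (i : ZMod r) :
    (triS p q r)^[n] (tC i) = tC (i + (n : ZMod r)) := by
  induction n generalizing i with
  | zero => rw [Nat.cast_zero, add_zero]; rfl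
  | succ n ih => exact (ih (i + 1)).trans (congrArg tC (by push_cast; ring))

variable (p q r) in
/-- The cycles of `Δ(p,q,r)`. -/
def triCyc (hp : 2 ≤ p) (hq : 2 ≤ q) (hr : 2 ≤ r) : CycData (TriV p q r) (TriE p q r) where
  s := triS p q r
  v := triSrc p q r
  ℓ := triL p q r
  c := triC p q r
  two_le x := by rcases x with i | i | i <;> assumption
  ℓ_s x := by rcases x with i | i | i <;> rfl
  iter x := by
    rcases x with i | i | i
    · exact (triS_iter₁ p i).trans (congrArg tA (by rw [ZMod.natCast_self, add_zero]))
    · exact (triS_iter₂ q i).trans (congrArg tB (by rw [ZMod.natCast_self, add_zero]))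
    · exact (triS_iter₃ r i).trans (congrArg tC (by rw [ZMod.natCast_self, add_zero]))
  v_c w := by
    rcases w with _ | i | i | i
    · exact dif_pos rfl
    · exact dif_neg i.2
    · exact dif_neg i.2
    · exact dif_neg i.2

variable {A : Type} [Ring A] (a : TriE p q r → A)

lemma prod_taw (m n : ℕ) :
    ((taw p q r m n).map a).prod = cycWord a (triS p q r) (tA m) n := by
  rw [cycWord_eq_prod_range]
  refine congrArg List.prod (List.map_map.trans (List.map_congr_left fun u _ => ?_))
  exact congrArg a ((congrArg tA (Nat.cast_add m u)).trans (triS_iter₁ u _).symm)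

lemma prod_tbw (m n : ℕ) :
    ((tbw p q r m n).map a).prod = cycWord a (triS p q r) (tB m) n := by
  rw [cycWord_eq_prod_range]
  refine congrArg List.prod (List.map_map.trans (List.map_congr_left fun u _ => ?_))
  exact congrArg a ((congrArg tB (Nat.cast_add m u)).trans (triS_iter₂ u _).symm)

lemma prod_tgw (m n : ℕ) :
    ((tgw p q r m n).map a).prod = cycWord a (triS p q r) (tC m) n := by
  rw [cycWord_eq_prod_range]
  refine congrArg List.prod (List.map_map.trans (List.map_congr_left fun u _ => ?_))
  exact congrArg a ((congrArg tC (Nat.cast_add m u)).trans (triS_iter₃ u _).symm)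

lemma triC_triV1 (i : ZMod p) : triC p q r (triV1 p q r i) = tA i := by
  by_cases h : i = 0
  · rw [show triV1 p q r i = none from dif_pos h, h]
    rfl
  · rw [show triV1 p q r i = some (.inl ⟨i, h⟩) from dif_neg h]
    rfl

lemma triC_triV2 (i : ZMod q) : triC p q r (triV2 p q r i) = if i = 0 then tA 0 else tB i := by
  by_cases h : i = 0
  · rw [show triV2 p q r i = none from dif_pos h, if_pos h]
    rfl
  · rw [show triV2 p q r i = some (.inr (.inl ⟨i, h⟩)) from dif_neg h, if_neg h]
    rfl

lemma triC_triV3 (i : ZMod r) : triC p q r (triV3 p q r i) = if i = 0 then tA 0 else tC i := by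
  by_cases h : i = 0
  · rw [show triV3 p q r i = none from dif_pos h, if_pos h]
    rfl
  · rw [show triV3 p q r i = some (.inr (.inr ⟨i, h⟩)) from dif_neg h, if_neg h]
    rfl

lemma tA_inj {i j : ZMod p} (h : (tA i : TriE p q r) = tA j) : i = j := Sum.inl.inj h

lemma tB_inj {i j : ZMod q} (h : (tB i : TriE p q r) = tB j) : i = j :=
  Sum.inl.inj (Sum.inr.inj h)

lemma tC_inj {i j : ZMod r} (h : (tC i : TriE p q r) = tC j) : i = j :=
  Sum.inr.inj (Sum.inr.inj h)

lemma tA_ne_tB (i : ZMod p) (j : ZMod q) : (tA i : TriE p q r) ≠ tB j := nofun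

lemma tA_ne_tC (i : ZMod p) (j : ZMod r) : (tA i : TriE p q r) ≠ tC j := nofun

lemma tB_ne_tC (i : ZMod q) (j : ZMod r) : (tB i : TriE p q r) ≠ tC j :=
  fun h => nomatch Sum.inr.inj h

lemma triV1_inj {i j : ZMod p} (h : triV1 p q r i = triV1 p q r j) : i = j := by
  have h1 := congrArg (triC p q r) h
  rw [triC_triV1, triC_triV1] at h1
  exact tA_inj h1

lemma triV2_inj {i j : ZMod q} (h : triV2 p q r i = triV2 p q r j) : i = j := by
  have h1 := congrArg (triC p q r) h
  rw [triC_triV2, triC_triV2] at h1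
  split_ifs at h1 with h2 h3 h3
  · exact h2.trans h3.symm
  · exact absurd h1 (tA_ne_tB _ _)
  · exact absurd h1.symm (tA_ne_tB _ _)
  · exact tB_inj h1

lemma triV3_inj {i j : ZMod r} (h : triV3 p q r i = triV3 p q r j) : i = j := by
  have h1 := congrArg (triC p q r) h
  rw [triC_triV3, triC_triV3] at h1
  split_ifs at h1 with h2 h3 h3
  · exact h2.trans h3.symm
  · exact absurd h1 (tA_ne_tC _ _)
  · exact absurd h1.symm (tA_ne_tC _ _)
  · exact tC_inj h1

lemma triV1_eq_triV2 {i : ZMod p} {j : ZMod q} :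
    triV1 p q r i = triV2 p q r j ↔ i = 0 ∧ j = 0 := by
  refine ⟨fun h => ?_, fun ⟨h1, h2⟩ => (show triV1 p q r i = none from dif_pos h1).trans
    (show triV2 p q r j = none from dif_pos h2).symm⟩
  have h1 := congrArg (triC p q r) h
  rw [triC_triV1, triC_triV2] at h1
  split_ifs at h1 with h2
  · exact ⟨tA_inj h1, h2⟩
  · exact absurd h1 (tA_ne_tB _ _)

lemma triV1_eq_triV3 {i : ZMod p} {j : ZMod r} :
    triV1 p q r i = triV3 p q r j ↔ i = 0 ∧ j = 0 := by
  refine ⟨fun h => ?_, fun ⟨h1, h2⟩ => (show triV1 p q r i = none from dif_pos h1).trans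
    (show triV3 p q r j = none from dif_pos h2).symm⟩
  have h1 := congrArg (triC p q r) h
  rw [triC_triV1, triC_triV3] at h1
  split_ifs at h1 with h2
  · exact ⟨tA_inj h1, h2⟩
  · exact absurd h1 (tA_ne_tC _ _)

lemma triV2_eq_triV3 {i : ZMod q} {j : ZMod r} :
    triV2 p q r i = triV3 p q r j ↔ i = 0 ∧ j = 0 := by
  refine ⟨fun h => ?_, fun ⟨h1, h2⟩ => (show triV2 p q r i = none from dif_pos h1).trans
    (show triV3 p q r j = none from dif_pos h2).symm⟩
  have h1 := congrArg (triC p q r) h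
  rw [triC_triV2, triC_triV3] at h1
  split_ifs at h1 with h2 h3 h3
  · exact ⟨h2, h3⟩
  · exact absurd h1 (tA_ne_tC _ _)
  · exact absurd h1.symm (tA_ne_tB _ _)
  · exact absurd h1 (tB_ne_tC _ _)

lemma natCast_pred_of_add_one_eq_zero {n : ℕ} (hn : 2 ≤ n) {i : ZMod n} (h : i + 1 = 0) :
    ((n - 1 : ℕ) : ZMod n) = i := by
  rw [Nat.cast_sub (by omega), ZMod.natCast_self, Nat.cast_one, zero_sub]
  exact (eq_neg_of_add_eq_zero_left h).symm

lemma add_one_natCast_pred {n : ℕ} (hn : 2 ≤ n) : ((n - 1 : ℕ) : ZMod n) + 1 = 0 := by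
  rw [Nat.cast_sub (by omega), ZMod.natCast_self, Nat.cast_one, zero_sub, neg_add_cancel]

/-- A nonzero residue with nonzero successor comes from an interior index. -/
lemma exists_natCast {n : ℕ} (hn : 2 ≤ n) {i : ZMod n} (h0 : i ≠ 0) (h1 : i + 1 ≠ 0) :
    ∃ m, 2 ≤ m ∧ m ≤ n - 1 ∧ ((m - 1 : ℕ) : ZMod n) = i := by
  have : NeZero n := ⟨by omega⟩
  refine ⟨i.val + 1, ?_, ?_, ZMod.natCast_zmod_val i⟩
  · have : i.val ≠ 0 := fun h => h0 ((ZMod.val_eq_zero i).1 h)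
    omega
  · have h2 := i.val_lt
    have : i.val ≠ n - 1 := fun h => h1 (by
      rw [← ZMod.natCast_zmod_val i, h, add_one_natCast_pred hn])
    omega

variable {k : Type} [Field k] [Algebra k A]

lemma triExtra_iff [NeZero p] [NeZero q] [NeZero r] (e : TriV p q r → A) :
    (∀ x y, TRelExtra k p q r x y → ev e a x = ev e a y) ↔
      cycWord a (triS p q r) (tA (0 : ℕ)) p = cycWord a (triS p q r) (tB (0 : ℕ)) q ∧
      cycWord a (triS p q r) (tB (0 : ℕ)) q =
        cycWord a (triS p q r) (tC (0 : ℕ)) r ∧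
      a (tA (p - 1 : ℕ)) * a (tC (0 : ℕ)) = 0 ∧
      a (tB (q - 1 : ℕ)) * a (tC (0 : ℕ)) = 0 ∧
      a (tC (r - 1 : ℕ)) * a (tA (0 : ℕ)) = 0 ∧
      a (tC (r - 1 : ℕ)) * a (tB (0 : ℕ)) = 0 ∧
      a (tA (p - 1 : ℕ)) * a (tB (0 : ℕ)) = 0 ∧
      a (tB (q - 1 : ℕ)) * a (tA (0 : ℕ)) = 0 ∧
      (∀ i, 2 ≤ i → i ≤ p - 1 → cycWord a (triS p q r) (tA (i - 1 : ℕ)) (p + 1) = 0) ∧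
      (∀ i, 2 ≤ i → i ≤ q - 1 → cycWord a (triS p q r) (tB (i - 1 : ℕ)) (q + 1) = 0) ∧
      ∀ i, 2 ≤ i → i ≤ r - 1 → cycWord a (triS p q r) (tC (i - 1 : ℕ)) (r + 1) = 0 := by
  unfold TRelExtra
  simp only [or_imp, forall_and, forall_eq_and_eq, forall_exists_eq_and_eq, ev_arrWord,
    List.map_append, List.prod_append, prod_taw, prod_tbw, prod_tgw, cycWord_one, map_zero]
  refine Iff.and Iff.rfl <| Iff.and Iff.rfl <| Iff.and Iff.rfl <| Iff.and Iff.rfl <|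
    Iff.and Iff.rfl <| Iff.and Iff.rfl <| Iff.and Iff.rfl <| Iff.and Iff.rfl <| Iff.and ?_ <|
    Iff.and ?_ ?_ <;>
  refine forall_congr' fun i => forall_congr' fun h1 => forall_congr' fun h2 => ?_
  · rw [show p + 1 = p - i + 1 + i by omega, cycWord_add _ _ _ (p - i + 1), triS_iter₁, ← Nat.cast_add,
      show i - 1 + (p - i + 1) = p by omega, ZMod.natCast_self, Nat.cast_zero]
  · rw [show q + 1 = q - i + 1 + i by omega, cycWord_add _ _ _ (q - i + 1), triS_iter₂, ← Nat.cast_add,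
      show i - 1 + (q - i + 1) = q by omega, ZMod.natCast_self, Nat.cast_zero]
  · rw [show r + 1 = r - i + 1 + i by omega, cycWord_add _ _ _ (r - i + 1), triS_iter₃, ← Nat.cast_add,
      show i - 1 + (r - i + 1) = r by omega, ZMod.natCast_self, Nat.cast_zero]

lemma triRels_iff [NeZero p] [NeZero q] [NeZero r] (hp : 2 ≤ p) (hq : 2 ≤ q) (hr : 2 ≤ r)
    (e : TriV p q r → A) :
    (PathRels (triSrc p q r) (triTgt p q r) e a ∧
      ∀ x y, TRelExtra k p q r x y → ev e a x = ev e a y) ↔ (triCyc p q r hp hq hr).Rels e a := by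
  have ht : ∀ x, triTgt p q r x = (triCyc p q r hp hq hr).v ((triCyc p q r hp hq hr).s x) := by
    rintro (i | i | i) <;> rfl
  rw [triExtra_iff]
  constructor
  · rintro ⟨h, h1, h2, h3, h4, h5, h6, h7, h8, h9, h10, h11⟩
    rw [Nat.cast_zero] at h1 h3 h4 h5 h6 h7 h8
    rw [Nat.cast_zero] at h1 h2
    rw [Nat.cast_zero] at h2
    refine CycData.Rels.of_pathRels _ ht h ?_ ?_ ?_
    · rintro (i | i | i) (j | j | j) h12 h13
      · exact absurd (congrArg tA (triV1_inj h12).symm) h13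
      · obtain ⟨h14, rfl⟩ := triV1_eq_triV2.1 h12
        rw [natCast_pred_of_add_one_eq_zero hp h14] at h7
        exact h7
      · obtain ⟨h14, rfl⟩ := triV1_eq_triV3.1 h12
        rw [natCast_pred_of_add_one_eq_zero hp h14] at h3
        exact h3
      · obtain ⟨rfl, h14⟩ := triV1_eq_triV2.1 h12.symm
        rw [natCast_pred_of_add_one_eq_zero hq h14] at h8
        exact h8
      · exact absurd (congrArg tB (triV2_inj h12).symm) h13
      · obtain ⟨h14, rfl⟩ := triV2_eq_triV3.1 h12
        rw [natCast_pred_of_add_one_eq_zero hq h14] at h4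
        exact h4
      · obtain ⟨rfl, h14⟩ := triV1_eq_triV3.1 h12.symm
        rw [natCast_pred_of_add_one_eq_zero hr h14] at h5
        exact h5
      · obtain ⟨rfl, h14⟩ := triV2_eq_triV3.1 h12.symm
        rw [natCast_pred_of_add_one_eq_zero hr h14] at h6
        exact h6
      · exact absurd (congrArg tC (triV3_inj h12).symm) h13
    · rintro (i | i | i) (j | j | j) h12
      · rw [triV1_inj h12]
      · obtain ⟨rfl, rfl⟩ := triV1_eq_triV2.1 h12
        exact h1
      · obtain ⟨rfl, rfl⟩ := triV1_eq_triV3.1 h12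
        exact h1.trans h2
      · obtain ⟨rfl, rfl⟩ := triV1_eq_triV2.1 h12.symm
        exact h1.symm
      · rw [triV2_inj h12]
      · obtain ⟨rfl, rfl⟩ := triV2_eq_triV3.1 h12
        exact h2
      · obtain ⟨rfl, rfl⟩ := triV1_eq_triV3.1 h12.symm
        exact (h1.trans h2).symm
      · obtain ⟨rfl, rfl⟩ := triV2_eq_triV3.1 h12.symm
        exact h2.symm
      · rw [triV3_inj h12]
    · rintro (i | i | i) h12 h13
      · obtain ⟨m, h14, h15, rfl⟩ := exists_natCast hp
          (fun h0 => tA_ne_tB _ _ (h12 (tB 0) (triV1_eq_triV2.2 ⟨h0, rfl⟩).symm).symm)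
          fun h0 => tA_ne_tB _ _ (h13 (tB 0) (triV1_eq_triV2.2 ⟨h0, rfl⟩).symm).symm
        exact h9 m h14 h15
      · obtain ⟨m, h14, h15, rfl⟩ := exists_natCast hq
          (fun h0 => tA_ne_tB _ _ (h12 (tA 0) (triV1_eq_triV2.2 ⟨rfl, h0⟩)))
          fun h0 => tA_ne_tB _ _ (h13 (tA 0) (triV1_eq_triV2.2 ⟨rfl, h0⟩))
        exact h10 m h14 h15
      · obtain ⟨m, h14, h15, rfl⟩ := exists_natCast hr
          (fun h0 => tA_ne_tC _ _ (h12 (tA 0) (triV1_eq_triV3.2 ⟨rfl, h0⟩)))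
          fun h0 => tA_ne_tC _ _ (h13 (tA 0) (triV1_eq_triV3.2 ⟨rfl, h0⟩))
        exact h11 m h14 h15
  · intro h
    have h12 := triV1_eq_triV2 (r := r) (i := ((0 : ℕ) : ZMod p)) (j := ((0 : ℕ) : ZMod q))
      |>.2 ⟨Nat.cast_zero, Nat.cast_zero⟩
    have h23 := triV2_eq_triV3 (p := p) (i := ((0 : ℕ) : ZMod q)) (j := ((0 : ℕ) : ZMod r))
      |>.2 ⟨Nat.cast_zero, Nat.cast_zero⟩
    exact ⟨h.pathRels _ ht, h.cyc (tA (0 : ℕ)) (tB (0 : ℕ)) h12,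
      h.cyc (tB (0 : ℕ)) (tC (0 : ℕ)) h23,
      h.a_mul_a _ _ nofun, h.a_mul_a _ _ nofun, h.a_mul_a _ _ nofun, h.a_mul_a _ _ nofun,
      h.a_mul_a _ _ nofun, h.a_mul_a _ _ nofun, fun i _ _ => h.long (tA (i - 1 : ℕ)),
      fun i _ _ => h.long (tB (i - 1 : ℕ)), fun i _ _ => h.long (tC (i - 1 : ℕ))⟩

/-- The algebra `T(p,q,r)` is a cycle algebra. -/
def triPres (hp : 2 ≤ p) (hq : 2 ≤ q) (hr : 2 ≤ r) (hp' : 0 < p) (hq' : 0 < q) (hr' : 0 < r) :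
    let _ : NeZero p := ⟨by omega⟩
    let _ : NeZero q := ⟨by omega⟩
    let _ : NeZero r := ⟨by omega⟩
    (triCyc p q r hp hq hr).Pres k (TAlg3 k p q r hp' hq' hr') :=
  let _ : NeZero p := ⟨by omega⟩
  let _ : NeZero q := ⟨by omega⟩
  let _ : NeZero r := ⟨by omega⟩
  boundPres _ fun _ _ _ e a => triRels_iff a hp hq hr e

end Tri

section
variable {k : Type} [Field k] [IsAlgClosed k] {B : Type} [Ring B] [Algebra k B]
  [FiniteDimensional k B]

theorem not_tauTiltingFinite_of_TAlg3_333
    (h : DerivedEquivalent (TAlg3 k 3 3 3 (by norm_num) (by norm_num) (by norm_num)) B) :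
    ¬ TauTiltingFinite k B :=
  (triPres (k := k) (p := 3) (q := 3) (r := 3) (by norm_num) (by norm_num) (by norm_num) _ _
    _).not_tauTiltingFinite (fun v => v.elim 3 fun _ => -1) (v₀ := none) (by decide)
    (by decide +kernel) h

theorem not_tauTiltingFinite_of_TAlg3_244
    (h : DerivedEquivalent (TAlg3 k 2 4 4 (by norm_num) (by norm_num) (by norm_num)) B) :
    ¬ TauTiltingFinite k B :=
  (triPres (k := k) (p := 2) (q := 4) (r := 4) (by norm_num) (by norm_num) (by norm_num) _ _
    _).not_tauTiltingFinite
    (fun v => v.elim 4 (Sum.elim (fun _ => -2) fun _ => -1)) (v₀ := none) (by decide)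
    (by decide +kernel) h

theorem not_tauTiltingFinite_of_TAlg3_236
    (h : DerivedEquivalent (TAlg3 k 2 3 6 (by norm_num) (by norm_num) (by norm_num)) B) :
    ¬ TauTiltingFinite k B :=
  (triPres (k := k) (p := 2) (q := 3) (r := 6) (by norm_num) (by norm_num) (by norm_num) _ _
    _).not_tauTiltingFinite
    (fun v => v.elim 6 (Sum.elim (fun _ => -3) (Sum.elim (fun _ => -2) fun _ => -1)))
    (v₀ := none) (by decide) (by decide +kernel) h

end

section Cycle
variable {X : Type} {n : ℕ} {s : X → X} {f : Fin n → X} {g : X}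

/-- The map `s` permutes cyclically `f 0, ..., f (n - 1), g`. -/
structure IsCycle (s : X → X) (f : Fin n → X) (g : X) : Prop where
  pos : 0 < n
  step : ∀ i (h : i + 1 < n), s (f ⟨i, by omega⟩) = f ⟨i + 1, h⟩
  last : s (f ⟨n - 1, by omega⟩) = g
  first : s g = f ⟨0, pos⟩

lemma IsCycle.iter (h : IsCycle s f g) (m : ℕ) {i : ℕ} (hi : i + m < n) :
    s^[m] (f ⟨i, by omega⟩) = f ⟨i + m, hi⟩ := by
  induction m with
  | zero => rfl
  | succ m ih => rw [Function.iterate_succ_apply', ih (by omega), h.step _ (by omega)]; rfl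

lemma IsCycle.iter_last (h : IsCycle s f g) {i : ℕ} (hi : i < n) :
    s^[n - i] (f ⟨i, hi⟩) = g := by
  obtain ⟨m, hm⟩ : ∃ m, n - i = m + 1 := ⟨n - i - 1, by omega⟩
  rw [hm, Function.iterate_succ_apply', h.iter m (by omega), ← h.last]
  exact congrArg s (congrArg f (Fin.ext (by simp only; omega)))

lemma IsCycle.iter_g (h : IsCycle s f g) {i : ℕ} (hi : i < n) : s^[i + 1] g = f ⟨i, hi⟩ := by
  rw [Function.iterate_succ_apply, h.first, h.iter i (by omega)]
  exact congrArg f (Fin.ext (zero_add i))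

lemma IsCycle.period_g (h : IsCycle s f g) : s^[n + 1] g = g := by
  rw [Function.iterate_succ_apply, h.first]
  exact h.iter_last h.pos

lemma IsCycle.period (h : IsCycle s f g) (i : Fin n) : s^[n + 1] (f i) = f i := by
  rw [show n + 1 = (i + 1) + (n - i) by omega, Function.iterate_add_apply,
    h.iter_last i.2, h.iter_g i.2]

lemma IsCycle.sum_eq_zero (h : IsCycle s f g) (φ : X → ℤ)
    (h1 : ∀ i, φ (f i) = if i.1 = 0 then 1 else 0) (h2 : φ g = -1) :
    ∑ i ∈ Finset.range n, φ (s^[i + 1] g) = -φ g ∧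
      ∀ j, ∑ i ∈ Finset.range n, φ (s^[i + 1] (f j)) = -φ (f j) := by
  have h3 : ∑ i ∈ Finset.range n, φ (s^[i + 1] g) = -φ g := by
    have h4 : ∀ i ∈ Finset.range n, φ (s^[i + 1] g) = if i = 0 then 1 else 0 := fun i hi =>
      (congrArg φ (h.iter_g (Finset.mem_range.1 hi))).trans (h1 _)
    rw [Finset.sum_congr rfl h4, Finset.sum_ite_eq' (Finset.range n) 0 fun _ => 1, if_pos (Finset.mem_range.2 h.pos),
      h2, neg_neg]
  have h4 : ∀ m, ∑ i ∈ Finset.range (n + 1), φ (s^[i] (s^[m] g)) = 0 := by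
    intro m
    induction m with
    | zero => rw [Finset.sum_range_succ']; exact (congrArg (· + _) h3).trans (neg_add_cancel _)
    | succ m ih =>
      rw [Finset.sum_range_succ'] at ih
      rw [Finset.sum_range_succ, ← ih, Function.iterate_succ_apply']
      refine congrArg₂ _ (Finset.sum_congr rfl fun i _ => rfl) (congrArg φ ?_)
      rw [← Function.iterate_succ_apply, ← Function.iterate_add_apply, add_comm,
        Function.iterate_add_apply, h.period_g]
      rfl
  refine ⟨h3, fun j => eq_neg_of_add_eq_zero_left ?_⟩
  rw [← h4 (j + 1), Finset.sum_range_succ', h.iter_g j.2]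
  rfl

variable {A : Type} [Ring A] (a : X → A)

lemma IsCycle.prod (h : IsCycle s f g) {i m : ℕ} (hi : i < n) (hm : i + m ≤ n) :
    (((List.range m).map fun u => f ⟨(i + u) % n, Nat.mod_lt _ h.pos⟩).map a).prod =
      cycWord a s (f ⟨i, hi⟩) m := by
  rw [cycWord_eq_prod_range]
  refine congrArg List.prod (List.map_map.trans (List.map_congr_left fun u hu => ?_))
  have := List.mem_range.1 hu
  rw [h.iter u (by omega)]
  exact congrArg a (congrArg f (Fin.ext (Nat.mod_eq_of_lt (by omega))))

lemma IsCycle.word_succ (h : IsCycle s f g) :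
    cycWord a s (f ⟨0, h.pos⟩) (n + 1) = cycWord a s (f ⟨0, h.pos⟩) n * a g := by
  rw [cycWord_add, cycWord, cycWord, mul_one]
  exact congrArg (_ * a ·) (h.iter_last h.pos)

lemma IsCycle.word_g (h : IsCycle s f g) :
    cycWord a s g (n + 1) = a g * cycWord a s (f ⟨0, h.pos⟩) n := by
  rw [cycWord, h.first]

lemma IsCycle.word_long (h : IsCycle s f g) {i : ℕ} (hi : i < n) :
    cycWord a s (f ⟨i, hi⟩) (n + 2) =
      cycWord a s (f ⟨i, hi⟩) (n - i) * a g * cycWord a s (f ⟨0, h.pos⟩) (i + 1) := by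
  rw [show n + 2 = n - i + (1 + (i + 1)) by omega, cycWord_add, h.iter_last hi, cycWord_add,
    cycWord, cycWord, mul_one, mul_assoc, ← h.first]
  rfl

end Cycle

section Sig
variable (p q : ℕ)

instance : DecidableEq (SigE p q) := inferInstanceAs (DecidableEq (Bool ⊕ (Fin p ⊕ Fin q)))
instance : Fintype (SigE p q) := inferInstanceAs (Fintype (Bool ⊕ (Fin p ⊕ Fin q)))

variable {p q}

/-- The arrows from the second distinguished vertex to the first one. -/
def sG (b : Bool) : SigE p q := Sum.inl b
/-- The arrows of the first path. -/
def sA (i : Fin p) : SigE p q := Sum.inr (Sum.inl i)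
/-- The arrows of the second path. -/
def sB (i : Fin q) : SigE p q := Sum.inr (Sum.inr i)

lemma SigE.cases {P : SigE p q → Prop} (x : SigE p q) (h1 : ∀ b, P (sG b)) (h2 : ∀ i, P (sA i))
    (h3 : ∀ i, P (sB i)) : P x :=
  match x with
  | .inl b => h1 b
  | .inr (.inl i) => h2 i
  | .inr (.inr i) => h3 i

/-- The arrow following a given one on its cycle. -/
def sigS (hp : 0 < p) (hq : 0 < q) : SigE p q → SigE p q
  | .inl true => sA ⟨0, hp⟩
  | .inl false => sB ⟨0, hq⟩
  | .inr (.inl i) => if h : i.1 + 1 < p then sA ⟨i + 1, h⟩ else sG true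
  | .inr (.inr i) => if h : i.1 + 1 < q then sB ⟨i + 1, h⟩ else sG false

/-- The length of the cycle of an arrow. -/
def sigL : SigE p q → ℕ
  | .inl true => p + 1
  | .inl false => q + 1
  | .inr (.inl _) => p + 1
  | .inr (.inr _) => q + 1

/-- An arrow starting at a given vertex. -/
def sigC (hp : 0 < p) : SigV p q → SigE p q
  | none => sA ⟨0, hp⟩
  | some none => sG true
  | some (some (.inl i)) => sA ⟨i + 1, by omega⟩
  | some (some (.inr i)) => sB ⟨i + 1, by omega⟩

variable (hp : 0 < p) (hq : 0 < q)

lemma sigS_sA {i : Fin p} (h : i.1 + 1 < p) : sigS hp hq (sA i) = sA ⟨i + 1, h⟩ := dif_pos h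

lemma sigS_sA_last {i : Fin p} (h : ¬ i.1 + 1 < p) : sigS hp hq (sA i) = sG true := dif_neg h

lemma sigS_sB {i : Fin q} (h : i.1 + 1 < q) : sigS hp hq (sB i) = sB ⟨i + 1, h⟩ := dif_pos h

lemma sigS_sB_last {i : Fin q} (h : ¬ i.1 + 1 < q) : sigS hp hq (sB i) = sG false := dif_neg h

lemma isCycle_sA : IsCycle (sigS hp hq) sA (sG true) where
  pos := hp
  step _ h := dif_pos h
  last := dif_neg (by simp only; omega)
  first := rfl

lemma isCycle_sB : IsCycle (sigS hp hq) sB (sG false) where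
  pos := hq
  step _ h := dif_pos h
  last := dif_neg (by simp only; omega)
  first := rfl

include hp in
lemma sigVA_last : sigVA p q p = some none := (dif_neg hp.ne').trans (dif_pos le_rfl)

include hq in
lemma sigVB_last : sigVB p q q = some none := (dif_neg hq.ne').trans (dif_pos le_rfl)

lemma sigC_sigVA (i : Fin p) : sigC hp (sigVA p q i) = sA i := by
  rcases i with ⟨_ | i, hi⟩
  · rfl
  · rw [show sigVA p q (i + 1) = some (some (.inl ⟨i, by omega⟩)) from
      (dif_neg i.succ_ne_zero).trans (dif_neg (by omega))]
    rfl

lemma sigC_sigVB (i : Fin q) : sigC hp (sigVB p q i) = if i.1 = 0 then sA ⟨0, hp⟩ else sB i := by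
  rcases i with ⟨_ | i, hi⟩
  · rfl
  · rw [show sigVB p q (i + 1) = some (some (.inr ⟨i, by omega⟩)) from
      (dif_neg i.succ_ne_zero).trans (dif_neg (by omega)), if_neg i.succ_ne_zero]
    rfl

variable (p q) in
/-- The cycles of `Σ(p,q)`. -/
def sigCyc : CycData (SigV p q) (SigE p q) where
  s := sigS hp hq
  v := sigSrc p q
  ℓ := sigL
  c := sigC hp
  two_le x := by
    rcases x with (_ | _) | i | i
    · exact Nat.succ_le_succ hq
    · exact Nat.succ_le_succ hp
    · exact Nat.succ_le_succ hp
    · exact Nat.succ_le_succ hq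
  ℓ_s x := by
    rcases x with (_ | _) | i | i
    · rfl
    · rfl
    · by_cases h : i.1 + 1 < p
      · exact Eq.trans (congrArg sigL (sigS_sA hp hq h)) rfl
      · exact Eq.trans (congrArg sigL (sigS_sA_last hp hq h)) rfl
    · by_cases h : i.1 + 1 < q
      · exact Eq.trans (congrArg sigL (sigS_sB hp hq h)) rfl
      · exact Eq.trans (congrArg sigL (sigS_sB_last hp hq h)) rfl
  iter x := by
    rcases x with (_ | _) | i | i
    · exact (isCycle_sB hp hq).period_g
    · exact (isCycle_sA hp hq).period_g
    · exact (isCycle_sA hp hq).period i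
    · exact (isCycle_sB hp hq).period i
  v_c w := by
    rcases w with _ | _ | i | i
    · rfl
    · rfl
    · exact show sigVA p q (i + 1) = some (some (.inl i)) from
        (dif_neg i.1.succ_ne_zero).trans (dif_neg (by omega))
    · exact show sigVB p q (i + 1) = some (some (.inr i)) from
        (dif_neg i.1.succ_ne_zero).trans (dif_neg (by omega))

lemma sigCyc_v_s (x : SigE p q) : sigTgt p q x = sigSrc p q (sigS hp hq x) := by
  rcases x with (_ | _) | i | i
  · rfl
  · rfl
  · by_cases h : i.1 + 1 < p
    · exact (congrArg (sigSrc p q) (sigS_sA hp hq h)).symm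
    · refine Eq.trans ?_ (congrArg (sigSrc p q) (sigS_sA_last hp hq h)).symm
      exact (congrArg (sigVA p q) (by omega)).trans (sigVA_last hp)
  · by_cases h : i.1 + 1 < q
    · exact (congrArg (sigSrc p q) (sigS_sB hp hq h)).symm
    · refine Eq.trans ?_ (congrArg (sigSrc p q) (sigS_sB_last hp hq h)).symm
      exact (congrArg (sigVB p q) (by omega)).trans (sigVB_last hq)

variable {A : Type} [Ring A] (a : SigE p q → A)

lemma prod_saw {i m : ℕ} (hi : i < p) (hm : i + m ≤ p) :
    ((saw p q hp i m).map a).prod = cycWord a (sigS hp hq) (sA ⟨i, hi⟩) m :=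
  (isCycle_sA hp hq).prod a hi hm

lemma prod_sbw {i m : ℕ} (hi : i < q) (hm : i + m ≤ q) :
    ((sbw p q hq i m).map a).prod = cycWord a (sigS hp hq) (sB ⟨i, hi⟩) m :=
  (isCycle_sB hp hq).prod a hi hm

variable {k : Type} [Field k] [Algebra k A]

lemma sigExtra_iff (e : SigV p q → A) :
    (∀ x y, TpqRelExtra k p q hp hq x y → ev e a x = ev e a y) ↔
      cycWord a (sigS hp hq) (sA ⟨0, hp⟩) (p + 1) = cycWord a (sigS hp hq) (sB ⟨0, hq⟩) (q + 1) ∧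
      cycWord a (sigS hp hq) (sG true) (p + 1) = cycWord a (sigS hp hq) (sG false) (q + 1) ∧
      a (sA ⟨p - 1, by omega⟩) * a (sG false) = 0 ∧
      a (sG false) * a (sA ⟨0, hp⟩) = 0 ∧
      a (sB ⟨q - 1, by omega⟩) * a (sG true) = 0 ∧
      a (sG true) * a (sB ⟨0, hq⟩) = 0 ∧
      (∀ i, 2 ≤ i → ∀ h : i ≤ p - 1,
        cycWord a (sigS hp hq) (sA ⟨i - 1, by omega⟩) (p + 2) = 0) ∧
      ∀ i, 2 ≤ i → ∀ h : i ≤ q - 1,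
        cycWord a (sigS hp hq) (sB ⟨i - 1, by omega⟩) (q + 2) = 0 := by
  have hA := isCycle_sA hp hq
  have hB := isCycle_sB hp hq
  change (∀ x y, (x = arrWord k (saw p q hp 0 p ++ [sG true]) ∧
      y = arrWord k (sbw p q hq 0 q ++ [sG false])) ∨
    (x = arrWord k (sG true :: saw p q hp 0 p) ∧ y = arrWord k (sG false :: sbw p q hq 0 q)) ∨
    (x = arrWord k (saw p q hp (p - 1) 1 ++ [sG false]) ∧ y = 0) ∨
    (x = arrWord k (sG false :: saw p q hp 0 1) ∧ y = 0) ∨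
    (x = arrWord k (sbw p q hq (q - 1) 1 ++ [sG true]) ∧ y = 0) ∨
    (x = arrWord k (sG true :: sbw p q hq 0 1) ∧ y = 0) ∨
    (∃ i, 2 ≤ i ∧ i ≤ p - 1 ∧
      x = arrWord k (saw p q hp (i - 1) (p - i + 1) ++ [sG true] ++ saw p q hp 0 i) ∧ y = 0) ∨
    (∃ i, 2 ≤ i ∧ i ≤ q - 1 ∧
      x = arrWord k (sbw p q hq (i - 1) (q - i + 1) ++ [sG false] ++ sbw p q hq 0 i) ∧ y = 0) →
    _) ↔ _
  simp only [or_imp, forall_and, forall_eq_and_eq, forall_exists_eq_and_eq, ev_arrWord,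
    List.map_append, List.prod_append, List.map_cons, List.prod_cons, List.map_nil, List.prod_nil,
    mul_one, map_zero]
  rw [prod_saw hp hq a hp (by omega), prod_saw hp hq a (i := p - 1) (by omega) (by omega),
    prod_saw hp hq a hp (by omega), prod_sbw hp hq a hq (by omega),
    prod_sbw hp hq a (i := q - 1) (by omega) (by omega), prod_sbw hp hq a hq (by omega),
    hA.word_succ, hB.word_succ, hA.word_g, hB.word_g, cycWord_one, cycWord_one, cycWord_one,
    cycWord_one]
  refine Iff.and Iff.rfl <| Iff.and Iff.rfl <| Iff.and Iff.rfl <| Iff.and Iff.rfl <|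
    Iff.and Iff.rfl <| Iff.and Iff.rfl <| Iff.and ?_ ?_ <;>
  refine forall_congr' fun i => forall_congr' fun h1 => forall_congr' fun h2 => ?_
  · rw [prod_saw hp hq a (by omega) (by omega), prod_saw hp hq a hp (by omega), hA.word_long,
      show p - (i - 1) = p - i + 1 by omega, show i - 1 + 1 = i by omega]
  · rw [prod_sbw hp hq a (by omega) (by omega), prod_sbw hp hq a hq (by omega), hB.word_long,
      show q - (i - 1) = q - i + 1 by omega, show i - 1 + 1 = i by omega]

omit [Field k] [Algebra k A] [Ring A] in
lemma sigSrc_eq {x y : SigE p q} (h : sigSrc p q x = sigSrc p q y) : x = y ∨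
    (∃ b, x = sG b ∧ y = sG !b) ∨ (x = sA ⟨0, hp⟩ ∧ y = sB ⟨0, hq⟩) ∨
    (x = sB ⟨0, hq⟩ ∧ y = sA ⟨0, hp⟩) := by
  have key : ∀ x : SigE p q, sigC hp (sigSrc p q x) = x ∨
      (x = sG false ∧ sigC hp (sigSrc p q x) = sG true) ∨
      (x = sB ⟨0, hq⟩ ∧ sigC hp (sigSrc p q x) = sA ⟨0, hp⟩) := by
    intro x
    rcases x with (_ | _) | i | i
    · exact .inr (.inl ⟨rfl, rfl⟩)
    · exact .inl rfl
    · exact .inl (sigC_sigVA hp i)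
    · by_cases h : i.1 = 0
      · exact .inr (.inr ⟨congrArg sB (Fin.ext h), (sigC_sigVB hp i).trans (if_pos h)⟩)
      · exact .inl ((sigC_sigVB hp i).trans (if_neg h))
  have h1 := congrArg (sigC hp) h
  rcases key x with h2 | ⟨rfl, h2⟩ | ⟨rfl, h2⟩ <;> rcases key y with h3 | ⟨rfl, h3⟩ | ⟨rfl, h3⟩ <;>
  have h4 := h2.symm.trans (h1.trans h3)
  · exact .inl h4
  · exact .inr (.inl ⟨true, h4, rfl⟩)
  · exact .inr (.inr (.inl ⟨h4, rfl⟩))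
  · exact .inr (.inl ⟨false, rfl, h4.symm⟩)
  · exact .inl rfl
  · exact nomatch h4
  · exact .inr (.inr (.inr ⟨rfl, h4.symm⟩))
  · exact nomatch h4
  · exact .inl rfl

lemma sigRels_iff (e : SigV p q → A) :
    (PathRels (sigSrc p q) (sigTgt p q) e a ∧
      ∀ x y, TpqRelExtra k p q hp hq x y → ev e a x = ev e a y) ↔
      (sigCyc p q hp hq).Rels e a := by
  have ht := sigCyc_v_s hp hq
  have hA := isCycle_sA hp hq
  have hB := isCycle_sB hp hq
  rw [sigExtra_iff]
  constructor
  · rintro ⟨h, h1, h2, h3, h4, h5, h6, h7, h8⟩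
    refine CycData.Rels.of_pathRels (sigCyc p q hp hq) ht h (fun x y h9 h10 => ?_)
      (fun x y h9 => ?_) fun x h9 h10 => ?_
    · have hs : Function.Injective (sigS hp hq) := (sigCyc p q hp hq).s_injective
      rcases sigSrc_eq hp hq h9 with h11 | ⟨_ | _, h11, rfl⟩ | ⟨h11, rfl⟩ | ⟨h11, rfl⟩
      · exact absurd h11.symm h10
      · rw [hs (h11.trans hB.last.symm)]
        exact h5
      · rw [hs (h11.trans hA.last.symm)]
        exact h3
      · rw [hs (h11.trans hA.first.symm)]
        exact h6
      · rw [hs (h11.trans hB.first.symm)]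
        exact h4
    · rcases sigSrc_eq hp hq h9 with rfl | ⟨_ | _, rfl, rfl⟩ | ⟨rfl, rfl⟩ | ⟨rfl, rfl⟩
      · rfl
      · exact h2.symm
      · exact h2
      · exact h1
      · exact h1.symm
    · rcases x with b | ⟨i, hi⟩ | ⟨i, hi⟩
      · exact absurd (Sum.inl.inj (h9 (sG !b) rfl)) (by simp)
      · have h11 : i ≠ 0 := by
          rintro rfl
          exact nomatch h9 (sB ⟨0, hq⟩) rfl
        have h12 : i + 1 < p := by
          by_contra h12
          have h13 := sigS_sA_last hp hq (i := ⟨i, hi⟩) h12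
          exact nomatch (h10 (sG false) (congrArg (sigSrc p q) h13).symm).trans h13
        exact h7 (i + 1) (by omega) (by omega)
      · have h11 : i ≠ 0 := by
          rintro rfl
          exact nomatch h9 (sA ⟨0, hp⟩) rfl
        have h12 : i + 1 < q := by
          by_contra h12
          have h13 := sigS_sB_last hp hq (i := ⟨i, hi⟩) h12
          exact nomatch (h10 (sG true) (congrArg (sigSrc p q) h13).symm).trans h13
        exact h8 (i + 1) (by omega) (by omega)
  · intro h
    refine ⟨h.pathRels _ ht, h.cyc (sA ⟨0, hp⟩) (sB ⟨0, hq⟩) rfl, h.cyc (sG true) (sG false) rfl,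
      h.a_mul_a _ _ fun h1 => ?_, h.a_mul_a _ _ nofun, h.a_mul_a _ _ fun h1 => ?_,
      h.a_mul_a _ _ nofun, fun i _ _ => h.long (sA ⟨i - 1, _⟩), fun i _ _ => h.long (sB ⟨i - 1, _⟩)⟩
    · exact nomatch h1.trans hA.last
    · exact nomatch h1.trans hB.last

/-- The algebra `T(p,q)` is a cycle algebra. -/
def sigPres : (sigCyc p q hp hq).Pres k (TAlg2 k p q hp hq) :=
  boundPres _ fun _ _ _ e a => sigRels_iff hp hq a e

/-- The difference of the two distinguished vertices. -/
def sigDelta : SigV p q → ℤ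
  | none => 1
  | some none => -1
  | some (some _) => 0

omit [Field k] [Algebra k A] [Ring A] in
lemma sigDelta_cycle (x : SigE p q) :
    ∑ i ∈ Finset.range (sigL x - 1), sigDelta (sigSrc p q ((sigS hp hq)^[i + 1] x)) =
      -sigDelta (sigSrc p q x) := by
  have hA : ∀ j (hj : j < p), sigDelta (sigVA p q j) = if j = 0 then 1 else 0 := by
    rintro (_ | j) hj
    · rfl
    · exact congrArg sigDelta (show sigVA p q (j + 1) = some (some (.inl ⟨j, by omega⟩)) from
        (dif_neg j.succ_ne_zero).trans (dif_neg (by omega)))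
  have hB : ∀ j (hj : j < q), sigDelta (sigVB p q j) = if j = 0 then 1 else 0 := by
    rintro (_ | j) hj
    · rfl
    · exact congrArg sigDelta (show sigVB p q (j + 1) = some (some (.inr ⟨j, by omega⟩)) from
        (dif_neg j.succ_ne_zero).trans (dif_neg (by omega)))
  have key := fun n f g (h : IsCycle (sigS hp hq) (n := n) f g)
    (h1 : ∀ i, sigDelta (sigSrc p q (f i)) = if i.1 = 0 then 1 else 0)
    (h2 : sigDelta (sigSrc p q g) = -1) => h.sum_eq_zero (fun x => sigDelta (sigSrc p q x)) h1 h2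
  obtain ⟨hA1, hA2⟩ := key p sA (sG true) (isCycle_sA hp hq) (fun i => hA i i.2) rfl
  obtain ⟨hB1, hB2⟩ := key q sB (sG false) (isCycle_sB hp hq) (fun i => hB i i.2) rfl
  rcases x with (_ | _) | i | i
  · exact hB1
  · exact hA1
  · exact hA2 i
  · exact hB2 i

omit [Field k] [Algebra k A] [Ring A] in
include hp hq in
lemma sigDelta_card (w : SigV p q) : 
    2 * sigDelta w = ({x | sigSrc p q x = w} : Finset (SigE p q)).card * sigDelta w := by
  by_cases h : ∃ x y : SigE p q, x ≠ y ∧ sigSrc p q x = w ∧ sigSrc p q y = w ∧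
      ∀ z, sigSrc p q z = w → z = x ∨ z = y
  · obtain ⟨x, y, h1, h2, h3, h4⟩ := h
    have h5 : ({x | sigSrc p q x = w} : Finset (SigE p q)) = {x, y} := by
      ext z
      rw [Finset.mem_filter_univ, Finset.mem_insert, Finset.mem_singleton]
      exact ⟨h4 z, by rintro (rfl | rfl) <;> assumption⟩
    rw [h5, Finset.card_pair h1]
    rfl
  · rcases w with _ | _ | _
    · refine absurd ⟨sA ⟨0, hp⟩, sB ⟨0, hq⟩, nofun, rfl, rfl, fun z hz => ?_⟩ h
      rcases sigSrc_eq hp hq (y := sA ⟨0, hp⟩) hz with h1 | ⟨_, _, h1⟩ | ⟨_, h1⟩ | ⟨h1, _⟩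
      · exact .inl h1
      · exact nomatch h1
      · exact nomatch h1
      · exact .inr h1
    · refine absurd ⟨sG true, sG false, nofun, rfl, rfl, fun z hz => ?_⟩ h
      rcases sigSrc_eq hp hq (y := sG true) hz with h1 | ⟨_ | _, h1, h2⟩ | ⟨_, h1⟩ | ⟨h1, h2⟩
      · exact .inl h1
      · exact .inr h1
      · exact nomatch h2
      · exact nomatch h1
      · exact nomatch h2
    · exact (mul_zero _).trans (mul_zero _).symm

theorem not_tauTiltingFinite_of_TAlg2 [IsAlgClosed k] {B : Type} [Ring B] [Algebra k B]
    [FiniteDimensional k B] (h : DerivedEquivalent (TAlg2 k p q hp hq) B) :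
    ¬ TauTiltingFinite k B := by
  refine (sigPres hp hq (k := k)).not_tauTiltingFinite sigDelta (v₀ := none) one_ne_zero (fun w => ?_) h
  have h1 : ∑ x with sigSrc p q x = w, ∑ i ∈ Finset.range (sigL x - 1),
      sigDelta (sigSrc p q ((sigS hp hq)^[i + 1] x)) = ∑ x with sigSrc p q x = w, -sigDelta w :=
    Finset.sum_congr rfl fun x hx =>
      (sigDelta_cycle hp hq x).trans (by rw [(Finset.mem_filter_univ x).1 hx])
  refine (congrArg₂ (· + ·) (sigDelta_card hp hq w) h1).trans ?_
  rw [Finset.sum_const, nsmul_eq_mul, mul_neg, add_neg_cancel]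

end Sig

lemma exists_pow_eq_pow_succ_mul {k : Type} [Field k] {𝒟 : Type*} [Category* 𝒟] [Preadditive 𝒟]
    [Linear k 𝒟] {Z : 𝒟} [Module.Finite k (Z ⟶ Z)] (f : End Z) :
    ∃ (n : ℕ) (g : End Z), f ^ n = f ^ (n + 1) * g := by
  let L : Module.End k (Z ⟶ Z) := Linear.rightComp k Z f
  have hL : ∀ (n : ℕ) (g : End Z), (L ^ n) g = f ^ n * g := by
    intro n g
    induction n with
    | zero => rw [pow_zero, pow_zero, one_mul]; rfl
    | succ n ih => rw [pow_succ', pow_succ', mul_assoc, ← ih]; rfl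
  obtain ⟨n, hn⟩ := IsArtinian.monotone_stabilizes (LinearMap.iterateRange L)
  have h1 : (L ^ n) (1 : End Z) ∈ LinearMap.range (L ^ (n + 1)) :=
    (hn (n + 1) n.le_succ).ge ⟨_, rfl⟩
  obtain ⟨g, hg⟩ := h1
  exact ⟨n, g, (mul_one _).symm.trans ((hL n 1).symm.trans (hg.symm.trans (hL _ g)))⟩

lemma exists_pow_eq_of_derivedEquivalent {k : Type} [Field k] [IsAlgClosed k] {A B : Type} [Ring A]
    [Ring B] [Algebra k B] [FiniteDimensional k B] (h : DerivedEquivalent A B) (c : A) :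
    ∃ (n : ℕ) (y : A), c ^ n = c ^ (n + 1) * y := by
  let _ : HasDerivedCategory (RMod Aᵐᵒᵖ) := HasDerivedCategory.standard _
  let _ : HasDerivedCategory (RMod Bᵐᵒᵖ) := HasDerivedCategory.standard _
  obtain ⟨e, h1, h2⟩ := h
  have : FiniteDimensional k Bᵐᵒᵖ := Module.Finite.equiv (opLinearEquiv k)
  obtain ⟨m, ⟨D⟩⟩ := exists_matData k Bᵐᵒᵖ
  let M : RMod Aᵐᵒᵖ := ModuleCat.of Aᵐᵒᵖ Aᵐᵒᵖ
  have : Projective M := inferInstance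
  have : Module.Finite Aᵐᵒᵖ M := inferInstanceAs (Module.Finite Aᵐᵒᵖ Aᵐᵒᵖ)
  let F := DerivedCategory.singleFunctor (RMod Aᵐᵒᵖ) 0 ⋙ e.functor
  have hZ : IsCpt (F.obj M) := (isCpt_single M 0).map_equiv e
  obtain ⟨a, b, hb⟩ := hZ.exists_built D.toIdemData.toProjData
  have : Module.Finite k (F.obj M ⟶ F.obj M) := hb.finite_hom_built hb
  let ρ : A ≃+* End M := (RingEquiv.opOp A).trans ((RingEquiv.moduleEndSelf Aᵐᵒᵖ).trans
    (ModuleCat.endRingEquiv M).symm)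
  obtain ⟨n, g, hg⟩ := exists_pow_eq_pow_succ_mul (k := k) (F.mapEnd M (ρ c))
  obtain ⟨ψ, rfl⟩ : ∃ ψ, F.mapEnd M ψ = g := F.map_surjective g
  rw [← map_pow (F.mapEnd M), ← map_pow (F.mapEnd M), ← map_mul (F.mapEnd M)] at hg
  refine ⟨n, ρ.symm ψ, ρ.injective ?_⟩
  rw [map_pow, map_mul, map_pow, RingEquiv.apply_symm_apply]
  exact F.map_injective hg

lemma single_mul_prod_single {S I : Type} [Ring S] [Fintype I] [DecidableEq I] (u : ℕ → I) (i : I)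
    (x : S) (n : ℕ) : Matrix.single i (u 0) x *
      ((List.range n).map fun j => Matrix.single (u j) (u (j + 1)) (1 : S)).prod =
      Matrix.single i (u n) x := by
  induction n with
  | zero => exact mul_one _
  | succ n ih =>
    rw [List.range_succ, List.map_append, List.prod_append, ← mul_assoc, ih, List.map_singleton,
      List.prod_singleton, Matrix.single_mul_single_same, mul_one]

section Theta
open Polynomial
variable {r : ℕ}

/-- The first arrows of `Θ(r)`. -/
def thS (i : Fin 6) : ThE r := Sum.inl i
/-- The arrows of the cycle of `Θ(r)`. -/
def thG (i : Fin r) : ThE r := Sum.inr i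

/-- The weights of a representation of `Θ(r)` over `k[X]`. -/
def thWeight (k : Type) [Field k] : ThE r → k[X]
  | .inl i => if i = 4 then X else if i = 5 then 1 else 0
  | .inr i => if i.1 < 2 then 0 else 1

variable {k : Type} [Field k]

/-- The action of the arrows in a representation of `Θ(r)` over `k[X]`. -/
def thMat (k : Type) [Field k] (x : ThE r) : Matrix (ThV r) (ThV r) k[X] :=
  Matrix.single (thSrc r x) (thTgt r x) (thWeight k x)

lemma prod_thMat_eq_zero {l : List (ThE r)} {x : ThE r} (hx : x ∈ l) (h : thWeight k x = 0) :
    (l.map (thMat k)).prod = 0 := by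
  refine List.prod_eq_zero (List.mem_map.2 ⟨x, hx, ?_⟩)
  rw [thMat, h, Matrix.single_zero]

lemma mem_thw (hr : 0 < r) {s n : ℕ} (hn : 0 < n) : thG ⟨s % r, Nat.mod_lt _ hr⟩ ∈ thw r hr s n :=
  List.mem_map.2 ⟨0, List.mem_range.2 hn, rfl⟩

lemma thMat_rels (hr : 2 ≤ r) (hr' : 0 < r) :
    PathRels (thSrc r) (thTgt r) (fun v => Matrix.single v v (1 : k[X])) (thMat k) ∧
      ∀ x y, TStarRelExtra k r hr' x y → ev (fun v => Matrix.single v v (1 : k[X])) (thMat k) x =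
        ev (fun v => Matrix.single v v (1 : k[X])) (thMat k) y := by
  refine ⟨⟨fun v w => ?_, ?_, fun x => ?_, fun x => ?_⟩, fun x y h => ?_⟩
  · split_ifs with h
    · rw [h, Matrix.single_mul_single_same, mul_one]
    · exact Matrix.single_mul_single_of_ne _ _ _ _ h _
  · ext i j
    rw [Matrix.sum_apply]
    simp [Matrix.single_apply, Matrix.one_apply, ite_and]
  · rw [thMat, Matrix.single_mul_single_same, one_mul]
  · rw [thMat, Matrix.single_mul_single_same, mul_one]
  · have key {l : List (ThE r)} {x : ThE r} (hx : x ∈ l) (h : thWeight k x = 0) :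
        ev (fun v => Matrix.single v v (1 : k[X])) (thMat k) (arrWord k l) = 0 :=
      (ev_arrWord _ _ l).trans (prod_thMat_eq_zero hx h)
    have w0 : thWeight k (thG ⟨0 % r, Nat.mod_lt _ hr'⟩) = 0 :=
      (if_pos (show 0 % r < 2 from (Nat.mod_le 0 r).trans_lt two_pos) : ite _ 0 (1 : k[X]) = 0)
    have w1 : thWeight k (thG ⟨1 % r, Nat.mod_lt _ hr'⟩) = 0 :=
      (if_pos (show 1 % r < 2 from (Nat.mod_le 1 r).trans_lt one_lt_two) : ite _ 0 (1 : k[X]) = 0)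
    have wS (i : Fin 4) : thWeight k (thS (r := r) (i.castAdd 2)) = 0 := by
      fin_cases i <;> rfl
    have m0 {n : ℕ} (hn : 0 < n) := mem_thw (s := 0) hr' hn
    have hd {x : ThE r} {l : List (ThE r)} : x ∈ x :: l := List.mem_cons_self
    have tl {x y : ThE r} {l : List (ThE r)} (h : x ∈ l) : x ∈ y :: l := List.mem_cons_of_mem _ h
    rcases h with ⟨rfl, rfl⟩ | ⟨rfl, rfl⟩ | ⟨rfl, rfl⟩ | ⟨rfl, rfl⟩ | ⟨rfl, rfl⟩ | ⟨rfl, rfl⟩ |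
      ⟨rfl, rfl⟩ | ⟨rfl, rfl⟩ | ⟨rfl, rfl⟩ | ⟨rfl, rfl⟩ | ⟨rfl, rfl⟩ | ⟨rfl, rfl⟩ | ⟨rfl, rfl⟩ |
      ⟨rfl, rfl⟩ | ⟨l, hl, -, rfl, rfl⟩
    · exact (key hd (wS 0)).trans (key (m0 hr') w0).symm
    · exact (key hd (wS 2)).trans (key (m0 hr') w0).symm
    all_goals rw [map_zero]
    · exact key (List.mem_append_right _ hd) (wS 0)
    · exact key hd (wS 3)
    · exact key (List.mem_append_right _ hd) (wS 2)
    · exact key hd (wS 1)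
    · exact key hd (wS 1)
    · exact key hd (wS 1)
    · exact key hd (wS 3)
    · exact key hd (wS 3)
    · exact key hd (wS 1)
    · exact key hd (wS 3)
    · exact key (List.mem_append_left _ (mem_thw hr' (by omega))) w1
    · exact key (tl (List.mem_append_right _ (m0 one_pos))) w0
    · exact key (List.mem_append_right _ (m0 (by omega))) w0

lemma not_derivedEquivalent_TStarAlg [IsAlgClosed k] (hr : 2 ≤ r) (hr' : 0 < r) {B : Type} [Ring B]
    [Algebra k B] [FiniteDimensional k B] : ¬ DerivedEquivalent (TStarAlg k r hr') B := by
  intro h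
  obtain ⟨φ, -, hφ⟩ := boundGen_lift (thMat_rels (k := k) hr hr').1 (thMat_rels hr hr').2
  let g (x : ThE r) : TStarAlg k r hr' :=
    boundGen (thSrc r) (thTgt r) (TStarRelExtra k r hr') (.inr x)
  let z : ThV r := Sum.inl 0
  let c : TStarAlg k r hr' := g (thS 4) * g (thS 5) * ((thw r hr' 2 (r - 2)).map g).prod
  have hc : φ c = Matrix.single z z X := by
    have h1 : φ c = thMat k (thS 4) * thMat k (thS 5) *
        ((thw r hr' 2 (r - 2)).map (thMat k)).prod := by
      refine (map_mul φ _ _).trans (congrArg₂ _ ((map_mul φ _ _).trans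
        (congrArg₂ _ (hφ _) (hφ _))) ((map_list_prod φ _).trans (congrArg _ ?_)))
      exact List.map_map.trans (List.map_congr_left fun x _ => hφ x)
    have h2 : thMat k (thS (r := r) 4) * thMat k (thS 5) = Matrix.single z (thC r (2 + 0)) X :=
      (Matrix.single_mul_single_same ..).trans (congrArg _ (mul_one _))
    have h3 : (thw r hr' 2 (r - 2)).map (thMat k) = (List.range (r - 2)).map fun j =>
        Matrix.single (thC r (2 + j)) (thC r (2 + (j + 1))) 1 := by
      refine List.map_map.trans (List.map_congr_left fun j hj => ?_)
      have h4 : (2 + j) % r = 2 + j := Nat.mod_eq_of_lt (by have := List.mem_range.1 hj; omega)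
      have h5 : thWeight k (thG ⟨(2 + j) % r, Nat.mod_lt _ hr'⟩) = 1 :=
        if_neg (show ¬ (2 + j) % r < 2 by omega)
      refine (congrArg (Matrix.single _ _) h5).trans ?_
      exact congrArg (fun m => Matrix.single (thC r m) (thC r (m + 1)) (1 : k[X])) h4
    rw [h1, h2, h3, single_mul_prod_single fun j => thC r (2 + j)]
    exact congrArg (Matrix.single z · X) (dif_pos (.inr (by omega)))
  obtain ⟨n, y, hn⟩ := exists_pow_eq_of_derivedEquivalent (k := k) h c
  have hpow (m : ℕ) (Y : Matrix (ThV r) (ThV r) k[X]) :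
      ((Matrix.single z z X : Matrix (ThV r) (ThV r) k[X]) ^ m * Y) z z = X ^ m * Y z z := by
    induction m with
    | zero => rw [pow_zero, pow_zero, one_mul, one_mul]
    | succ m ih => rw [pow_succ', pow_succ', mul_assoc, mul_assoc, Matrix.single_mul_apply_same, ih]
  have h1 : φ c ^ n * 1 = φ c ^ (n + 1) * φ y :=
    (mul_one _).trans <| (map_pow φ c n).symm.trans <| (congrArg φ hn).trans <|
      (map_mul φ _ _).trans (congrArg (· * φ y) (map_pow φ c (n + 1)))
  rw [hc] at h1
  have h2 := congrFun (congrFun h1 z) z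
  rw [hpow, hpow, Matrix.one_apply_eq, pow_succ, mul_assoc] at h2
  exact not_isUnit_X (IsUnit.of_mul_eq_one _ (mul_left_cancel₀ (pow_ne_zero n X_ne_zero) h2).symm)

end Theta

end DerivedTools

/-- Every algebra derived equivalent to one of `T(p,q)` (`1 ≤ p ≤ q`), `T(2,2,r)*` (`r ≥ 2`),
`T(3,3,3)`, `T(2,4,4)` or `T(2,3,6)` is τ-tilting infinite. -/
theorem statement18 (k : Type) [Field k] [IsAlgClosed k]
    (B : Type) [Ring B] [Algebra k B] [FiniteDimensional k B]
    (h : (∃ (p q : ℕ) (hp : 1 ≤ p) (hpq : p ≤ q),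
            DerivedEquivalent (TAlg2 k p q hp (le_trans hp hpq)) B) ∨
         (∃ (r : ℕ) (hr : 2 ≤ r), DerivedEquivalent (TStarAlg k r (by omega)) B) ∨
         DerivedEquivalent (TAlg3 k 3 3 3 (by norm_num) (by norm_num) (by norm_num)) B ∨
         DerivedEquivalent (TAlg3 k 2 4 4 (by norm_num) (by norm_num) (by norm_num)) B ∨
         DerivedEquivalent (TAlg3 k 2 3 6 (by norm_num) (by norm_num) (by norm_num)) B) :
    ¬ TauTiltingFinite k B := by
  rcases h with ⟨p, q, hp, hpq, h⟩ | ⟨r, hr, h⟩ | h | h | h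
  · exact DerivedTools.not_tauTiltingFinite_of_TAlg2 hp (le_trans hp hpq) h
  · exact absurd h (DerivedTools.not_derivedEquivalent_TStarAlg (k := k) hr (by omega))
  · exact DerivedTools.not_tauTiltingFinite_of_TAlg3_333 h
  · exact DerivedTools.not_tauTiltingFinite_of_TAlg3_244 h
  · exact DerivedTools.not_tauTiltingFinite_of_TAlg3_236 h

end
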